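/- Let G ⊆ Ĉ be a lemniscate graph and let ε > 0. Then there exists δ > 0 such that for every continuous injective map h : G → Ĉ with sup_{z ∈ G} d(h(z), z) < δ, there is a homeomorphism H : Ĉ → Ĉ extending h (H(z) = h(z) for z ∈ G) with sup_{z ∈ Ĉ} d(H(z), z) < ε. -/

import Mathlib

open Set Metric Topology Filter Polynomial

noncomputable section

/-- A Jordan curve: a set homeomorphic to the unit circle. -/
def IsJordanCurve {X : Type*} [TopologicalSpace X] (E : Set X) : Prop :=
  Nonempty (E ≃ₜ (Metric.sphere (0 : ℂ) 1 : Set ℂ))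

/-- A simple arc: a set homeomorphic to the open unit interval `(0,1)`. -/
def IsSimpleArc {X : Type*} [TopologicalSpace X] (E : Set X) : Prop :=
  Nonempty (E ≃ₜ (Set.Ioo (0 : ℝ) 1 : Set ℝ))

/-- The connected components of a set. -/
def setComponents {X : Type*} [TopologicalSpace X] (A : Set X) : Set (Set X) :=
  {C | ∃ x ∈ A, C = connectedComponentIn A x}

/-- The edges of the pair `(G, V)`: the connected components of `G \ V`. -/
def graphEdges {X : Type*} [TopologicalSpace X] (G V : Set X) : Set (Set X) :=
  setComponents (G \ V)

/-- The degree of a vertex `v`: the number of edges `e` with `v ∈ closure e \ e`,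
where an edge is counted twice if `closure e \ e = {v}`. -/
def vertexDegree {X : Type*} [TopologicalSpace X] (G V : Set X) (v : X) : ℕ :=
  {e ∈ graphEdges G V | v ∈ closure e \ e}.ncard +
    {e ∈ graphEdges G V | closure e \ e = {v}}.ncard

/-- `G` is a lemniscate graph with (finite) vertex set `V`. -/
structure IsLemniscateGraphWith {X : Type*} [TopologicalSpace X] (G V : Set X) : Prop where
  vertex_subset : V ⊆ G
  vertex_finite : V.Finite
  edges_finite : (graphEdges G V).Finite
  edge_shape : ∀ e ∈ graphEdges G V, IsJordanCurve e ∨ (IsSimpleArc e ∧ closure e \ e ⊆ V)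
  degree_even : ∀ v ∈ V, Even (vertexDegree G V v)
  degree_ge_four : ∀ v ∈ V, 4 ≤ vertexDegree G V v

/-- `G` is a lemniscate graph (for some finite vertex set). -/
def IsLemniscateGraph {X : Type*} [TopologicalSpace X] (G : Set X) : Prop :=
  ∃ V, IsLemniscateGraphWith G V

/-- The faces of `G`: the connected components of the complement of `G`. -/
def graphFaces {X : Type*} [TopologicalSpace X] (G : Set X) : Set (Set X) :=
  setComponents Gᶜ

/-- A 2-coloring of the faces of `G`, recorded by the set `grey` of grey faces:
two distinct faces whose closures share a common edge get different colors. -/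
def IsTwoColoring {X : Type*} [TopologicalSpace X] (G V : Set X) (grey : Set (Set X)) : Prop :=
  grey ⊆ graphFaces G ∧
    ∀ F₁ ∈ graphFaces G, ∀ F₂ ∈ graphFaces G, F₁ ≠ F₂ →
      (∃ e ∈ graphEdges G V, e ⊆ closure F₁ ∧ e ⊆ closure F₂) →
      (F₁ ∈ grey ↔ F₂ ∉ grey)

/-- The distance function of a metric space structure on the Riemann sphere. -/
def mdist (m : MetricSpace (OnePoint ℂ)) : OnePoint ℂ → OnePoint ℂ → ℝ :=
  m.toPseudoMetricSpace.toDist.dist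

/-- The metric space structure `m` induces the standard topology of the Riemann sphere. -/
def InducesSphereTopology (m : MetricSpace (OnePoint ℂ)) : Prop :=
  m.toPseudoMetricSpace.toUniformSpace.toTopologicalSpace =
    (inferInstance : TopologicalSpace (OnePoint ℂ))

/-- `E` and `F` are `ε`-homeomorphic with respect to the metric `m`: there is a
homeomorphism of the sphere carrying `E` to `F` and moving points less than `ε`. -/
def EpsHomeomorphic (m : MetricSpace (OnePoint ℂ)) (ε : ℝ) (E F : Set (OnePoint ℂ)) : Prop :=
  ∃ φ : OnePoint ℂ ≃ₜ OnePoint ℂ, φ '' E = F ∧ ∃ c < ε, ∀ z, mdist m (φ z) z ≤ c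

/-- `r` is a rational map on the Riemann sphere: the continuous extension of `p/q`
for coprime polynomials `p`, `q`, not both constant. -/
def IsRationalMap (r : OnePoint ℂ → OnePoint ℂ) : Prop :=
  Continuous r ∧ ∃ p q : ℂ[X], IsCoprime p q ∧ ¬(p.natDegree = 0 ∧ q.natDegree = 0) ∧
    ∀ z : ℂ, q.eval z ≠ 0 → r (z : OnePoint ℂ) = ((p.eval z / q.eval z : ℂ) : OnePoint ℂ)

/-- The lemniscate of `r` : the preimage of the unit circle. -/
def lemniscate (r : OnePoint ℂ → OnePoint ℂ) : Set (OnePoint ℂ) :=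
  r ⁻¹' ((fun w : ℂ => (w : OnePoint ℂ)) '' {w : ℂ | ‖w‖ = 1})

/-- The copy of a planar set inside the Riemann sphere. -/
def toSphere (s : Set ℂ) : Set (OnePoint ℂ) := (fun z : ℂ => (z : OnePoint ℂ)) '' s

/-! ### Continuous logarithms -/

/-- `f` has a continuous logarithm on `K`. -/
def HasLog {X : Type*} [TopologicalSpace X] (f : X → ℂ) (K : Set X) : Prop :=
  ∃ g : X → ℂ, ContinuousOn g K ∧ ∀ z ∈ K, Complex.exp (g z) = f z

namespace HasLog

variable {X Y : Type*} [TopologicalSpace X] [TopologicalSpace Y]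

lemma mono {f : X → ℂ} {K L : Set X} (h : HasLog f L) (hKL : K ⊆ L) : HasLog f K :=
  let ⟨g, hg, he⟩ := h
  ⟨g, hg.mono hKL, fun z hz => he z (hKL hz)⟩

lemma congr {f f' : X → ℂ} {K : Set X} (h : HasLog f K) (hf : ∀ z ∈ K, f z = f' z) :
    HasLog f' K :=
  let ⟨g, hg, he⟩ := h
  ⟨g, hg, fun z hz => (he z hz).trans (hf z hz)⟩

lemma mul {f f' : X → ℂ} {K : Set X} (h : HasLog f K) (h' : HasLog f' K) :
    HasLog (fun z => f z * f' z) K := by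
  obtain ⟨g, hg, he⟩ := h
  obtain ⟨g', hg', he'⟩ := h'
  exact ⟨fun z => g z + g' z, hg.add hg', fun z hz => by
    rw [Complex.exp_add, he z hz, he' z hz]⟩

lemma inv {f : X → ℂ} {K : Set X} (h : HasLog f K) : HasLog (fun z => (f z)⁻¹) K := by
  obtain ⟨g, hg, he⟩ := h
  exact ⟨fun z => - g z, hg.neg, fun z hz => by rw [Complex.exp_neg, he z hz]⟩

lemma comp {f : Y → ℂ} {L : Set Y} (h : HasLog f L) {φ : X → Y} {K : Set X}
    (hφ : ContinuousOn φ K) (hm : MapsTo φ K L) : HasLog (fun x => f (φ x)) K := by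
  obtain ⟨g, hg, he⟩ := h
  exact ⟨fun x => g (φ x), hg.comp hφ hm, fun z hz => he _ (hm hz)⟩

lemma const {c : ℂ} (hc : c ≠ 0) (K : Set X) : HasLog (fun _ => c) K :=
  ⟨fun _ => Complex.log c, continuousOn_const, fun _ _ => Complex.exp_log hc⟩

lemma ne_zero {f : X → ℂ} {K : Set X} (h : HasLog f K) {z : X} (hz : z ∈ K) : f z ≠ 0 := by
  obtain ⟨g, -, he⟩ := h
  rw [← he z hz]; exact Complex.exp_ne_zero _

/-- Homotopy lifting for the exponential. -/
lemma homotopy {K : Set X} {F : ℝ → X → ℂ}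
    (hF : ContinuousOn (fun p : ℝ × X => F p.1 p.2) (Icc 0 1 ×ˢ K))
    (h0 : ∀ t ∈ Icc (0 : ℝ) 1, ∀ x ∈ K, F t x ≠ 0) (hl : HasLog (F 0) K) : HasLog (F 1) K := by
  classical
  obtain ⟨g, hg, he⟩ := hl
  let H : C(unitInterval × K, {z : ℂ // z ≠ 0}) :=
    ⟨fun p => ⟨F p.1 p.2, h0 _ p.1.2 _ p.2.2⟩, by
      refine Continuous.subtype_mk ?_ _
      have : ContinuousOn (fun p : ℝ × X => F p.1 p.2) (Icc 0 1 ×ˢ K) := hF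
      exact this.comp_continuous (f := fun p : unitInterval × K => ((p.1 : ℝ), (p.2 : X)))
        (by fun_prop) (fun p => ⟨p.1.2, p.2.2⟩)⟩
  let f : C(K, ℂ) := ⟨fun x => g x, hg.comp_continuous continuous_subtype_val fun x => x.2⟩
  have H0 : ∀ a, H (0, a) = (⟨_, (f a).exp_ne_zero⟩ : {z : ℂ // z ≠ 0}) := fun a =>
    Subtype.ext (he a a.2).symm
  let L := Complex.isCoveringMap_exp.liftHomotopy H f H0
  have hL := Complex.isCoveringMap_exp.liftHomotopy_lifts H f H0
  refine ⟨fun x => if hx : x ∈ K then L (1, ⟨x, hx⟩) else 0, ?_, fun x hx => ?_⟩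
  · rw [continuousOn_iff_continuous_domRestrict]
    have : Continuous fun x : K => L (1, x) := by fun_prop
    convert this using 1
    ext x
    simp
  · simp only [hx, dif_pos]
    have := congrArg Subtype.val (congrFun hL (1, ⟨x, hx⟩))
    change Complex.exp (L (1, ⟨x, hx⟩)) = F ((1 : unitInterval) : ℝ) x at this
    exact this

lemma of_convex {E : Type*} [NormedAddCommGroup E] [NormedSpace ℝ E] {K : Set E}
    (hK : Convex ℝ K) {f : E → ℂ} (hf : ContinuousOn f K) (h0 : ∀ z ∈ K, f z ≠ 0) :
    HasLog f K := by
  rcases K.eq_empty_or_nonempty with rfl | ⟨x₀, hx₀⟩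
  · exact ⟨fun _ => 0, continuousOn_const, by simp⟩
  have hm : ∀ t ∈ Icc (0 : ℝ) 1, ∀ x ∈ K, (1 - t) • x₀ + t • x ∈ K := fun t ht x hx =>
    hK hx₀ hx (by linarith [ht.2]) ht.1 (by ring)
  have := homotopy (K := K) (F := fun t x => f ((1 - t) • x₀ + t • x)) ?_
    (fun t ht x hx => h0 _ (hm t ht x hx)) ?_
  · simpa using this
  · exact hf.comp (f := fun p : ℝ × E => (1 - p.1) • x₀ + p.1 • p.2) (by fun_prop)
      fun p hp => hm _ hp.1 _ hp.2
  · simpa using const (h0 _ hx₀) K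

end HasLog

lemma continuousOn_invFunOn_image {X Y : Type*} [TopologicalSpace X] [TopologicalSpace Y]
    [T2Space Y] [Nonempty X] {φ : X → Y} {S : Set X} (hS : IsCompact S) (hφ : ContinuousOn φ S)
    (hi : InjOn φ S) : ContinuousOn (Function.invFunOn φ S) (φ '' S) := by
  rw [continuousOn_iff_isClosed]
  intro t ht
  refine ⟨φ '' (S ∩ t), ((hS.inter_right ht).image_of_continuousOn
    (hφ.mono inter_subset_left)).isClosed, ?_⟩
  ext y
  constructor
  · rintro ⟨h1, x, hx, rfl⟩
    rw [mem_preimage, hi.leftInvOn_invFunOn hx] at h1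
    exact ⟨⟨x, ⟨hx, h1⟩, rfl⟩, x, hx, rfl⟩
  · rintro ⟨⟨x, ⟨hx, hxt⟩, rfl⟩, -⟩
    refine ⟨?_, x, hx, rfl⟩
    rwa [mem_preimage, hi.leftInvOn_invFunOn hx]

/-- Two logarithms of the same function on a preconnected set differ by a constant. -/
lemma exists_int_of_exp_eq {X : Type*} [TopologicalSpace X] {K : Set X} (hK : IsPreconnected K)
    {f g : X → ℂ} (hf : ContinuousOn f K) (hg : ContinuousOn g K)
    (h : ∀ z ∈ K, Complex.exp (f z) = Complex.exp (g z)) :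
    ∃ n : ℤ, ∀ z ∈ K, f z = g z + n * (2 * Real.pi * Complex.I) := by
  rcases K.eq_empty_or_nonempty with rfl | ⟨x₀, hx₀⟩
  · exact ⟨0, by simp⟩
  choose n hn using fun z : K => Complex.exp_eq_exp_iff_exists_int.1 (h z z.2)
  have hc : ContinuousOn (fun z => ((f z - g z) / (2 * Real.pi * Complex.I)).re) K :=
    Complex.continuous_re.comp_continuousOn ((hf.sub hg).div_const _)
  have hpi : (2 * Real.pi * Complex.I : ℂ) ≠ 0 := Complex.two_pi_I_ne_zero
  have hv : ∀ z : K, ((f z - g z) / (2 * Real.pi * Complex.I)).re = n z := by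
    intro z
    rw [hn z, add_sub_cancel_left, mul_div_cancel_right₀ _ hpi]
    simp
  have key : ∀ x y : K, ¬ n x < n y := by
    intro x y hxy
    have hxy' : (n x : ℝ) + 1 ≤ n y := by exact_mod_cast hxy
    have := hK.intermediate_value x.2 y.2 hc
    obtain ⟨z, hz, hzv⟩ := this (show (n x : ℝ) + 1 / 2 ∈ Icc _ _ by
      rw [hv, hv]; constructor <;> linarith)
    have h1 := (hv ⟨z, hz⟩).symm.trans hzv
    have h2 : (2 * n ⟨z, hz⟩ : ℤ) = 2 * n x + 1 := by
      have : (2 * n ⟨z, hz⟩ : ℝ) = 2 * n x + 1 := by rw [h1]; ring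
      exact_mod_cast this
    omega
  refine ⟨n ⟨x₀, hx₀⟩, fun z hz => ?_⟩
  have : n ⟨z, hz⟩ = n ⟨x₀, hx₀⟩ := le_antisymm (not_lt.1 (key _ _)) (not_lt.1 (key _ _))
  rw [← this]; exact hn ⟨z, hz⟩

/-- A power of `z - a` has no logarithm on the frontier of a bounded open set around `a`, even
after multiplication by a function which does not vanish on the closure. -/
lemma not_hasLog_frontier {U : Set ℂ} (hU : IsOpen U) (hb : Bornology.IsBounded U) {a : ℂ}
    (ha : a ∈ U) {n : ℤ} (hn : n ≠ 0) {u : ℂ → ℂ} (hu : ContinuousOn u (closure U))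
    (hu0 : ∀ z ∈ closure U, u z ≠ 0) :
    ¬ HasLog (fun z => (z - a) ^ n * u z) (frontier U) := by
  classical
  rintro ⟨g, hg, he⟩
  obtain ⟨G, hG⟩ := ContinuousMap.exists_restrict_eq (isClosed_frontier (s := U))
    (⟨(frontier U).domRestrict g, hg.domRestrict⟩ : C(frontier U, ℂ))
  have hG' : ∀ z ∈ frontier U, G z = g z := fun z hz => by
    simpa using DFunLike.congr_fun hG ⟨z, hz⟩
  let φ : ℂ → ℂ := fun z => if z ∈ closure U then Complex.exp (G z) / u z else (z - a) ^ n
  have hφ1 : ∀ z ∈ Uᶜ, φ z = (z - a) ^ n := by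
    intro z hz
    by_cases hc : z ∈ closure U
    · have hf : z ∈ frontier U := by rw [hU.frontier_eq]; exact ⟨hc, hz⟩
      simp only [φ, hc, if_true, hG' z hf, he z hf]
      exact mul_div_cancel_right₀ _ (hu0 z hc)
    · simp [φ, hc]
  have hza : ∀ z ∈ Uᶜ, z - a ≠ 0 := fun z hz h => hz (by rwa [sub_eq_zero.1 h])
  have hφc : Continuous φ := by
    rw [← continuousOn_univ]
    have : (univ : Set ℂ) = closure U ∪ Uᶜ := by
      ext z; by_cases hz : z ∈ U <;> simp [hz, @subset_closure _ _ U z]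
    rw [this]
    refine ContinuousOn.union_of_isClosed ?_ ?_ isClosed_closure hU.isClosed_compl
    · have : ContinuousOn (fun z => Complex.exp (G z) / u z) (closure U) :=
        (Complex.continuous_exp.comp G.continuous).continuousOn.div hu hu0
      exact this.congr fun z hz => by simp [φ, hz]
    · have : ContinuousOn (fun z : ℂ => (z - a) ^ n) Uᶜ :=
        ContinuousOn.zpow₀ (by fun_prop) n fun z hz => Or.inl (hza z hz)
      exact this.congr hφ1
  have hφ0 : ∀ z, φ z ≠ 0 := by
    intro z
    by_cases hc : z ∈ closure U
    · simp only [φ, hc, if_true]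
      exact div_ne_zero (Complex.exp_ne_zero _) (hu0 z hc)
    · simp only [φ, hc, if_false]
      exact zpow_ne_zero _ (hza z fun h => hc (subset_closure h))
  obtain ⟨L, hL, hLe⟩ := HasLog.of_convex (convex_univ (𝕜 := ℝ) (E := ℂ)) hφc.continuousOn
    fun z _ => hφ0 z
  rw [continuousOn_univ] at hL
  obtain ⟨R, hR⟩ := hb.subset_ball a
  have hRpos : 0 < R := by
    have := hR ha
    simpa using this
  have hcirc : ∀ θ : ℝ, a + R * Complex.exp (θ * Complex.I) ∈ Uᶜ := by
    intro θ h
    have := hR h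
    rw [mem_ball, dist_eq_norm, add_sub_cancel_left, norm_mul, Complex.norm_exp_ofReal_mul_I] at this
    simp [abs_of_pos hRpos] at this
  have hR0 : (R : ℂ) ≠ 0 := by exact_mod_cast hRpos.ne'
  obtain ⟨m, hm⟩ := exists_int_of_exp_eq (K := (univ : Set ℝ)) isPreconnected_univ
    (f := fun θ : ℝ => L (a + R * Complex.exp (θ * Complex.I)))
    (g := fun θ : ℝ => n * (Complex.log R + θ * Complex.I))
    (by fun_prop) (by fun_prop) (by
      intro θ _
      rw [hLe _ (mem_univ _), hφ1 _ (hcirc θ), Complex.exp_int_mul, Complex.exp_add,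
        Complex.exp_log hR0]
      simp)
  have h1 := hm 0 (mem_univ _)
  have h2 := hm (2 * Real.pi) (mem_univ _)
  simp only [Complex.ofReal_mul, Complex.ofReal_ofNat, Complex.exp_two_pi_mul_I,
    Complex.ofReal_zero, zero_mul, Complex.exp_zero] at h1 h2
  rw [h1] at h2
  have h3 : (n : ℂ) * (2 * Real.pi * Complex.I) = 0 := by linear_combination -h2
  rcases mul_eq_zero.1 h3 with h | h
  · exact hn (by exact_mod_cast h)
  · exact Complex.two_pi_I_ne_zero h

/-! ### Gluing logarithms -/

lemma HasLog.glue_of_eqOn {X : Type*} [TopologicalSpace X] {f : X → ℂ} {K L : Set X}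
    (hKL : (IsClosed K ∧ IsClosed L) ∨ (IsOpen K ∧ IsOpen L)) {g g' : X → ℂ}
    (hg : ContinuousOn g K) (hg' : ContinuousOn g' L)
    (he : ∀ z ∈ K, Complex.exp (g z) = f z) (he' : ∀ z ∈ L, Complex.exp (g' z) = f z)
    (heq : ∀ z ∈ K ∩ L, g z = g' z) : HasLog f (K ∪ L) := by
  classical
  let h : X → ℂ := fun z => if z ∈ K then g z else g' z
  have h1 : ∀ z ∈ K, h z = g z := fun z hz => by simp [h, hz]
  have h2 : ∀ z ∈ L, h z = g' z := fun z hz => by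
    by_cases hk : z ∈ K
    · rw [h1 z hk, heq z ⟨hk, hz⟩]
    · simp [h, hk]
  refine ⟨h, ?_, ?_⟩
  · rcases hKL with ⟨h3, h4⟩ | ⟨h3, h4⟩
    · exact (hg.congr h1).union_of_isClosed (hg'.congr h2) h3 h4
    · exact (hg.congr h1).union_of_isOpen (hg'.congr h2) h3 h4
  · rintro z (hz | hz)
    · rw [h1 z hz, he z hz]
    · rw [h2 z hz, he' z hz]

/-- Janiszewski gluing. -/
lemma HasLog.union {X : Type*} [TopologicalSpace X] {f : X → ℂ} {K L : Set X}
    (hKL : (IsClosed K ∧ IsClosed L) ∨ (IsOpen K ∧ IsOpen L)) (hc : IsPreconnected (K ∩ L))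
    (h : HasLog f K) (h' : HasLog f L) : HasLog f (K ∪ L) := by
  obtain ⟨g, hg, he⟩ := h
  obtain ⟨g', hg', he'⟩ := h'
  obtain ⟨n, hn⟩ := exists_int_of_exp_eq hc (hg.mono inter_subset_left)
    (hg'.mono inter_subset_right) fun z hz => (he z hz.1).trans (he' z hz.2).symm
  refine HasLog.glue_of_eqOn hKL hg (g' := fun z => g' z + n * (2 * Real.pi * Complex.I))
    (hg'.add continuousOn_const) he (fun z hz => ?_) hn
  rw [Complex.exp_add, he' z hz, Complex.exp_int_mul_two_pi_mul_I, mul_one]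

/-! ### The bounded and unbounded complementary components of a compact set -/

/-- The union of the bounded complementary components of `K`. -/
def inside (K : Set ℂ) : Set ℂ := {a | a ∉ K ∧ ¬ HasLog (fun z => z - a) K}

/-- The union of the unbounded complementary components of `K`. -/
def outside (K : Set ℂ) : Set ℂ := {a | a ∉ K ∧ HasLog (fun z => z - a) K}

lemma compl_eq_inside_union_outside (K : Set ℂ) : Kᶜ = inside K ∪ outside K := by
  ext a; simp only [mem_compl_iff, inside, outside, mem_union, mem_ofPred_eq]; tauto

lemma disjoint_inside_outside (K : Set ℂ) : Disjoint (inside K) (outside K) :=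
  disjoint_left.2 fun _ h h' => h.2 h'.2

lemma HasLog.of_joinedIn {K : Set ℂ} {a b : ℂ} (h : JoinedIn Kᶜ a b) :
    HasLog (fun z => (z - b) / (z - a)) K := by
  obtain ⟨γ, hγ⟩ := h
  have ha : a ∉ K := by simpa using hγ 0
  have hne : ∀ z ∈ K, z - a ≠ 0 := fun z hz h => ha (by rwa [← sub_eq_zero.1 h])
  have hmem : ∀ t : ℝ, γ.extend t ∉ K := by
    intro t
    have : γ.extend t ∈ range γ := by rw [← γ.extend_range]; exact mem_range_self t
    obtain ⟨s, hs⟩ := this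
    rw [← hs]; exact hγ s
  have := HasLog.homotopy (K := K) (F := fun t z => (z - γ.extend t) / (z - a)) ?_
    (fun t _ z hz => div_ne_zero (fun h => hmem t (by rwa [← sub_eq_zero.1 h])) (hne z hz)) ?_
  · simpa using this
  · refine ContinuousOn.div ?_ (by fun_prop) fun p hp => hne _ hp.2
    exact (continuous_snd.sub (γ.continuous_extend.comp continuous_fst)).continuousOn
  · refine (HasLog.const one_ne_zero K).congr fun z hz => ?_
    simp [div_self (hne z hz)]

lemma HasLog.of_preconnected {K S : Set ℂ} (hK : IsClosed K) (hS : IsPreconnected S)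
    (hSK : Disjoint S K) {a b : ℂ} (ha : a ∈ S) (hb : b ∈ S) :
    HasLog (fun z => (z - b) / (z - a)) K := by
  have haK : a ∈ Kᶜ := disjoint_left.1 hSK ha
  have hc : IsConnected (connectedComponentIn Kᶜ a) := isConnected_connectedComponentIn_iff.2 haK
  have ho : IsOpen (connectedComponentIn Kᶜ a) := hK.isOpen_compl.connectedComponentIn
  have hsub : S ⊆ connectedComponentIn Kᶜ a :=
    hS.subset_connectedComponentIn ha (subset_compl_iff_disjoint_right.2 hSK)
  have := (ho.isConnected_iff_isPathConnected.1 hc).joinedIn a (hsub ha) b (hsub hb)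
  exact HasLog.of_joinedIn (this.mono (connectedComponentIn_subset _ _))

lemma HasLog.sub_of_preconnected {K S : Set ℂ} (hK : IsClosed K) (hS : IsPreconnected S)
    (hSK : Disjoint S K) {a b : ℂ} (ha : a ∈ S) (hb : b ∈ S) (h : HasLog (fun z => z - a) K) :
    HasLog (fun z => z - b) K :=
  (h.mul (HasLog.of_preconnected hK hS hSK ha hb)).congr fun z hz => by
    have : z - a ≠ 0 := h.ne_zero hz
    field_simp

lemma subset_inside_of_preconnected {K S : Set ℂ} (hK : IsClosed K) (hS : IsPreconnected S)
    (hSK : Disjoint S K) {a : ℂ} (ha : a ∈ S) (hi : a ∈ inside K) : S ⊆ inside K :=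
  fun _ hb => ⟨disjoint_left.1 hSK hb, fun h => hi.2 (h.sub_of_preconnected hK hS hSK hb ha)⟩

lemma subset_outside_of_preconnected {K S : Set ℂ} (hK : IsClosed K) (hS : IsPreconnected S)
    (hSK : Disjoint S K) {a : ℂ} (ha : a ∈ S) (hi : a ∈ outside K) : S ⊆ outside K :=
  fun _ hb => ⟨disjoint_left.1 hSK hb, hi.2.sub_of_preconnected hK hS hSK ha hb⟩

lemma isOpen_inside {K : Set ℂ} (hK : IsClosed K) : IsOpen (inside K) := by
  rw [Metric.isOpen_iff]
  intro a ha
  obtain ⟨r, hr, hb⟩ := Metric.isOpen_iff.1 hK.isOpen_compl a ha.1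
  exact ⟨r, hr, subset_inside_of_preconnected hK (convex_ball a r).isPreconnected
    (subset_compl_iff_disjoint_right.1 hb) (mem_ball_self hr) ha⟩

lemma isOpen_outside {K : Set ℂ} (hK : IsClosed K) : IsOpen (outside K) := by
  rw [Metric.isOpen_iff]
  intro a ha
  obtain ⟨r, hr, hb⟩ := Metric.isOpen_iff.1 hK.isOpen_compl a ha.1
  exact ⟨r, hr, subset_outside_of_preconnected hK (convex_ball a r).isPreconnected
    (subset_compl_iff_disjoint_right.1 hb) (mem_ball_self hr) ha⟩

lemma closure_inside_subset {K : Set ℂ} (hK : IsClosed K) : closure (inside K) ⊆ inside K ∪ K := by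
  have : inside K ∪ K = (outside K)ᶜ := by
    ext a; simp only [inside, outside, mem_union, mem_compl_iff, mem_ofPred_eq]; tauto
  rw [this]
  exact closure_minimal (disjoint_inside_outside K).subset_compl_right
    (isOpen_outside hK).isClosed_compl

lemma closure_outside_subset {K : Set ℂ} (hK : IsClosed K) :
    closure (outside K) ⊆ outside K ∪ K := by
  have : outside K ∪ K = (inside K)ᶜ := by
    ext a; simp only [inside, outside, mem_union, mem_compl_iff, mem_ofPred_eq]; tauto
  rw [this]
  exact closure_minimal (disjoint_inside_outside K).symm.subset_compl_right
    (isOpen_inside hK).isClosed_compl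

lemma inside_subset_of_convex {K C : Set ℂ} (hC : Convex ℝ C) (hKC : K ⊆ C) : inside K ⊆ C := by
  intro a ha
  by_contra h
  refine ha.2 ((HasLog.of_convex hC (by fun_prop) fun z hz h' => h ?_).mono hKC)
  rwa [← sub_eq_zero.1 h']

lemma isBounded_inside {K : Set ℂ} (hK : Bornology.IsBounded K) :
    Bornology.IsBounded (inside K) := by
  obtain ⟨R, hR⟩ := hK.subset_ball 0
  exact Metric.isBounded_ball.subset (inside_subset_of_convex (convex_ball 0 R) hR)

lemma isPreconnected_norm_gt (R : ℝ) : IsPreconnected {z : ℂ | R < ‖z‖} := by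
  rcases lt_or_ge 0 R with hR | hR
  · have : {z : ℂ | R < ‖z‖} = Complex.exp '' {z : ℂ | Real.log R < z.re} := by
      ext z
      simp only [mem_ofPred_eq, mem_image]
      constructor
      · intro h
        have hz : z ≠ 0 := by rintro rfl; simp at h; linarith
        refine ⟨Complex.log z, ?_, Complex.exp_log hz⟩
        rw [Complex.log_re]
        exact Real.log_lt_log hR h
      · rintro ⟨w, hw, rfl⟩
        rw [Complex.norm_exp]
        exact (Real.log_lt_iff_lt_exp hR).1 hw
    rw [this]
    exact (convex_halfSpace_re_gt _).isPreconnected.image _ Complex.continuous_exp.continuousOn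
  · rcases hR.lt_or_eq with hR | rfl
    · have : {z : ℂ | R < ‖z‖} = univ := by
        ext z; simp only [mem_ofPred_eq, mem_univ, iff_true]; linarith [norm_nonneg z]
      rw [this]; exact isPreconnected_univ
    · have : {z : ℂ | 0 < ‖z‖} = range Complex.exp := by
        rw [Complex.range_exp]; ext z; simp
      rw [this]; exact isPreconnected_range Complex.continuous_exp

lemma mem_outside_of_norm_gt {K : Set ℂ} {R : ℝ} (hK : K ⊆ closedBall 0 R) {b : ℂ}
    (hb : R < ‖b‖) : b ∈ outside K := by
  have hbn : b ∉ closedBall (0 : ℂ) R := by simpa using hb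
  refine ⟨fun h => hbn (hK h), ?_⟩
  refine (HasLog.of_convex (convex_closedBall 0 R) (by fun_prop) fun z hz h' => ?_).mono hK
  exact hbn (by rwa [← sub_eq_zero.1 h'])

/-- The complementary component of an inside point is bounded. -/
lemma connectedComponentIn_subset_inside {K : Set ℂ} (hK : IsClosed K) {a : ℂ}
    (ha : a ∈ inside K) : connectedComponentIn Kᶜ a ⊆ inside K :=
  subset_inside_of_preconnected hK isPreconnected_connectedComponentIn
    (subset_compl_iff_disjoint_right.1 (connectedComponentIn_subset _ _))
    (mem_connectedComponentIn ha.1) ha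

lemma frontier_connectedComponentIn_subset {K : Set ℂ} (hK : IsClosed K) (a : ℂ) :
    frontier (connectedComponentIn Kᶜ a) ⊆ K := by
  intro z hz
  by_contra h
  have ho : IsOpen (connectedComponentIn Kᶜ a) := hK.isOpen_compl.connectedComponentIn
  have ho' : IsOpen (connectedComponentIn Kᶜ z) := hK.isOpen_compl.connectedComponentIn
  have hz' : z ∈ connectedComponentIn Kᶜ z := mem_connectedComponentIn h
  rw [ho.frontier_eq] at hz
  obtain ⟨w, hw, hw'⟩ := mem_closure_iff.1 hz.1 _ ho' hz'
  rw [connectedComponentIn_eq hw, ← connectedComponentIn_eq hw'] at hz'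
  exact hz.2 hz'

/-- In the complement of a compact set, the component of an unbounded point. -/
lemma isBounded_connectedComponentIn_iff {K : Set ℂ} (hK : IsCompact K) {a : ℂ} (ha : a ∉ K) :
    Bornology.IsBounded (connectedComponentIn Kᶜ a) ↔ a ∈ inside K := by
  refine ⟨fun hb => ⟨ha, fun h => ?_⟩, fun h =>
    (isBounded_inside hK.isBounded).subset (connectedComponentIn_subset_inside hK.isClosed h)⟩
  refine not_hasLog_frontier (n := 1) (u := fun _ => 1) hK.isClosed.isOpen_compl.connectedComponentIn
    hb (mem_connectedComponentIn ha) one_ne_zero continuousOn_const (by simp) ?_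
  exact (h.mono (frontier_connectedComponentIn_subset hK.isClosed a)).congr (by simp)

lemma isPreconnected_outside {K : Set ℂ} (hK : IsCompact K) : IsPreconnected (outside K) := by
  obtain ⟨R, hR⟩ := hK.isBounded.subset_closedBall 0
  have hW : {z : ℂ | R < ‖z‖} ⊆ outside K := fun z hz => mem_outside_of_norm_gt hR hz
  have hR0 : R < ‖((|R| + 1 : ℝ) : ℂ)‖ := by
    rw [Complex.norm_real, Real.norm_of_nonneg (by positivity)]; linarith [le_abs_self R]
  refine isPreconnected_of_forall (((|R| + 1 : ℝ) : ℂ)) fun a ha => ?_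
  have hub : ¬ Bornology.IsBounded (connectedComponentIn Kᶜ a) := by
    rw [isBounded_connectedComponentIn_iff hK ha.1]
    exact fun h => disjoint_left.1 (disjoint_inside_outside K) h ha
  have : ∃ b ∈ connectedComponentIn Kᶜ a, R < ‖b‖ := by
    by_contra! hcon
    exact hub (isBounded_closedBall.subset (fun b hb => by simpa using hcon b hb :
      connectedComponentIn Kᶜ a ⊆ closedBall 0 R))
  obtain ⟨b, hb, hbR⟩ := this
  have hsub : connectedComponentIn Kᶜ a ⊆ outside K :=
    subset_outside_of_preconnected hK.isClosed isPreconnected_connectedComponentIn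
    (subset_compl_iff_disjoint_right.1 (connectedComponentIn_subset _ _))
    (mem_connectedComponentIn ha.1) ha
  refine ⟨_, union_subset hsub hW, Or.inr hR0, Or.inl (mem_connectedComponentIn ha.1), ?_⟩
  exact IsPreconnected.union b hb hbR isPreconnected_connectedComponentIn (isPreconnected_norm_gt R)

lemma outside_not_bounded {K : Set ℂ} (hK : Bornology.IsBounded K) :
    ¬ Bornology.IsBounded (outside K) := by
  intro h
  obtain ⟨R, hR⟩ := (hK.union h).subset_closedBall 0
  have hR0 : R < ‖((|R| + 1 : ℝ) : ℂ)‖ := by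
    rw [Complex.norm_real, Real.norm_of_nonneg (by positivity)]; linarith [le_abs_self R]
  have h1 := mem_outside_of_norm_gt (subset_union_left.trans hR) hR0
  have h2 := hR (Or.inr h1)
  rw [mem_closedBall_zero_iff] at h2
  linarith

lemma outside_subset_outside {K L : Set ℂ} (hK : IsCompact K) (hL : IsCompact L)
    (h : Disjoint (outside K) L) : outside K ⊆ outside L := by
  have hex : ∃ a ∈ outside K, a ∈ outside L := by
    by_contra! hcon
    refine outside_not_bounded hK.isBounded ((isBounded_inside hL.isBounded).subset fun a ha => ?_)
    have : a ∈ Lᶜ := disjoint_left.1 h ha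
    rw [compl_eq_inside_union_outside] at this
    exact this.resolve_right (hcon a ha)
  obtain ⟨a, ha, ha'⟩ := hex
  exact subset_outside_of_preconnected hL.isClosed (isPreconnected_outside hK) h ha ha'

/-- If the quotient `(z - a) / (z - b)` has a logarithm on `K`, then `K` does not separate. -/
lemma exists_preconnected_of_hasLog {K : Set ℂ} (hK : IsCompact K) {a b : ℂ} (ha : a ∉ K)
    (hb : b ∉ K) (h : HasLog (fun z => (z - b) / (z - a)) K) :
    b ∈ connectedComponentIn Kᶜ a := by
  have key : ∀ a b : ℂ, a ∈ inside K → b ∉ K → HasLog (fun z => (z - b) / (z - a)) K →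
      b ∈ connectedComponentIn Kᶜ a := by
    intro a b hai hb h
    by_contra hnb
    have hcl : b ∉ closure (connectedComponentIn Kᶜ a) := by
      intro hcl
      have ho : IsOpen (connectedComponentIn Kᶜ a) := hK.isClosed.isOpen_compl.connectedComponentIn
      exact hb (frontier_connectedComponentIn_subset hK.isClosed a
        (by rw [ho.frontier_eq]; exact ⟨hcl, hnb⟩))
    have hne : ∀ z ∈ closure (connectedComponentIn Kᶜ a), z - b ≠ 0 := fun z hz h0 =>
      hcl (by rwa [← sub_eq_zero.1 h0])
    refine not_hasLog_frontier (n := 1) (u := fun z => (z - b)⁻¹)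
      hK.isClosed.isOpen_compl.connectedComponentIn
      ((isBounded_connectedComponentIn_iff hK hai.1).2 hai) (mem_connectedComponentIn hai.1)
      one_ne_zero (ContinuousOn.inv₀ (by fun_prop) hne) (fun z hz => inv_ne_zero (hne z hz)) ?_
    exact (h.inv.mono (frontier_connectedComponentIn_subset hK.isClosed a)).congr fun z _ => by
      rw [inv_div, zpow_one, div_eq_mul_inv]
  by_cases hai : a ∈ inside K
  · exact key a b hai hb h
  by_cases hbi : b ∈ inside K
  · have := key b a hbi ha (h.inv.congr fun z _ => by rw [inv_div])
    rw [← connectedComponentIn_eq this]; exact mem_connectedComponentIn hb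
  have hao : a ∈ outside K := ⟨ha, by by_contra h; exact hai ⟨ha, h⟩⟩
  have hbo : b ∈ outside K := ⟨hb, by by_contra h; exact hbi ⟨hb, h⟩⟩
  exact (isPreconnected_outside hK).subset_connectedComponentIn hao (fun z hz => hz.1) hbo

/-- Janiszewski's theorem. -/
lemma mem_connectedComponentIn_union {K L : Set ℂ} (hK : IsCompact K) (hL : IsCompact L)
    (hc : IsPreconnected (K ∩ L)) {a b : ℂ} (hKa : b ∈ connectedComponentIn Kᶜ a)
    (hLa : b ∈ connectedComponentIn Lᶜ a) : b ∈ connectedComponentIn (K ∪ L)ᶜ a := by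
  have haK : a ∈ Kᶜ := connectedComponentIn_nonempty_iff.1 ⟨_, hKa⟩
  have haL : a ∈ Lᶜ := connectedComponentIn_nonempty_iff.1 ⟨_, hLa⟩
  have hbK : b ∈ Kᶜ := connectedComponentIn_subset _ _ hKa
  have hbL : b ∈ Lᶜ := connectedComponentIn_subset _ _ hLa
  refine exists_preconnected_of_hasLog (hK.union hL) (by simp_all) (by simp_all)
    (HasLog.union (Or.inl ⟨hK.isClosed, hL.isClosed⟩) hc ?_ ?_)
  · exact HasLog.of_preconnected hK.isClosed isPreconnected_connectedComponentIn
      (subset_compl_iff_disjoint_right.1 (connectedComponentIn_subset _ _))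
      (mem_connectedComponentIn haK) hKa
  · exact HasLog.of_preconnected hL.isClosed isPreconnected_connectedComponentIn
      (subset_compl_iff_disjoint_right.1 (connectedComponentIn_subset _ _))
      (mem_connectedComponentIn haL) hLa

/-! ### Arcs and Jordan curves -/

/-- `A` is an arc with end points `a` and `b`. -/
def IsArc {X : Type*} [TopologicalSpace X] (A : Set X) (a b : X) : Prop :=
  ∃ φ : ℝ → X, ContinuousOn φ (Icc 0 1) ∧ InjOn φ (Icc 0 1) ∧ φ 0 = a ∧ φ 1 = b ∧
    φ '' Icc 0 1 = A

/-- `J` is a closed Jordan curve, given by a periodic parametrization. -/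
def IsJordanLoop {X : Type*} [TopologicalSpace X] (J : Set X) : Prop :=
  ∃ g : ℝ → X, Continuous g ∧ Function.Periodic g 1 ∧ InjOn g (Ico 0 1) ∧ range g = J

section Arcs

variable {X Y : Type*} [TopologicalSpace X] [TopologicalSpace Y] {A B J : Set X} {a b c : X}

lemma isArc_image_Icc {φ : ℝ → X} {s t : ℝ} (hst : s < t) (hφ : ContinuousOn φ (Icc s t))
    (hi : InjOn φ (Icc s t)) : IsArc (φ '' Icc s t) (φ s) (φ t) := by
  have hm : (fun u : ℝ => (t - s) * u + s) '' Icc 0 1 = Icc s t := by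
    rw [image_affine_Icc' (by linarith)]; simp
  have hmaps : MapsTo (fun u : ℝ => (t - s) * u + s) (Icc 0 1) (Icc s t) := by
    rw [← hm]; exact mapsTo_image _ _
  refine ⟨fun u => φ ((t - s) * u + s), hφ.comp (by fun_prop) hmaps,
    hi.comp (fun x _ y _ hxy => ?_) hmaps, by simp, by simp, ?_⟩
  · have : (t - s) * x = (t - s) * y := by simpa using hxy
    exact mul_left_cancel₀ (by linarith) this
  · rw [← hm, image_image]

lemma IsArc.symm (h : IsArc A a b) : IsArc A b a := by
  obtain ⟨φ, hc, hi, h0, h1, hA⟩ := h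
  have hm : (fun u : ℝ => 1 - u) '' Icc 0 1 = Icc 0 1 := by simp
  have hmaps : MapsTo (fun u : ℝ => 1 - u) (Icc 0 1) (Icc 0 1) := by
    intro u hu; exact ⟨by linarith [hu.2], by linarith [hu.1]⟩
  refine ⟨fun u => φ (1 - u), hc.comp (by fun_prop) hmaps,
    hi.comp (fun x _ y _ hxy => by simpa using hxy) hmaps, by simpa, by simpa, ?_⟩
  rw [← hA]
  conv_rhs => rw [← hm, image_image]

lemma IsArc.left_mem (h : IsArc A a b) : a ∈ A := by
  obtain ⟨φ, -, -, h0, -, rfl⟩ := h; exact ⟨0, by simp, h0⟩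

lemma IsArc.right_mem (h : IsArc A a b) : b ∈ A := h.symm.left_mem

lemma IsArc.ne (h : IsArc A a b) : a ≠ b := by
  obtain ⟨φ, -, hi, h0, h1, rfl⟩ := h
  intro hab
  have := hi (by simp : (0 : ℝ) ∈ Icc (0 : ℝ) 1) (by simp : (1 : ℝ) ∈ Icc (0 : ℝ) 1)
    (by rw [h0, h1, hab])
  norm_num at this

lemma IsArc.isCompact (h : IsArc A a b) : IsCompact A := by
  obtain ⟨φ, hc, -, -, -, rfl⟩ := h; exact isCompact_Icc.image_of_continuousOn hc

lemma IsArc.isPreconnected (h : IsArc A a b) : IsPreconnected A := by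
  obtain ⟨φ, hc, -, -, -, rfl⟩ := h; exact isPreconnected_Icc.image _ hc

lemma IsArc.image (h : IsArc A a b) {f : X → Y} (hf : ContinuousOn f A) (hi : InjOn f A) :
    IsArc (f '' A) (f a) (f b) := by
  obtain ⟨φ, hc, hφ, rfl, rfl, rfl⟩ := h
  exact ⟨f ∘ φ, hf.comp hc (mapsTo_image _ _), hi.comp hφ (mapsTo_image _ _), rfl, rfl,
    image_comp _ _ _⟩

lemma IsArc.hasLog [T2Space X] (h : IsArc A a b) {f : X → ℂ} (hf : ContinuousOn f A)
    (h0 : ∀ z ∈ A, f z ≠ 0) : HasLog f A := by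
  obtain ⟨φ, hc, hi, -, -, rfl⟩ := h
  have h1 : HasLog (fun t => f (φ t)) (Icc (0 : ℝ) 1) :=
    HasLog.of_convex (convex_Icc 0 1) (hf.comp hc (mapsTo_image _ _))
      fun t ht => h0 _ (mem_image_of_mem _ ht)
  refine (h1.comp (continuousOn_invFunOn_image isCompact_Icc hc hi)
    fun y hy => Function.invFunOn_mem hy).congr fun y hy => ?_
  rw [Function.invFunOn_eq hy]

lemma continuousOn_Icc_ite {f g : ℝ → X} {s t u : ℝ} (hst : s ≤ t) (htu : t ≤ u)
    (hf : ContinuousOn f (Icc s t)) (hg : ContinuousOn g (Icc t u)) (h : f t = g t) :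
    ContinuousOn (fun x => if x ≤ t then f x else g x) (Icc s u) := by
  rw [← Icc_union_Icc_eq_Icc hst htu]
  refine ContinuousOn.union_of_isClosed (hf.congr fun x hx => by simp [hx.2]) (hg.congr
    fun x hx => ?_) isClosed_Icc isClosed_Icc
  rcases hx.1.lt_or_eq with h1 | rfl
  · simp [not_le.2 h1]
  · simp [h]

lemma IsArc.trans (hA : IsArc A a b) (hB : IsArc B b c) (h : A ∩ B ⊆ {b}) :
    IsArc (A ∪ B) a c := by
  obtain ⟨φ, hφc, hφi, hφ0, hφ1, rfl⟩ := hA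
  obtain ⟨ψ, hψc, hψi, hψ0, hψ1, rfl⟩ := hB
  have hm : MapsTo (fun x : ℝ => x - 1) (Icc 1 2) (Icc 0 1) := fun x hx =>
    ⟨by linarith [hx.1], by linarith [hx.2]⟩
  have hc := continuousOn_Icc_ite (f := φ) (g := fun x => ψ (x - 1)) (s := 0) (t := 1) (u := 2)
    (by norm_num) (by norm_num) hφc (hψc.comp (by fun_prop) hm) (by simp [hφ1, hψ0])
  have hx2 : ∀ x : ℝ, x ∈ Icc (0 : ℝ) 2 → ¬ x ≤ 1 → x - 1 ∈ Icc (0 : ℝ) 1 := fun x hx h =>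
    ⟨by linarith, by linarith [hx.2]⟩
  have hcross : ∀ x y : ℝ, x ∈ Icc (0 : ℝ) 2 → y ∈ Icc (0 : ℝ) 2 → x ≤ 1 → ¬ y ≤ 1 →
      φ x ≠ ψ (y - 1) := by
    intro x y hx hy hx1 hy1 heq
    have h1 : φ x = b := h ⟨⟨x, ⟨hx.1, hx1⟩, rfl⟩, heq ▸ ⟨y - 1, hx2 y hy hy1, rfl⟩⟩
    have := hψi (hx2 y hy hy1) (by simp : (0 : ℝ) ∈ Icc (0 : ℝ) 1) (by rw [← heq, h1, hψ0])
    linarith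
  have hi : InjOn (fun x => if x ≤ 1 then φ x else ψ (x - 1)) (Icc 0 2) := by
    intro x hx y hy hxy
    by_cases hx1 : x ≤ 1 <;> by_cases hy1 : y ≤ 1 <;> simp only [hx1, hy1, if_true, if_false] at hxy
    · exact hφi ⟨hx.1, hx1⟩ ⟨hy.1, hy1⟩ hxy
    · exact absurd hxy (hcross x y hx hy hx1 hy1)
    · exact absurd hxy.symm (hcross y x hy hx hy1 hx1)
    · have := hψi (hx2 x hx hx1) (hx2 y hy hy1) hxy
      linarith
  have := isArc_image_Icc (by norm_num) hc hi
  convert this using 1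
  · ext z
    constructor
    · rintro (⟨x, hx, rfl⟩ | ⟨x, hx, rfl⟩)
      · exact ⟨x, ⟨hx.1, by linarith [hx.2]⟩, by simp [hx.2]⟩
      · refine ⟨x + 1, ⟨by linarith [hx.1], by linarith [hx.2]⟩, ?_⟩
        rcases hx.1.lt_or_eq with h1 | rfl
        · simp [h1]
        · simp [hφ1, hψ0]
    · rintro ⟨x, hx, rfl⟩
      by_cases hx1 : x ≤ 1
      · left; exact ⟨x, ⟨hx.1, hx1⟩, by simp [hx1]⟩
      · right; exact ⟨x - 1, hx2 x hx hx1, by simp [hx1]⟩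
  · simp [hφ0]
  · norm_num [hψ1]

lemma IsArc.exists_subarc (h : IsArc A a b) {x y : X} (hx : x ∈ A) (hy : y ∈ A) (hxy : x ≠ y) :
    ∃ A' ⊆ A, IsArc A' x y := by
  obtain ⟨φ, hc, hi, rfl, rfl, rfl⟩ := h
  obtain ⟨s, hs, rfl⟩ := hx
  obtain ⟨t, ht, rfl⟩ := hy
  have key : ∀ s t : ℝ, s ∈ Icc (0 : ℝ) 1 → t ∈ Icc (0 : ℝ) 1 → s < t →
      ∃ A' ⊆ φ '' Icc 0 1, IsArc A' (φ s) (φ t) := fun s t hs ht hst => by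
    have hsub : Icc s t ⊆ Icc (0 : ℝ) 1 := Icc_subset_Icc hs.1 ht.2
    exact ⟨φ '' Icc s t, image_mono hsub, isArc_image_Icc hst (hc.mono hsub) (hi.mono hsub)⟩
  rcases lt_or_gt_of_ne (fun h => hxy (by rw [h]) : s ≠ t) with h | h
  · exact key s t hs ht h
  · obtain ⟨A', h1, h2⟩ := key t s ht hs h
    exact ⟨A', h1, h2.symm⟩

lemma IsArc.isPreconnected_diff (h : IsArc A a b) : IsPreconnected (A \ {a, b}) ∧
    (A \ {a, b}).Nonempty ∧ A ⊆ closure (A \ {a, b}) := by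
  obtain ⟨φ, hc, hi, rfl, rfl, rfl⟩ := h
  have he : φ '' Icc 0 1 \ {φ 0, φ 1} = φ '' Ioo 0 1 := by
    ext z
    constructor
    · rintro ⟨⟨t, ht, rfl⟩, hz⟩
      simp only [mem_insert_iff, mem_singleton_iff, not_or] at hz
      exact ⟨t, ⟨ht.1.lt_of_ne fun h => hz.1 (by rw [h]), ht.2.lt_of_ne fun h => hz.2 (by rw [h])⟩,
        rfl⟩
    · rintro ⟨t, ht, rfl⟩
      refine ⟨⟨t, Ioo_subset_Icc_self ht, rfl⟩, ?_⟩
      simp only [mem_insert_iff, mem_singleton_iff, not_or]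
      exact ⟨fun h => ht.1.ne' (hi (Ioo_subset_Icc_self ht) (by simp) h),
        fun h => ht.2.ne (hi (Ioo_subset_Icc_self ht) (by simp) h)⟩
  rw [he]
  refine ⟨isPreconnected_Ioo.image _ (hc.mono Ioo_subset_Icc_self), ⟨φ (1 / 2), 1 / 2,
    by norm_num, rfl⟩, ?_⟩
  have h01 : closure (Ioo (0 : ℝ) 1) = Icc 0 1 := closure_Ioo (by norm_num)
  rw [← h01] at hc ⊢
  exact hc.image_closure

lemma IsJordanLoop.of_arcs (hA : IsArc A a b) (hB : IsArc B a b) (h : A ∩ B ⊆ {a, b}) :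
    IsJordanLoop (A ∪ B) := by
  obtain ⟨φ, hφc, hφi, hφ0, hφ1, rfl⟩ := hA
  obtain ⟨ψ, hψc, hψi, hψ0, hψ1, rfl⟩ := hB
  have m1 : MapsTo (fun x : ℝ => 2 * x) (Icc 0 (1 / 2)) (Icc 0 1) := fun x hx =>
    ⟨by linarith [hx.1], by linarith [hx.2]⟩
  have m2 : MapsTo (fun x : ℝ => 2 - 2 * x) (Icc (1 / 2) 1) (Icc 0 1) := fun x hx =>
    ⟨by linarith [hx.2], by linarith [hx.1]⟩
  have hc := continuousOn_Icc_ite (f := fun x => φ (2 * x)) (g := fun x => ψ (2 - 2 * x)) (s := 0)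
    (t := 1 / 2) (u := 1) (by norm_num) (by norm_num) (hφc.comp (by fun_prop) m1)
    (hψc.comp (by fun_prop) m2) (by norm_num [hφ1, hψ1])
  set f : ℝ → X := fun x => if x ≤ 1 / 2 then φ (2 * x) else ψ (2 - 2 * x) with hf
  have f1 : ∀ x, x ≤ 1 / 2 → f x = φ (2 * x) := fun x hx => by simp only [hf, if_pos hx]
  have f2 : ∀ x, ¬ x ≤ 1 / 2 → f x = ψ (2 - 2 * x) := fun x hx => by simp only [hf, if_neg hx]
  have hcross : ∀ x y : ℝ, x ∈ Ico (0 : ℝ) 1 → y ∈ Ico (0 : ℝ) 1 → x ≤ 1 / 2 → ¬ y ≤ 1 / 2 →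
      φ (2 * x) ≠ ψ (2 - 2 * y) := by
    intro x y hx hy hx1 hy1 heq
    have hm1 := m1 ⟨hx.1, hx1⟩
    have hm2 := m2 ⟨(not_le.1 hy1).le, hy.2.le⟩
    rcases h ⟨⟨_, hm1, rfl⟩, heq ▸ ⟨_, hm2, rfl⟩⟩ with h1 | h1
    · have := hψi hm2 (by simp : (0 : ℝ) ∈ Icc (0 : ℝ) 1) (by rw [← heq, h1, hψ0])
      dsimp at this
      linarith [hy.2]
    · have := hψi hm2 (by simp : (1 : ℝ) ∈ Icc (0 : ℝ) 1)
        (by rw [← heq, mem_singleton_iff.1 h1, hψ1])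
      dsimp at this
      exact hy1 (by linarith)
  refine ⟨f ∘ Int.fract, ?_, fun x => by simp, ?_, ?_⟩
  · refine ContinuousOn.comp_fract'' hc ?_
    rw [f1 0 (by norm_num), f2 1 (by norm_num)]
    norm_num [hφ0, hψ0]
  · intro x hx y hy hxy
    simp only [Function.comp, Int.fract_eq_self.2 ⟨hx.1, hx.2⟩,
      Int.fract_eq_self.2 ⟨hy.1, hy.2⟩] at hxy
    by_cases hx1 : x ≤ 1 / 2 <;> by_cases hy1 : y ≤ 1 / 2
    · rw [f1 x hx1, f1 y hy1] at hxy
      have := hφi (m1 ⟨hx.1, hx1⟩) (m1 ⟨hy.1, hy1⟩) hxy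
      dsimp at this; linarith
    · rw [f1 x hx1, f2 y hy1] at hxy
      exact absurd hxy (hcross x y hx hy hx1 hy1)
    · rw [f2 x hx1, f1 y hy1] at hxy
      exact absurd hxy.symm (hcross y x hy hx hy1 hx1)
    · rw [f2 x hx1, f2 y hy1] at hxy
      have := hψi (m2 ⟨(not_le.1 hx1).le, hx.2.le⟩) (m2 ⟨(not_le.1 hy1).le, hy.2.le⟩) hxy
      dsimp at this; linarith
  · ext z
    constructor
    · rintro ⟨x, rfl⟩
      have h0 := Int.fract_nonneg x
      have h1 := Int.fract_lt_one x
      by_cases hx : Int.fract x ≤ 1 / 2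
      · left; exact ⟨_, m1 ⟨h0, hx⟩, (f1 _ hx).symm⟩
      · right; exact ⟨_, m2 ⟨(not_le.1 hx).le, h1.le⟩, (f2 _ hx).symm⟩
    · have key : ∀ u : ℝ, u ∈ Ico (0 : ℝ) 1 → f u ∈ range (f ∘ Int.fract) := fun u hu =>
        ⟨u, by simp [Int.fract_eq_self.2 ⟨hu.1, hu.2⟩]⟩
      rintro (⟨x, hx, rfl⟩ | ⟨x, hx, rfl⟩)
      · have := key (x / 2) ⟨by linarith [hx.1], by linarith [hx.2]⟩
        rwa [f1 _ (by linarith [hx.2]), mul_div_cancel₀ _ two_ne_zero] at this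
      · rcases hx.1.lt_or_eq with h0 | rfl
        · rcases hx.2.lt_or_eq with h1 | rfl
          · have := key (1 - x / 2) ⟨by linarith, by linarith⟩
            rw [f2 _ (by linarith)] at this
            convert this using 2; ring
          · have := key (1 / 2) ⟨by norm_num, by norm_num⟩
            rw [f1 _ (by norm_num)] at this
            rw [hψ1]; norm_num [hφ1] at this; simpa using this
        · have := key 0 ⟨by norm_num, by norm_num⟩
          rw [f1 _ (by norm_num)] at this
          rw [hψ0]; norm_num [hφ0] at this; simpa using this

lemma map_fract_of_periodic {Z : Type*} {g : ℝ → Z} (hp : Function.Periodic g 1) (t : ℝ) :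
    g (Int.fract t) = g t := by
  have := hp.sub_int_mul_eq (x := t) ⌊t⌋
  rwa [mul_one] at this

lemma IsJordanLoop.exists_param (h : IsJordanLoop J) {x : X} (hx : x ∈ J) : ∃ g : ℝ → X, Continuous g ∧
    Function.Periodic g 1 ∧ InjOn g (Ico 0 1) ∧ range g = J ∧ g 0 = x := by
  obtain ⟨g, hc, hp, hi, rfl⟩ := h
  obtain ⟨s, rfl⟩ := hx
  refine ⟨fun t => g (t + s), by fun_prop, fun t => ?_, ?_, ?_, by simp⟩
  · dsimp only
    rw [show t + 1 + s = t + s + 1 by ring, hp]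
  · intro x hx y hy hxy
    dsimp only at hxy
    have hf : ∀ u, g u = g (Int.fract u) := fun u => (map_fract_of_periodic hp u).symm
    rw [hf, hf (y + s)] at hxy
    have h1 := hi ⟨Int.fract_nonneg _, Int.fract_lt_one _⟩
      ⟨Int.fract_nonneg _, Int.fract_lt_one _⟩ hxy
    obtain ⟨n, hn⟩ := Int.fract_eq_fract.1 h1
    have h2 : x - y = n := by linarith
    have h3 : (-1 : ℝ) < n := by rw [← h2]; linarith [hx.1, hy.2]
    have h4 : (n : ℝ) < 1 := by rw [← h2]; linarith [hx.2, hy.1]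
    have h5 : n = 0 := by
      have : -1 < n := by exact_mod_cast h3
      have : n < 1 := by exact_mod_cast h4
      omega
    rw [h5] at h2; push_cast at h2; linarith
  · ext z
    constructor
    · rintro ⟨t, rfl⟩; exact ⟨t + s, rfl⟩
    · rintro ⟨t, rfl⟩; exact ⟨t - s, by simp⟩

lemma range_eq_image_Ico_of_periodic {Z : Type*} {g : ℝ → Z} (hp : Function.Periodic g 1) :
    range g = g '' Ico 0 1 := by
  refine Subset.antisymm ?_ (image_subset_range _ _)
  rintro _ ⟨t, rfl⟩
  exact ⟨Int.fract t, ⟨Int.fract_nonneg _, Int.fract_lt_one _⟩, map_fract_of_periodic hp t⟩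

lemma IsJordanLoop.isCompact (h : IsJordanLoop J) : IsCompact J := by
  obtain ⟨g, hc, hp, -, rfl⟩ := h
  have : range g = g '' Icc 0 1 := by
    refine Subset.antisymm ?_ (image_subset_range _ _)
    rw [range_eq_image_Ico_of_periodic hp]; exact image_mono Ico_subset_Icc_self
  rw [this]
  exact isCompact_Icc.image hc

lemma IsJordanLoop.nonempty (h : IsJordanLoop J) : J.Nonempty := by
  obtain ⟨g, -, -, -, rfl⟩ := h
  exact range_nonempty _

lemma IsJordanLoop.image (h : IsJordanLoop J) {f : X → Y} (hf : ContinuousOn f J) (hi : InjOn f J) :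
    IsJordanLoop (f '' J) := by
  obtain ⟨g, hc, hp, hg, rfl⟩ := h
  exact ⟨f ∘ g, hf.comp_continuous hc mem_range_self, fun x => by simp [hp x],
    hi.comp hg fun x _ => mem_range_self x, range_comp _ _⟩

/-- A Jordan curve is cut by two points into two arcs. -/
lemma IsJordanLoop.split (h : IsJordanLoop J) (ha : a ∈ J) (hb : b ∈ J) (hab : a ≠ b) :
    ∃ A B, IsArc A a b ∧ IsArc B a b ∧ A ∪ B = J ∧ A ∩ B = {a, b} := by
  obtain ⟨g, hc, hp, hi, rfl, rfl⟩ := h.exists_param ha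
  rw [range_eq_image_Ico_of_periodic hp] at hb
  obtain ⟨t, ht, rfl⟩ := hb
  have h0 : 0 < t := ht.1.lt_of_ne fun h => hab (by rw [h])
  have h10 : g 1 = g 0 := by simpa using hp 0
  have hi1 : InjOn g (Icc 0 t) := hi.mono (Icc_subset_Ico_right ht.2)
  have hi2 : InjOn g (Icc t 1) := by
    intro x hx y hy hxy
    have key : ∀ x ∈ Icc t 1, g x = g 1 → x = 1 := by
      intro x hx h
      by_contra hne
      have := hi (⟨h0.le.trans hx.1, hx.2.lt_of_ne hne⟩ : x ∈ Ico (0 : ℝ) 1) (by simp)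
        (h.trans h10)
      linarith [hx.1]
    by_cases hx1 : x = 1
    · subst hx1; exact (key y hy hxy.symm).symm
    · by_cases hy1 : y = 1
      · subst hy1; exact key x hx hxy
      · exact hi ⟨h0.le.trans hx.1, hx.2.lt_of_ne hx1⟩ ⟨h0.le.trans hy.1, hy.2.lt_of_ne hy1⟩ hxy
  refine ⟨g '' Icc 0 t, g '' Icc t 1, isArc_image_Icc h0 hc.continuousOn hi1, ?_, ?_, ?_⟩
  · have := (isArc_image_Icc ht.2 hc.continuousOn hi2).symm
    rwa [h10] at this
  · rw [← image_union, Icc_union_Icc_eq_Icc h0.le ht.2.le, range_eq_image_Ico_of_periodic hp]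
    refine Subset.antisymm ?_ (image_mono Ico_subset_Icc_self)
    rintro _ ⟨x, hx, rfl⟩
    rcases hx.2.lt_or_eq with h1 | rfl
    · exact ⟨x, ⟨hx.1, h1⟩, rfl⟩
    · exact ⟨0, by simp, h10.symm⟩
  · ext z
    simp only [mem_inter_iff, mem_insert_iff, mem_singleton_iff]
    constructor
    · rintro ⟨⟨x, hx, rfl⟩, y, hy, hxy⟩
      rcases hy.2.lt_or_eq with h1 | rfl
      · have := hi ⟨h0.le.trans hy.1, h1⟩ ⟨hx.1, hx.2.trans_lt ht.2⟩ hxy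
        right; rw [← le_antisymm hx.2 (this ▸ hy.1)]
      · left; rw [← hxy, h10]
    · rintro (rfl | rfl)
      · exact ⟨⟨0, ⟨le_rfl, h0.le⟩, rfl⟩, 1, ⟨ht.2.le, le_rfl⟩, h10⟩
      · exact ⟨⟨t, ⟨h0.le, le_rfl⟩, rfl⟩, t, ⟨le_rfl, ht.2.le⟩, rfl⟩

/-- A Jordan curve without a neighbourhood of one of its points lies in a subarc. -/
lemma IsJordanLoop.exists_arc_avoiding (h : IsJordanLoop J) {x : X} (hx : x ∈ J) {N : Set X}
    (hN : N ∈ 𝓝 x) : ∃ A c d, IsArc A c d ∧ A ⊆ J \ {x} ∧ J \ N ⊆ A := by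
  obtain ⟨g, hc, hp, hi, rfl, rfl⟩ := h.exists_param hx
  obtain ⟨r, hr, hrN⟩ := Metric.mem_nhds_iff.1 (hc.continuousAt.preimage_mem_nhds hN)
  set d := min (r / 2) (1 / 4) with hd
  have hd0 : 0 < d := by positivity
  have hd1 : d ≤ 1 / 4 := min_le_right _ _
  have hdr : d < r := (min_le_left _ _).trans_lt (by linarith)
  have hs : Icc d (1 - d) ⊆ Ico 0 1 := fun u hu => ⟨by linarith [hu.1], by linarith [hu.2]⟩
  refine ⟨g '' Icc d (1 - d), _, _, isArc_image_Icc (by linarith) hc.continuousOn (hi.mono hs),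
    ?_, ?_⟩
  · rintro _ ⟨u, hu, rfl⟩
    refine ⟨mem_range_self u, fun h => ?_⟩
    have := hi (hs hu) (by simp) h
    linarith [hu.1]
  · rintro z ⟨hz, hzN⟩
    rw [range_eq_image_Ico_of_periodic hp] at hz
    obtain ⟨u, hu, rfl⟩ := hz
    refine ⟨u, ?_, rfl⟩
    by_contra hcon
    rcases lt_or_ge u d with h1 | h1
    · refine hzN (hrN (show u ∈ ball 0 r from ?_))
      rw [mem_ball_zero_iff, Real.norm_of_nonneg hu.1]; linarith
    · have h2 : 1 - d < u := by by_contra h2; exact hcon ⟨h1, not_lt.1 h2⟩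
      have h3 : g (u - 1) ∈ N := hrN (show u - 1 ∈ ball 0 r by
        rw [mem_ball_zero_iff, Real.norm_eq_abs, abs_lt]; constructor <;> linarith [hu.2])
      rw [hp.sub_eq] at h3
      exact hzN h3

end Arcs

/-! ### The Jordan curve theorem -/

lemma IsArc.hasLog_compl {A : Set ℂ} {p q : ℂ} (hA : IsArc A p q) :
    HasLog (fun z => (z - p) / (z - q)) Aᶜ := by
  obtain ⟨φ, hc, hi, rfl, rfl, rfl⟩ := hA
  have hm : MapsTo (fun u : ℝ => 1 - u) (Icc 0 1) (Icc 0 1) := by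
    intro u hu; exact ⟨by linarith [hu.2], by linarith [hu.1]⟩
  have hne : ∀ t ∈ Icc (0 : ℝ) 1, ∀ z ∈ (φ '' Icc 0 1)ᶜ, z - φ t ≠ 0 := fun t ht z hz h =>
    hz ⟨t, ht, (sub_eq_zero.1 h).symm⟩
  have h1 : (1 : ℝ) ∈ Icc (0 : ℝ) 1 := by simp
  have := HasLog.homotopy (K := (φ '' Icc 0 1)ᶜ)
    (F := fun t z => (z - φ (1 - t)) / (z - φ 1)) ?_
    (fun t ht z hz => div_ne_zero (hne _ (hm ht) z hz) (hne 1 h1 z hz)) ?_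
  · simpa using this
  · refine ContinuousOn.div (continuousOn_snd.sub ?_) (by fun_prop) fun p hp => hne 1 h1 _ hp.2
    exact (hc.comp (f := fun u : ℝ => 1 - u) (by fun_prop) hm).comp continuousOn_fst
      fun p hp => hp.1
  · refine (HasLog.const one_ne_zero _).congr fun z hz => ?_
    simp [div_self (hne 1 h1 z hz)]

lemma inside_union_arcs_nonempty {A B : Set ℂ} {p q : ℂ} (hA : IsArc A p q) (hB : IsArc B p q)
    (h : A ∩ B = {p, q}) : (inside (A ∪ B)).Nonempty := by
  by_contra hne
  rw [not_nonempty_iff_eq_empty] at hne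
  have hconn : IsPreconnected (Aᶜ ∩ Bᶜ) := by
    rw [← compl_union, compl_eq_inside_union_outside, hne, empty_union]
    exact isPreconnected_outside (hA.isCompact.union hB.isCompact)
  have hlog := HasLog.union (Or.inr ⟨hA.isCompact.isClosed.isOpen_compl,
    hB.isCompact.isClosed.isOpen_compl⟩) hconn hA.hasLog_compl hB.hasLog_compl
  rw [← compl_inter, h] at hlog
  have hpq : 0 < dist p q := dist_pos.2 hA.ne
  set r := dist p q / 2 with hr
  have hr0 : 0 < r := by positivity
  have hq : ∀ z ∈ closure (ball p r), z - q ≠ 0 := by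
    rw [closure_ball p hr0.ne']
    intro z hz h0
    rw [sub_eq_zero.1 h0, mem_closedBall, dist_comm] at hz
    linarith
  refine not_hasLog_frontier (n := 1) (u := fun z => (z - q)⁻¹) (U := ball p r) isOpen_ball
    isBounded_ball (mem_ball_self hr0) one_ne_zero (ContinuousOn.inv₀ (by fun_prop) hq)
    (fun z hz => inv_ne_zero (hq z hz)) ?_
  refine (hlog.mono ?_).congr fun z _ => by rw [zpow_one, div_eq_mul_inv]
  rw [frontier_ball p hr0.ne']
  rintro z hz (rfl | rfl)
  · simp only [mem_sphere, dist_self] at hz; linarith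
  · rw [mem_sphere, dist_comm] at hz; linarith

lemma HasLog.union_of_two_points {K L : Set ℂ} (hK : IsClosed K) (hL : IsClosed L) {p q : ℂ}
    (h : K ∩ L = {p, q}) {f g g' : ℂ → ℂ} (hg : ContinuousOn g K) (hg' : ContinuousOn g' L)
    (he : ∀ z ∈ K, Complex.exp (g z) = f z) (he' : ∀ z ∈ L, Complex.exp (g' z) = f z)
    (hpq : g p - g' p = g q - g' q) : HasLog f (K ∪ L) := by
  have hp : p ∈ K ∩ L := by rw [h]; simp
  refine HasLog.glue_of_eqOn (Or.inl ⟨hK, hL⟩) hg (g' := fun z => g' z + (g p - g' p))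
    (hg'.add continuousOn_const) he (fun z hz => ?_) ?_
  · rw [Complex.exp_add, he' z hz, Complex.exp_sub, he p hp.1, he' p hp.2, div_self, mul_one]
    rw [← he p hp.1]; exact Complex.exp_ne_zero _
  · rw [h]
    rintro z (rfl | rfl)
    · ring
    · rw [hpq]; ring

lemma isPreconnected_inside_union_arcs {A B : Set ℂ} {p q : ℂ} (hA : IsArc A p q)
    (hB : IsArc B p q) (h : A ∩ B = {p, q}) : IsPreconnected (inside (A ∪ B)) := by
  have hpq : p ∈ A ∩ B ∧ q ∈ A ∩ B := by rw [h]; simp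
  have hAc := hA.isCompact.isClosed
  have hBc := hB.isCompact.isClosed
  have hJ : IsCompact (A ∪ B) := hA.isCompact.union hB.isCompact
  have key : ∀ a ∈ inside (A ∪ B), ∃ g g' : ℂ → ℂ, ∃ n : ℤ, n ≠ 0 ∧ ContinuousOn g A ∧
      ContinuousOn g' B ∧ (∀ z ∈ A, Complex.exp (g z) = z - a) ∧
      (∀ z ∈ B, Complex.exp (g' z) = z - a) ∧
      (g p - g' p) - (g q - g' q) = n * (2 * Real.pi * Complex.I) := by
    intro a ha
    obtain ⟨g, hg, he⟩ := hA.hasLog (f := fun z => z - a) (by fun_prop)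
      fun z hz h => ha.1 (Or.inl (by rwa [← sub_eq_zero.1 h]))
    obtain ⟨g', hg', he'⟩ := hB.hasLog (f := fun z => z - a) (by fun_prop)
      fun z hz h => ha.1 (Or.inr (by rwa [← sub_eq_zero.1 h]))
    obtain ⟨m, hm⟩ := Complex.exp_eq_exp_iff_exists_int.1
      ((he p hpq.1.1).trans (he' p hpq.1.2).symm)
    obtain ⟨k, hk⟩ := Complex.exp_eq_exp_iff_exists_int.1
      ((he q hpq.2.1).trans (he' q hpq.2.2).symm)
    refine ⟨g, g', m - k, fun h0 => ?_, hg, hg', he, he', by rw [hm, hk]; push_cast; ring⟩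
    refine ha.2 (HasLog.union_of_two_points hAc hBc h hg hg' he he' ?_)
    rw [hm, hk, sub_eq_zero.1 h0]; ring
  rcases (inside (A ∪ B)).eq_empty_or_nonempty with h0 | ⟨a, ha⟩
  · rw [h0]; exact isPreconnected_empty
  suffices inside (A ∪ B) = connectedComponentIn (A ∪ B)ᶜ a by
    rw [this]; exact isPreconnected_connectedComponentIn
  refine Subset.antisymm (fun b hb => ?_) (connectedComponentIn_subset_inside hJ.isClosed ha)
  by_contra hnb
  obtain ⟨g₁, g₁', n, hn, hg₁, hg₁', he₁, he₁', hn'⟩ := key a ha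
  obtain ⟨g₂, g₂', m, hm, hg₂, hg₂', he₂, he₂', hm'⟩ := key b hb
  have hlog : HasLog (fun z => (z - a) ^ m * (z - b) ^ (-n)) (A ∪ B) := by
    refine HasLog.union_of_two_points hAc hBc h (g := fun z => m * g₁ z + ((-n : ℤ) : ℂ) * g₂ z)
      (g' := fun z => m * g₁' z + ((-n : ℤ) : ℂ) * g₂' z) (by fun_prop) (by fun_prop)
      (fun z hz => ?_) (fun z hz => ?_) ?_
    · rw [Complex.exp_add, Complex.exp_int_mul, Complex.exp_int_mul, he₁ z hz, he₂ z hz]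
    · rw [Complex.exp_add, Complex.exp_int_mul, Complex.exp_int_mul, he₁' z hz, he₂' z hz]
    · push_cast; linear_combination m * hn' - n * hm'
  have ho : IsOpen (connectedComponentIn (A ∪ B)ᶜ a) :=
    hJ.isClosed.isOpen_compl.connectedComponentIn
  have hf := frontier_connectedComponentIn_subset hJ.isClosed a
  have hcl : ∀ z ∈ closure (connectedComponentIn (A ∪ B)ᶜ a), z - b ≠ 0 := by
    intro z hz h0
    rw [sub_eq_zero.1 h0] at hz
    exact hb.1 (hf (by rw [ho.frontier_eq]; exact ⟨hz, hnb⟩))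
  exact not_hasLog_frontier ho ((isBounded_connectedComponentIn_iff hJ ha.1).2 ha)
    (mem_connectedComponentIn ha.1) hm (u := fun z => (z - b) ^ (-n))
    (ContinuousOn.zpow₀ (by fun_prop) _ fun z hz => Or.inl (hcl z hz))
    (fun z hz => zpow_ne_zero _ (hcl z hz)) (hlog.mono hf)

namespace IsJordanLoop

variable {J : Set ℂ}

lemma exists_ne {X : Type*} [TopologicalSpace X] {J : Set X} (hJ : IsJordanLoop J) :
    ∃ p ∈ J, ∃ q ∈ J, p ≠ q := by
  obtain ⟨g, -, -, hi, rfl⟩ := hJ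
  refine ⟨g 0, mem_range_self _, g (1 / 2), mem_range_self _, fun h => ?_⟩
  have := hi (by norm_num) (by norm_num) h
  norm_num at this

lemma inside_nonempty (hJ : IsJordanLoop J) : (inside J).Nonempty := by
  obtain ⟨p, hp, q, hq, hpq⟩ := hJ.exists_ne
  obtain ⟨A, B, hA, hB, rfl, h⟩ := hJ.split hp hq hpq
  exact inside_union_arcs_nonempty hA hB h

lemma isPreconnected_inside (hJ : IsJordanLoop J) : IsPreconnected (inside J) := by
  obtain ⟨p, hp, q, hq, hpq⟩ := hJ.exists_ne
  obtain ⟨A, B, hA, hB, rfl, h⟩ := hJ.split hp hq hpq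
  exact isPreconnected_inside_union_arcs hA hB h

lemma isClosed (hJ : IsJordanLoop J) : IsClosed J := hJ.isCompact.isClosed

lemma subset_closure_inside (hJ : IsJordanLoop J) : J ⊆ closure (inside J) := by
  intro x hx
  by_contra hcon
  obtain ⟨A, c, d, hA, hAJ, hAN⟩ := hJ.exists_arc_avoiding hx
    (isClosed_closure.isOpen_compl.mem_nhds hcon)
  obtain ⟨a, ha⟩ := hJ.inside_nonempty
  have hfr : frontier (inside J) ⊆ A := by
    intro z hz
    rw [(isOpen_inside hJ.isClosed).frontier_eq] at hz
    refine hAN ⟨(closure_inside_subset hJ.isClosed hz.1).resolve_left hz.2, ?_⟩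
    simpa using hz.1
  refine not_hasLog_frontier (n := 1) (u := fun _ => 1) (isOpen_inside hJ.isClosed)
    (isBounded_inside hJ.isCompact.isBounded) ha one_ne_zero continuousOn_const (by simp) ?_
  refine ((hA.hasLog (f := fun z => z - a) (by fun_prop) fun z hz h => ha.1 ?_).mono hfr).congr
    (by simp)
  exact (hAJ (by rwa [← sub_eq_zero.1 h])).1

lemma subset_closure_outside (hJ : IsJordanLoop J) : J ⊆ closure (outside J) := by
  intro x hx
  by_contra hcon
  obtain ⟨A, c, d, hA, hAJ, hAN⟩ := hJ.exists_arc_avoiding hx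
    (isClosed_closure.isOpen_compl.mem_nhds hcon)
  obtain ⟨a, ha⟩ := hJ.inside_nonempty
  have hfr : frontier (closure (outside J))ᶜ ⊆ A := by
    intro z hz
    rw [frontier_compl] at hz
    have hz' := frontier_closure_subset hz
    rw [(isOpen_outside hJ.isClosed).frontier_eq] at hz'
    refine hAN ⟨(closure_outside_subset hJ.isClosed hz'.1).resolve_left hz'.2, ?_⟩
    simpa using hz'.1
  have hsub : (closure (outside J))ᶜ ⊆ inside J ∪ J := by
    intro z hz
    by_cases hzJ : z ∈ J
    · exact Or.inr hzJ
    · have : z ∈ Jᶜ := hzJ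
      rw [compl_eq_inside_union_outside] at this
      exact Or.inl (this.resolve_right fun h => hz (subset_closure h))
  refine not_hasLog_frontier (n := 1) (u := fun _ => 1) (U := (closure (outside J))ᶜ)
    isClosed_closure.isOpen_compl
    (((isBounded_inside hJ.isCompact.isBounded).union hJ.isCompact.isBounded).subset hsub)
    (a := a) (fun h => ?_) one_ne_zero continuousOn_const (by simp) ?_
  · rcases closure_outside_subset hJ.isClosed h with h | h
    · exact disjoint_left.1 (disjoint_inside_outside J) ha h
    · exact ha.1 h
  refine ((hA.hasLog (f := fun z => z - a) (by fun_prop) fun z hz h => ha.1 ?_).mono hfr).congr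
    (by simp)
  exact (hAJ (by rwa [← sub_eq_zero.1 h])).1

lemma closure_inside (hJ : IsJordanLoop J) : closure (inside J) = inside J ∪ J :=
  Subset.antisymm (closure_inside_subset hJ.isClosed)
    (union_subset subset_closure hJ.subset_closure_inside)

lemma isCompact_closedInside (hJ : IsJordanLoop J) : IsCompact (inside J ∪ J) := by
  rw [← hJ.closure_inside]
  exact (isBounded_inside hJ.isCompact.isBounded).isCompact_closure

/-- A loop whose exterior misses the other loop: comparison of the insides. -/
lemma inside_subset_inside {K : Set ℂ} (hJ : IsJordanLoop J) (hK : IsCompact K)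
    (h : K ⊆ inside J ∪ J) : inside K ⊆ inside J := by
  have hd : Disjoint (outside J) K := by
    rw [disjoint_left]
    intro z hz hzK
    rcases h hzK with h | h
    · exact disjoint_left.1 (disjoint_inside_outside J) h hz
    · exact hz.1 h
  have hsub := outside_subset_outside hJ.isCompact hK hd
  intro z hz
  by_contra hcon
  have hzc : z ∈ closure (outside J) := by
    by_cases hzJ : z ∈ J
    · exact hJ.subset_closure_outside hzJ
    · have : z ∈ Jᶜ := hzJ
      rw [compl_eq_inside_union_outside] at this
      exact subset_closure (this.resolve_left hcon)
  obtain ⟨w, hw, hw'⟩ := mem_closure_iff.1 hzc _ (isOpen_inside hK.isClosed) hz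
  exact disjoint_left.1 (disjoint_inside_outside K) hw (hsub hw')

end IsJordanLoop

/-! ### Crosscuts -/

/-- `γ` is a crosscut from `p` to `q` of the Jordan domain bounded by `J`. -/
def IsCrosscut (J γ : Set ℂ) (p q : ℂ) : Prop :=
  IsArc γ p q ∧ p ∈ J ∧ q ∈ J ∧ γ \ {p, q} ⊆ inside J

lemma IsCrosscut.inter_subset {J γ : Set ℂ} {p q : ℂ} (h : IsCrosscut J γ p q) :
    J ∩ γ ⊆ {p, q} := by
  rintro z ⟨hz, hz'⟩
  by_contra hcon
  exact (h.2.2.2 ⟨hz', hcon⟩).1 hz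

/-- The theta curve lemma. -/
lemma theta_lemma {A B γ : Set ℂ} {p q : ℂ} (hA : IsArc A p q) (hB : IsArc B p q)
    (hAB : A ∩ B ⊆ {p, q}) (hγ : IsCrosscut (A ∪ B) γ p q) :
    IsJordanLoop (A ∪ γ) ∧ IsJordanLoop (B ∪ γ) ∧
    inside (A ∪ γ) ⊆ inside (A ∪ B) ∧ inside (B ∪ γ) ⊆ inside (A ∪ B) ∧
    Disjoint (inside (A ∪ γ)) (inside (B ∪ γ)) ∧
    inside (A ∪ B) ⊆ inside (A ∪ γ) ∪ inside (B ∪ γ) ∪ γ := by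
  have hJ := IsJordanLoop.of_arcs hA hB hAB
  have hAγ : A ∩ γ ⊆ {p, q} := fun z hz => hγ.inter_subset ⟨Or.inl hz.1, hz.2⟩
  have hBγ : B ∩ γ ⊆ {p, q} := fun z hz => hγ.inter_subset ⟨Or.inr hz.1, hz.2⟩
  have hJ1 := IsJordanLoop.of_arcs hA hγ.1 hAγ
  have hJ2 := IsJordanLoop.of_arcs hB hγ.1 hBγ
  have hγsub : γ ⊆ inside (A ∪ B) ∪ (A ∪ B) := by
    intro z hz
    by_cases h : z ∈ ({p, q} : Set ℂ)
    · rcases h with rfl | rfl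
      · exact Or.inr hγ.2.1
      · exact Or.inr hγ.2.2.1
    · exact Or.inl (hγ.2.2.2 ⟨hz, h⟩)
  have h1 : inside (A ∪ γ) ⊆ inside (A ∪ B) := hJ.inside_subset_inside hJ1.isCompact
    (union_subset (fun z hz => Or.inr (Or.inl hz)) hγsub)
  have h2 : inside (B ∪ γ) ⊆ inside (A ∪ B) := hJ.inside_subset_inside hJ2.isCompact
    (union_subset (fun z hz => Or.inr (Or.inr hz)) hγsub)
  refine ⟨hJ1, hJ2, h1, h2, ?_, ?_⟩
  · by_contra hnd
    obtain ⟨x, hx1, hx2⟩ := not_disjoint_iff.1 hnd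
    have e1 : inside (A ∪ γ) ⊆ inside (B ∪ γ) := subset_inside_of_preconnected hJ2.isClosed
      hJ1.isPreconnected_inside (disjoint_left.2 fun z hz hz' => by
        rcases hz' with h | h
        · exact (h1 hz).1 (Or.inr h)
        · exact hz.1 (Or.inr h)) hx1 hx2
    have e2 : inside (B ∪ γ) ⊆ inside (A ∪ γ) := subset_inside_of_preconnected hJ1.isClosed
      hJ2.isPreconnected_inside (disjoint_left.2 fun z hz hz' => by
        rcases hz' with h | h
        · exact (h2 hz).1 (Or.inl h)
        · exact hz.1 (Or.inr h)) hx2 hx1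
    obtain ⟨z, hz, hzpq⟩ := hA.isPreconnected_diff.2.1
    have hzc := hJ1.subset_closure_inside (Or.inl hz)
    rw [Subset.antisymm e1 e2] at hzc
    rcases closure_inside_subset hJ2.isClosed hzc with h | h | h
    · exact (h2 h).1 (Or.inl hz)
    · exact hzpq (hAB ⟨hz, h⟩)
    · exact hzpq (hAγ ⟨hz, h⟩)
  · intro x hx
    by_contra hcon
    simp only [mem_union, not_or] at hcon
    obtain ⟨⟨hx1, hx2⟩, hxγ⟩ := hcon
    have hxA : x ∉ A ∪ γ := fun h => h.elim (fun h => hx.1 (Or.inl h)) hxγ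
    have hxB : x ∉ B ∪ γ := fun h => h.elim (fun h => hx.1 (Or.inr h)) hxγ
    have l1 : HasLog (fun z => z - x) (A ∪ γ) := by by_contra h; exact hx1 ⟨hxA, h⟩
    have l2 : HasLog (fun z => z - x) (B ∪ γ) := by by_contra h; exact hx2 ⟨hxB, h⟩
    have hint : (A ∪ γ) ∩ (B ∪ γ) = γ := by
      rw [← inter_union_distrib_right, union_eq_right]
      exact hAB.trans (by rintro z (rfl | rfl); exacts [hγ.1.left_mem, hγ.1.right_mem])
    refine hx.2 ((HasLog.union (Or.inl ⟨hJ1.isClosed, hJ2.isClosed⟩) ?_ l1 l2).mono ?_)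
    · rw [hint]; exact hγ.1.isPreconnected
    · exact union_subset (fun z hz => Or.inl (Or.inl hz)) (fun z hz => Or.inr (Or.inl hz))

/-! ### Surgery on arcs -/

section ArcSurgery

variable {X : Type*} [TopologicalSpace X] {A B : Set X} {a b c : X}

lemma IsArc.first_hit (h : IsArc A a b) (hB : IsClosed B) (ha : a ∉ B) (hAB : (A ∩ B).Nonempty) :
    ∃ x ∈ B, ∃ A' ⊆ A, IsArc A' a x ∧ A' ∩ B = {x} := by
  obtain ⟨φ, hc, hi, rfl, rfl, rfl⟩ := h
  have hcl : IsClosed (Icc (0 : ℝ) 1 ∩ φ ⁻¹' B) := hc.preimage_isClosed_of_isClosed isClosed_Icc hB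
  obtain ⟨_, ⟨t₁, ht₁, rfl⟩, hB₁⟩ := hAB
  obtain ⟨t, ⟨ht, htB⟩, hmin⟩ := (isCompact_Icc.inter_right hcl).exists_isLeast
    ⟨t₁, ht₁, ht₁, hB₁⟩
  have h0 : 0 < t := ht.1.lt_of_ne fun h => ha (by rw [h]; exact htB.2)
  have hs : Icc 0 t ⊆ Icc (0 : ℝ) 1 := Icc_subset_Icc_right ht.2
  refine ⟨φ t, htB.2, φ '' Icc 0 t, image_mono hs, isArc_image_Icc h0 (hc.mono hs) (hi.mono hs), ?_⟩
  ext z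
  constructor
  · rintro ⟨⟨s, hs', rfl⟩, hsB⟩
    have := hmin ⟨hs hs', hs hs', hsB⟩
    rw [le_antisymm hs'.2 this]; rfl
  · rintro rfl
    exact ⟨⟨t, ⟨ht.1, le_rfl⟩, rfl⟩, htB.2⟩

lemma IsArc.exists_trans [T2Space X] (hA : IsArc A a b) (hB : IsArc B b c) (hac : a ≠ c) :
    ∃ C ⊆ A ∪ B, IsArc C a c := by
  by_cases haB : a ∈ B
  · obtain ⟨C, hC, hC'⟩ := hB.exists_subarc haB hB.right_mem hac
    exact ⟨C, hC.trans subset_union_right, hC'⟩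
  obtain ⟨x, hx, A', hA', hax, hint⟩ := hA.first_hit hB.isCompact.isClosed haB
    ⟨b, hA.right_mem, hB.left_mem⟩
  by_cases hxc : x = c
  · subst hxc; exact ⟨A', hA'.trans subset_union_left, hax⟩
  · obtain ⟨C, hC, hC'⟩ := hB.exists_subarc hx hB.right_mem hxc
    refine ⟨A' ∪ C, union_subset_union hA' hC, hax.trans hC' ?_⟩
    rw [← hint]; exact inter_subset_inter_right _ hC

lemma isArc_segment {E : Type*} [NormedAddCommGroup E] [NormedSpace ℝ E] {a b : E} (h : a ≠ b) :
    IsArc (segment ℝ a b) a b := by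
  refine ⟨fun t => AffineMap.lineMap a b t, by fun_prop, ?_, by simp, by simp, ?_⟩
  · exact (AffineMap.lineMap_injective ℝ h).injOn
  · exact (segment_eq_image_lineMap ℝ a b).symm

/-- In an open connected set, two points are joined by an arc. -/
lemma IsOpen.exists_isArc {E : Type*} [NormedAddCommGroup E] [NormedSpace ℝ E] {U : Set E}
    (hU : IsOpen U) (hc : IsPreconnected U) {a b : E} (ha : a ∈ U) (hb : b ∈ U) (hab : a ≠ b) :
    ∃ A ⊆ U, IsArc A a b := by
  let W : Set E := {y | y = a ∨ ∃ A ⊆ U, IsArc A a y}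
  have key : ∀ y z : E, ∀ r, y ∈ W → ball y r ⊆ U → z ∈ ball y r → z ∈ W := by
    intro y z r hy hr hz
    by_cases hza : z = a
    · exact Or.inl hza
    by_cases hyz : y = z
    · subst hyz; exact hy
    have hyr : y ∈ ball y r := mem_ball_self (by linarith [dist_nonneg.trans_lt (mem_ball.1 hz)])
    have hseg : segment ℝ y z ⊆ U := ((convex_ball y r).segment_subset hyr hz).trans hr
    rcases hy with rfl | ⟨A, hA, hA'⟩
    · exact Or.inr ⟨_, hseg, isArc_segment hyz⟩
    · obtain ⟨C, hC, hC'⟩ := hA'.exists_trans (isArc_segment hyz) (Ne.symm hza)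
      exact Or.inr ⟨C, hC.trans (union_subset hA hseg), hC'⟩
  have hWU : W ⊆ U := by
    rintro y (rfl | ⟨A, hA, hA'⟩)
    · exact ha
    · exact hA hA'.right_mem
  have hWo : IsOpen W := by
    rw [Metric.isOpen_iff]
    intro y hy
    obtain ⟨r, hr, hb⟩ := Metric.isOpen_iff.1 hU y (hWU hy)
    exact ⟨r, hr, fun z hz => key y z r hy hb hz⟩
  have hsub := hc.subset_of_closure_inter_subset hWo ⟨a, ha, Or.inl rfl⟩ (by
    rintro z ⟨hz, hzU⟩
    obtain ⟨r, hr, hb⟩ := Metric.isOpen_iff.1 hU z hzU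
    obtain ⟨y, hy, hyr⟩ := Metric.mem_closure_iff.1 hz (r / 2) (by linarith)
    refine key y z (r / 2) hy ((ball_subset_ball' ?_).trans hb) (mem_ball.2 hyr)
    rw [dist_comm] at hyr; linarith)
  rcases hsub hb with h | h
  · exact absurd h.symm hab
  · exact h

/-- Concatenation of an infinite chain of arcs shrinking to a point. -/
lemma isArc_iUnion_chain {τ : ℕ → Set X} {z : ℕ → X} {a : X}
    (hτ : ∀ n, IsArc (τ n) (z n) (z (n + 1))) (h1 : ∀ n, τ n ∩ τ (n + 1) ⊆ {z (n + 1)})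
    (h2 : ∀ n k, n + 2 ≤ k → Disjoint (τ n) (τ k)) (ha : ∀ n, a ∉ τ n)
    (hlim : ∀ N ∈ 𝓝 a, ∃ n₀, ∀ n ≥ n₀, τ n ⊆ N) : IsArc ({a} ∪ ⋃ n, τ n) (z 0) a := by
  choose φ hc hi h0 h1' hφ using hτ
  let g : ℝ → X := fun t => φ ⌊t⌋₊ (t - ⌊t⌋₊)
  have hgmem : ∀ t : ℝ, 0 ≤ t → t - ⌊t⌋₊ ∈ Ico (0 : ℝ) 1 := fun t ht =>
    ⟨sub_nonneg.2 (Nat.floor_le ht), by linarith [Nat.lt_floor_add_one t]⟩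
  have hgτ : ∀ t : ℝ, 0 ≤ t → g t ∈ τ ⌊t⌋₊ := fun t ht => by
    rw [← hφ]; exact ⟨_, Ico_subset_Icc_self (hgmem t ht), rfl⟩
  have hgn : ∀ n : ℕ, ∀ t ∈ Icc (n : ℝ) (n + 1), g t = φ n (t - n) := by
    intro n t ht
    rcases ht.2.lt_or_eq with h | rfl
    · have : ⌊t⌋₊ = n := (Nat.floor_eq_iff ((Nat.cast_nonneg n).trans ht.1)).2 ⟨ht.1, h⟩
      simp only [g, this]
    · have : ⌊(n : ℝ) + 1⌋₊ = n + 1 := by exact_mod_cast Nat.floor_natCast (R := ℝ) (n + 1)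
      simp only [g, this]
      push_cast
      rw [sub_self, add_sub_cancel_left, h0, h1']
  have hgc : ∀ n : ℕ, ContinuousOn g (Icc 0 n) := by
    intro n
    induction n with
    | zero => simp
    | succ n ih =>
      push_cast
      rw [← Icc_union_Icc_eq_Icc (Nat.cast_nonneg n) (by linarith : (n : ℝ) ≤ n + 1)]
      refine ih.union_of_isClosed ?_ isClosed_Icc isClosed_Icc
      refine ContinuousOn.congr ?_ (hgn n)
      exact (hc n).comp (by fun_prop) fun t ht => ⟨by linarith [ht.1], by linarith [ht.2]⟩
  have hgci : ContinuousOn g (Ici 0) := by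
    intro t ht
    obtain ⟨n, hn⟩ := exists_nat_gt t
    refine (hgc n t ⟨ht, hn.le⟩).mono_of_mem_nhdsWithin ?_
    rw [← Ici_inter_Iic]
    exact inter_mem self_mem_nhdsWithin (mem_nhdsWithin_of_mem_nhds (Iic_mem_nhds hn))
  have hgi : ∀ s t : ℝ, 0 ≤ s → 0 ≤ t → ⌊s⌋₊ ≤ ⌊t⌋₊ → g s = g t → s = t := by
    intro s t hs ht hst heq
    rcases hst.eq_or_lt with h | h
    · have := hi ⌊s⌋₊ (Ico_subset_Icc_self (hgmem s hs))
        (show t - ⌊s⌋₊ ∈ Icc (0 : ℝ) 1 by rw [h]; exact Ico_subset_Icc_self (hgmem t ht))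
        (by simpa only [g, h] using heq)
      linarith
    · exfalso
      rcases (Nat.succ_le_of_lt h).eq_or_lt with h' | h'
      · have hm : g s ∈ τ ⌊s⌋₊ ∩ τ (⌊s⌋₊ + 1) := ⟨hgτ s hs, by
          rw [heq, show ⌊s⌋₊ + 1 = ⌊t⌋₊ from h']; exact hgτ t ht⟩
        have h3 : φ ⌊s⌋₊ (s - ⌊s⌋₊) = φ ⌊s⌋₊ 1 := by rw [h1']; exact h1 _ hm
        have := hi _ (Ico_subset_Icc_self (hgmem s hs)) (by simp) h3
        linarith [(hgmem s hs).2]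
      · exact disjoint_left.1 (h2 _ _ h') (hgτ s hs) (heq ▸ hgτ t ht)
  have hgi' : InjOn g (Ici 0) := by
    intro s hs t ht heq
    rcases le_total ⌊s⌋₊ ⌊t⌋₊ with h | h
    · exact hgi s t hs ht h heq
    · exact (hgi t s ht hs h heq.symm).symm
  let F : ℝ → X := fun s => if s < 1 then g (s / (1 - s)) else a
  have hpos : ∀ s ∈ Ico (0 : ℝ) 1, 0 ≤ s / (1 - s) := fun s hs =>
    div_nonneg hs.1 (by linarith [hs.2])
  have hF1 : F 1 = a := by simp [F]
  have hFs : ∀ s, s < 1 → F s = g (s / (1 - s)) := fun s hs => by simp [F, hs]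
  have hga : ∀ t, 0 ≤ t → g t ≠ a := fun t ht h => ha ⌊t⌋₊ (h ▸ hgτ t ht)
  refine ⟨F, ?_, ?_, ?_, hF1, ?_⟩
  · intro s hs
    rcases hs.2.lt_or_eq with h | rfl
    · have hcont : ContinuousOn (fun s : ℝ => g (s / (1 - s))) (Ico 0 1) := by
        refine hgci.comp (ContinuousOn.div (by fun_prop) (by fun_prop) fun s hs => ?_) hpos
        linarith [hs.2]
      have := (hcont s ⟨hs.1, h⟩).congr (g := F) (fun u hu => hFs u hu.2) (hFs s h)
      refine this.mono_of_mem_nhdsWithin ?_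
      rw [← Ici_inter_Iio]
      exact inter_mem (mem_nhdsWithin.2 ⟨univ, isOpen_univ, mem_univ _, fun x hx => hx.2.1⟩)
        (mem_nhdsWithin_of_mem_nhds (Iio_mem_nhds h))
    · intro N hN
      rw [hF1] at hN
      obtain ⟨n, hn⟩ := hlim N hN
      rw [mem_map, mem_nhdsWithin]
      refine ⟨Ioi (1 - 1 / (n + 1 : ℝ)), isOpen_Ioi, ?_, ?_⟩
      · simp only [mem_Ioi]; linarith [show (0 : ℝ) < 1 / (n + 1 : ℝ) by positivity]
      · rintro u ⟨hu, hu0, hu1⟩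
        rcases hu1.lt_or_eq with h | rfl
        · rw [mem_preimage, hFs u h]
          have hnu : (n : ℝ) ≤ u / (1 - u) := by
            rw [le_div_iff₀ (by linarith)]
            simp only [mem_Ioi] at hu
            have h4 : (1 - u) * (n + 1) < 1 := by
              rw [← lt_div_iff₀ (by positivity)]; linarith
            nlinarith
          exact hn _ (Nat.le_floor hnu) (hgτ _ (hpos u ⟨hu0, h⟩))
        · rw [mem_preimage, hF1]; exact mem_of_mem_nhds hN
  · intro s hs t ht heq
    rcases hs.2.lt_or_eq with h | rfl <;> rcases ht.2.lt_or_eq with h' | rfl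
    · rw [hFs s h, hFs t h'] at heq
      have := hgi' (hpos s ⟨hs.1, h⟩) (hpos t ⟨ht.1, h'⟩) heq
      rw [div_eq_div_iff (by linarith) (by linarith)] at this
      linarith
    · rw [hFs s h, hF1] at heq
      exact absurd heq (hga _ (hpos s ⟨hs.1, h⟩))
    · rw [hFs t h', hF1] at heq
      exact absurd heq.symm (hga _ (hpos t ⟨ht.1, h'⟩))
    · rfl
  · rw [hFs 0 one_pos]; simp [g, h0]
  · ext x
    constructor
    · rintro ⟨s, hs, rfl⟩
      rcases hs.2.lt_or_eq with h | rfl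
      · right; rw [hFs s h]; exact mem_iUnion.2 ⟨_, hgτ _ (hpos s ⟨hs.1, h⟩)⟩
      · left; exact hF1
    · rintro (rfl | hx)
      · exact ⟨1, by simp, hF1⟩
      · obtain ⟨n, hn⟩ := mem_iUnion.1 hx
        rw [← hφ] at hn
        obtain ⟨t, ht, rfl⟩ := hn
        have hn0 : (0 : ℝ) ≤ n := Nat.cast_nonneg n
        have hu : (0 : ℝ) < 1 + (t + n) := by linarith [ht.1]
        refine ⟨(t + n) / (1 + (t + n)), ⟨div_nonneg (by linarith [ht.1]) hu.le,
          (div_le_one hu).2 (by linarith)⟩, ?_⟩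
        rw [hFs _ ((div_lt_one hu).2 (by linarith))]
        have : (t + n) / (1 + (t + n)) / (1 - (t + n) / (1 + (t + n))) = t + n := by
          field_simp; ring
        rw [this, hgn n _ ⟨by linarith [ht.1], by linarith [ht.2]⟩, add_sub_cancel_right]

end ArcSurgery

/-! ### Boundary accessibility in Jordan domains -/

namespace IsJordanLoop

variable {J : Set ℂ} {a : ℂ}

/-- The inside of a Jordan loop is uniformly locally connected at its boundary points. -/
lemma exists_arc_in_ball (hJ : IsJordanLoop J) (ha : a ∈ J) {ε : ℝ} (hε : 0 < ε) :
    ∃ δ > 0, δ ≤ ε ∧ ∀ x ∈ inside J ∩ ball a δ, ∀ y ∈ inside J ∩ ball a δ, x ≠ y →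
      ∃ A ⊆ inside J ∩ ball a ε, IsArc A x y := by
  obtain ⟨M, c, d, hM, hMJ, hMN⟩ := hJ.exists_arc_avoiding ha (ball_mem_nhds a hε)
  obtain ⟨δ, hδ, hδM⟩ := Metric.isOpen_iff.1 hM.isCompact.isClosed.isOpen_compl a
    (fun h => (hMJ h).2 rfl)
  refine ⟨min δ ε, lt_min hδ hε, min_le_right _ _, fun x hx y hy hxy => ?_⟩
  have hdis : Disjoint (ball a (min δ ε)) (M ∪ sphere a ε) := by
    rw [disjoint_left]
    rintro z hz (h | h)
    · exact hδM (ball_subset_ball (min_le_left _ _) hz) h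
    · exact (lt_of_lt_of_le (mem_ball.1 hz) (min_le_right _ _)).ne h
  have hint : J ∩ (M ∪ sphere a ε) = M := by
    refine subset_antisymm ?_ fun z hz => ⟨(hMJ hz).1, Or.inl hz⟩
    rintro z ⟨hz, h | h⟩
    · exact h
    · exact hMN ⟨hz, fun h' => (mem_ball.1 h').ne h⟩
  have hK : IsCompact (M ∪ sphere a ε) := hM.isCompact.union (isCompact_sphere _ _)
  have hJc : inside J ⊆ Jᶜ := fun z hz => hz.1
  have hmem := mem_connectedComponentIn_union hJ.isCompact hK (by rw [hint]; exact hM.isPreconnected)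
    (hJ.isPreconnected_inside.subset_connectedComponentIn hx.1 hJc hy.1)
    ((convex_ball a _).isPreconnected.subset_connectedComponentIn hx.2
      (subset_compl_iff_disjoint_right.2 hdis) hy.2)
  have hcl : IsClosed (J ∪ (M ∪ sphere a ε)) := (hJ.isCompact.union hK).isClosed
  have hxU : x ∈ (J ∪ (M ∪ sphere a ε))ᶜ := by
    rintro (h | h)
    · exact hx.1.1 h
    · exact disjoint_left.1 hdis hx.2 h
  obtain ⟨A, hA, hA'⟩ := (hcl.isOpen_compl.connectedComponentIn (x := x)).exists_isArc
    isPreconnected_connectedComponentIn (mem_connectedComponentIn hxU) hmem hxy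
  have hsub := connectedComponentIn_subset (J ∪ (M ∪ sphere a ε))ᶜ x
  have hdisA : ∀ z ∈ A, z ∉ J ∪ (M ∪ sphere a ε) := fun z hz => hsub (hA hz)
  refine ⟨A, subset_inter ?_ ?_, hA'⟩
  · exact subset_inside_of_preconnected hJ.isClosed hA'.isPreconnected
      (disjoint_left.2 fun z hz h => hdisA z hz (Or.inl h)) hA'.left_mem hx.1
  · refine hA'.isPreconnected.subset_left_of_subset_union isOpen_ball
      (isClosed_closedBall (x := a) (ε := ε)).isOpen_compl ?_ ?_
      ⟨x, hA'.left_mem, ball_subset_ball (min_le_right _ _) hx.2⟩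
    · exact disjoint_left.2 fun z hz h => h (ball_subset_closedBall hz)
    · intro z hz
      rcases lt_trichotomy (dist z a) ε with h | h | h
      · exact Or.inl h
      · exact absurd (Or.inr (Or.inr h)) (hdisA z hz)
      · exact Or.inr fun h' => absurd (mem_closedBall.1 h') (not_le.2 h)

/-- Every boundary point of a Jordan domain is accessible by an arc. -/
lemma exists_access (hJ : IsJordanLoop J) (ha : a ∈ J) {x : ℂ} (hx : x ∈ inside J) :
    ∃ A, IsArc A x a ∧ A \ {a} ⊆ inside J := by
  have hpos : ∀ r : ℝ, ∃ δ > 0, δ ≤ max r 1 ∧ (0 < r → δ ≤ r ∧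
      ∀ x ∈ inside J ∩ ball a δ, ∀ y ∈ inside J ∩ ball a δ, x ≠ y →
      ∃ A ⊆ inside J ∩ ball a r, IsArc A x y) := fun r => by
    by_cases hr : 0 < r
    · obtain ⟨δ, h1, h2, h3⟩ := hJ.exists_arc_in_ball ha hr
      exact ⟨δ, h1, h2.trans (le_max_left _ _), fun _ => ⟨h2, h3⟩⟩
    · exact ⟨1, one_pos, le_max_right _ _, fun h => absurd h hr⟩
  choose δ hδ _ hδr using hpos
  have hnear : ∀ r > 0, ∀ y : ℂ, ∃ y' ∈ inside J ∩ ball a r, y' ≠ y := by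
    intro r hr y
    obtain ⟨w, hw, hwr⟩ := Metric.mem_closure_iff.1 (hJ.subset_closure_inside ha) r hr
    have ho : IsOpen (inside J ∩ ball a r) := (isOpen_inside hJ.isClosed).inter isOpen_ball
    obtain ⟨s, hs, hsub⟩ := Metric.isOpen_iff.1 ho w ⟨hw, by rwa [mem_ball, dist_comm]⟩
    by_cases h : w = y
    · refine ⟨w + (s / 2 : ℝ), hsub ?_, ?_⟩
      · simp [abs_of_pos hs]; linarith
      · rw [← h]; simp [hs.ne']
    · exact ⟨w, ⟨hw, by rwa [mem_ball, dist_comm]⟩, h⟩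
  have hxa : 0 < dist x a := dist_pos.2 fun h => hx.1 (h ▸ ha)
  let S := {s : Set ℂ × ℂ × ℂ × ℝ // IsArc s.1 s.2.1 s.2.2.1 ∧ s.1 ⊆ inside J ∧ 0 < s.2.2.2 ∧
    s.2.2.1 ∈ inside J ∩ ball a (δ s.2.2.2)}
  have hstep : ∀ s : S, ∃ s' : S, s'.1.2.1 = s.1.2.2.1 ∧ s'.1.2.2.2 ≤ s.1.2.2.2 / 2 ∧
      Disjoint s.1.1 (ball a s'.1.2.2.2) ∧ s'.1.1 ⊆ ball a s.1.2.2.2 := by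
    rintro ⟨⟨α, p, y, r⟩, harc, hin, hr, hy⟩
    dsimp only at harc hin hr hy ⊢
    obtain ⟨ρ, hρ, hρα⟩ := Metric.isOpen_iff.1 harc.isCompact.isClosed.isOpen_compl a
      (fun h => (hin h).1 ha)
    have hr' : 0 < min ρ (r / 2) := lt_min hρ (by linarith)
    obtain ⟨y', hy', hne⟩ := hnear (min (δ (min ρ (r / 2))) (δ r)) (lt_min (hδ _) (hδ _)) y
    obtain ⟨A, hA, hA'⟩ := (hδr r hr).2 y hy y'
      ⟨hy'.1, ball_subset_ball (min_le_right _ _) hy'.2⟩ hne.symm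
    refine ⟨⟨⟨A, y, y', min ρ (r / 2)⟩, hA', fun z hz => (hA hz).1, hr', hy'.1,
      ball_subset_ball (min_le_left _ _) hy'.2⟩, rfl, min_le_right _ _, ?_, fun z hz => (hA hz).2⟩
    exact disjoint_left.2 fun z hz h => hρα (ball_subset_ball (min_le_left _ _) h) hz
  choose next hn1 hn2 hn3 hn4 using hstep
  obtain ⟨y₀, hy₀, hne₀⟩ := hnear (δ (dist x a)) (hδ _) x
  obtain ⟨A₀, hA₀, hA₀'⟩ := (isOpen_inside hJ.isClosed).exists_isArc hJ.isPreconnected_inside hx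
    hy₀.1 hne₀.symm
  let s : ℕ → S := fun n => Nat.rec ⟨⟨A₀, x, y₀, dist x a⟩, hA₀', hA₀, hxa, hy₀⟩
    (fun _ s => next s) n
  let α : ℕ → Set ℂ := fun n => (s n).1.1
  let y : ℕ → ℂ := fun n => (s n).1.2.2.1
  let r : ℕ → ℝ := fun n => (s n).1.2.2.2
  have hr0 : ∀ n, 0 < r n := fun n => (s n).2.2.2.1
  have hr2 : ∀ n, r (n + 1) ≤ r n / 2 := fun n => hn2 (s n)
  have hanti : Antitone r := antitone_nat_of_succ_le fun n => by linarith [hr2 n, hr0 n]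
  have hαr : ∀ n, α (n + 1) ⊆ ball a (r n) := fun n => hn4 (s n)
  have hαd : ∀ n k, n + 2 ≤ k → Disjoint (α n) (α k) := by
    intro n k hk
    obtain ⟨j, rfl⟩ : ∃ j, k = j + 1 := ⟨k - 1, by omega⟩
    exact (hn3 (s n)).mono_right ((hαr j).trans
      (ball_subset_ball (hanti (show n + 1 ≤ j by omega))))
  have hαin : ∀ n, α n ⊆ inside J := fun n => (s n).2.2.1
  have hyα : ∀ n, y n ∈ α n := fun n => (s n).2.1.right_mem
  have hyα' : ∀ n, y n ∈ α (n + 1) := fun n => by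
    have := (s (n + 1)).2.1.left_mem
    rwa [show (s (n + 1)).1.2.1 = y n from hn1 (s n)] at this
  have hsub : ∀ n (z : {z // z ∈ α n ∧ z ∉ α (n + 1)}),
      ∃ z' : {z // z ∈ α (n + 1) ∧ z ∉ α (n + 1 + 1)}, ∃ τ ⊆ α n, IsArc τ z.1 z'.1 ∧
        τ ∩ α (n + 1) = {z'.1} := by
    rintro n ⟨z, hz, hz'⟩
    obtain ⟨β, hβ, hβ'⟩ := (s n).2.1.exists_subarc hz (hyα n) fun h => hz' (h ▸ hyα' n)
    obtain ⟨w, hw, τ, hτ, hτ', hint⟩ := hβ'.first_hit (s (n + 1)).2.1.isCompact.isClosed hz'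
      ⟨y n, hβ'.right_mem, hyα' n⟩
    exact ⟨⟨w, hw, disjoint_left.1 (hαd n (n + 2) le_rfl) (hβ (hτ hτ'.right_mem))⟩, τ,
      hτ.trans hβ, hτ', hint⟩
  choose zn τ hτα hτarc hτint using hsub
  let z : ∀ n, {z // z ∈ α n ∧ z ∉ α (n + 1)} := fun n => Nat.rec
    ⟨x, hA₀'.left_mem, fun h => (mem_ball.1 (hαr 0 h)).ne rfl⟩ (fun n z => zn n z) n
  refine ⟨_, isArc_iUnion_chain (τ := fun n => τ n (z n)) (z := fun n => (z n).1) (a := a)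
    (fun n => hτarc n (z n)) (fun n => ?_) (fun n k hk => ?_) (fun n h => ?_) fun N hN => ?_, ?_⟩
  · intro w hw
    have : w ∈ τ n (z n) ∩ α (n + 1) := ⟨hw.1, hτα _ _ hw.2⟩
    rwa [hτint] at this
  · exact (hαd n k hk).mono (hτα _ _) (hτα _ _)
  · exact (hαin n (hτα _ _ h)).1 ha
  · obtain ⟨e, he, heN⟩ := Metric.mem_nhds_iff.1 hN
    have hgeo : ∀ n, r n ≤ r 0 * (1 / 2) ^ n := by
      intro n
      induction n with
      | zero => simp
      | succ n ih => rw [pow_succ]; linarith [hr2 n]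
    obtain ⟨n₀, hn₀⟩ := exists_pow_lt_of_lt_one (div_pos he (hr0 0)) (by norm_num : (1 / 2 : ℝ) < 1)
    rw [lt_div_iff₀ (hr0 0)] at hn₀
    refine ⟨n₀ + 1, fun n hn => (hτα _ _).trans ?_⟩
    obtain ⟨j, rfl⟩ : ∃ j, n = j + 1 := ⟨n - 1, by omega⟩
    refine (hαr j).trans ((ball_subset_ball ?_).trans heN)
    linarith [hanti (show n₀ ≤ j by omega), hgeo n₀]
  · rintro w ⟨h | h, hwa⟩
    · exact absurd h hwa
    · obtain ⟨n, hn⟩ := mem_iUnion.1 h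
      exact hαin n (hτα _ _ hn)

/-- Any two boundary points of a Jordan domain are joined by a crosscut. -/
lemma exists_crosscut (hJ : IsJordanLoop J) {p q : ℂ} (hp : p ∈ J) (hq : q ∈ J) (hpq : p ≠ q) :
    ∃ γ, IsCrosscut J γ p q := by
  obtain ⟨x, hx⟩ := hJ.inside_nonempty
  obtain ⟨A, hA, hA'⟩ := hJ.exists_access hp hx
  obtain ⟨B, hB, hB'⟩ := hJ.exists_access hq hx
  obtain ⟨C, hC, hC'⟩ := hA.symm.exists_trans hB hpq
  refine ⟨C, hC', hp, hq, ?_⟩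
  rintro z ⟨hz, hne⟩
  simp only [mem_insert_iff, mem_singleton_iff, not_or] at hne
  rcases hC hz with h | h
  · exact hA' ⟨h, hne.1⟩
  · exact hB' ⟨h, hne.2⟩

end IsJordanLoop

/-! ### Subdividing Jordan domains into small ones by crosscuts -/

/-- `J` can be cut by finitely many successive crosscuts into Jordan loops satisfying `Q`. -/
inductive Divisible (Q : Set ℂ → Prop) : Set ℂ → Prop
  | leaf {J : Set ℂ} : IsJordanLoop J → Q J → Divisible Q J
  | cut {J A B γ : Set ℂ} {p q : ℂ} : A ∪ B = J → IsArc A p q → IsArc B p q → A ∩ B ⊆ {p, q} →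
      IsCrosscut (A ∪ B) γ p q → Divisible Q (A ∪ γ) → Divisible Q (B ∪ γ) → Divisible Q J

lemma IsCrosscut.subset {J γ : Set ℂ} {p q : ℂ} (h : IsCrosscut J γ p q) : γ ⊆ inside J ∪ J := by
  intro z hz
  by_cases hzp : z ∈ ({p, q} : Set ℂ)
  · rcases hzp with rfl | rfl
    · exact Or.inr h.2.1
    · exact Or.inr h.2.2.1
  · exact Or.inl (h.2.2.2 ⟨hz, hzp⟩)

namespace Divisible

variable {Q R : Set ℂ → Prop} {J : Set ℂ}

lemma bind (h : Divisible Q J) (hQ : ∀ P, IsJordanLoop P → Q P → Divisible R P) :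
    Divisible R J := by
  induction h with
  | leaf h h' => exact hQ _ h h'
  | cut e hA hB hAB hγ _ _ ih₁ ih₂ => exact .cut e hA hB hAB hγ ih₁ ih₂

lemma and_subset_convex (h : Divisible Q J) {C : Set ℂ} (hC : Convex ℝ C) (hJ : J ⊆ C) :
    Divisible (fun P => Q P ∧ P ⊆ C) J := by
  induction h with
  | leaf h h' => exact .leaf h ⟨h', hJ⟩
  | cut e hA hB hAB hγ _ _ ih₁ ih₂ =>
    subst e
    have hγC := hγ.subset.trans (union_subset (inside_subset_of_convex hC hJ) hJ)
    exact .cut rfl hA hB hAB hγ (ih₁ (union_subset (subset_union_left.trans hJ) hγC))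
      (ih₂ (union_subset (subset_union_right.trans hJ) hγC))

end Divisible

/-- Two nearby points of a Jordan loop bound a small arc of it. -/
lemma IsJordanLoop.exists_small_arc {J : Set ℂ} (hJ : IsJordanLoop J) {η : ℝ} (hη : 0 < η) :
    ∃ l > 0, ∀ p ∈ J, ∀ q ∈ J, p ≠ q → dist p q < l → ∃ A B, IsArc A p q ∧ IsArc B p q ∧
      A ∪ B = J ∧ A ∩ B = {p, q} ∧ A ⊆ ball p η := by
  have hloc : ∀ a ∈ J, ∃ l > 0, ∀ p ∈ J ∩ ball a l, ∀ q ∈ J ∩ ball a l, p ≠ q →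
      ∃ A B, IsArc A p q ∧ IsArc B p q ∧ A ∪ B = J ∧ A ∩ B = {p, q} ∧ A ⊆ ball a (η / 2) := by
    intro a ha
    obtain ⟨M, c, d, hM, hMJ, hMN⟩ := hJ.exists_arc_avoiding ha (ball_mem_nhds a (half_pos hη))
    obtain ⟨l, hl, hlM⟩ := Metric.isOpen_iff.1 hM.isCompact.isClosed.isOpen_compl a
      (fun h => (hMJ h).2 rfl)
    refine ⟨l, hl, fun p hp q hq hpq => ?_⟩
    have key : ∀ A B : Set ℂ, A ∪ B = J → Disjoint M (A ∩ B) → M ⊆ B → A ⊆ ball a (η / 2) := by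
      intro A B hAB hint hMB z hz
      by_contra h
      have hzM := hMN ⟨hAB ▸ Or.inl hz, h⟩
      exact disjoint_left.1 hint hzM ⟨hz, hMB hzM⟩
    obtain ⟨A, B, hA, hB, hAB, hint⟩ := hJ.split hp.1 hq.1 hpq
    have hpqM : Disjoint M (A ∩ B) := by
      rw [hint, disjoint_left]
      rintro z hz (rfl | rfl)
      · exact hlM hp.2 hz
      · exact hlM hq.2 hz
    rcases isPreconnected_iff_subset_of_disjoint_closed.1 hM.isPreconnected A B
      hA.isCompact.isClosed hB.isCompact.isClosed (hAB ▸ fun z hz => (hMJ hz).1)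
      (disjoint_iff_inter_eq_empty.1 hpqM) with h | h
    · exact ⟨B, A, hB, hA, by rw [union_comm, hAB], by rw [inter_comm, hint],
        key B A (by rw [union_comm, hAB]) (by rwa [inter_comm]) h⟩
    · exact ⟨A, B, hA, hB, hAB, hint, key A B hAB hpqM h⟩
  choose! l hl hl' using hloc
  obtain ⟨δ, hδ, hδJ⟩ := lebesgue_number_lemma_of_metric (c := fun a : J => ball a.1 (min (l a) (η / 2)))
    hJ.isCompact (fun _ => isOpen_ball) fun a ha => mem_iUnion.2
      ⟨⟨a, ha⟩, mem_ball_self (lt_min (hl a ha) (half_pos hη))⟩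
  refine ⟨δ, hδ, fun p hp q hq hpq hlt => ?_⟩
  obtain ⟨⟨a, ha⟩, hsub⟩ := hδJ p hp
  have hpb := hsub (mem_ball_self hδ)
  obtain ⟨A, B, hA, hB, hAB, hint, hAa⟩ := hl' a ha p
    ⟨hp, ball_subset_ball (min_le_left _ _) hpb⟩ q
    ⟨hq, ball_subset_ball (min_le_left _ _) (hsub (by rwa [mem_ball, dist_comm]))⟩ hpq
  refine ⟨A, B, hA, hB, hAB, hint, hAa.trans (ball_subset_ball' ?_)⟩
  have := ball_subset_ball (min_le_right _ _) hpb
  rw [mem_ball, dist_comm] at this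
  linarith

section LineCuts

/-- The point with parameter `y` on the line through `w` in direction `d`. -/
def linePt (w d : ℂ) (y : ℝ) : ℂ := w + y * d

/-- Signed distance to the line through `w` in the unit direction `d`. -/
def lineHt (w d z : ℂ) : ℝ := ((z - w) / d).im

variable {w d : ℂ}

lemma continuous_linePt : Continuous (linePt w d) := by unfold linePt; fun_prop

lemma continuous_lineHt : Continuous (lineHt w d) := by unfold lineHt; fun_prop

lemma lineHt_linePt (hd : ‖d‖ = 1) (y : ℝ) : lineHt w d (linePt w d y) = 0 := by
  have : d ≠ 0 := by rintro rfl; simp at hd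
  simp [lineHt, linePt, this]

lemma dist_linePt (hd : ‖d‖ = 1) (y y' : ℝ) : dist (linePt w d y) (linePt w d y') = |y - y'| := by
  rw [dist_eq_norm, show linePt w d y - linePt w d y' = ((y - y' : ℝ) : ℂ) * d by
    simp [linePt]; ring, norm_mul, hd, mul_one, Complex.norm_real, Real.norm_eq_abs]

lemma linePt_injective (hd : ‖d‖ = 1) : Function.Injective (linePt w d) := fun y y' h => by
  have := dist_linePt (w := w) hd y y'
  rw [h, dist_self] at this
  linarith [abs_eq_zero.1 this.symm]

lemma exists_linePt_eq (hd : ‖d‖ = 1) {z : ℂ} (hz : lineHt w d z = 0) : ∃ y, linePt w d y = z := by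
  have h0 : d ≠ 0 := by rintro rfl; simp at hd
  refine ⟨((z - w) / d).re, ?_⟩
  have : (((z - w) / d).re : ℂ) = (z - w) / d := by
    apply Complex.ext
    · simp
    · simpa [lineHt] using hz.symm
  rw [linePt, this, div_mul_cancel₀ _ h0]; ring

lemma abs_lineHt_sub_le (hd : ‖d‖ = 1) (z z' : ℂ) :
    |lineHt w d z - lineHt w d z'| ≤ dist z z' := by
  have : lineHt w d z - lineHt w d z' = ((z - z') / d).im := by
    rw [lineHt, lineHt, ← Complex.sub_im]; congr 1; ring
  rw [this, dist_eq_norm]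
  refine (Complex.abs_im_le_norm _).trans ?_
  rw [norm_div, hd, div_one]

lemma lineHt_combo (z z' : ℂ) {a b : ℝ} (hab : a + b = 1) :
    lineHt w d (a • z + b • z') = a * lineHt w d z + b * lineHt w d z' := by
  have : (a • z + b • z' - w) / d = a • ((z - w) / d) + b • ((z' - w) / d) := by
    have : w = (a + b : ℝ) • w := by rw [hab, one_smul]
    conv_lhs => rw [this]
    simp only [Complex.real_smul]; push_cast; ring
  rw [lineHt, this]; simp [lineHt]

lemma convex_lineHt_lt (c : ℝ) : Convex ℝ {z | lineHt w d z < c} := by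
  intro z hz z' hz' a b ha hb hab
  simp only [mem_ofPred_eq] at *
  rw [lineHt_combo z z' hab]
  rcases ha.eq_or_lt with rfl | ha
  · obtain rfl : b = 1 := by linarith
    simpa
  · have hb' : b = 1 - a := by linarith
    subst hb'
    nlinarith

lemma convex_lineHt_gt (c : ℝ) : Convex ℝ {z | c < lineHt w d z} := by
  intro z hz z' hz' a b ha hb hab
  simp only [mem_ofPred_eq] at *
  rw [lineHt_combo z z' hab]
  rcases ha.eq_or_lt with rfl | ha
  · obtain rfl : b = 1 := by linarith
    simpa
  · have hb' : b = 1 - a := by linarith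
    subst hb'
    nlinarith

/-- `(s, t)` parametrizes a component of the intersection of a line with `D`. -/
def IsGap (w d : ℂ) (D : Set ℂ) (s t : ℝ) : Prop :=
  s < t ∧ linePt w d s ∉ D ∧ linePt w d t ∉ D ∧ ∀ y ∈ Ioo s t, linePt w d y ∈ D

lemma exists_isGap (hd : ‖d‖ = 1) {D : Set ℂ} (hD : IsOpen D) (hb : Bornology.IsBounded D) {y : ℝ}
    (hy : linePt w d y ∈ D) : ∃ s t, IsGap w d D s t ∧ y ∈ Ioo s t := by
  obtain ⟨R, hR⟩ := hb.subset_closedBall (linePt w d y)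
  have hout : ∀ u, R < |u - y| → linePt w d u ∉ D := fun u hu h => by
    have := hR h
    rw [mem_closedBall, dist_linePt hd] at this
    linarith
  have hR0 : 0 ≤ R := by simpa using hR hy
  have hcl : IsClosed (linePt w d ⁻¹' Dᶜ) := hD.isClosed_compl.preimage continuous_linePt
  obtain ⟨t, ⟨ht, htD⟩, htmin⟩ := ((isCompact_Icc (a := y)
    (b := y + R + 1)).inter_right hcl).exists_isLeast ⟨y + R + 1, ⟨by linarith, le_rfl⟩, hout _ (by
      rw [abs_of_pos] <;> linarith)⟩
  obtain ⟨s, ⟨hs, hsD⟩, hsmax⟩ := ((isCompact_Icc (a := y - R - 1)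
    (b := y)).inter_right hcl).exists_isGreatest ⟨y - R - 1, ⟨le_rfl, by linarith⟩, hout _ (by
      rw [abs_of_neg] <;> linarith)⟩
  have hsy : s < y := hs.2.lt_of_ne fun h => hsD (h ▸ hy)
  have hyt : y < t := ht.1.lt_of_ne fun h => htD (h ▸ hy)
  refine ⟨s, t, ⟨hsy.trans hyt, hsD, htD, fun u hu => ?_⟩, hsy, hyt⟩
  by_contra huD
  rcases le_total y u with h | h
  · exact absurd (htmin ⟨⟨h, hu.2.le.trans ht.2⟩, huD⟩) (not_le.2 hu.2)
  · exact absurd (hsmax ⟨⟨hs.1.trans hu.1.le, h⟩, huD⟩) (not_le.2 hu.1)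

lemma IsGap.eq {D : Set ℂ} {s t s' t' y : ℝ} (h : IsGap w d D s t) (h' : IsGap w d D s' t')
    (hy : y ∈ Ioo s t) (hy' : y ∈ Ioo s' t') : s = s' ∧ t = t' := by
  have key : ∀ {s t s' t' : ℝ}, IsGap w d D s t → IsGap w d D s' t' → y ∈ Ioo s t → y ∈ Ioo s' t' →
      s ≤ s' ∧ t' ≤ t := fun h h' hy hy' => by
    constructor <;> by_contra! hlt
    · exact h.2.1 (h'.2.2.2 _ ⟨hlt, hy.1.trans hy'.2⟩)
    · exact h.2.2.1 (h'.2.2.2 _ ⟨hy'.1.trans hy.2, hlt⟩)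
  exact ⟨(key h h' hy hy').1.antisymm (key h' h hy' hy).1,
    (key h' h hy' hy).2.antisymm (key h h' hy hy').2⟩

lemma IsGap.isCrosscut (hd : ‖d‖ = 1) {J : Set ℂ} (hJ : IsJordanLoop J) {s t : ℝ}
    (h : IsGap w d (inside J) s t) :
    IsCrosscut J (linePt w d '' Icc s t) (linePt w d s) (linePt w d t) := by
  have hcl : linePt w d '' Icc s t ⊆ inside J ∪ J := by
    rw [← hJ.closure_inside]
    rintro _ ⟨y, hy, rfl⟩
    rw [← closure_Ioo h.1.ne] at hy
    exact closure_mono (by rintro _ ⟨y, hy, rfl⟩; exact h.2.2.2 y hy)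
      (image_closure_subset_closure_image continuous_linePt ⟨y, hy, rfl⟩)
  refine ⟨isArc_image_Icc h.1 continuous_linePt.continuousOn (linePt_injective hd).injOn,
    (hcl ⟨s, left_mem_Icc.2 h.1.le, rfl⟩).resolve_left h.2.1,
    (hcl ⟨t, right_mem_Icc.2 h.1.le, rfl⟩).resolve_left h.2.2.1, ?_⟩
  rintro _ ⟨⟨y, hy, rfl⟩, hne⟩
  simp only [mem_insert_iff, mem_singleton_iff, not_or] at hne
  exact h.2.2.2 y ⟨hy.1.lt_of_ne fun h => hne.1 (h ▸ rfl), hy.2.lt_of_ne fun h => hne.2 (h ▸ rfl)⟩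

/-- `P` is a piece of `J`: every component of the line inside `J` is inside `P` or avoids it. -/
def IsLinePiece (w d : ℂ) (J P : Set ℂ) : Prop :=
  inside P ⊆ inside J ∧ ∀ s t, IsGap w d (inside J) s t →
    linePt w d '' Ioo s t ⊆ inside P ∨ Disjoint (linePt w d '' Ioo s t) (inside P)

lemma IsLinePiece.of_cut {J P A B : Set ℂ} (h : IsLinePiece w d J P) {s t : ℝ}
    (hg : IsGap w d (inside J) s t) (hA : IsClosed (A ∪ linePt w d '' Icc s t))
    (hB : IsClosed (B ∪ linePt w d '' Icc s t))
    (hAP : inside (A ∪ linePt w d '' Icc s t) ⊆ inside P)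
    (hdis : Disjoint (inside (A ∪ linePt w d '' Icc s t)) (inside (B ∪ linePt w d '' Icc s t)))
    (hcov : inside P ⊆ inside (A ∪ linePt w d '' Icc s t) ∪ inside (B ∪ linePt w d '' Icc s t) ∪
      linePt w d '' Icc s t) (hd : ‖d‖ = 1) :
    IsLinePiece w d J (A ∪ linePt w d '' Icc s t) := by
  refine ⟨hAP.trans h.1, fun s' t' hg' => ?_⟩
  rcases h.2 s' t' hg' with hin | hdj
  swap
  · exact Or.inr (hdj.mono_right hAP)
  by_cases hmeet : ∃ y ∈ Ioo s t, y ∈ Ioo s' t'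
  · obtain ⟨y, hy, hy'⟩ := hmeet
    obtain ⟨rfl, rfl⟩ := hg.eq hg' hy hy'
    right
    rw [disjoint_left]
    rintro _ ⟨u, hu, rfl⟩ hin'
    exact hin'.1 (Or.inr ⟨u, Ioo_subset_Icc_self hu, rfl⟩)
  · push Not at hmeet
    have hsub : linePt w d '' Ioo s' t' ⊆ inside (A ∪ linePt w d '' Icc s t) ∪
        inside (B ∪ linePt w d '' Icc s t) := by
      rintro _ ⟨u, hu, rfl⟩
      refine (hcov (hin ⟨u, hu, rfl⟩)).resolve_right ?_
      rintro ⟨v, hv, hvu⟩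
      obtain rfl := linePt_injective hd hvu
      have h1 : v ≠ s := by rintro rfl; exact hg.2.1 (hg'.2.2.2 _ hu)
      have h2 : v ≠ t := by rintro rfl; exact hg.2.2.1 (hg'.2.2.2 _ hu)
      exact hmeet v ⟨hv.1.lt_of_ne h1.symm, hv.2.lt_of_ne h2⟩ hu
    rcases (isPreconnected_Ioo.image _ continuous_linePt.continuousOn).subset_or_subset
      (isOpen_inside hA) (isOpen_inside hB) hdis hsub with h' | h'
    · exact Or.inl h'
    · exact Or.inr (hdis.symm.mono_left h')

lemma divisible_avoiding (hd : ‖d‖ = 1) {J : Set ℂ} (hJ : IsJordanLoop J) (L : List ℝ) :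
    Divisible (fun P => IsLinePiece w d J P ∧ ∀ y ∈ L, linePt w d y ∉ inside P) J := by
  induction L with
  | nil =>
    refine .leaf hJ ⟨⟨subset_rfl, fun s t hg => Or.inl ?_⟩, by simp⟩
    rintro _ ⟨y, hy, rfl⟩
    exact hg.2.2.2 y hy
  | cons y L ih =>
    refine ih.bind fun P hP ⟨hpc, hL⟩ => ?_
    by_cases hy : linePt w d y ∈ inside P
    swap
    · exact .leaf hP ⟨hpc, by simpa [hy] using hL⟩
    obtain ⟨s, t, hg, hyst⟩ := exists_isGap hd (isOpen_inside hJ.isClosed)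
      (isBounded_inside hJ.isCompact.isBounded) (hpc.1 hy)
    have hγP : linePt w d '' Ioo s t ⊆ inside P := (hpc.2 s t hg).resolve_right fun h =>
      disjoint_left.1 h ⟨y, hyst, rfl⟩ hy
    have hgP : IsGap w d (inside P) s t := ⟨hg.1, fun h => hg.2.1 (hpc.1 h),
      fun h => hg.2.2.1 (hpc.1 h), fun u hu => hγP ⟨u, hu, rfl⟩⟩
    have hcc := hgP.isCrosscut hd hP
    obtain ⟨A, B, hA, hB, rfl, hAB⟩ := hP.split hcc.2.1 hcc.2.2.1 hcc.1.ne
    obtain ⟨h1, h2, h3, h4, h5, h6⟩ := theta_lemma hA hB hAB.subset hcc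
    refine .cut rfl hA hB hAB.subset hcc (.leaf h1 ⟨?_, ?_⟩) (.leaf h2 ⟨?_, ?_⟩)
    · exact hpc.of_cut hg h1.isClosed h2.isClosed h3 h5 h6 hd
    · simp only [List.mem_cons, forall_eq_or_imp]
      exact ⟨fun h => h.1 (Or.inr ⟨y, Ioo_subset_Icc_self hyst, rfl⟩),
        fun u hu h => hL u hu (h3 h)⟩
    · exact hpc.of_cut hg h2.isClosed h1.isClosed h4 h5.symm
        (by rwa [union_comm (inside _) (inside (A ∪ _))]) hd
    · simp only [List.mem_cons, forall_eq_or_imp]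
      exact ⟨fun h => h.1 (Or.inr ⟨y, Ioo_subset_Icc_self hyst, rfl⟩),
        fun u hu h => hL u hu (h4 h)⟩

end LineCuts

section LineSeparation

variable {w d : ℂ}

lemma lineHt_add_mul_I (hd : ‖d‖ = 1) (z : ℂ) (τ : ℝ) :
    lineHt w d (z + τ * Complex.I * d) = lineHt w d z + τ := by
  have h0 : d ≠ 0 := by rintro rfl; simp at hd
  have : (z + τ * Complex.I * d - w) / d = (z - w) / d + τ * Complex.I := by field_simp; ring
  rw [lineHt, this]; simp [lineHt]

lemma mem_closure_lineHt_neg (hd : ‖d‖ = 1) {O : Set ℂ} (hO : IsOpen O) {z : ℂ} (hz : z ∈ O)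
    (h0 : lineHt w d z = 0) : z ∈ closure (O ∩ {z | lineHt w d z < 0}) := by
  rw [Metric.mem_closure_iff]
  intro ε hε
  obtain ⟨r, hr, hrO⟩ := Metric.isOpen_iff.1 hO z hz
  have hm : 0 < min r ε / 2 := half_pos (lt_min hr hε)
  have hdist : dist z (z + (-(min r ε / 2) : ℝ) * Complex.I * d) = min r ε / 2 := by
    rw [dist_eq_norm, sub_add_cancel_left, norm_neg, norm_mul, norm_mul, hd, Complex.norm_I,
      Complex.norm_real, Real.norm_eq_abs, abs_neg, abs_of_pos hm]; ring
  refine ⟨z + (-(min r ε / 2) : ℝ) * Complex.I * d, ⟨hrO ?_, ?_⟩, ?_⟩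
  · rw [mem_ball, dist_comm, hdist]; linarith [min_le_left r ε]
  · rw [mem_ofPred_eq, lineHt_add_mul_I hd, h0]; linarith
  · rw [hdist]; linarith [min_le_right r ε]

lemma exists_lineHt_pos (hd : ‖d‖ = 1) {O : Set ℂ} (hO : IsOpen O) {z : ℂ} (hz : z ∈ O)
    (h0 : lineHt w d z = 0) : ∃ z' ∈ O, 0 < lineHt w d z' := by
  obtain ⟨r, hr, hrO⟩ := Metric.isOpen_iff.1 hO z hz
  refine ⟨z + ((r / 2) : ℝ) * Complex.I * d, hrO ?_, ?_⟩
  · rw [mem_ball, dist_eq_norm, add_sub_cancel_left, norm_mul, norm_mul, hd, Complex.norm_I,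
      Complex.norm_real, Real.norm_eq_abs, abs_of_pos (half_pos hr)]; linarith
  · rw [lineHt_add_mul_I hd, h0]; linarith

/-- Two points of a piece on different sides of the line are separated, in the original domain, by
a single component of the line. -/
lemma IsLinePiece.exists_separating_gap (hd : ‖d‖ = 1) {J P : Set ℂ} (hJ : IsJordanLoop J)
    (hP : IsJordanLoop P) (hpc : IsLinePiece w d J P) {u v : ℂ} (hu : u ∈ inside P)
    (hv : v ∈ inside P) (hu0 : lineHt w d u < 0) (hv0 : 0 < lineHt w d v) :
    ∃ s t, IsGap w d (inside J) s t ∧ linePt w d '' Ioo s t ⊆ inside P ∧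
      ∀ A B, IsArc A (linePt w d s) (linePt w d t) → IsArc B (linePt w d s) (linePt w d t) →
      A ∪ B = J → A ∩ B = {linePt w d s, linePt w d t} →
      u ∈ inside (A ∪ linePt w d '' Icc s t) ∧ v ∈ inside (B ∪ linePt w d '' Icc s t) ∨
      u ∈ inside (B ∪ linePt w d '' Icc s t) ∧ v ∈ inside (A ∪ linePt w d '' Icc s t) := by
  have hPo := isOpen_inside hP.isClosed
  have hfc : Continuous (lineHt w d) := continuous_lineHt
  set U := connectedComponentIn (inside P ∩ {z | lineHt w d z < 0}) u with hU
  have huU : u ∈ U := mem_connectedComponentIn ⟨hu, hu0⟩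
  have hUsub : U ⊆ inside P ∩ {z | lineHt w d z < 0} := connectedComponentIn_subset _ _
  have hUo : IsOpen U :=
    (hPo.inter (isOpen_lt hfc continuous_const)).connectedComponentIn
  have hUcl : ∀ z ∈ closure U, lineHt w d z ≤ 0 := fun z hz =>
    closure_minimal (fun z hz => (hUsub hz).2.le) (isClosed_le hfc continuous_const) hz
  have hhalf : ∀ y ρ, ball y ρ ⊆ inside P → y ∈ closure U → 0 < ρ →
      ball y ρ ∩ {z | lineHt w d z < 0} ⊆ U := by
    intro y ρ hρ hy hρ0
    obtain ⟨z, hzU, hz⟩ := Metric.mem_closure_iff.1 hy ρ hρ0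
    rw [hU, connectedComponentIn_eq hzU]
    exact ((convex_ball y ρ).inter (convex_lineHt_lt 0)).isPreconnected.subset_connectedComponentIn
      ⟨by rwa [mem_ball, dist_comm], (hUsub hzU).2⟩ (inter_subset_inter_left _ hρ)
  have hhalf0 : ∀ y ρ, ball y ρ ⊆ inside P → y ∈ closure U → ∀ z ∈ ball y ρ, lineHt w d z = 0 →
      z ∈ closure U := fun y ρ hρ hy z hz h0 =>
    closure_mono (hhalf y ρ hρ hy (dist_nonneg.trans_lt hz))
      (mem_closure_lineHt_neg hd isOpen_ball hz h0)
  have huv : v ≠ u := by rintro rfl; linarith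
  obtain ⟨A₀, hA₀, hA₀'⟩ := hPo.exists_isArc hP.isPreconnected_inside hv hu huv
  obtain ⟨x, hxU, A', hA'sub, hA', hint⟩ := hA₀'.first_hit isClosed_closure
    (fun h => absurd (hUcl v h) (not_le.2 hv0)) ⟨u, hA₀'.right_mem, subset_closure huU⟩
  have hA'P := hA'sub.trans hA₀
  have hxP : x ∈ inside P := hA'P hA'.right_mem
  obtain ⟨hpre, -, hclo⟩ := hA'.isPreconnected_diff
  have hnotU : ∀ z ∈ A' \ {v, x}, z ∉ closure U := fun z hz h => by
    have : z ∈ A' ∩ closure U := ⟨hz.1, h⟩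
    rw [hint] at this
    exact hz.2 (Or.inr this)
  have hx0 : lineHt w d x = 0 := by
    refine (hUcl x hxU).antisymm (not_lt.1 fun hlt => ?_)
    obtain ⟨ρ, hρ, hρP⟩ := Metric.isOpen_iff.1 hPo x hxP
    have hxU' := hhalf x ρ hρP hxU hρ ⟨mem_ball_self hρ, hlt⟩
    obtain ⟨z, hz, hz'⟩ := mem_closure_iff.1 (hclo hA'.right_mem) U hUo hxU'
    exact hnotU z hz' (subset_closure hz)
  obtain ⟨y, rfl⟩ := exists_linePt_eq hd hx0
  obtain ⟨s, t, hg, hyst⟩ := exists_isGap hd (isOpen_inside hJ.isClosed)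
    (isBounded_inside hJ.isCompact.isBounded) (hpc.1 hxP)
  have hγP : linePt w d '' Ioo s t ⊆ inside P := (hpc.2 s t hg).resolve_right fun h =>
    disjoint_left.1 h ⟨y, hyst, rfl⟩ hxP
  refine ⟨s, t, hg, hγP, fun A B hA hB hAB hint' => ?_⟩
  have hγU : linePt w d '' Ioo s t ⊆ closure U := by
    choose! ρ hρ hρP using fun z (hz : z ∈ inside P) => Metric.isOpen_iff.1 hPo z hz
    let W := ⋃ z ∈ linePt w d '' Ioo s t ∩ closure U, ball z (ρ z)
    have hW : IsOpen W := isOpen_biUnion fun z _ => isOpen_ball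
    have hxW : linePt w d y ∈ W :=
      mem_biUnion (⟨⟨y, hyst, rfl⟩, hxU⟩ : _ ∈ linePt w d '' Ioo s t ∩ closure U)
        (mem_ball_self (hρ _ hxP))
    refine (isPreconnected_iff_subset_of_disjoint_closed.1
      (isPreconnected_Ioo.image _ continuous_linePt.continuousOn) (closure U) Wᶜ isClosed_closure
      hW.isClosed_compl ?_ ?_).resolve_right fun h => h ⟨y, hyst, rfl⟩ hxW
    · intro z hz
      by_cases hzW : z ∈ W
      · obtain ⟨z', hz', hzz'⟩ := mem_iUnion₂.1 hzW
        obtain ⟨τ, -, rfl⟩ := hz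
        exact Or.inl (hhalf0 z' _ (hρP z' (hγP hz'.1)) hz'.2 _ hzz' (lineHt_linePt hd τ))
      · exact Or.inr hzW
    · rw [← disjoint_iff_inter_eq_empty, disjoint_left]
      exact fun z hz hz' => hz'.2 (mem_biUnion (⟨hz, hz'.1⟩ :
        z ∈ linePt w d '' Ioo s t ∩ closure U) (mem_ball_self (hρ _ (hγP hz))))
  have hcc := hg.isCrosscut hd hJ
  rw [← hAB] at hcc
  obtain ⟨h1, h2, h3, h4, h5, h6⟩ := theta_lemma hA hB hint'.subset hcc
  set γ := linePt w d '' Icc s t with hγ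
  have hγ0 : ∀ z ∈ γ, lineHt w d z = 0 := by
    rintro _ ⟨τ, -, rfl⟩; exact lineHt_linePt hd τ
  have hγin : ∀ z ∈ γ, z ∈ inside P → z ∈ linePt w d '' Ioo s t := by
    rintro _ ⟨τ, hτ, rfl⟩ hz
    refine ⟨τ, ⟨hτ.1.lt_of_ne ?_, hτ.2.lt_of_ne ?_⟩, rfl⟩
    · rintro rfl; exact hg.2.1 (hpc.1 hz)
    · rintro rfl; exact hg.2.2.1 (hpc.1 hz)
  have hcov : inside J \ γ ⊆ inside (A ∪ γ) ∪ inside (B ∪ γ) := fun z hz =>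
    (h6 (hAB.symm ▸ hz.1)).resolve_right hz.2
  have ho1 := isOpen_inside h1.isClosed
  have ho2 := isOpen_inside h2.isClosed
  have hUJ : U ⊆ inside J \ γ := fun z hz =>
    ⟨hpc.1 (hUsub hz).1, fun h => (hUsub hz).2.ne (hγ0 z h)⟩
  set S := A' \ {linePt w d y} with hS
  have hSpre : IsPreconnected S := hpre.subset_closure
    (sdiff_subset_sdiff_right (by simp)) (sdiff_subset.trans hclo)
  have hvS : v ∈ S := ⟨hA'.left_mem, hA'.ne⟩
  have hSU : ∀ z ∈ S, z ∉ closure U := fun z hz h => by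
    have : z ∈ A' ∩ closure U := ⟨hz.1, h⟩
    rw [hint] at this
    exact hz.2 this
  have hSJ : S ⊆ inside J \ γ := fun z hz =>
    ⟨hpc.1 (hA'P hz.1), fun h => hSU z hz (hγU (hγin z h (hA'P hz.1)))⟩
  have key : ∀ X Y : Set ℂ, Disjoint X Y → IsOpen X → IsOpen Y → inside J \ γ ⊆ X ∪ Y →
      linePt w d y ∈ closure Y → U ⊆ X → S ⊆ X → False := by
    intro X Y hXY hX hY hc hyY hUX hSX
    obtain ⟨ρ, hρ, hρP⟩ := Metric.isOpen_iff.1 hPo _ hxP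
    obtain ⟨z₁, hz₁, hz₁'⟩ := mem_closure_iff.1 (hclo hA'.right_mem) _ isOpen_ball (mem_ball_self hρ)
    have hz₁S : z₁ ∈ S := ⟨hz₁'.1, fun h => hz₁'.2 (Or.inr h)⟩
    have hz₁0 : 0 < lineHt w d z₁ := by
      rcases lt_trichotomy (lineHt w d z₁) 0 with h | h | h
      · exact absurd (subset_closure (hhalf _ ρ hρP hxU hρ ⟨hz₁, h⟩)) (hSU z₁ hz₁S)
      · exact absurd (hhalf0 _ ρ hρP hxU z₁ hz₁ h) (hSU z₁ hz₁S)
      · exact h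
    have hplus : ball (linePt w d y) ρ ∩ {z | 0 < lineHt w d z} ⊆ X := by
      have hsub : ball (linePt w d y) ρ ∩ {z | 0 < lineHt w d z} ⊆ inside J \ γ := fun z hz =>
        ⟨hpc.1 (hρP hz.1), fun h => hz.2.ne' (hγ0 z h)⟩
      exact ((convex_ball _ ρ).inter (convex_lineHt_gt 0)).isPreconnected.subset_left_of_subset_union
        hX hY hXY (hsub.trans hc) ⟨z₁, ⟨hz₁, hz₁0⟩, hSX hz₁S⟩
    obtain ⟨z, hz, hzY⟩ := mem_closure_iff.1 hyY _ isOpen_ball (mem_ball_self hρ)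
    rcases lt_trichotomy (lineHt w d z) 0 with h | h | h
    · exact disjoint_left.1 hXY (hUX (hhalf _ ρ hρP hxU hρ ⟨hz, h⟩)) hzY
    · obtain ⟨z', hz', hz'0⟩ := exists_lineHt_pos hd (hY.inter isOpen_ball) ⟨hzY, hz⟩ h
      exact disjoint_left.1 hXY (hplus ⟨hz'.2, hz'0⟩) hz'.1
    · exact disjoint_left.1 hXY (hplus ⟨hz, h⟩) hzY
  have hyγ : linePt w d y ∈ γ := ⟨y, Ioo_subset_Icc_self hyst, rfl⟩
  have hUpre : IsPreconnected U := isPreconnected_connectedComponentIn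
  rcases hUpre.subset_or_subset ho1 ho2 h5 (hUJ.trans hcov) with hU1 | hU1 <;>
    rcases hSpre.subset_or_subset ho1 ho2 h5 (hSJ.trans hcov) with hS1 | hS1
  · exact (key _ _ h5 ho1 ho2 hcov (h2.subset_closure_inside (Or.inr hyγ)) hU1 hS1).elim
  · exact Or.inl ⟨hU1 huU, hS1 hvS⟩
  · exact Or.inr ⟨hU1 huU, hS1 hvS⟩
  · exact (key _ _ h5.symm ho2 ho1 (by rwa [union_comm]) (h1.subset_closure_inside (Or.inr hyγ))
      hU1 hS1).elim

/-- A Jordan domain can be cut into pieces lying essentially on one side of a given line. -/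
lemma IsJordanLoop.divisible_line (hd : ‖d‖ = 1) {J : Set ℂ} (hJ : IsJordanLoop J) {η : ℝ}
    (hη : 0 < η) : Divisible (fun P => (∀ z ∈ P, lineHt w d z ≤ η) ∨ ∀ z ∈ P, -η ≤ lineHt w d z)
      J := by
  obtain ⟨l₀, hl₀, hsmall⟩ := hJ.exists_small_arc hη
  obtain ⟨l, hl, hll₀, hlη⟩ : ∃ l > 0, l ≤ l₀ ∧ l ≤ η :=
    ⟨min l₀ η, lt_min hl₀ hη, min_le_left _ _, min_le_right _ _⟩
  obtain ⟨R, hR⟩ := (isBounded_inside hJ.isCompact.isBounded).subset_closedBall (linePt w d 0)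
  obtain ⟨M, hM⟩ := exists_nat_gt (R / (l / 2))
  refine (divisible_avoiding (w := w) hd hJ
    ((Finset.Icc (-M : ℤ) M).toList.map fun k : ℤ => (k * (l / 2) : ℝ))).bind
      fun P hP ⟨hpc, hL⟩ => .leaf hP ?_
  by_contra! hcon
  obtain ⟨⟨v', hv'P, hv'⟩, u', hu'P, hu'⟩ := hcon
  have hfc : Continuous (lineHt w d) := continuous_lineHt
  obtain ⟨v, hv0, hv⟩ := mem_closure_iff.1 (hP.subset_closure_inside hv'P) _
    (isOpen_lt continuous_const hfc) hv'
  obtain ⟨u, hu0, hu⟩ := mem_closure_iff.1 (hP.subset_closure_inside hu'P) _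
    (isOpen_lt hfc continuous_const) hu'
  simp only [mem_ofPred_eq] at hv0 hu0
  obtain ⟨s, t, hg, hgP, hsep⟩ := hpc.exists_separating_gap hd hJ hP hu hv (by linarith)
    (by linarith)
  have hlen : t - s < l := by
    by_contra! hlen
    have h1 := Int.lt_floor_add_one (s / (l / 2))
    have h2 := Int.floor_le (s / (l / 2))
    set k := ⌊s / (l / 2)⌋ + 1 with hk
    rw [div_lt_iff₀ (by linarith)] at h1
    rw [le_div_iff₀ (by linarith)] at h2
    have hkt : (k : ℝ) * (l / 2) ∈ Ioo s t := by
      rw [hk]; push_cast; constructor <;> nlinarith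
    have hkP := hgP ⟨_, hkt, rfl⟩
    refine hL _ (List.mem_map.2 ⟨k, ?_, rfl⟩) hkP
    have := hR (hpc.1 hkP)
    rw [mem_closedBall, dist_linePt hd, sub_zero, abs_mul, abs_of_pos (half_pos hl),
      ← le_div_iff₀ (half_pos hl)] at this
    have hkM : |(k : ℝ)| ≤ M := by linarith
    rw [Finset.mem_toList, Finset.mem_Icc, ← abs_le]
    exact_mod_cast hkM
  have hcc := hg.isCrosscut hd hJ
  have hst := dist_linePt (w := w) hd s t
  obtain ⟨A, B, hA, hB, hAB, hint, hball⟩ := hsmall _ hcc.2.1 _ hcc.2.2.1 hcc.1.ne (by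
    rw [hst, abs_sub_comm, abs_of_pos (sub_pos.2 hg.1)]; exact hlen.trans_le hll₀)
  have hγ : linePt w d '' Icc s t ⊆ ball (linePt w d s) η := by
    rintro _ ⟨y, hy, rfl⟩
    rw [mem_ball, dist_linePt hd, abs_of_nonneg (by linarith [hy.1])]
    linarith [hy.2]
  have hin : ∀ z ∈ inside (A ∪ linePt w d '' Icc s t), |lineHt w d z| < η := fun z hz => by
    have h1 := inside_subset_of_convex (convex_ball _ _) (union_subset hball hγ) hz
    have h2 := abs_lineHt_sub_le (w := w) hd z (linePt w d s)
    rw [lineHt_linePt hd, sub_zero] at h2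
    exact h2.trans_lt h1
  rcases hsep A B hA hB hAB hint with h | h
  · linarith [neg_le_abs (lineHt w d u), hin u h.1]
  · linarith [le_abs_self (lineHt w d v), hin v h.2]

lemma convex_lineHt_strip (b c : ℝ) : Convex ℝ {z | b ≤ lineHt w d z ∧ lineHt w d z ≤ c} := by
  intro z hz z' hz' s t hs ht hst
  simp only [mem_ofPred_eq] at *
  rw [lineHt_combo z z' hst]
  have ht' : t = 1 - s := by linarith
  subst ht'
  constructor <;> nlinarith

/-- A Jordan domain can be cut into pieces of small width in a given direction. -/
lemma IsJordanLoop.divisible_strip (hd : ‖d‖ = 1) {e : ℝ} (he : 0 < e) (n : ℕ) :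
    ∀ J, IsJordanLoop J → ∀ w : ℂ, (∀ z ∈ J, 0 ≤ lineHt w d z ∧ lineHt w d z ≤ (n + 3) * e) →
      Divisible (fun P => ∃ w : ℂ, ∀ z ∈ P, 0 ≤ lineHt w d z ∧ lineHt w d z ≤ 3 * e) J := by
  induction n with
  | zero => exact fun J hJ w h => .leaf hJ ⟨w, by simpa using h⟩
  | succ n ih =>
    intro J hJ w h
    have hC : Convex ℝ {z | 0 ≤ lineHt w d z ∧ lineHt w d z ≤ ((n + 1 : ℕ) + 3) * e} :=
    convex_lineHt_strip _ _
    have hsh : ∀ (τ : ℝ) z, lineHt (w + τ * Complex.I * d) d z = lineHt w d z - τ := by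
      intro τ z
      have := lineHt_add_mul_I (w := w + τ * Complex.I * d) hd (z - τ * Complex.I * d) τ
      rw [sub_add_cancel] at this
      rw [this, lineHt, lineHt]
      have h0 : d ≠ 0 := by rintro rfl; simp at hd
      have : (z - τ * Complex.I * d - (w + τ * Complex.I * d)) / d =
        (z - w) / d - (2 * τ : ℝ) * Complex.I := by field_simp; push_cast; ring
      rw [this]; simp; ring
    refine ((hJ.divisible_line (w := w + (2 * e : ℝ) * Complex.I * d) hd he).and_subset_convex hC
      h).bind fun P hP ⟨h1, h2⟩ => ?_
    rcases h1 with h1 | h1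
    · refine .leaf hP ⟨w, fun z hz => ⟨(h2 hz).1, ?_⟩⟩
      have := h1 z hz
      rw [hsh] at this
      linarith
    · refine ih P hP (w + e * Complex.I * d) fun z hz => ?_
      have h3 := h1 z hz
      have h4 := (h2 hz).2
      push_cast at h4
      rw [hsh] at h3 ⊢
      constructor <;> linarith

end LineSeparation

/-- Every Jordan domain can be cut into arbitrarily small Jordan domains. -/
lemma IsJordanLoop.divisible_small {J : Set ℂ} (hJ : IsJordanLoop J) {ε : ℝ} (hε : 0 < ε) :
    Divisible (fun P => ∃ C, Convex ℝ C ∧ P ⊆ C ∧ ∀ x ∈ C, ∀ y ∈ C, dist x y ≤ ε) J := by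
  have he : 0 < ε / 6 := by linarith
  have hstrip : ∀ d : ℂ, ‖d‖ = 1 → ∀ P, IsJordanLoop P → Divisible (fun P => ∃ w : ℂ,
      ∀ z ∈ P, 0 ≤ lineHt w d z ∧ lineHt w d z ≤ 3 * (ε / 6)) P := by
    intro d hd P hP
    obtain ⟨R, hR⟩ := hP.isCompact.isBounded.subset_closedBall 0
    obtain ⟨n, hn⟩ := exists_nat_gt (2 * R / (ε / 6))
    rw [div_lt_iff₀ he] at hn
    refine hP.divisible_strip hd he n P ((-R : ℝ) * Complex.I * d) fun z hz => ?_
    have h0 : d ≠ 0 := by rintro rfl; simp at hd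
    have h1 : lineHt ((-R : ℝ) * Complex.I * d) d z = (z / d).im + R := by
      rw [lineHt, show (z - (-R : ℝ) * Complex.I * d) / d = z / d + R * Complex.I by
        field_simp; push_cast; ring]
      simp
    have h2 : |(z / d).im| ≤ R := (Complex.abs_im_le_norm _).trans (by
      rw [norm_div, hd, div_one]; simpa using hR hz)
    rw [h1]
    constructor <;> linarith [abs_le.1 h2]
  refine (hstrip 1 (by simp) J hJ).bind fun P hP ⟨w, hw⟩ => ?_
  have hC : Convex ℝ {z : ℂ | 0 ≤ lineHt w 1 z ∧ lineHt w 1 z ≤ 3 * (ε / 6)} :=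
    convex_lineHt_strip _ _
  refine ((hstrip Complex.I (by simp) P hP).and_subset_convex hC hw).bind
    fun P' hP' ⟨⟨w', hw'⟩, hP'C⟩ => .leaf hP' ?_
  have hC' : Convex ℝ {z : ℂ | 0 ≤ lineHt w' Complex.I z ∧ lineHt w' Complex.I z ≤ 3 * (ε / 6)} :=
    convex_lineHt_strip _ _
  refine ⟨_, hC.inter hC', fun z hz => ⟨hP'C hz, hw' z hz⟩, fun x hx y hy => ?_⟩
  rw [Complex.dist_eq]
  refine (Complex.norm_le_abs_re_add_abs_im _).trans ?_
  simp only [lineHt, mem_inter_iff, mem_ofPred_eq, div_one, Complex.div_I, Complex.sub_im,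
    Complex.neg_im, Complex.mul_im, Complex.I_re, Complex.I_im, mul_zero, mul_one,
    Complex.sub_re, add_zero] at hx hy
  have h1 : |(x - y).re| ≤ ε / 2 := by
    rw [abs_le, Complex.sub_re]; constructor <;> linarith [hx.2.1, hx.2.2, hy.2.1, hy.2.2]
  have h2 : |(x - y).im| ≤ ε / 2 := by
    rw [abs_le, Complex.sub_im]; constructor <;> linarith [hx.1.1, hx.1.2, hy.1.1, hy.1.2]
  linarith

/-! ### Matched subdivisions of two Jordan domains and the Schoenflies theorem -/

/-- The closed Jordan domain bounded by `J`. -/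
def fill (J : Set ℂ) : Set ℂ := inside J ∪ J

lemma subset_fill {J : Set ℂ} : J ⊆ fill J := subset_union_right

/-- A matched pair of Jordan loops, encoded as the graph of a homeomorphism between them. -/
structure IsCell (ρ : Set (ℂ × ℂ)) : Prop where
  loop : IsJordanLoop ρ
  inj_fst : InjOn Prod.fst ρ
  inj_snd : InjOn Prod.snd ρ

lemma IsCell.loop_fst {ρ : Set (ℂ × ℂ)} (h : IsCell ρ) : IsJordanLoop (Prod.fst '' ρ) :=
  h.loop.image continuous_fst.continuousOn h.inj_fst

lemma IsCell.loop_snd {ρ : Set (ℂ × ℂ)} (h : IsCell ρ) : IsJordanLoop (Prod.snd '' ρ) :=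
  h.loop.image continuous_snd.continuousOn h.inj_snd

lemma IsCell.swap {ρ : Set (ℂ × ℂ)} (h : IsCell ρ) : IsCell (Prod.swap '' ρ) :=
  ⟨h.loop.image continuous_swap.continuousOn Prod.swap_injective.injOn,
    InjOn.image_of_comp (g := Prod.fst) (f := Prod.swap) h.inj_snd,
    InjOn.image_of_comp (g := Prod.snd) (f := Prod.swap) h.inj_fst⟩

/-- The cell `ρ` is cut by a matched pair of crosscuts into `ρ₁` and `ρ₂`. -/
def IsSplit (ρ ρ₁ ρ₂ : Set (ℂ × ℂ)) : Prop :=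
  IsCell ρ ∧ ∃ A B σ P Q, IsArc A P Q ∧ IsArc B P Q ∧ A ∩ B ⊆ {P, Q} ∧ A ∪ B = ρ ∧ IsArc σ P Q ∧
    InjOn Prod.fst σ ∧ InjOn Prod.snd σ ∧ IsCrosscut (Prod.fst '' ρ) (Prod.fst '' σ) P.1 Q.1 ∧
    IsCrosscut (Prod.snd '' ρ) (Prod.snd '' σ) P.2 Q.2 ∧ ρ₁ = A ∪ σ ∧ ρ₂ = B ∪ σ

namespace IsSplit

variable {ρ ρ₁ ρ₂ : Set (ℂ × ℂ)}

lemma symm (h : IsSplit ρ ρ₁ ρ₂) : IsSplit ρ ρ₂ ρ₁ := by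
  obtain ⟨hρ, A, B, σ, P, Q, hA, hB, hAB, e, hσ, h1, h2, h3, h4, e1, e2⟩ := h
  exact ⟨hρ, B, A, σ, P, Q, hB, hA, by rwa [inter_comm], by rw [union_comm, e], hσ, h1, h2, h3, h4,
    e2, e1⟩

lemma swap (h : IsSplit ρ ρ₁ ρ₂) :
    IsSplit (Prod.swap '' ρ) (Prod.swap '' ρ₁) (Prod.swap '' ρ₂) := by
  obtain ⟨hρ, A, B, σ, P, Q, hA, hB, hAB, e, hσ, h1, h2, h3, h4, e1, e2⟩ := h
  have hs : ∀ T : Set (ℂ × ℂ), ContinuousOn Prod.swap T := fun T => continuous_swap.continuousOn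
  have hi : ∀ T : Set (ℂ × ℂ), InjOn Prod.swap T := fun T => Prod.swap_injective.injOn
  refine ⟨hρ.swap, Prod.swap '' A, Prod.swap '' B, Prod.swap '' σ, P.swap, Q.swap,
    hA.image (hs _) (hi _), hB.image (hs _) (hi _), ?_, ?_, hσ.image (hs _) (hi _),
    InjOn.image_of_comp (g := Prod.fst) (f := Prod.swap) h2,
    InjOn.image_of_comp (g := Prod.snd) (f := Prod.swap) h1, ?_, ?_, ?_, ?_⟩
  · rw [← image_inter Prod.swap_injective, ← image_pair]; exact image_mono hAB
  · rw [← image_union, e]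
  · simpa [image_image] using h4
  · simpa [image_image] using h3
  · rw [← image_union, e1]
  · rw [← image_union, e2]

lemma isCell_left (h : IsSplit ρ ρ₁ ρ₂) : IsCell ρ₁ := by
  obtain ⟨hρ, A, B, σ, P, Q, hA, hB, hAB, rfl, hσ, h1, h2, h3, h4, rfl, rfl⟩ := h
  have hPρ : P ∈ A ∪ B := Or.inl hA.left_mem
  have hQρ : Q ∈ A ∪ B := Or.inl hA.right_mem
  have hmeet1 : ∀ z ∈ A, ∀ z' ∈ σ, z.1 = z'.1 → z = z' := by
    intro z hz z' hz' e
    have : z.1 ∈ ({P.1, Q.1} : Set ℂ) := h3.inter_subset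
      ⟨⟨z, Or.inl hz, rfl⟩, ⟨z', hz', e.symm⟩⟩
    rcases this with h | h
    · rw [hρ.inj_fst (Or.inl hz) hPρ h, h1 hz' hσ.left_mem (e.symm.trans h)]
    · rw [hρ.inj_fst (Or.inl hz) hQρ h, h1 hz' hσ.right_mem (e.symm.trans h)]
  have hmeet2 : ∀ z ∈ A, ∀ z' ∈ σ, z.2 = z'.2 → z = z' := by
    intro z hz z' hz' e
    have : z.2 ∈ ({P.2, Q.2} : Set ℂ) := h4.inter_subset
      ⟨⟨z, Or.inl hz, rfl⟩, ⟨z', hz', e.symm⟩⟩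
    rcases this with h | h
    · rw [hρ.inj_snd (Or.inl hz) hPρ h, h2 hz' hσ.left_mem (e.symm.trans h)]
    · rw [hρ.inj_snd (Or.inl hz) hQρ h, h2 hz' hσ.right_mem (e.symm.trans h)]
  refine ⟨.of_arcs hA hσ ?_, ?_, ?_⟩
  · rintro z ⟨hz, hz'⟩
    have : z.1 ∈ ({P.1, Q.1} : Set ℂ) := h3.inter_subset
      ⟨⟨z, Or.inl hz, rfl⟩, ⟨z, hz', rfl⟩⟩
    rcases this with h | h
    · exact Or.inl (h1 hz' hσ.left_mem h)
    · exact Or.inr (h1 hz' hσ.right_mem h)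
  · rintro z (hz | hz) z' (hz' | hz') e
    · exact hρ.inj_fst (Or.inl hz) (Or.inl hz') e
    · exact hmeet1 z hz z' hz' e
    · exact (hmeet1 z' hz' z hz e.symm).symm
    · exact h1 hz hz' e
  · rintro z (hz | hz) z' (hz' | hz') e
    · exact hρ.inj_snd (Or.inl hz) (Or.inl hz') e
    · exact hmeet2 z hz z' hz' e
    · exact (hmeet2 z' hz' z hz e.symm).symm
    · exact h2 hz hz' e

lemma isCell_right (h : IsSplit ρ ρ₁ ρ₂) : IsCell ρ₂ := h.symm.isCell_left

lemma subset_union (h : IsSplit ρ ρ₁ ρ₂) : ρ ⊆ ρ₁ ∪ ρ₂ := by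
  obtain ⟨hρ, A, B, σ, P, Q, hA, hB, hAB, rfl, hσ, h1, h2, h3, h4, rfl, rfl⟩ := h
  exact union_subset_union subset_union_left subset_union_left

lemma fill_fst_left (h : IsSplit ρ ρ₁ ρ₂) : fill (Prod.fst '' ρ₁) ⊆ fill (Prod.fst '' ρ) := by
  obtain ⟨hρ, A, B, σ, P, Q, hA, hB, hAB, rfl, hσ, h1, h2, h3, h4, rfl, rfl⟩ := h
  have hc := hρ.loop_fst
  have hsub : Prod.fst '' (A ∪ σ) ⊆ fill (Prod.fst '' (A ∪ B)) := by
    rw [image_union Prod.fst A σ]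
    exact union_subset ((image_mono subset_union_left).trans subset_fill) h3.subset
  refine union_subset ((hc.inside_subset_inside ?_ hsub).trans subset_union_left) hsub
  exact (hA.isCompact.union hσ.isCompact).image continuous_fst

lemma fill_fst_right (h : IsSplit ρ ρ₁ ρ₂) : fill (Prod.fst '' ρ₂) ⊆ fill (Prod.fst '' ρ) :=
  h.symm.fill_fst_left

lemma theta (h : IsSplit ρ ρ₁ ρ₂) :
    fill (Prod.fst '' ρ) ⊆ fill (Prod.fst '' ρ₁) ∪ fill (Prod.fst '' ρ₂) ∧
    (∀ x ∈ fill (Prod.fst '' ρ₁) ∩ fill (Prod.fst '' ρ₂), ∃ y, (x, y) ∈ ρ₁ ∩ ρ₂) ∧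
    ∀ z ∈ ρ, z.1 ∈ fill (Prod.fst '' ρ₁) → z ∈ ρ₁ := by
  obtain ⟨hρ, A, B, σ, P, Q, hA, hB, hAB, rfl, hσ, h1, h2, h3, h4, rfl, rfl⟩ := h
  have hf : ∀ T : Set (ℂ × ℂ), ContinuousOn Prod.fst T := fun T => continuous_fst.continuousOn
  have hA' := hA.image (hf _) (hρ.inj_fst.mono subset_union_left)
  have hB' := hB.image (hf _) (hρ.inj_fst.mono subset_union_right)
  have hAB' : Prod.fst '' A ∩ Prod.fst '' B ⊆ {P.1, Q.1} := by
    rintro _ ⟨⟨z, hz, rfl⟩, z', hz', e⟩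
    have := hρ.inj_fst (Or.inr hz') (Or.inl hz) e
    subst this
    rcases hAB ⟨hz, hz'⟩ with rfl | rfl <;> simp
  rw [image_union] at h3
  obtain ⟨-, -, t3, t4, t5, t6⟩ := theta_lemma hA' hB' hAB' h3
  have hPσ : {P.1, Q.1} ⊆ Prod.fst '' σ := by
    rintro _ (rfl | rfl)
    · exact ⟨P, hσ.left_mem, rfl⟩
    · exact ⟨Q, hσ.right_mem, rfl⟩
  simp only [image_union, fill] at *
  refine ⟨?_, ?_, ?_⟩
  · rintro x (hx | hx | hx)
    · rcases t6 hx with (h | h) | h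
      · exact Or.inl (Or.inl h)
      · exact Or.inr (Or.inl h)
      · exact Or.inl (Or.inr (Or.inr h))
    · exact Or.inl (Or.inr (Or.inl hx))
    · exact Or.inr (Or.inr (Or.inl hx))
  · intro x hx
    suffices x ∈ Prod.fst '' σ by
      obtain ⟨z, hz, rfl⟩ := this
      exact ⟨z.2, Or.inr hz, Or.inr hz⟩
    rcases hx with ⟨h | h | h, h' | h' | h'⟩
    · exact absurd h' (disjoint_left.1 t5 h)
    · exact absurd (Or.inr h') (t3 h).1
    · exact h'
    · exact absurd (Or.inl h) (t4 h').1
    · exact hPσ (hAB' ⟨h, h'⟩)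
    all_goals first | exact h | exact h'
  · intro z hz hx
    rcases hz with hz | hz
    · exact Or.inl hz
    have hzB : z.1 ∈ Prod.fst '' B := ⟨z, hz, rfl⟩
    rcases hx with h | ⟨z', hz', e⟩ | h
    · exact absurd (Or.inr hzB) (t3 h).1
    · rw [← hρ.inj_fst (Or.inl hz') (Or.inr hz) e]; exact Or.inl hz'
    · have : z.1 ∈ ({P.1, Q.1} : Set ℂ) := h3.inter_subset ⟨Or.inr hzB, h⟩
      rcases this with e | e
      · rw [hρ.inj_fst (Or.inr hz) (Or.inl hA.left_mem) e]; exact Or.inl hA.left_mem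
      · rw [hρ.inj_fst (Or.inr hz) (Or.inl hA.right_mem) e]; exact Or.inl hA.right_mem

end IsSplit

/-- `S` is the set of cells of a matched subdivision of the cell `ρ`. -/
inductive IsSubdivision : Set (ℂ × ℂ) → Set (Set (ℂ × ℂ)) → Prop
  | refl {ρ : Set (ℂ × ℂ)} : IsCell ρ → IsSubdivision ρ {ρ}
  | split {ρ ρ₁ ρ₂ : Set (ℂ × ℂ)} {S₁ S₂ : Set (Set (ℂ × ℂ))} : IsSplit ρ ρ₁ ρ₂ →
      IsSubdivision ρ₁ S₁ → IsSubdivision ρ₂ S₂ → IsSubdivision ρ (S₁ ∪ S₂)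

namespace IsSubdivision

variable {ρ : Set (ℂ × ℂ)} {S : Set (Set (ℂ × ℂ))}

lemma isCell_of_mem (h : IsSubdivision ρ S) : ∀ σ ∈ S, IsCell σ := by
  induction h with
  | refl h => rintro _ rfl; exact h
  | split h _ _ ih₁ ih₂ => rintro σ (hσ | hσ); exacts [ih₁ σ hσ, ih₂ σ hσ]

lemma finite (h : IsSubdivision ρ S) : S.Finite := by
  induction h with
  | refl h => simp
  | split h _ _ ih₁ ih₂ => exact ih₁.union ih₂

lemma swap (h : IsSubdivision ρ S) :
    IsSubdivision (Prod.swap '' ρ) ((fun σ => Prod.swap '' σ) '' S) := by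
  induction h with
  | refl h => rw [image_singleton]; exact .refl h.swap
  | split h _ _ ih₁ ih₂ => rw [image_union]; exact .split h.swap ih₁ ih₂

lemma fill_fst_subset (h : IsSubdivision ρ S) :
    ∀ σ ∈ S, fill (Prod.fst '' σ) ⊆ fill (Prod.fst '' ρ) := by
  induction h with
  | refl h => rintro _ rfl; rfl
  | split h _ _ ih₁ ih₂ =>
    rintro σ (hσ | hσ)
    exacts [(ih₁ σ hσ).trans h.fill_fst_left, (ih₂ σ hσ).trans h.fill_fst_right]

lemma exists_mem_fill_fst (h : IsSubdivision ρ S) :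
    ∀ x ∈ fill (Prod.fst '' ρ), ∃ σ ∈ S, x ∈ fill (Prod.fst '' σ) := by
  induction h with
  | refl h => exact fun x hx => ⟨_, rfl, hx⟩
  | split h _ _ ih₁ ih₂ =>
    intro x hx
    rcases h.theta.1 hx with hx | hx
    · obtain ⟨σ, hσ, hx⟩ := ih₁ x hx; exact ⟨σ, Or.inl hσ, hx⟩
    · obtain ⟨σ, hσ, hx⟩ := ih₂ x hx; exact ⟨σ, Or.inr hσ, hx⟩

lemma exists_mem (h : IsSubdivision ρ S) : ∀ z ∈ ρ, ∃ σ ∈ S, z ∈ σ := by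
  induction h with
  | refl h => exact fun x hx => ⟨_, rfl, hx⟩
  | split h _ _ ih₁ ih₂ =>
    intro x hx
    rcases h.subset_union hx with hx | hx
    · obtain ⟨σ, hσ, hx⟩ := ih₁ x hx; exact ⟨σ, Or.inl hσ, hx⟩
    · obtain ⟨σ, hσ, hx⟩ := ih₂ x hx; exact ⟨σ, Or.inr hσ, hx⟩

lemma mem_of_mem_fill_fst (h : IsSubdivision ρ S) :
    ∀ z ∈ ρ, ∀ σ ∈ S, z.1 ∈ fill (Prod.fst '' σ) → z ∈ σ := by
  induction h with
  | refl h => rintro z hz _ rfl _; exact hz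
  | split h h₁ h₂ ih₁ ih₂ =>
    rintro z hz σ (hσ | hσ) hx
    · exact ih₁ z (h.theta.2.2 z hz (h₁.fill_fst_subset σ hσ hx)) σ hσ hx
    · exact ih₂ z (h.symm.theta.2.2 z hz (h₂.fill_fst_subset σ hσ hx)) σ hσ hx

lemma exists_common (h : IsSubdivision ρ S) : ∀ σ ∈ S, ∀ τ ∈ S, σ ≠ τ → ∀ x ∈ fill (Prod.fst '' σ),
    x ∈ fill (Prod.fst '' τ) → ∃ y, (x, y) ∈ σ ∩ τ := by
  induction h with
  | refl h => rintro _ rfl _ rfl hne; exact absurd rfl hne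
  | split h h₁ h₂ ih₁ ih₂ =>
    have key : ∀ σ ∈ _, ∀ τ ∈ _, ∀ x ∈ fill (Prod.fst '' σ),
        x ∈ fill (Prod.fst '' τ) → ∃ y, (x, y) ∈ σ ∩ τ := fun σ hσ τ hτ x hx hx' => by
      obtain ⟨y, hy⟩ := h.theta.2.1 x ⟨h₁.fill_fst_subset σ hσ hx, h₂.fill_fst_subset τ hτ hx'⟩
      exact ⟨y, h₁.mem_of_mem_fill_fst _ hy.1 σ hσ hx, h₂.mem_of_mem_fill_fst _ hy.2 τ hτ hx'⟩
    rintro σ (hσ | hσ) τ (hτ | hτ) hne x hx hx'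
    · exact ih₁ σ hσ τ hτ hne x hx hx'
    · exact key σ hσ τ hτ x hx hx'
    · obtain ⟨y, hy⟩ := key τ hτ σ hσ x hx' hx
      exact ⟨y, hy.2, hy.1⟩
    · exact ih₂ σ hσ τ hτ hne x hx hx'

lemma fill_snd_subset (h : IsSubdivision ρ S) :
    ∀ σ ∈ S, fill (Prod.snd '' σ) ⊆ fill (Prod.snd '' ρ) := fun σ hσ => by
  simpa [image_image] using h.swap.fill_fst_subset _ ⟨σ, hσ, rfl⟩

/-- Subdivide every cell of a subdivision. -/
lemma bind (h : IsSubdivision ρ S) {Q : Set (ℂ × ℂ) → Prop}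
    (hQ : ∀ σ ∈ S, IsCell σ → ∃ T, IsSubdivision σ T ∧ ∀ τ ∈ T, Q τ) :
    ∃ T, IsSubdivision ρ T ∧ (∀ τ ∈ T, Q τ) ∧ (∀ σ ∈ S, ∀ z ∈ σ, ∃ τ ∈ T, z ∈ τ) ∧
      ∀ τ ∈ T, ∃ σ ∈ S, fill (Prod.fst '' τ) ⊆ fill (Prod.fst '' σ) ∧
        fill (Prod.snd '' τ) ⊆ fill (Prod.snd '' σ) := by
  induction h with
  | refl h =>
    obtain ⟨T, hT, hTQ⟩ := hQ _ rfl h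
    refine ⟨T, hT, hTQ, ?_, fun τ hτ => ⟨_, rfl, hT.fill_fst_subset τ hτ, hT.fill_snd_subset τ hτ⟩⟩
    rintro _ rfl
    exact hT.exists_mem
  | split h h₁ h₂ ih₁ ih₂ =>
    obtain ⟨T₁, a₁, b₁, c₁, d₁⟩ := ih₁ fun σ hσ => hQ σ (Or.inl hσ)
    obtain ⟨T₂, a₂, b₂, c₂, d₂⟩ := ih₂ fun σ hσ => hQ σ (Or.inr hσ)
    refine ⟨T₁ ∪ T₂, .split h a₁ a₂, ?_, ?_, ?_⟩
    · rintro τ (hτ | hτ); exacts [b₁ τ hτ, b₂ τ hτ]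
    · rintro σ (hσ | hσ) z hz
      · obtain ⟨τ, hτ, h⟩ := c₁ σ hσ z hz; exact ⟨τ, Or.inl hτ, h⟩
      · obtain ⟨τ, hτ, h⟩ := c₂ σ hσ z hz; exact ⟨τ, Or.inr hτ, h⟩
    · rintro τ (hτ | hτ)
      · obtain ⟨σ, hσ, h⟩ := d₁ τ hτ; exact ⟨σ, Or.inl hσ, h⟩
      · obtain ⟨σ, hσ, h⟩ := d₂ τ hτ; exact ⟨σ, Or.inr hσ, h⟩

end IsSubdivision

lemma IsArc.exists_pairing {X Y : Type*} [TopologicalSpace X] [TopologicalSpace Y] {A : Set X}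
    {B : Set Y} {a b : X} {c d : Y} (hA : IsArc A a b) (hB : IsArc B c d) :
    ∃ σ : Set (X × Y), IsArc σ (a, c) (b, d) ∧ Prod.fst '' σ = A ∧ Prod.snd '' σ = B ∧
      InjOn Prod.fst σ ∧ InjOn Prod.snd σ := by
  obtain ⟨φ, hφ, hφi, rfl, rfl, rfl⟩ := hA
  obtain ⟨χ, hχ, hχi, rfl, rfl, rfl⟩ := hB
  refine ⟨(fun t => (φ t, χ t)) '' Icc 0 1, ⟨_, hφ.prodMk hχ, ?_, rfl, rfl, rfl⟩, ?_, ?_, ?_, ?_⟩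
  · intro s hs t ht e; exact hφi hs ht (congrArg Prod.fst e)
  · rw [image_image]
  · rw [image_image]
  · rintro _ ⟨s, hs, rfl⟩ _ ⟨t, ht, rfl⟩ e; rw [hφi hs ht e]
  · rintro _ ⟨s, hs, rfl⟩ _ ⟨t, ht, rfl⟩ e; rw [hχi hs ht e]

lemma Divisible.exists_isSubdivision {Q : Set ℂ → Prop} {J : Set ℂ} (h : Divisible Q J) :
    ∀ ρ, IsCell ρ → Prod.fst '' ρ = J → ∃ S, IsSubdivision ρ S ∧ ∀ σ ∈ S, Q (Prod.fst '' σ) := by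
  induction h with
  | leaf hJ hQ =>
    rintro ρ hρ rfl
    exact ⟨{ρ}, .refl hρ, by rintro σ rfl; exact hQ⟩
  | @cut J A B γ p q e hA hB hAB hγ _ _ ih₁ ih₂ =>
    intro ρ hρ hρJ
    set ψ := Function.invFunOn Prod.fst ρ with hψ
    have hψc : ContinuousOn ψ J := hρJ ▸
      continuousOn_invFunOn_image hρ.loop.isCompact continuous_fst.continuousOn hρ.inj_fst
    have hr : ∀ x ∈ J, ψ x ∈ ρ ∧ (ψ x).1 = x := fun x hx => by
      rw [← hρJ] at hx; exact ⟨Function.invFunOn_mem hx, Function.invFunOn_eq hx⟩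
    have hψi : InjOn ψ J := fun x hx y hy e => by
      rw [← (hr x hx).2, ← (hr y hy).2, e]
    have hl : ∀ z ∈ ρ, ψ z.1 = z := fun z hz => hρ.inj_fst (hr z.1 (hρJ ▸ ⟨z, hz, rfl⟩)).1 hz
      (hr z.1 (hρJ ▸ ⟨z, hz, rfl⟩)).2
    have hAJ : A ⊆ J := e ▸ subset_union_left
    have hBJ : B ⊆ J := e ▸ subset_union_right
    have hfst : ∀ T ⊆ J, Prod.fst '' (ψ '' T) = T := fun T hT => by
      rw [image_image]
      exact (image_congr fun x hx => (hr x (hT hx)).2).trans (image_id' T)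
    have hp := hr p (hAJ hA.left_mem)
    have hq := hr q (hAJ hA.right_mem)
    have hne : (ψ p).2 ≠ (ψ q).2 := fun e =>
      hA.ne (hψi (hAJ hA.left_mem) (hAJ hA.right_mem) (hρ.inj_snd hp.1 hq.1 e))
    obtain ⟨γ₂, hγ₂⟩ := hρ.loop_snd.exists_crosscut ⟨_, hp.1, rfl⟩ ⟨_, hq.1, rfl⟩ hne
    obtain ⟨σ, hσ, hσ1, hσ2, hi1, hi2⟩ := hγ.1.exists_pairing hγ₂.1
    have ep : (p, (ψ p).2) = ψ p := Prod.ext hp.2.symm rfl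
    have eq : (q, (ψ q).2) = ψ q := Prod.ext hq.2.symm rfl
    rw [ep, eq] at hσ
    have hs : IsSplit ρ (ψ '' A ∪ σ) (ψ '' B ∪ σ) := by
      refine ⟨hρ, ψ '' A, ψ '' B, σ, ψ p, ψ q, hA.image (hψc.mono hAJ) (hψi.mono hAJ),
        hB.image (hψc.mono hBJ) (hψi.mono hBJ), ?_, ?_, hσ, hi1, hi2, ?_, ?_, rfl, rfl⟩
      · rw [← hψi.image_inter hAJ hBJ, ← image_pair]; exact image_mono hAB
      · rw [← image_union, e, ← hρJ, image_image]
        exact (image_congr hl).trans (image_id' ρ)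
      · rw [hp.2, hq.2, hσ1, hρJ, ← e]; exact hγ
      · rw [hσ2]; exact hγ₂
    obtain ⟨S₁, hS₁, hQ₁⟩ := ih₁ _ hs.isCell_left (by rw [image_union, hfst A hAJ, hσ1])
    obtain ⟨S₂, hS₂, hQ₂⟩ := ih₂ _ hs.isCell_right (by rw [image_union, hfst B hBJ, hσ1])
    exact ⟨S₁ ∪ S₂, .split hs hS₁ hS₂, fun σ hσ => hσ.elim (hQ₁ σ) (hQ₂ σ)⟩

lemma fill_subset_of_convex {J C : Set ℂ} (hC : Convex ℝ C) (h : J ⊆ C) : fill J ⊆ C :=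
  union_subset (inside_subset_of_convex hC h) h

lemma IsCell.isCompact_fill_fst {ρ : Set (ℂ × ℂ)} (h : IsCell ρ) :
    IsCompact (fill (Prod.fst '' ρ)) := h.loop_fst.isCompact_closedInside

lemma IsCell.isCompact_fill_snd {ρ : Set (ℂ × ℂ)} (h : IsCell ρ) :
    IsCompact (fill (Prod.snd '' ρ)) := h.loop_snd.isCompact_closedInside

/-- All points of the set `s` are at mutual distance at most `e`. -/
def IsSmall (e : ℝ) (s : Set ℂ) : Prop := ∀ x ∈ s, ∀ y ∈ s, dist x y ≤ e

lemma IsCell.exists_small_fst {ρ : Set (ℂ × ℂ)} (h : IsCell ρ) {e : ℝ} (he : 0 < e) :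
    ∃ S, IsSubdivision ρ S ∧ ∀ σ ∈ S, IsSmall e (fill (Prod.fst '' σ)) := by
  obtain ⟨S, hS, hQ⟩ := (h.loop_fst.divisible_small he).exists_isSubdivision ρ h rfl
  refine ⟨S, hS, fun σ hσ x hx y hy => ?_⟩
  obtain ⟨C, hC, hsub, hd⟩ := hQ σ hσ
  exact hd x (fill_subset_of_convex hC hsub hx) y (fill_subset_of_convex hC hsub hy)

lemma IsCell.exists_small_snd {ρ : Set (ℂ × ℂ)} (h : IsCell ρ) {e : ℝ} (he : 0 < e) :
    ∃ S, IsSubdivision ρ S ∧ ∀ σ ∈ S, IsSmall e (fill (Prod.snd '' σ)) := by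
  obtain ⟨S, hS, hQ⟩ := h.swap.exists_small_fst he
  refine ⟨_, by simpa [image_image] using hS.swap, ?_⟩
  rintro _ ⟨σ, hσ, rfl⟩
  simpa [image_image] using hQ σ hσ

lemma IsSubdivision.exists_refinement {ρ : Set (ℂ × ℂ)} {S : Set (Set (ℂ × ℂ))}
    (h : IsSubdivision ρ S) {e : ℝ} (he : 0 < e) : ∃ T, IsSubdivision ρ T ∧
      (∀ τ ∈ T, IsSmall e (fill (Prod.fst '' τ)) ∧ IsSmall e (fill (Prod.snd '' τ))) ∧
      (∀ σ ∈ S, ∀ z ∈ σ, ∃ τ ∈ T, z ∈ τ) ∧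
      ∀ τ ∈ T, ∃ σ ∈ S, fill (Prod.fst '' τ) ⊆ fill (Prod.fst '' σ) ∧
        fill (Prod.snd '' τ) ⊆ fill (Prod.snd '' σ) := by
  obtain ⟨T, hT, hs, hm, hr⟩ := h.bind fun σ _ hσ => hσ.exists_small_fst he
  obtain ⟨T', hT', hs', hm', hr'⟩ := hT.bind fun σ _ hσ => hσ.exists_small_snd he
  refine ⟨T', hT', fun τ hτ => ⟨?_, hs' τ hτ⟩, fun σ hσ z hz => ?_, fun τ hτ => ?_⟩
  · obtain ⟨σ, hσ, h1, -⟩ := hr' τ hτ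
    exact fun x hx y hy => hs σ hσ x (h1 hx) y (h1 hy)
  · obtain ⟨τ, hτ, hzτ⟩ := hm σ hσ z hz
    exact hm' τ hτ z hzτ
  · obtain ⟨σ, hσ, h1, h2⟩ := hr' τ hτ
    obtain ⟨σ', hσ', h1', h2'⟩ := hr σ hσ
    exact ⟨σ', hσ', h1.trans h1', h2.trans h2'⟩

/-- The union of the product boxes over the cells of a subdivision. -/
def boxUnion (S : Set (Set (ℂ × ℂ))) : Set (ℂ × ℂ) :=
  ⋃ σ ∈ S, fill (Prod.fst '' σ) ×ˢ fill (Prod.snd '' σ)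

lemma mem_boxUnion {S : Set (Set (ℂ × ℂ))} {z : ℂ × ℂ} : z ∈ boxUnion S ↔
    ∃ σ ∈ S, z.1 ∈ fill (Prod.fst '' σ) ∧ z.2 ∈ fill (Prod.snd '' σ) := by
  simp only [boxUnion, mem_iUnion, mem_prod, exists_prop]

/-- A matched subdivision of two Jordan domains is realized by a homeomorphism. -/
theorem schoenflies {ρ : Set (ℂ × ℂ)} {S : Set (Set (ℂ × ℂ))} (h : IsSubdivision ρ S) :
    ∃ F : ℂ → ℂ, ContinuousOn F (fill (Prod.fst '' ρ)) ∧
      BijOn F (fill (Prod.fst '' ρ)) (fill (Prod.snd '' ρ)) ∧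
      (∀ x ∈ fill (Prod.fst '' ρ), ∃ σ ∈ S, x ∈ fill (Prod.fst '' σ) ∧
        F x ∈ fill (Prod.snd '' σ)) ∧ ∀ σ ∈ S, ∀ z ∈ σ, F z.1 = z.2 := by
  choose! next hn using fun (T : Set (Set (ℂ × ℂ))) (hT : IsSubdivision ρ T) (k : ℕ) =>
    hT.exists_refinement (e := 1 / ((k : ℝ) + 1)) (by positivity)
  let U : ℕ → Set (Set (ℂ × ℂ)) := fun n => Nat.rec S (fun k T => next T k) n
  have hU : ∀ n, IsSubdivision ρ (U n) := fun n => by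
    induction n with
    | zero => exact h
    | succ k ih => exact (hn _ ih k).1
  have hsm : ∀ k, ∀ τ ∈ U (k + 1), IsSmall (1 / ((k : ℝ) + 1)) (fill (Prod.fst '' τ)) ∧
      IsSmall (1 / ((k : ℝ) + 1)) (fill (Prod.snd '' τ)) := fun k => (hn _ (hU k) k).2.1
  have hmem : ∀ σ ∈ S, ∀ z ∈ σ, ∀ n, ∃ τ ∈ U n, z ∈ τ := by
    intro σ hσ z hz n
    induction n with
    | zero => exact ⟨σ, hσ, hz⟩
    | succ k ih => obtain ⟨τ, hτ, hz'⟩ := ih; exact (hn _ (hU k) k).2.2.1 τ hτ z hz'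
  have hdec : ∀ n, boxUnion (U (n + 1)) ⊆ boxUnion (U n) := by
    intro n z hz
    obtain ⟨τ, hτ, h1, h2⟩ := mem_boxUnion.1 hz
    obtain ⟨σ, hσ, h3, h4⟩ := (hn _ (hU n) n).2.2.2 τ hτ
    exact mem_boxUnion.2 ⟨σ, hσ, h3 h1, h4 h2⟩
  have hcpt : ∀ n, IsCompact (boxUnion (U n)) := fun n =>
    (hU n).finite.isCompact_biUnion fun σ hσ =>
      ((hU n).isCell_of_mem σ hσ).isCompact_fill_fst.prod
        ((hU n).isCell_of_mem σ hσ).isCompact_fill_snd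
  have hlim : ∀ a b : ℂ, (∀ n : ℕ, dist a b ≤ 1 / ((n : ℝ) + 1) + 1 / ((n : ℝ) + 1)) → a = b := by
    intro a b hab
    have := ge_of_tendsto' (tendsto_one_div_add_atTop_nhds_zero_nat.add
      tendsto_one_div_add_atTop_nhds_zero_nat) hab
    exact dist_le_zero.1 (by simpa using this)
  set R := ⋂ n, boxUnion (U n) with hR
  have hRc : IsCompact R := (hcpt 0).of_isClosed_subset
    (isClosed_iInter fun n => (hcpt n).isClosed) (iInter_subset _ 0)
  have hi1 : InjOn Prod.fst R := by
    rintro ⟨x, y⟩ hz ⟨x', y'⟩ hz' (rfl : x = x')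
    refine Prod.ext rfl (hlim _ _ fun n => ?_)
    have hpos : (0 : ℝ) ≤ 1 / ((n : ℝ) + 1) := by positivity
    obtain ⟨σ, hσ, h1, h2⟩ := mem_boxUnion.1 (mem_iInter.1 hz (n + 1))
    obtain ⟨τ, hτ, h3, h4⟩ := mem_boxUnion.1 (mem_iInter.1 hz' (n + 1))
    by_cases hst : σ = τ
    · subst hst
      have := (hsm n σ hσ).2 _ h2 _ h4
      simp only at this ⊢
      linarith
    · obtain ⟨w, hw1, hw2⟩ := (hU (n + 1)).exists_common σ hσ τ hτ hst x h1 h3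
      have a1 := (hsm n σ hσ).2 _ h2 w (subset_fill ⟨_, hw1, rfl⟩)
      have a2 := (hsm n τ hτ).2 w (subset_fill ⟨_, hw2, rfl⟩) _ h4
      exact (dist_triangle _ w _).trans (add_le_add a1 a2)
  have hi2 : InjOn Prod.snd R := by
    rintro ⟨x, y⟩ hz ⟨x', y'⟩ hz' (rfl : y = y')
    refine Prod.ext (hlim _ _ fun n => ?_) rfl
    have hpos : (0 : ℝ) ≤ 1 / ((n : ℝ) + 1) := by positivity
    obtain ⟨σ, hσ, h1, h2⟩ := mem_boxUnion.1 (mem_iInter.1 hz (n + 1))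
    obtain ⟨τ, hτ, h3, h4⟩ := mem_boxUnion.1 (mem_iInter.1 hz' (n + 1))
    by_cases hst : σ = τ
    · subst hst
      have := (hsm n σ hσ).1 _ h1 _ h3
      simp only at this ⊢
      linarith
    · obtain ⟨w, ⟨u, hu, hu'⟩, ⟨v, hv, hv'⟩⟩ := (hU (n + 1)).swap.exists_common _ ⟨σ, hσ, rfl⟩ _
        ⟨τ, hτ, rfl⟩ (fun e => hst (Prod.swap_injective.image_injective e)) y
        (by simpa [image_image] using h2) (by simpa [image_image] using h4)
      have e1 : u.1 = w := congrArg Prod.snd hu'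
      have e2 : v.1 = w := congrArg Prod.snd hv'
      have a1 := (hsm n σ hσ).1 _ h1 w (subset_fill ⟨_, hu, e1⟩)
      have a2 := (hsm n τ hτ).1 w (subset_fill ⟨_, hv, e2⟩) _ h3
      exact (dist_triangle _ w _).trans (add_le_add a1 a2)
  have hne : ∀ Z : Set (ℂ × ℂ), IsClosed Z → (∀ n, (boxUnion (U n) ∩ Z).Nonempty) →
      (R ∩ Z).Nonempty := by
    intro Z hZ hZn
    rw [hR, iInter_inter]
    exact IsCompact.nonempty_iInter_of_sequence_nonempty_isCompact_isClosed _
      (fun n => inter_subset_inter_left _ (hdec n)) hZn ((hcpt 0).inter_right hZ)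
      fun n => (hcpt n).isClosed.inter hZ
  have hs1 : Prod.fst '' R = fill (Prod.fst '' ρ) := by
    apply Subset.antisymm
    · rintro _ ⟨z, hz, rfl⟩
      obtain ⟨σ, hσ, h1, -⟩ := mem_boxUnion.1 (mem_iInter.1 hz 0)
      exact h.fill_fst_subset σ hσ h1
    · intro x hx
      obtain ⟨z, hz, hz'⟩ := hne (Prod.fst ⁻¹' {x}) (isClosed_singleton.preimage continuous_fst)
        fun n => by
          obtain ⟨σ, hσ, hxσ⟩ := (hU n).exists_mem_fill_fst x hx
          obtain ⟨w, hw⟩ := ((hU n).isCell_of_mem σ hσ).loop.nonempty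
          exact ⟨(x, w.2), mem_boxUnion.2 ⟨σ, hσ, hxσ, subset_fill ⟨w, hw, rfl⟩⟩, rfl⟩
      exact ⟨z, hz, hz'⟩
  have hs2 : Prod.snd '' R = fill (Prod.snd '' ρ) := by
    apply Subset.antisymm
    · rintro _ ⟨z, hz, rfl⟩
      obtain ⟨σ, hσ, -, h1⟩ := mem_boxUnion.1 (mem_iInter.1 hz 0)
      exact h.fill_snd_subset σ hσ h1
    · intro y hy
      obtain ⟨z, hz, hz'⟩ := hne (Prod.snd ⁻¹' {y}) (isClosed_singleton.preimage continuous_snd)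
        fun n => by
          obtain ⟨_, ⟨σ, hσ, rfl⟩, hyσ⟩ := (hU n).swap.exists_mem_fill_fst y
            (by simpa [image_image] using hy)
          obtain ⟨w, hw⟩ := ((hU n).isCell_of_mem σ hσ).loop.nonempty
          exact ⟨(w.1, y), mem_boxUnion.2 ⟨σ, hσ, subset_fill ⟨w, hw, rfl⟩,
            by simpa [image_image] using hyσ⟩, rfl⟩
      exact ⟨z, hz, hz'⟩
  set ψ := Function.invFunOn Prod.fst R with hψ
  have hψm : ∀ x ∈ fill (Prod.fst '' ρ), ψ x ∈ R ∧ (ψ x).1 = x := fun x hx => by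
    rw [← hs1] at hx; exact ⟨Function.invFunOn_mem hx, Function.invFunOn_eq hx⟩
  have hψl : ∀ z ∈ R, ψ z.1 = z := fun z hz => by
    have := hψm z.1 (hs1 ▸ ⟨z, hz, rfl⟩)
    exact hi1 this.1 hz this.2
  refine ⟨fun x => (ψ x).2, ?_, ⟨?_, ?_, ?_⟩, ?_, ?_⟩
  · exact continuous_snd.comp_continuousOn
      (hs1 ▸ continuousOn_invFunOn_image hRc continuous_fst.continuousOn hi1)
  · exact fun x hx => hs2 ▸ ⟨_, (hψm x hx).1, rfl⟩
  · intro x hx y hy e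
    rw [← (hψm x hx).2, ← (hψm y hy).2, hi2 (hψm x hx).1 (hψm y hy).1 e]
  · rw [← hs2, ← hs1]
    rintro _ ⟨z, hz, rfl⟩
    exact ⟨z.1, ⟨z, hz, rfl⟩, by simp only [hψl z hz]⟩
  · intro x hx
    obtain ⟨σ, hσ, h1, h2⟩ := mem_boxUnion.1 (mem_iInter.1 (hψm x hx).1 0)
    exact ⟨σ, hσ, (hψm x hx).2 ▸ h1, h2⟩
  · intro σ hσ z hz
    have : z ∈ R := mem_iInter.2 fun n => by
      obtain ⟨τ, hτ, hzτ⟩ := hmem σ hσ z hz n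
      exact mem_boxUnion.2 ⟨τ, hτ, subset_fill ⟨z, hzτ, rfl⟩, subset_fill ⟨z, hzτ, rfl⟩⟩
    simp only [hψl z this]

/-! ### Ladders: controlled straightening of a thin arc -/

lemma convex_im_mul_lt (η c : ℝ) : Convex ℝ {z : ℂ | z.im * η < c} := by
  intro z hz w hw a b ha hb hab
  simp only [mem_ofPred_eq, Complex.add_im, Complex.smul_im, smul_eq_mul] at *
  have := convex_Iio (𝕜 := ℝ) c (mem_Iio.2 hz) (mem_Iio.2 hw) ha hb hab
  simp only [smul_eq_mul, mem_Iio] at this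
  linarith

lemma convex_im_mul_le (η c : ℝ) : Convex ℝ {z : ℂ | z.im * η ≤ c} := by
  intro z hz w hw a b ha hb hab
  simp only [mem_ofPred_eq, Complex.add_im, Complex.smul_im, smul_eq_mul] at *
  have := convex_Iic (𝕜 := ℝ) c (mem_Iic.2 hz) (mem_Iic.2 hw) ha hb hab
  simp only [smul_eq_mul, mem_Iic] at this
  linarith

/-- A connected set reaching the top edge of a Jordan loop from below lies inside the loop. -/
lemma IsJordanLoop.subset_inside_of_top {J K S : Set ℂ} {η : ℝ} {a : ℂ} (hη : η ≠ 0)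
    (hJ : IsJordanLoop J) (htop : ∀ z ∈ J, z.im * η ≤ η * η) (ha : a ∈ J) (hK : IsClosed K)
    (haK : a ∉ K) (hJK : ∀ z ∈ J, z ∈ K ∨ z.im = η) (hS : IsPreconnected S)
    (hSJ : Disjoint S J) (hSlt : ∀ z ∈ S, z.im * η < η * η) (haS : a ∈ closure S) :
    S ⊆ inside J := by
  obtain ⟨r, hr, hrK⟩ := Metric.isOpen_iff.1 hK.isOpen_compl a haK
  set B := ball a r ∩ {z : ℂ | z.im * η < η * η} with hB
  have hBc : IsPreconnected B := ((convex_ball a r).inter (convex_im_mul_lt _ _)).isPreconnected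
  have hBJ : Disjoint B J := by
    rw [disjoint_left]
    rintro z ⟨hz, hz'⟩ hzJ
    rcases hJK z hzJ with h | h
    · exact hrK hz h
    · simp only [mem_ofPred_eq, h, lt_irrefl] at hz'
  have hins : inside J ⊆ {z : ℂ | z.im * η ≤ η * η} :=
    inside_subset_of_convex (convex_im_mul_le _ _) htop
  obtain ⟨w, hw, hwB⟩ : (inside J ∩ B).Nonempty := by
    obtain ⟨w, hwa, hw⟩ := mem_closure_iff.1 (hJ.subset_closure_inside ha) _ isOpen_ball
      (mem_ball_self hr)
    have hO : IsOpen (inside J ∩ ball a r) := (isOpen_inside hJ.isClosed).inter isOpen_ball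
    have hc : Tendsto (fun s : ℝ => w - (s * η : ℝ) * Complex.I) (𝓝[>] 0) (𝓝 w) := by
      have : Continuous fun s : ℝ => w - (s * η : ℝ) * Complex.I := by fun_prop
      simpa using (this.tendsto 0).mono_left nhdsWithin_le_nhds
    obtain ⟨s, hs, hs0⟩ := ((hc.eventually (hO.mem_nhds ⟨hw, hwa⟩)).and
      self_mem_nhdsWithin).exists
    refine ⟨_, hs.1, hs.2, ?_⟩
    have h1 : w.im * η ≤ η * η := hins hw
    have h2 : 0 < s * (η * η) := mul_pos hs0 (mul_self_pos.2 hη)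
    have h3 : (w - (s * η : ℝ) * Complex.I).im = w.im - s * η := by simp
    change (w - (s * η : ℝ) * Complex.I).im * η < η * η
    rw [h3]; nlinarith
  have hBi : B ⊆ inside J := subset_inside_of_preconnected hJ.isClosed hBc hBJ hwB hw
  obtain ⟨z, hza, hzS⟩ := mem_closure_iff.1 haS _ isOpen_ball (mem_ball_self hr)
  exact subset_inside_of_preconnected hJ.isClosed hS hSJ hzS (hBi ⟨hza, hSlt z hzS⟩)

/-- A matched pair of rungs of a ladder of height `η`: a slanted segment from `x + iη` to `t`, and
a vertical segment from `x + iη` to `x + iy`. -/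
def rung (η x t y : ℝ) : Set (ℂ × ℂ) :=
  (fun s : ℝ => ((⟨(1 - s) * x + s * t, (1 - s) * η⟩ : ℂ), (⟨x, (1 - s) * η + s * y⟩ : ℂ))) ''
    Icc 0 1

/-- The diagonal copy of a horizontal segment at height `η`. -/
def topEdge (η a b : ℝ) : Set (ℂ × ℂ) := (fun u : ℝ => ((⟨u, η⟩ : ℂ), (⟨u, η⟩ : ℂ))) '' Icc a b

/-- The matched pair of a real interval and its image. -/
def baseEdge (k : ℝ → ℂ) (a b : ℝ) : Set (ℂ × ℂ) := (fun u : ℝ => ((u : ℂ), k u)) '' Icc a b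

/-- `k` is an embedding of `[p, q]` at height less than `|η|`. -/
structure IsThinArc (k : ℝ → ℂ) (p q η : ℝ) : Prop where
  ne_zero : η ≠ 0
  cont : ContinuousOn k (Icc p q)
  inj : InjOn k (Icc p q)
  thin : ∀ u ∈ Icc p q, |(k u).im| < |η|

/-- The vertical segment above `k t` from height `η` meets the arc `k` only in `k t`. -/
structure IsPost (k : ℝ → ℂ) (p q η x t : ℝ) : Prop where
  mem : t ∈ Icc p q
  re_eq : (k t).re = x
  unique : ∀ u ∈ Icc p q, ∀ s ∈ Icc (0 : ℝ) 1, k u = ⟨x, (1 - s) * η + s * (k t).im⟩ → u = t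

lemma IsThinArc.lt {k : ℝ → ℂ} {p q η : ℝ} (h : IsThinArc k p q η) {u : ℝ} (hu : u ∈ Icc p q) :
    (k u).im * η < η * η := by
  have h1 := h.thin u hu
  calc (k u).im * η ≤ |(k u).im| * |η| := by rw [← abs_mul]; exact le_abs_self _
    _ < |η| * |η| := mul_lt_mul_of_pos_right h1 (abs_pos.2 h.ne_zero)
    _ = η * η := abs_mul_abs_self η

section Ladder

variable {k : ℝ → ℂ} {p q η x t x' t' x'' t'' a b : ℝ} {z w : ℂ × ℂ}

lemma isArc_baseEdge (hk : IsThinArc k p q η) (ha : p ≤ a) (hb : b ≤ q) (hab : a < b) :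
    IsArc (baseEdge k a b) ((a : ℂ), k a) ((b : ℂ), k b) := by
  refine isArc_image_Icc (φ := fun u : ℝ => ((u : ℂ), k u)) hab ?_ ?_
  · exact Complex.continuous_ofReal.continuousOn.prodMk (hk.cont.mono (Icc_subset_Icc ha hb))
  · intro u _ v _ e
    exact Complex.ofReal_injective (congrArg Prod.fst e)

lemma isArc_topEdge (hab : a < b) :
    IsArc (topEdge η a b) ((⟨a, η⟩ : ℂ), (⟨a, η⟩ : ℂ)) ((⟨b, η⟩ : ℂ), (⟨b, η⟩ : ℂ)) := by
  have hc : Continuous fun u : ℝ => (⟨u, η⟩ : ℂ) :=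
    Complex.equivRealProdCLM.symm.continuous.comp (by fun_prop : Continuous fun u : ℝ => (u, η))
  refine isArc_image_Icc (φ := fun u : ℝ => ((⟨u, η⟩ : ℂ), (⟨u, η⟩ : ℂ))) hab
    (hc.prodMk hc).continuousOn ?_
  intro u _ v _ e
  exact congrArg Complex.re (congrArg Prod.fst e)

lemma injOn_fst_rung {y : ℝ} (hη : η ≠ 0) : InjOn Prod.fst (rung η x t y) := by
  rintro _ ⟨s, hs, rfl⟩ _ ⟨s', hs', rfl⟩ e
  have := congrArg Complex.im e
  simp only [mul_eq_mul_right_iff, hη, or_false] at this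
  rw [show s = s' by linarith]

lemma injOn_snd_rung {y : ℝ} (hη : y * η < η * η) : InjOn Prod.snd (rung η x t y) := by
  rintro _ ⟨s, hs, rfl⟩ _ ⟨s', hs', rfl⟩ e
  have := congrArg Complex.im e
  simp only at this
  have hne : y - η ≠ 0 := fun h => by rw [sub_eq_zero.1 h] at hη; exact lt_irrefl _ hη
  have h2 : (s - s') * (y - η) = 0 := by linarith
  rcases mul_eq_zero.1 h2 with h | h
  · rw [sub_eq_zero.1 h]
  · exact absurd h hne

lemma isArc_rung {y : ℝ} (hη : η ≠ 0) :
    IsArc (rung η x t y) ((⟨x, η⟩ : ℂ), (⟨x, η⟩ : ℂ)) ((t : ℂ), (⟨x, y⟩ : ℂ)) := by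
  have hc : ∀ f g : ℝ → ℝ, Continuous f → Continuous g →
      Continuous fun s : ℝ => (⟨f s, g s⟩ : ℂ) := fun f g hf hg =>
    Complex.equivRealProdCLM.symm.continuous.comp (hf.prodMk hg)
  have h := isArc_image_Icc (X := ℂ × ℂ) (φ := fun s : ℝ =>
    ((⟨(1 - s) * x + s * t, (1 - s) * η⟩ : ℂ), (⟨x, (1 - s) * η + s * y⟩ : ℂ))) one_pos
    ((hc _ _ (by fun_prop) (by fun_prop)).prodMk
      (hc _ _ (by fun_prop) (by fun_prop))).continuousOn ?_
  · have e : (⟨t, 0⟩ : ℂ) = t := rfl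
    simpa [rung, e] using h
  · intro s _ s' _ e
    have := congrArg Complex.im (congrArg Prod.fst e)
    simp only [mul_eq_mul_right_iff, hη, or_false] at this
    linarith

lemma rung_ne_rung_fst {y y' : ℝ} (hη : η ≠ 0) (hx : x < x') (ht : t < t') (hz : z ∈ rung η x t y)
    (hw : w ∈ rung η x' t' y') : z.1 ≠ w.1 := by
  obtain ⟨s, hs, rfl⟩ := hz
  obtain ⟨s', hs', rfl⟩ := hw
  intro e
  have h1 := congrArg Complex.im e
  have h2 := congrArg Complex.re e
  simp only [mul_eq_mul_right_iff, hη, or_false] at h1 h2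
  obtain rfl : s = s' := by linarith
  have hs1 := hs.1
  have hs2 := hs.2
  rcases eq_or_lt_of_le hs1 with h | h
  · subst h; linarith
  · nlinarith [mul_lt_mul_of_pos_left ht h, mul_le_mul_of_nonneg_left hx.le (sub_nonneg.2 hs2)]

lemma rung_ne_rung_snd {y y' : ℝ} (hx : x ≠ x') (hz : z ∈ rung η x t y)
    (hw : w ∈ rung η x' t' y') : z.2 ≠ w.2 := by
  obtain ⟨s, hs, rfl⟩ := hz
  obtain ⟨s', hs', rfl⟩ := hw
  exact fun e => hx (congrArg Complex.re e)

lemma rung_topEdge_fst {y : ℝ} (hη : η ≠ 0) (hz : z ∈ rung η x t y) (hw : w ∈ topEdge η a b)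
    (e : z.1 = w.1) : z = (⟨x, η⟩, ⟨x, η⟩) ∧ w = (⟨x, η⟩, ⟨x, η⟩) := by
  obtain ⟨s, hs, rfl⟩ := hz
  obtain ⟨u, hu, rfl⟩ := hw
  have h1 := congrArg Complex.im e
  have h2 := congrArg Complex.re e
  simp only at h1 h2
  have : s = 0 := by
    have : s * η = 0 := by linarith
    exact (mul_eq_zero.1 this).resolve_right hη
  subst this
  obtain rfl : x = u := by linarith
  simp

lemma rung_topEdge_snd {y : ℝ} (hy : y * η < η * η) (hz : z ∈ rung η x t y)
    (hw : w ∈ topEdge η a b) (e : z.2 = w.2) :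
    z = (⟨x, η⟩, ⟨x, η⟩) ∧ w = (⟨x, η⟩, ⟨x, η⟩) := by
  obtain ⟨s, hs, rfl⟩ := hz
  obtain ⟨u, hu, rfl⟩ := hw
  have h1 := congrArg Complex.im e
  have h2 := congrArg Complex.re e
  simp only at h1 h2
  have hne : y - η ≠ 0 := fun h => by rw [sub_eq_zero.1 h] at hy; exact lt_irrefl _ hy
  have : s = 0 := by
    have : s * (y - η) = 0 := by linarith
    exact (mul_eq_zero.1 this).resolve_right hne
  subst this h2
  simp

lemma IsPost.eq_mk (hp : IsPost k p q η x t) : (⟨x, (k t).im⟩ : ℂ) = k t :=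
  Complex.ext hp.re_eq.symm rfl

lemma rung_baseEdge_fst (hη : η ≠ 0) (hp : IsPost k p q η x t)
    (hz : z ∈ rung η x t (k t).im) (hw : w ∈ baseEdge k a b)
    (e : z.1 = w.1) : z = ((t : ℂ), k t) ∧ w = ((t : ℂ), k t) := by
  obtain ⟨s, hs, rfl⟩ := hz
  obtain ⟨u, hu, rfl⟩ := hw
  have h1 := congrArg Complex.im e
  have h2 := congrArg Complex.re e
  simp only [Complex.ofReal_im, mul_eq_zero, hη, or_false, Complex.ofReal_re] at h1 h2
  obtain rfl : s = 1 := by linarith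
  obtain rfl : t = u := by linarith
  refine ⟨Prod.ext ?_ ?_, rfl⟩
  · exact Complex.ext (by simp) (by simp)
  · simp [hp.eq_mk]

lemma rung_baseEdge_snd (hk : IsThinArc k p q η) (hp : IsPost k p q η x t) (ha : p ≤ a)
    (hb : b ≤ q) (hz : z ∈ rung η x t (k t).im) (hw : w ∈ baseEdge k a b)
    (e : z.2 = w.2) : z = ((t : ℂ), k t) ∧ w = ((t : ℂ), k t) := by
  obtain ⟨s, hs, rfl⟩ := hz
  obtain ⟨u, hu, rfl⟩ := hw
  obtain rfl := hp.unique u (Icc_subset_Icc ha hb hu) s hs e.symm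
  have harc := isArc_rung (x := x) (t := u) (y := (k u).im) hk.ne_zero
  refine ⟨injOn_snd_rung (hk.lt hp.mem) ⟨s, hs, rfl⟩ ?_ e, rfl⟩
  have := harc.right_mem
  rwa [hp.eq_mk] at this

lemma topEdge_ne_baseEdge_fst {c d : ℝ} (hη : η ≠ 0) (hz : z ∈ topEdge η a b)
    (hw : w ∈ baseEdge k c d) : z.1 ≠ w.1 := by
  obtain ⟨s, hs, rfl⟩ := hz
  obtain ⟨u, hu, rfl⟩ := hw
  intro e
  exact hη (by simpa using congrArg Complex.im e)

lemma topEdge_ne_baseEdge_snd {c d : ℝ} (hk : IsThinArc k p q η) (hc : p ≤ c) (hd : d ≤ q)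
    (hz : z ∈ topEdge η a b) (hw : w ∈ baseEdge k c d) : z.2 ≠ w.2 := by
  obtain ⟨s, hs, rfl⟩ := hz
  obtain ⟨u, hu, rfl⟩ := hw
  intro e
  have h := hk.lt (Icc_subset_Icc hc hd hu)
  simp only at e
  rw [← e] at h
  exact lt_irrefl _ h

lemma injOn_topEdge : InjOn Prod.fst (topEdge η a b) ∧ InjOn Prod.snd (topEdge η a b) := by
  constructor <;>
  · rintro _ ⟨s, hs, rfl⟩ _ ⟨s', hs', rfl⟩ e
    have := congrArg Complex.re e
    simp only at this
    rw [this]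

lemma injOn_baseEdge (hk : IsThinArc k p q η) (ha : p ≤ a) (hb : b ≤ q) :
    InjOn Prod.fst (baseEdge k a b) ∧ InjOn Prod.snd (baseEdge k a b) := by
  constructor
  · rintro _ ⟨s, hs, rfl⟩ _ ⟨s', hs', rfl⟩ e
    rw [Complex.ofReal_injective e]
  · rintro _ ⟨s, hs, rfl⟩ _ ⟨s', hs', rfl⟩ e
    rw [hk.inj (Icc_subset_Icc ha hb hs) (Icc_subset_Icc ha hb hs') e]

lemma InjOn.union_of_cross {X Y : Type*} {f : X → Y} {A B : Set X} (hA : InjOn f A)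
    (hB : InjOn f B) (h : ∀ z ∈ A, ∀ w ∈ B, f z = f w → z = w) : InjOn f (A ∪ B) := by
  rintro z (hz | hz) w (hw | hw) e
  · exact hA hz hw e
  · exact h z hz w hw e
  · exact (h w hw z hz e.symm).symm
  · exact hB hz hw e

/-- Two rungs together with the top edge between them. -/
def gate (η x t y x' t' y' : ℝ) : Set (ℂ × ℂ) := rung η x t y ∪ topEdge η x x' ∪ rung η x' t' y'

lemma isArc_gate {y y' : ℝ} (hη : η ≠ 0) (hx : x < x') (ht : t < t') :
    IsArc (gate η x t y x' t' y') ((t : ℂ), (⟨x, y⟩ : ℂ)) ((t' : ℂ), (⟨x', y'⟩ : ℂ)) := by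
  refine ((isArc_rung hη).symm.trans (isArc_topEdge hx) ?_).trans (isArc_rung hη) ?_
  · rintro z ⟨h1, h2⟩; exact (rung_topEdge_fst hη h1 h2 rfl).1
  · rintro z ⟨h1 | h1, h2⟩
    · exact absurd rfl (rung_ne_rung_fst hη hx ht h1 h2)
    · exact (rung_topEdge_fst hη h2 h1 rfl).1

lemma injOn_fst_gate {y y' : ℝ} (hη : η ≠ 0) (hx : x < x') (ht : t < t') :
    InjOn Prod.fst (gate η x t y x' t' y') := by
  refine InjOn.union_of_cross (InjOn.union_of_cross (injOn_fst_rung hη) injOn_topEdge.1 ?_)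
    (injOn_fst_rung hη) ?_
  · intro z hz w hw e; obtain ⟨h1, h2⟩ := rung_topEdge_fst hη hz hw e; rw [h1, h2]
  · rintro z (hz | hz) w hw e
    · exact absurd e (rung_ne_rung_fst hη hx ht hz hw)
    · obtain ⟨h1, h2⟩ := rung_topEdge_fst hη hw hz e.symm; rw [h1, h2]

lemma injOn_snd_gate {y y' : ℝ} (hy : y * η < η * η) (hy' : y' * η < η * η) (hx : x < x') :
    InjOn Prod.snd (gate η x t y x' t' y') := by
  refine InjOn.union_of_cross (InjOn.union_of_cross (injOn_snd_rung hy) injOn_topEdge.2 ?_)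
    (injOn_snd_rung hy') ?_
  · intro z hz w hw e; obtain ⟨h1, h2⟩ := rung_topEdge_snd hy hz hw e; rw [h1, h2]
  · rintro z (hz | hz) w hw e
    · exact absurd e (rung_ne_rung_snd hx.ne hz hw)
    · obtain ⟨h1, h2⟩ := rung_topEdge_snd hy' hw hz e.symm; rw [h1, h2]

/-- The cell of a ladder between two posts. -/
def ladderCell (k : ℝ → ℂ) (η x t x' t' : ℝ) : Set (ℂ × ℂ) :=
  gate η x t (k t).im x' t' (k t').im ∪ baseEdge k t t'

lemma gate_baseEdge_fst (hk : IsThinArc k p q η) (h : IsPost k p q η x t)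
    (h' : IsPost k p q η x' t') (hz : z ∈ gate η x t (k t).im x' t' (k t').im)
    (hw : w ∈ baseEdge k a b) (e : z.1 = w.1) :
    z = w ∧ (z = ((t : ℂ), k t) ∨ z = ((t' : ℂ), k t')) := by
  rcases hz with (hz | hz) | hz
  · obtain ⟨h1, h2⟩ := rung_baseEdge_fst hk.ne_zero h hz hw e; simp [h1, h2]
  · exact absurd e (topEdge_ne_baseEdge_fst hk.ne_zero hz hw)
  · obtain ⟨h1, h2⟩ := rung_baseEdge_fst hk.ne_zero h' hz hw e; simp [h1, h2]

lemma gate_baseEdge_snd (hk : IsThinArc k p q η) (h : IsPost k p q η x t)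
    (h' : IsPost k p q η x' t') (ha : p ≤ a) (hb : b ≤ q)
    (hz : z ∈ gate η x t (k t).im x' t' (k t').im)
    (hw : w ∈ baseEdge k a b) (e : z.2 = w.2) : z = w := by
  rcases hz with (hz | hz) | hz
  · obtain ⟨h1, h2⟩ := rung_baseEdge_snd hk h ha hb hz hw e; simp [h1, h2]
  · exact absurd e (topEdge_ne_baseEdge_snd hk ha hb hz hw)
  · obtain ⟨h1, h2⟩ := rung_baseEdge_snd hk h' ha hb hz hw e; simp [h1, h2]

lemma isCell_ladderCell (hk : IsThinArc k p q η) (h : IsPost k p q η x t)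
    (h' : IsPost k p q η x' t') (hx : x < x') (ht : t < t') :
    IsCell (ladderCell k η x t x' t') := by
  have hg := isArc_gate (y := (k t).im) (y' := (k t').im) hk.ne_zero hx ht
  rw [h.eq_mk, h'.eq_mk] at hg
  refine ⟨.of_arcs hg (isArc_baseEdge hk h.mem.1 h'.mem.2 ht) ?_, ?_, ?_⟩
  · rintro z ⟨h1, h2⟩
    exact (gate_baseEdge_fst hk h h' h1 h2 rfl).2
  · exact InjOn.union_of_cross (injOn_fst_gate hk.ne_zero hx ht)
      (injOn_baseEdge hk h.mem.1 h'.mem.2).1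
      fun z hz w hw e => (gate_baseEdge_fst hk h h' hz hw e).1
  · exact InjOn.union_of_cross (injOn_snd_gate (hk.lt h.mem) (hk.lt h'.mem) hx)
      (injOn_baseEdge hk h.mem.1 h'.mem.2).2
      fun z hz w hw e => gate_baseEdge_snd hk h h' h.mem.1 h'.mem.2 hz hw e

end Ladder

section Ladder

variable {k : ℝ → ℂ} {p q η x t x' t' x'' t'' a b : ℝ} {z w : ℂ × ℂ}

lemma topEdge_union (hx : x ≤ x') (hx' : x' ≤ x'') :
    topEdge η x x' ∪ topEdge η x' x'' = topEdge η x x'' := by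
  rw [topEdge, topEdge, topEdge, ← image_union, Icc_union_Icc_eq_Icc hx hx']

lemma baseEdge_union (hx : x ≤ x') (hx' : x' ≤ x'') :
    baseEdge k x x' ∪ baseEdge k x' x'' = baseEdge k x x'' := by
  rw [baseEdge, baseEdge, baseEdge, ← image_union, Icc_union_Icc_eq_Icc hx hx']

lemma topEdge_inter : topEdge η x x' ∩ topEdge η x' x'' ⊆ {(⟨x', η⟩, ⟨x', η⟩)} := by
  rintro _ ⟨⟨u, hu, rfl⟩, ⟨v, hv, e⟩⟩
  have : v = u := congrArg Complex.re (congrArg Prod.fst e)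
  rw [show u = x' from le_antisymm hu.2 (this ▸ hv.1)]
  rfl

lemma baseEdge_inter : baseEdge k x x' ∩ baseEdge k x' x'' ⊆ {((x' : ℂ), k x')} := by
  rintro _ ⟨⟨u, hu, rfl⟩, ⟨v, hv, e⟩⟩
  have : v = u := Complex.ofReal_injective (congrArg Prod.fst e)
  rw [show u = x' from le_antisymm hu.2 (this ▸ hv.1)]
  rfl

lemma isCrosscut_of_top {π : ℂ × ℂ → ℂ} (hπ : Continuous π) (hη : η ≠ 0) {ρ R σ : Set (ℂ × ℂ)}
    {P Q : ℂ × ℂ} (hρ : IsJordanLoop (π '' ρ)) (hσ : IsArc σ P Q) (hi : InjOn π σ)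
    (hP : P ∈ ρ) (hQ : Q ∈ ρ) (hcross : ∀ z ∈ ρ, ∀ w ∈ σ, π z = π w → w = P ∨ w = Q)
    (htop : ∀ z ∈ ρ, (π z).im * η ≤ η * η) (hlt : ∀ z ∈ σ, z ≠ P → (π z).im * η < η * η)
    (hR : IsCompact R) (hρR : ∀ z ∈ ρ, z ∈ R ∨ (π z).im = η) (hPR : ∀ z ∈ R, π z ≠ π P) :
    IsCrosscut (π '' ρ) (π '' σ) (π P) (π Q) := by
  have harc := hσ.image hπ.continuousOn hi
  have hdiff : ∀ z ∈ σ, π z ∈ π '' σ \ {π P, π Q} → z ≠ P ∧ z ≠ Q := by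
    rintro z hz ⟨-, h⟩
    constructor <;> rintro rfl <;> simp at h
  refine ⟨harc, ⟨P, hP, rfl⟩, ⟨Q, hQ, rfl⟩, ?_⟩
  refine hρ.subset_inside_of_top (K := π '' R) (a := π P) hη ?_ ⟨P, hP, rfl⟩
    (hR.image hπ).isClosed ?_ ?_ harc.isPreconnected_diff.1 ?_ ?_
    (harc.isPreconnected_diff.2.2 ⟨P, hσ.left_mem, rfl⟩)
  · rintro _ ⟨z, hz, rfl⟩; exact htop z hz
  · rintro ⟨z, hz, e⟩; exact hPR z hz e
  · rintro _ ⟨z, hz, rfl⟩; exact (hρR z hz).imp (fun h => ⟨z, h, rfl⟩) id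
  · rw [disjoint_left]
    rintro _ ⟨⟨w, hw, rfl⟩, hn⟩ ⟨z, hz, e⟩
    obtain ⟨h1, h2⟩ := hdiff w hw ⟨⟨w, hw, rfl⟩, hn⟩
    exact (hcross z hz w hw e).elim h1 h2
  · rintro _ ⟨⟨w, hw, rfl⟩, hn⟩
    exact hlt w hw (hdiff w hw ⟨⟨w, hw, rfl⟩, hn⟩).1

lemma rung_fst_im_lt {y : ℝ} (hη : η ≠ 0) (hz : z ∈ rung η x t y) :
    z.1.im * η ≤ η * η ∧ (z ≠ (⟨x, η⟩, ⟨x, η⟩) → z.1.im * η < η * η) := by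
  obtain ⟨s, hs, rfl⟩ := hz
  have h2 := mul_self_pos.2 hη
  simp only
  refine ⟨by nlinarith [mul_nonneg hs.1 h2.le], fun h => ?_⟩
  have : 0 < s := lt_of_le_of_ne hs.1 (by rintro rfl; simp at h)
  nlinarith [mul_pos this h2]

lemma rung_snd_im_lt {y : ℝ} (hy : y * η < η * η) (hz : z ∈ rung η x t y) :
    z.2.im * η ≤ η * η ∧ (z ≠ (⟨x, η⟩, ⟨x, η⟩) → z.2.im * η < η * η) := by
  obtain ⟨s, hs, rfl⟩ := hz
  simp only
  refine ⟨by nlinarith [mul_nonneg hs.1 (sub_nonneg.2 hy.le)], fun h => ?_⟩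
  have : 0 < s := lt_of_le_of_ne hs.1 (by rintro rfl; simp at h)
  nlinarith [mul_pos this (sub_pos.2 hy)]

lemma isSplit_ladderCell (hk : IsThinArc k p q η) (h : IsPost k p q η x t)
    (h' : IsPost k p q η x' t') (h'' : IsPost k p q η x'' t'') (hx : x < x') (hx' : x' < x'')
    (ht : t < t') (ht' : t' < t'') :
    IsSplit (ladderCell k η x t x'' t'') (ladderCell k η x t x' t')
      (ladderCell k η x' t' x'' t'') := by
  have hη := hk.ne_zero
  have hcell := isCell_ladderCell hk h h'' (hx.trans hx') (ht.trans ht')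
  set P : ℂ × ℂ := (⟨x', η⟩, ⟨x', η⟩) with hPdef
  set Q : ℂ × ℂ := ((t' : ℂ), k t') with hQdef
  have hr := isArc_rung (x := x) (t := t) (y := (k t).im) hη
  have hr' := isArc_rung (x := x') (t := t') (y := (k t').im) hη
  have hr'' := isArc_rung (x := x'') (t := t'') (y := (k t'').im) hη
  rw [h.eq_mk] at hr
  rw [h'.eq_mk] at hr'
  rw [h''.eq_mk] at hr''
  have htL := (isArc_topEdge (η := η) hx).symm
  have htR := isArc_topEdge (η := η) hx'
  have hbL := isArc_baseEdge hk h.mem.1 h'.mem.2 ht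
  have hbR := (isArc_baseEdge hk h'.mem.1 h''.mem.2 ht').symm
  have hA : IsArc (topEdge η x x' ∪ rung η x t (k t).im ∪ baseEdge k t t') P Q := by
    refine (htL.trans hr ?_).trans hbL ?_
    · rintro z ⟨h1, h2⟩; exact (rung_topEdge_fst hη h2 h1 rfl).1
    · rintro z ⟨h1 | h1, h2⟩
      · exact absurd rfl (topEdge_ne_baseEdge_fst hη h1 h2)
      · exact (rung_baseEdge_fst hη h h1 h2 rfl).1
  have hB : IsArc (topEdge η x' x'' ∪ rung η x'' t'' (k t'').im ∪ baseEdge k t' t'') P Q := by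
    refine (htR.trans hr'' ?_).trans hbR ?_
    · rintro z ⟨h1, h2⟩; exact (rung_topEdge_fst hη h2 h1 rfl).1
    · rintro z ⟨h1 | h1, h2⟩
      · exact absurd rfl (topEdge_ne_baseEdge_fst hη h1 h2)
      · exact (rung_baseEdge_fst hη h'' h1 h2 rfl).1
  have eρ : topEdge η x x' ∪ rung η x t (k t).im ∪ baseEdge k t t' ∪
      (topEdge η x' x'' ∪ rung η x'' t'' (k t'').im ∪ baseEdge k t' t'') =
      ladderCell k η x t x'' t'' := by
    rw [ladderCell, gate, ← topEdge_union hx.le hx'.le, ← baseEdge_union ht.le ht'.le]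
    ext z; simp only [mem_union]; tauto
  have hcross1 : ∀ z ∈ ladderCell k η x t x'' t'', ∀ w ∈ rung η x' t' (k t').im, z.1 = w.1 →
      w = P ∨ w = Q := by
    rintro z (((hz | hz) | hz) | hz) w hw e
    · exact absurd e (rung_ne_rung_fst hη hx ht hz hw)
    · exact Or.inl (rung_topEdge_fst hη hw hz e.symm).1
    · exact absurd e.symm (rung_ne_rung_fst hη hx' ht' hw hz)
    · exact Or.inr (rung_baseEdge_fst hη h' hw hz e.symm).1
  have hcross2 : ∀ z ∈ ladderCell k η x t x'' t'', ∀ w ∈ rung η x' t' (k t').im, z.2 = w.2 →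
      w = P ∨ w = Q := by
    rintro z (((hz | hz) | hz) | hz) w hw e
    · exact absurd e (rung_ne_rung_snd hx.ne hz hw)
    · exact Or.inl (rung_topEdge_snd (hk.lt h'.mem) hw hz e.symm).1
    · exact absurd e.symm (rung_ne_rung_snd hx'.ne hw hz)
    · exact Or.inr (rung_baseEdge_snd hk h' h.mem.1 h''.mem.2 hw hz e.symm).1
  have hPρ : P ∈ ladderCell k η x t x'' t'' := eρ ▸ Or.inl hA.left_mem
  have hQρ : Q ∈ ladderCell k η x t x'' t'' := eρ ▸ Or.inl hA.right_mem
  set R := rung η x t (k t).im ∪ rung η x'' t'' (k t'').im ∪ baseEdge k t t'' with hRdef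
  have hR : IsCompact R := (hr.isCompact.union hr''.isCompact).union
    (isArc_baseEdge hk h.mem.1 h''.mem.2 (ht.trans ht')).isCompact
  have hPtop : P ∈ topEdge η x x'' := ⟨x', ⟨hx.le, hx'.le⟩, rfl⟩
  have hxP : ∀ y y' : ℝ, y ≠ y' → ((⟨y, η⟩, ⟨y, η⟩) : ℂ × ℂ) ≠ (⟨y', η⟩, ⟨y', η⟩) :=
    fun y y' hy e => hy (congrArg Complex.re (congrArg Prod.fst e))
  refine ⟨hcell, _, _, rung η x' t' (k t').im, P, Q, hA, hB, ?_, eρ, hr', injOn_fst_rung hη,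
    injOn_snd_rung (hk.lt h'.mem), ?_, ?_, ?_, ?_⟩
  · rintro z ⟨(h1 | h1) | h1, (h2 | h2) | h2⟩
    · exact Or.inl (topEdge_inter ⟨h1, h2⟩)
    · have := rung_topEdge_fst hη h2 h1 rfl
      obtain ⟨u, hu, e⟩ := h1
      have e' : u = x'' := congrArg Complex.re (congrArg Prod.fst (e.trans this.1))
      exact absurd hu.2 (by rw [e']; exact not_le.2 hx')
    · exact absurd rfl (topEdge_ne_baseEdge_fst hη h1 h2)
    · have := rung_topEdge_fst hη h1 h2 rfl
      obtain ⟨u, hu, e⟩ := h2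
      have e' : u = x := congrArg Complex.re (congrArg Prod.fst (e.trans this.1))
      exact absurd hu.1 (by rw [e']; exact not_le.2 hx)
    · exact absurd rfl (rung_ne_rung_fst hη (hx.trans hx') (ht.trans ht') h1 h2)
    · have := rung_baseEdge_fst hη h h1 h2 rfl
      obtain ⟨u, hu, e⟩ := h2
      have e' : u = t := Complex.ofReal_injective (congrArg Prod.fst (e.trans this.1))
      exact absurd hu.1 (by rw [e']; exact not_le.2 ht)
    · exact absurd rfl (topEdge_ne_baseEdge_fst hη h2 h1)
    · have := rung_baseEdge_fst hη h'' h2 h1 rfl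
      obtain ⟨u, hu, e⟩ := h1
      have e' : u = t'' := Complex.ofReal_injective (congrArg Prod.fst (e.trans this.1))
      exact absurd hu.2 (by rw [e']; exact not_le.2 ht')
    · exact Or.inr (baseEdge_inter ⟨h1, h2⟩)
  · refine isCrosscut_of_top continuous_fst hη hcell.loop_fst hr' (injOn_fst_rung hη) hPρ hQρ
      hcross1 ?_ (fun z hz => (rung_fst_im_lt hη hz).2) hR ?_ ?_
    · rintro z (((hz | hz) | hz) | hz)
      · exact (rung_fst_im_lt hη hz).1
      · obtain ⟨u, hu, rfl⟩ := hz; exact le_rfl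
      · exact (rung_fst_im_lt hη hz).1
      · obtain ⟨u, hu, rfl⟩ := hz
        simpa using mul_self_nonneg η
    · rintro z (((hz | hz) | hz) | hz)
      · exact Or.inl (Or.inl (Or.inl hz))
      · obtain ⟨u, hu, rfl⟩ := hz; exact Or.inr rfl
      · exact Or.inl (Or.inl (Or.inr hz))
      · exact Or.inl (Or.inr hz)
    · rintro z ((hz | hz) | hz) e
      · exact hxP _ _ hx.ne (rung_topEdge_fst hη hz hPtop e).2.symm
      · exact hxP _ _ hx'.ne (rung_topEdge_fst hη hz hPtop e).2
      · exact topEdge_ne_baseEdge_fst hη hPtop hz e.symm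
  · refine isCrosscut_of_top continuous_snd hη hcell.loop_snd hr' (injOn_snd_rung (hk.lt h'.mem))
      hPρ hQρ hcross2 ?_ (fun z hz => (rung_snd_im_lt (hk.lt h'.mem) hz).2) hR ?_ ?_
    · rintro z (((hz | hz) | hz) | hz)
      · exact (rung_snd_im_lt (hk.lt h.mem) hz).1
      · obtain ⟨u, hu, rfl⟩ := hz; exact le_rfl
      · exact (rung_snd_im_lt (hk.lt h''.mem) hz).1
      · obtain ⟨u, hu, rfl⟩ := hz
        exact (hk.lt (Icc_subset_Icc h.mem.1 h''.mem.2 hu)).le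
    · rintro z (((hz | hz) | hz) | hz)
      · exact Or.inl (Or.inl (Or.inl hz))
      · obtain ⟨u, hu, rfl⟩ := hz; exact Or.inr rfl
      · exact Or.inl (Or.inl (Or.inr hz))
      · exact Or.inl (Or.inr hz)
    · rintro z ((hz | hz) | hz) e
      · exact hxP _ _ hx.ne (rung_topEdge_snd (hk.lt h.mem) hz hPtop e).2.symm
      · exact hxP _ _ hx'.ne (rung_topEdge_snd (hk.lt h''.mem) hz hPtop e).2
      · exact topEdge_ne_baseEdge_snd hk h.mem.1 h''.mem.2 hPtop hz e.symm
  · rw [ladderCell, gate]; ext z; simp only [mem_union]; tauto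
  · rw [ladderCell, gate]; ext z; simp only [mem_union]; tauto

lemma isSubdivision_ladder (hk : IsThinArc k p q η) {x t : ℕ → ℝ} (n : ℕ)
    (h : ∀ j ≤ n + 1, IsPost k p q η (x j) (t j)) (hx : ∀ j ≤ n, x j < x (j + 1))
    (ht : ∀ j ≤ n, t j < t (j + 1)) :
    IsSubdivision (ladderCell k η (x 0) (t 0) (x (n + 1)) (t (n + 1)))
      {σ | ∃ j ≤ n, σ = ladderCell k η (x j) (t j) (x (j + 1)) (t (j + 1))} ∧
      x 0 < x (n + 1) ∧ t 0 < t (n + 1) := by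
  induction n with
  | zero =>
    refine ⟨?_, hx 0 le_rfl, ht 0 le_rfl⟩
    have := IsSubdivision.refl (isCell_ladderCell hk (h 0 (by simp)) (h 1 (by simp))
      (hx 0 le_rfl) (ht 0 le_rfl))
    convert this using 1
    ext σ; simp
  | succ n ih =>
    obtain ⟨h1, h2, h3⟩ := ih (fun j hj => h j (by omega)) (fun j hj => hx j (by omega))
      (fun j hj => ht j (by omega))
    have hxl := hx (n + 1) le_rfl
    have htl := ht (n + 1) le_rfl
    refine ⟨?_, h2.trans hxl, h3.trans htl⟩
    have := IsSubdivision.split (isSplit_ladderCell hk (h 0 (by simp)) (h (n + 1) (by omega))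
      (h (n + 2) (by omega)) h2 hxl h3 htl) h1
      (.refl (isCell_ladderCell hk (h (n + 1) (by omega)) (h (n + 2) (by omega)) hxl htl))
    convert this using 1
    ext σ
    simp only [mem_union, mem_singleton_iff, mem_ofPred_eq]
    constructor
    · rintro ⟨j, hj, rfl⟩
      rcases Nat.lt_or_ge j (n + 1) with h | h
      · exact Or.inl ⟨j, by omega, rfl⟩
      · right; rw [show j = n + 1 by omega]
    · rintro (⟨j, hj, rfl⟩ | rfl)
      · exact ⟨j, by omega, rfl⟩
      · exact ⟨n + 1, le_rfl, rfl⟩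

end Ladder

/-- The boundary of a rectangle symmetric about the real axis. -/
def frame (p q η : ℝ) : Set ℂ := (Icc p q ×ℂ Icc (-η) η) \ (Ioo p q ×ℂ Ioo (-η) η)

section Rect

variable {p q η : ℝ}

lemma mem_frame_cases {z : ℂ} (h : z ∈ frame p q η) :
    z.re = p ∨ z.re = q ∨ z.im = -η ∨ z.im = η := by
  obtain ⟨⟨⟨h1, h2⟩, h3, h4⟩, h5⟩ := h
  by_contra! hc
  exact h5 ⟨⟨lt_of_le_of_ne h1 hc.1.symm, lt_of_le_of_ne h2 hc.2.1⟩,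
    lt_of_le_of_ne h3 hc.2.2.1.symm, lt_of_le_of_ne h4 hc.2.2.2⟩

/-- The half of the frame on the side of `η`, as a matched pair. -/
lemma mem_gate_iff (hpq : p < q) (z : ℂ × ℂ) :
    z ∈ gate η p p 0 q q 0 ↔ z.1 = z.2 ∧ z.1.re ∈ Icc p q ∧
      (∃ s ∈ Icc (0 : ℝ) 1, z.1.im = s * η) ∧ (z.1.re = p ∨ z.1.re = q ∨ z.1.im = η) := by
  constructor
  · rintro ((⟨s, hs, rfl⟩ | ⟨u, hu, rfl⟩) | ⟨s, hs, rfl⟩)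
    · refine ⟨Complex.ext (by simp; ring) (by simp), ?_, ⟨1 - s, ⟨by linarith [hs.2],
        by linarith [hs.1]⟩, rfl⟩, Or.inl (by simp; ring)⟩
      have : (1 - s) * p + s * p = p := by ring
      simp only [this]; exact ⟨le_rfl, hpq.le⟩
    · exact ⟨rfl, hu, ⟨1, by simp, by simp⟩, Or.inr (Or.inr rfl)⟩
    · refine ⟨Complex.ext (by simp; ring) (by simp), ?_, ⟨1 - s, ⟨by linarith [hs.2],
        by linarith [hs.1]⟩, rfl⟩, Or.inr (Or.inl (by simp; ring))⟩
      have : (1 - s) * q + s * q = q := by ring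
      simp only [this]; exact ⟨hpq.le, le_rfl⟩
  · obtain ⟨z, w⟩ := z
    rintro ⟨e, hre, ⟨s, hs, him⟩, h⟩
    simp only at e him h hre
    subst e
    rcases h with h | h | h
    · refine Or.inl (Or.inl ⟨1 - s, ⟨by linarith [hs.2], by linarith [hs.1]⟩, ?_⟩)
      refine Prod.ext (Complex.ext ?_ ?_) (Complex.ext ?_ ?_) <;> simp [h, him] ; ring
    · refine Or.inr ⟨1 - s, ⟨by linarith [hs.2], by linarith [hs.1]⟩, ?_⟩
      refine Prod.ext (Complex.ext ?_ ?_) (Complex.ext ?_ ?_) <;> simp [h, him] ; ring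
    · exact Or.inl (Or.inr ⟨z.re, hre, Prod.ext (Complex.ext rfl h.symm) (Complex.ext rfl h.symm)⟩)

lemma gate_union (hpq : p < q) (hη : 0 < η) :
    gate η p p 0 q q 0 ∪ gate (-η) p p 0 q q 0 = (fun z => (z, z)) '' frame p q η := by
  ext z
  rw [mem_union, mem_gate_iff hpq, mem_gate_iff hpq]
  constructor
  · have key : z.1 = z.2 → z.1.re ∈ Icc p q → z.1.im ∈ Icc (-η) η →
        (z.1.re = p ∨ z.1.re = q ∨ z.1.im = η ∨ z.1.im = -η) →
        z ∈ (fun z => (z, z)) '' frame p q η := by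
      intro e h1 h2 h3
      refine ⟨z.1, ⟨⟨h1, h2⟩, ?_⟩, Prod.ext rfl e⟩
      rintro ⟨h4, h5⟩
      rcases h3 with h | h | h | h
      · exact h4.1.ne' h
      · exact h4.2.ne h
      · exact h5.2.ne h
      · exact h5.1.ne' h
    rintro (⟨e, h1, ⟨s, hs, h2⟩, h3⟩ | ⟨e, h1, ⟨s, hs, h2⟩, h3⟩)
    · exact key e h1 ⟨by rw [h2]; nlinarith [hs.1], by rw [h2]; nlinarith [hs.2]⟩ (by tauto)
    · exact key e h1 ⟨by rw [h2]; nlinarith [hs.2], by rw [h2]; nlinarith [hs.1]⟩ (by tauto)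
  · rintro ⟨w, hw, rfl⟩
    have hc := mem_frame_cases hw
    obtain ⟨⟨h1, h2, h3⟩, -⟩ := hw
    simp only at *
    rcases le_total 0 w.im with h | h
    · refine Or.inl ⟨trivial, h1, ⟨w.im / η, ⟨by positivity, by rwa [div_le_one hη]⟩, by field_simp⟩, ?_⟩
      rcases hc with h' | h' | h' | h' <;> first | tauto | linarith
    · refine Or.inr ⟨trivial, h1, ⟨w.im / (-η), ⟨div_nonneg_of_nonpos h (by linarith), ?_⟩,
        by field_simp⟩, ?_⟩
      · rw [div_le_one_of_neg (by linarith)]; exact h2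
      rcases hc with h' | h' | h' | h' <;> first | tauto | linarith

lemma gate_inter (hpq : p < q) (hη : 0 < η) :
    gate η p p 0 q q 0 ∩ gate (-η) p p 0 q q 0 ⊆ {((p : ℂ), (p : ℂ)), ((q : ℂ), (q : ℂ))} := by
  rintro z ⟨h1, h2⟩
  rw [mem_gate_iff hpq] at h1 h2
  obtain ⟨e, -, ⟨s, hs, h⟩, h3⟩ := h1
  obtain ⟨-, -, ⟨s', hs', h'⟩, -⟩ := h2
  have him : z.1.im = 0 := by
    have h1 : s * η = s' * -η := h ▸ h'
    have : s = 0 := by nlinarith [hs.1, hs'.1]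
    rw [h, this, zero_mul]
  rcases h3 with h3 | h3 | h3
  · left
    have : z.1 = p := Complex.ext h3 him
    exact Prod.ext this (e ▸ this)
  · right
    have : z.1 = q := Complex.ext h3 him
    exact Prod.ext this (e ▸ this)
  · rw [him] at h3; exact absurd h3 hη.ne

lemma isArc_gate_frame (hpq : p < q) (hη : η ≠ 0) :
    IsArc (gate η p p 0 q q 0) ((p : ℂ), (p : ℂ)) ((q : ℂ), (q : ℂ)) :=
  isArc_gate hη hpq hpq

lemma isCell_frame (hpq : p < q) (hη : 0 < η) : IsCell ((fun z => (z, z)) '' frame p q η) := by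
  refine ⟨?_, ?_, ?_⟩
  · rw [← gate_union hpq hη]
    exact .of_arcs (isArc_gate_frame hpq hη.ne') (isArc_gate_frame hpq (neg_ne_zero.2 hη.ne'))
      (gate_inter hpq hη)
  · rintro _ ⟨z, -, rfl⟩ _ ⟨w, -, rfl⟩ e; simpa using e
  · rintro _ ⟨z, -, rfl⟩ _ ⟨w, -, rfl⟩ e; simpa using e

lemma fst_image_diag (s : Set ℂ) : Prod.fst '' ((fun z : ℂ => (z, z)) '' s) = s := by
  rw [image_image]; simp

lemma snd_image_diag (s : Set ℂ) : Prod.snd '' ((fun z : ℂ => (z, z)) '' s) = s := by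
  rw [image_image]; simp

lemma isJordanLoop_frame (hpq : p < q) (hη : 0 < η) : IsJordanLoop (frame p q η) := by
  have := (isCell_frame hpq hη).loop_fst
  rwa [fst_image_diag] at this

lemma convex_reProdIm {s t : Set ℝ} (hs : Convex ℝ s) (ht : Convex ℝ t) : Convex ℝ (s ×ℂ t) := by
  rintro z ⟨h1, h2⟩ w ⟨h3, h4⟩ a b ha hb hab
  refine ⟨?_, ?_⟩
  · simpa using hs h1 h3 ha hb hab
  · simpa using ht h2 h4 ha hb hab

lemma inside_frame (hpq : p < q) (hη : 0 < η) :
    inside (frame p q η) = Ioo p q ×ℂ Ioo (-η) η := by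
  have hJ := isJordanLoop_frame hpq hη
  apply subset_antisymm
  · intro z hz
    by_contra hc
    have h1 : z ∈ Icc p q ×ℂ Icc (-η) η := inside_subset_of_convex
      (convex_reProdIm (convex_Icc p q) (convex_Icc (-η) η)) sdiff_subset hz
    have h2 : z ∈ (frame p q η)ᶜ := by
      rw [compl_eq_inside_union_outside]; exact Or.inl hz
    exact h2 ⟨h1, hc⟩
  · refine hJ.subset_inside_of_top (η := η) (a := ⟨(p + q) / 2, η⟩)
      (K := {z | z.re = p} ∪ {z | z.re = q} ∪ {z | z.im = -η}) hη.ne' ?_ ?_ ?_ ?_ ?_ ?_ ?_ ?_ ?_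
    · rintro z ⟨⟨-, h⟩, -⟩; exact mul_le_mul_of_nonneg_right h.2 hη.le
    · refine ⟨⟨⟨?_, ?_⟩, ?_, le_rfl⟩, fun h => h.2.2.ne rfl⟩ <;> simp only <;> linarith
    · exact ((isClosed_eq Complex.continuous_re continuous_const).union
        (isClosed_eq Complex.continuous_re continuous_const)).union
        (isClosed_eq Complex.continuous_im continuous_const)
    · rintro ((h | h) | h) <;> simp only [mem_ofPred_eq] at h <;> linarith
    · intro z hz
      rcases mem_frame_cases hz with h | h | h | h
      · exact Or.inl (Or.inl (Or.inl h))
      · exact Or.inl (Or.inl (Or.inr h))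
      · exact Or.inl (Or.inr h)
      · exact Or.inr h
    · exact (convex_reProdIm (convex_Ioo p q) (convex_Ioo (-η) η)).isPreconnected
    · exact disjoint_sdiff_right
    · rintro z ⟨-, h⟩; exact mul_lt_mul_of_pos_right h.2 hη
    · rw [Complex.closure_reProdIm, closure_Ioo hpq.ne, closure_Ioo (by linarith)]
      refine ⟨⟨?_, ?_⟩, ?_, le_rfl⟩ <;> simp only <;> linarith

lemma fill_frame (hpq : p < q) (hη : 0 < η) :
    fill (frame p q η) = Icc p q ×ℂ Icc (-η) η := by
  rw [fill, inside_frame hpq hη, frame, union_sdiff_cancel]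
  rintro z ⟨h1, h2⟩
  exact ⟨Ioo_subset_Icc_self h1, Ioo_subset_Icc_self h2⟩

end Rect

section Glue

/-- Extend a self-homeomorphism of a compact set by the identity. -/
lemma exists_homeomorph_of_bijOn {C : Set ℂ} (hC : IsCompact C) {F : ℂ → ℂ}
    (hF : ContinuousOn F C) (hb : BijOn F C C) (hid : ∀ z ∈ frontier C, F z = z) :
    ∃ H : ℂ ≃ₜ ℂ, (∀ z ∈ C, H z = F z) ∧ ∀ z ∉ C, H z = z := by
  classical
  have hfC : frontier C ⊆ C := hC.isClosed.frontier_subset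
  set G := Function.invFunOn F C with hG
  have hinv : InvOn G F C C := hb.invOn_invFunOn
  have hGc : ContinuousOn G C := by
    have := continuousOn_invFunOn_image hC hF hb.injOn
    rwa [hb.image_eq] at this
  have hGm : MapsTo G C C := hb.surjOn.mapsTo_invFunOn
  have hGid : ∀ z ∈ frontier C, G z = z := fun z hz => by
    have := hinv.1 (hfC hz)
    rwa [hid z hz] at this
  refine ⟨⟨⟨C.piecewise F id, C.piecewise G id, ?_, ?_⟩, ?_, ?_⟩, ?_, ?_⟩
  · intro z
    by_cases hz : z ∈ C
    · simp [hz, hb.mapsTo hz, hinv.1 hz]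
    · simp [hz]
  · intro z
    by_cases hz : z ∈ C
    · simp [hz, hGm hz, hinv.2 hz]
    · simp [hz]
  · exact continuous_piecewise hid (by rwa [hC.isClosed.closure_eq]) continuousOn_id
  · exact continuous_piecewise hGid (by rwa [hC.isClosed.closure_eq]) continuousOn_id
  · intro z hz; simp [hz]
  · intro z hz; simp [hz]

end Glue

/-- `k` is an embedding of `[p, q]` as a crosscut of the rectangle with the same ends. -/
structure IsRectArc (k : ℝ → ℂ) (p q η : ℝ) : Prop where
  lt : p < q
  pos : 0 < η
  cont : ContinuousOn k (Icc p q)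
  inj : InjOn k (Icc p q)
  left : k p = p
  right : k q = q
  mem : ∀ u ∈ Ioo p q, k u ∈ Ioo p q ×ℂ Ioo (-η) η

namespace IsRectArc

variable {k : ℝ → ℂ} {p q η ζ x δ : ℝ}

lemma isThinArc (h : IsRectArc k p q η) (hζ : |ζ| = η) : IsThinArc k p q ζ := by
  refine ⟨abs_pos.1 (hζ ▸ h.pos), h.cont, h.inj, fun u hu => ?_⟩
  rw [hζ]
  rcases eq_endpoints_or_mem_Ioo_of_mem_Icc hu with rfl | rfl | hu
  · simpa [h.left] using h.pos
  · simpa [h.right] using h.pos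
  · exact abs_lt.2 (h.mem u hu).2

lemma exists_isPost (h : IsRectArc k p q η) (hζ : |ζ| = η) (hx : x ∈ Icc p q) :
    ∃ t, IsPost k p q ζ x t := by
  have hthin := h.isThinArc hζ
  have hre : ContinuousOn (fun u => (k u).re) (Icc p q) := Complex.continuous_re.comp_continuousOn h.cont
  have hT : IsCompact (Icc p q ∩ (fun u => (k u).re) ⁻¹' {x}) :=
    isCompact_Icc.of_isClosed_subset (hre.preimage_isClosed_of_isClosed isClosed_Icc
      isClosed_singleton) inter_subset_left
  have hne : (Icc p q ∩ (fun u => (k u).re) ⁻¹' {x}).Nonempty := by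
    have := intermediate_value_Icc h.lt.le hre
    simp only [h.left, h.right, Complex.ofReal_re] at this
    obtain ⟨u, hu, e⟩ := this hx
    exact ⟨u, hu, e⟩
  obtain ⟨t, ⟨ht, hx'⟩, hmax⟩ := hT.exists_isMaxOn hne (f := fun u => (k u).im * ζ)
    (((Complex.continuous_im.comp_continuousOn h.cont).mul continuousOn_const).mono
      inter_subset_left)
  refine ⟨t, ht, hx', fun u hu s hs e => h.inj hu ht ?_⟩
  have h1 : (k u).im * ζ ≤ (k t).im * ζ := hmax ⟨hu, by simp [e]⟩
  have h2 := hthin.lt ht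
  have him : (k u).im = (1 - s) * ζ + s * (k t).im := by rw [e]
  have hs1 : s = 1 := by
    rw [him] at h1
    nlinarith [hs.2]
  rw [e, hs1]
  exact Complex.ext hx'.symm (by simp)

lemma exists_isSubdivision (h : IsRectArc k p q η) (hζ : |ζ| = η) (n : ℕ)
    (hδ : ∀ u ∈ Icc p q, ‖k u - u‖ ≤ δ) (hn : 3 * δ < (q - p) / (n + 1)) :
    ∃ S, IsSubdivision (ladderCell k ζ p p q q) S ∧ (∀ σ ∈ S, ∃ c, ∀ z ∈ σ,
      z.1 ∈ Icc c (c + 3 * ((q - p) / (n + 1))) ×ℂ Icc (-η) η ∧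
      z.2 ∈ Icc c (c + 3 * ((q - p) / (n + 1))) ×ℂ Icc (-η) η) := by
  have hthin := h.isThinArc hζ
  set w := (q - p) / (n + 1) with hw
  have hw0 : 0 < w := div_pos (sub_pos.2 h.lt) (by positivity)
  set x : ℕ → ℝ := fun j => p + j * w with hx
  have hx0 : x 0 = p := by simp [hx]
  have hx1 : x (n + 1) = q := by simp only [hx, hw]; push_cast; field_simp; ring
  have hxm : ∀ j ≤ n + 1, x j ∈ Icc p q := by
    intro j hj
    refine ⟨by simp only [hx]; nlinarith [(Nat.cast_nonneg j : (0:ℝ) ≤ j)], ?_⟩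
    rw [← hx1]; simp only [hx]
    gcongr
  have : ∀ j, ∃ t, j ≤ n + 1 → IsPost k p q ζ (x j) t := fun j => by
    by_cases hj : j ≤ n + 1
    · obtain ⟨t, ht⟩ := h.exists_isPost hζ (hxm j hj); exact ⟨t, fun _ => ht⟩
    · exact ⟨0, fun h => absurd h hj⟩
  choose t ht using this
  have hxt : ∀ j ≤ n + 1, |x j - t j| ≤ δ := fun j hj => by
    have h1 := hδ _ (ht j hj).mem
    have h2 := Complex.abs_re_le_norm (k (t j) - t j)
    rw [Complex.sub_re, Complex.ofReal_re, (ht j hj).re_eq] at h2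
    exact h2.trans h1
  have hstep : ∀ j, x (j + 1) = x j + w := fun j => by simp only [hx]; push_cast; ring
  have hxx : ∀ j ≤ n, x j < x (j + 1) := fun j _ => by rw [hstep]; linarith
  have htt : ∀ j ≤ n, t j < t (j + 1) := fun j hj => by
    have h1 := abs_le.1 (hxt j (by omega))
    have h2 := abs_le.1 (hxt (j + 1) (by omega))
    have := hstep j
    linarith
  have ht0 : t 0 = p := by
    have h0 := ht 0 (by omega)
    rcases eq_endpoints_or_mem_Ioo_of_mem_Icc h0.mem with e | e | hu
    · exact e
    · have := h0.re_eq
      rw [e, h.right, hx0] at this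
      exact absurd this h.lt.ne'
    · exact absurd (h0.re_eq.trans hx0) (h.mem _ hu).1.1.ne'
  have ht1 : t (n + 1) = q := by
    have h0 := ht (n + 1) le_rfl
    rcases eq_endpoints_or_mem_Ioo_of_mem_Icc h0.mem with e | e | hu
    · have := h0.re_eq
      rw [e, h.left, hx1] at this
      exact absurd this h.lt.ne
    · exact e
    · exact absurd (h0.re_eq.trans hx1) (h.mem _ hu).1.2.ne
  have hsub := (isSubdivision_ladder hthin n ht hxx htt).1
  rw [hx0, hx1, ht0, ht1] at hsub
  refine ⟨_, hsub, ?_⟩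
  rintro σ ⟨j, hj, rfl⟩
  have a1 := abs_le.1 (hxt j (by omega))
  have a2 := abs_le.1 (hxt (j + 1) (by omega))
  have a3 := hstep j
  have hδ0 : 0 ≤ δ := (norm_nonneg _).trans (hδ p ⟨le_rfl, h.lt.le⟩)
  have hη : ∀ s ∈ Icc (0 : ℝ) 1, ∀ y, |y| ≤ η → (1 - s) * ζ + s * y ∈ Icc (-η) η := by
    intro s hs y hy
    rw [← hζ] at hy ⊢
    rw [mem_Icc, ← abs_le]
    calc |(1 - s) * ζ + s * y| ≤ |(1 - s) * ζ| + |s * y| := abs_add_le _ _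
      _ = (1 - s) * |ζ| + s * |y| := by
        rw [abs_mul, abs_mul, abs_of_nonneg hs.1, abs_of_nonneg (sub_nonneg.2 hs.2)]
      _ ≤ (1 - s) * |ζ| + s * |ζ| := by gcongr; exact hs.1
      _ = |ζ| := by ring
  have hrung : ∀ i ≤ n + 1, x j ≤ x i → x i ≤ x (j + 1) → ∀ z ∈ rung ζ (x i) (t i) (k (t i)).im,
      z.1 ∈ Icc (x j - 2 * δ) (x j - 2 * δ + 3 * w) ×ℂ Icc (-η) η ∧
      z.2 ∈ Icc (x j - 2 * δ) (x j - 2 * δ + 3 * w) ×ℂ Icc (-η) η := by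
    rintro i hi h1 h2 _ ⟨s, hs, rfl⟩
    have a4 := abs_le.1 (hxt i hi)
    have e : (1 - s) * x i + s * t i = x i - s * (x i - t i) := by ring
    have hs0 := hs.1
    have hs1 := hs.2
    refine ⟨⟨?_, ?_⟩, ⟨?_, ?_⟩⟩
    · simp only [mem_preimage, e]
      constructor <;> nlinarith
    · simpa using hη s hs 0 (by simpa using h.pos.le)
    · simp only [mem_preimage]
      constructor <;> linarith
    · refine hη s hs _ ?_
      have := (hthin.thin _ (ht i hi).mem).le
      rwa [hζ] at this
  refine ⟨x j - 2 * δ, ?_⟩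
  rintro z (((hz | hz) | hz) | hz)
  · exact hrung j (by omega) le_rfl (by linarith) z hz
  · obtain ⟨u, hu, rfl⟩ := hz
    have := hu.1; have := hu.2
    have hz : (⟨u, ζ⟩ : ℂ) ∈ Icc (x j - 2 * δ) (x j - 2 * δ + 3 * w) ×ℂ Icc (-η) η :=
      ⟨⟨by simp only; linarith, by simp only; linarith⟩, abs_le.1 hζ.le⟩
    exact ⟨hz, hz⟩
  · exact hrung (j + 1) (by omega) (by linarith) le_rfl z hz
  · obtain ⟨u, hu, rfl⟩ := hz
    have b1 := hu.1; have b2 := hu.2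
    have hum : u ∈ Icc p q := Icc_subset_Icc (ht j (by omega)).mem.1 (ht (j + 1) (by omega)).mem.2 hu
    have h2 := (Complex.abs_re_le_norm (k u - u)).trans (hδ u hum)
    rw [Complex.sub_re, Complex.ofReal_re, abs_le] at h2
    refine ⟨⟨⟨?_, ?_⟩, ?_⟩, ⟨⟨?_, ?_⟩, ?_⟩⟩
    · simp only [Complex.ofReal_re]; linarith
    · simp only [Complex.ofReal_re]; linarith
    · simpa using h.pos.le
    · simp only; linarith
    · simp only; linarith
    · have := (hthin.thin u hum).le
      rw [hζ] at this
      exact abs_le.1 this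

lemma isSplit (h : IsRectArc k p q η) :
    IsSplit ((fun z => (z, z)) '' frame p q η) (ladderCell k η p p q q)
      (ladderCell k (-η) p p q q) := by
  have hb := isArc_baseEdge (h.isThinArc (abs_of_pos h.pos)) le_rfl le_rfl h.lt
  have hi := injOn_baseEdge (h.isThinArc (abs_of_pos h.pos)) le_rfl le_rfl
  have hpf : (p : ℂ) ∈ frame p q η := by
    refine ⟨⟨⟨le_rfl, h.lt.le⟩, ?_⟩, fun h => h.1.1.ne rfl⟩
    simpa using h.pos.le
  have hqf : (q : ℂ) ∈ frame p q η := by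
    refine ⟨⟨⟨h.lt.le, le_rfl⟩, ?_⟩, fun h => h.1.2.ne rfl⟩
    simpa using h.pos.le
  have key : ∀ s : Set ℂ, IsArc s p q → (∀ z ∈ s, z = p ∨ z = q ∨ z ∈ Ioo p q ×ℂ Ioo (-η) η) →
      IsCrosscut (frame p q η) s p q := by
    intro s hs hz
    refine ⟨hs, hpf, hqf, ?_⟩
    rw [inside_frame h.lt h.pos]
    rintro z ⟨hzs, hne⟩
    rcases hz z hzs with e | e | e
    · exact absurd (Or.inl e) hne
    · exact absurd (Or.inr e) hne
    · exact e
  rw [h.left, h.right] at hb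
  refine ⟨isCell_frame h.lt h.pos, _, _, baseEdge k p q, _, _, isArc_gate_frame h.lt h.pos.ne',
    isArc_gate_frame h.lt (neg_ne_zero.2 h.pos.ne'), gate_inter h.lt h.pos, gate_union h.lt h.pos,
    hb, hi.1, hi.2, ?_, ?_, ?_, ?_⟩
  · rw [fst_image_diag]
    refine key _ (hb.image continuous_fst.continuousOn hi.1) ?_
    rintro _ ⟨_, ⟨u, hu, rfl⟩, rfl⟩
    rcases eq_endpoints_or_mem_Ioo_of_mem_Icc hu with rfl | rfl | hu
    · exact Or.inl rfl
    · exact Or.inr (Or.inl rfl)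
    · refine Or.inr (Or.inr ⟨by simpa using hu, by simpa using h.pos⟩)
  · rw [snd_image_diag]
    refine key _ (hb.image continuous_snd.continuousOn hi.2) ?_
    rintro _ ⟨_, ⟨u, hu, rfl⟩, rfl⟩
    rcases eq_endpoints_or_mem_Ioo_of_mem_Icc hu with rfl | rfl | hu
    · exact Or.inl h.left
    · exact Or.inr (Or.inl h.right)
    · exact Or.inr (Or.inr (h.mem u hu))
  · rw [ladderCell, h.left, h.right]; simp
  · rw [ladderCell, h.left, h.right]; simp

theorem exists_homeomorph (h : IsRectArc k p q η) (n : ℕ)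
    (hδ : ∀ u ∈ Icc p q, ‖k u - u‖ ≤ δ) (hn : 3 * δ < (q - p) / (n + 1)) :
    ∃ H : ℂ ≃ₜ ℂ, (∀ z ∉ Ioo p q ×ℂ Ioo (-η) η, H z = z) ∧ (∀ u ∈ Icc p q, H (u : ℂ) = k u) ∧
      ∀ z, ‖H z - z‖ ≤ 3 * ((q - p) / (n + 1)) + 2 * η := by
  obtain ⟨S, hS, hS'⟩ := h.exists_isSubdivision (abs_of_pos h.pos) n hδ hn
  obtain ⟨T, hT, hT'⟩ := h.exists_isSubdivision (ζ := -η) (by rw [abs_neg, abs_of_pos h.pos]) n hδ hn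
  have hsub := IsSubdivision.split h.isSplit hS hT
  obtain ⟨F, hF, hb, hsm, hFS⟩ := schoenflies hsub
  rw [fst_image_diag, fill_frame h.lt h.pos] at hF hb hsm
  rw [snd_image_diag, fill_frame h.lt h.pos] at hb
  have hcl : ∀ z ∈ frame p q η, F z = z := by
    intro z hz
    obtain ⟨σ, hσ, hzσ⟩ := hsub.exists_mem (z, z) ⟨z, hz, rfl⟩
    exact hFS σ hσ _ hzσ
  have hC : IsCompact (Icc p q ×ℂ Icc (-η) η) := isCompact_Icc.reProdIm isCompact_Icc
  obtain ⟨H, h1, h2⟩ := exists_homeomorph_of_bijOn hC hF hb fun z hz => by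
    apply hcl
    refine ⟨hC.isClosed.frontier_subset hz, fun hz' => ?_⟩
    have : z ∈ interior (Icc p q ×ℂ Icc (-η) η) := by
      rwa [Complex.interior_reProdIm, interior_Icc, interior_Icc]
    exact hz.2 this
  have hbase : ∀ u ∈ Icc p q, ((u : ℂ), k u) ∈ ladderCell k η p p q q :=
    fun u hu => Or.inr ⟨u, hu, rfl⟩
  refine ⟨H, fun z hz => ?_, fun u hu => ?_, fun z => ?_⟩
  · by_cases hz' : z ∈ Icc p q ×ℂ Icc (-η) η
    · rw [h1 z hz', hcl z ⟨hz', hz⟩]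
    · exact h2 z hz'
  · have hu' : (u : ℂ) ∈ Icc p q ×ℂ Icc (-η) η := ⟨hu, by simpa using h.pos.le⟩
    rw [h1 _ hu']
    obtain ⟨σ, hσ, hz⟩ := hS.exists_mem _ (hbase u hu)
    exact hFS σ (Or.inl hσ) _ hz
  · have hpos : 0 ≤ 3 * ((q - p) / (n + 1)) + 2 * η := by
      have := h.pos; have := sub_pos.2 h.lt; positivity
    by_cases hz : z ∈ Icc p q ×ℂ Icc (-η) η
    · rw [h1 z hz]
      obtain ⟨σ, hσ, hz1, hz2⟩ := hsm z hz
      have : ∃ c, ∀ z ∈ σ, z.1 ∈ Icc c (c + 3 * ((q - p) / (n + 1))) ×ℂ Icc (-η) η ∧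
          z.2 ∈ Icc c (c + 3 * ((q - p) / (n + 1))) ×ℂ Icc (-η) η := by
        rcases hσ with hσ | hσ
        · exact hS' σ hσ
        · exact hT' σ hσ
      obtain ⟨c, hc⟩ := this
      have hconv := convex_reProdIm (convex_Icc c (c + 3 * ((q - p) / (n + 1)))) (convex_Icc (-η) η)
      have m1 := fill_subset_of_convex hconv (image_subset_iff.2 fun z hz => (hc z hz).1) hz1
      have m2 := fill_subset_of_convex hconv (image_subset_iff.2 fun z hz => (hc z hz).2) hz2
      obtain ⟨⟨a1, a2⟩, a3, a4⟩ := m1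
      obtain ⟨⟨b1, b2⟩, b3, b4⟩ := m2
      refine (Complex.norm_le_abs_re_add_abs_im _).trans (add_le_add ?_ ?_)
      · rw [Complex.sub_re, abs_le]; constructor <;> linarith
      · rw [Complex.sub_im, abs_le]; constructor <;> linarith
    · rw [h2 z hz]; simpa using hpos

end IsRectArc

/-- `k` is an embedding of `[p, q]` moving points by at most `δ`. -/
structure IsNearId (k : ℝ → ℂ) (p q δ : ℝ) : Prop where
  cont : ContinuousOn k (Icc p q)
  inj : InjOn k (Icc p q)
  near : ∀ u ∈ Icc p q, ‖k u - u‖ ≤ δ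

namespace IsNearId

variable {k : ℝ → ℂ} {p c d q δ : ℝ}

lemma re_bounds (h : IsNearId k p q δ) {u : ℝ} (hu : u ∈ Icc p q) :
    u - δ ≤ (k u).re ∧ (k u).re ≤ u + δ := by
  have := (Complex.abs_re_le_norm (k u - u)).trans (h.near u hu)
  rw [Complex.sub_re, Complex.ofReal_re, abs_le] at this
  constructor <;> linarith

lemma im_bound (h : IsNearId k p q δ) {u : ℝ} (hu : u ∈ Icc p q) : |(k u).im| ≤ δ := by
  have := (Complex.abs_im_le_norm (k u - u)).trans (h.near u hu)
  rwa [Complex.sub_im, Complex.ofReal_im, sub_zero] at this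

/-- Straighten the right end of the arc so that it ends in `q`. -/
lemma exists_right (h : IsNearId k p q δ) (hpd : p ≤ d) (hdq : d < q) (hδ : 2 * δ < q - d) :
    ∃ k', IsNearId k' p q δ ∧ EqOn k' k (Icc p d) ∧ k' q = q ∧
      (∀ u ∈ Ico p q, (k' u).re < q) ∧
      ((∀ u ∈ Icc d q, k u = u) → ∀ u ∈ Icc d q, k' u = u) := by
  have hpq : p < q := hpd.trans_lt hdq
  have hδ0 : 0 ≤ δ := (norm_nonneg _).trans (h.near p ⟨le_rfl, hpq.le⟩)
  set m := (d + q) / 2 with hm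
  have hre : ContinuousOn (fun u => (k u).re) (Icc p q) :=
    Complex.continuous_re.comp_continuousOn h.cont
  have hT : IsCompact (Icc p q ∩ (fun u => (k u).re) ⁻¹' {m}) :=
    isCompact_Icc.of_isClosed_subset (hre.preimage_isClosed_of_isClosed isClosed_Icc
      isClosed_singleton) inter_subset_left
  have hdm : d + δ < m := by rw [hm]; linarith
  have hmq : m < q - δ := by rw [hm]; linarith
  have hne : (Icc p q ∩ (fun u => (k u).re) ⁻¹' {m}).Nonempty := by
    obtain ⟨u, hu, e⟩ := intermediate_value_Icc hpq.le hre
      (show m ∈ Icc (k p).re (k q).re from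
        ⟨by linarith [(h.re_bounds ⟨le_rfl, hpq.le⟩).2], by
          linarith [(h.re_bounds ⟨hpq.le, le_rfl⟩).1]⟩)
    exact ⟨u, hu, e⟩
  obtain ⟨t, ⟨ht, hkt⟩, hmin⟩ := hT.exists_isMinOn hne (f := id) continuousOn_id
  simp only [mem_preimage, mem_singleton_iff] at hkt
  have hlt : ∀ u ∈ Ico p t, (k u).re < m := by
    intro u hu
    by_contra! hc
    obtain ⟨w, hw, e⟩ := intermediate_value_Icc hu.1
      (hre.mono (Icc_subset_Icc_right (hu.2.le.trans ht.2)))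
      (show m ∈ Icc (k p).re (k u).re from
        ⟨by linarith [(h.re_bounds ⟨le_rfl, hpq.le⟩).2], hc⟩)
    have : t ≤ w := hmin ⟨⟨hw.1, hw.2.trans (hu.2.le.trans ht.2)⟩, e⟩
    linarith [hw.2, hu.2]
  have hdt : d < t := by have := (h.re_bounds ht).2; linarith
  have htq : t < q := by have := (h.re_bounds ht).1; linarith
  have hqt : 0 < q - t := sub_pos.2 htq
  set L : ℝ → ℂ := fun u => u + (((q - u) / (q - t) : ℝ) : ℂ) * (k t - t) with hL
  have hLc : Continuous L := by
    refine Complex.continuous_ofReal.add ((Complex.continuous_ofReal.comp ?_).mul continuous_const)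
    exact (continuous_const.sub continuous_id).div_const _
  have hLt : L t = k t := by
    have : (q - t) / (q - t) = 1 := div_self hqt.ne'
    simp only [hL, this]; push_cast; ring
  have hLre : ∀ u, (L u).re = u + (q - u) / (q - t) * (m - t) := by
    intro u
    simp only [hL, Complex.add_re, Complex.ofReal_re, Complex.re_ofReal_mul, Complex.sub_re, hkt]
  have hLre' : ∀ u, (L u).re = m + (u - t) / (q - t) * (q - m) := by
    intro u; rw [hLre]; field_simp; ring
  set k' : ℝ → ℂ := fun u => if u ≤ t then k u else L u with hk'
  have e1 : ∀ u ≤ t, k' u = k u := fun u hu => if_pos hu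
  have e2 : ∀ u, t ≤ u → k' u = L u := fun u hu => by
    rcases hu.eq_or_lt with rfl | hu
    · rw [e1 _ le_rfl, hLt]
    · exact if_neg (not_le.2 hu)
  have hLinj : ∀ u w, L u = L w → u = w := by
    intro u w e
    have : (L u).re = (L w).re := by rw [e]
    rw [hLre', hLre'] at this
    have hqm : 0 < (q - m) / (q - t) := div_pos (by linarith) hqt
    have h3 : (u - w) * ((q - m) / (q - t)) = 0 := by linear_combination this
    rcases mul_eq_zero.1 h3 with h4 | h4
    · linarith
    · exact absurd h4 hqm.ne'
  have hcross : ∀ u ∈ Icc p t, ∀ w, t < w → k u ≠ L w := by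
    intro u hu w hw e
    have h1 : (k u).re ≤ m := by
      rcases hu.2.eq_or_lt with rfl | h'
      · exact hkt.le
      · exact (hlt u ⟨hu.1, h'⟩).le
    have h2 : m < (L w).re := by
      rw [hLre']
      have : 0 < (w - t) / (q - t) * (q - m) := by
        refine mul_pos (div_pos (by linarith) hqt) (by linarith)
      linarith
    rw [← e] at h2; linarith
  refine ⟨k', ⟨?_, ?_, ?_⟩, fun u hu => e1 u (hu.2.trans hdt.le), ?_, ?_, ?_⟩
  · exact continuousOn_Icc_ite ht.1 ht.2 (h.cont.mono (Icc_subset_Icc_right ht.2))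
      hLc.continuousOn hLt.symm
  · intro u hu w hw e
    rcases le_or_gt u t with hut | hut <;> rcases le_or_gt w t with hwt | hwt
    · rw [e1 u hut, e1 w hwt] at e; exact h.inj hu hw e
    · rw [e1 u hut, e2 w hwt.le] at e; exact absurd e (hcross u ⟨hu.1, hut⟩ w hwt)
    · rw [e2 u hut.le, e1 w hwt] at e; exact absurd e.symm (hcross w ⟨hw.1, hwt⟩ u hut)
    · rw [e2 u hut.le, e2 w hwt.le] at e; exact hLinj u w e
  · intro u hu
    rcases le_total u t with hut | hut
    · rw [e1 u hut]; exact h.near u hu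
    · rw [e2 u hut]
      have h1 : L u - u = (((q - u) / (q - t) : ℝ) : ℂ) * (k t - t) := by simp [hL]
      rw [h1, norm_mul, Complex.norm_real, Real.norm_eq_abs,
        abs_of_nonneg (div_nonneg (by linarith [hu.2]) hqt.le)]
      have h2 : (q - u) / (q - t) ≤ 1 := (div_le_one hqt).2 (by linarith)
      calc _ ≤ 1 * δ := mul_le_mul h2 (h.near t ht) (norm_nonneg _) zero_le_one
        _ = δ := one_mul δ
  · rw [e2 q htq.le]; simp [hL]
  · intro u hu
    rcases lt_or_ge u t with hut | hut
    · rw [e1 u hut.le]; linarith [hlt u ⟨hu.1, hut⟩]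
    · rw [e2 u hut, hLre']
      have h2 : (u - t) / (q - t) < 1 := (div_lt_one hqt).2 (by linarith [hu.2])
      nlinarith
  · intro hid u hu
    have htm : t = m := by
      have := hid t ⟨hdt.le, htq.le⟩
      rw [this] at hkt; simpa using hkt
    rcases le_total u t with hut | hut
    · rw [e1 u hut, hid u hu]
    · rw [e2 u hut]; simp [hL, hid t ⟨hdt.le, htq.le⟩]

lemma reflect (h : IsNearId k p q δ) : IsNearId (fun u => -k (-u)) (-q) (-p) δ := by
  have hm : MapsTo (fun u : ℝ => -u) (Icc (-q) (-p)) (Icc p q) :=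
    fun u hu => ⟨by linarith [hu.2], by linarith [hu.1]⟩
  refine ⟨(h.cont.comp continuous_neg.continuousOn hm).neg, ?_, ?_⟩
  · intro u hu w hw e
    exact neg_injective (h.inj (hm hu) (hm hw) (neg_injective e))
  · intro u hu
    have := h.near (-u) (hm hu)
    have e : -k (-u) - (u : ℂ) = -(k (-u) - ((-u : ℝ) : ℂ)) := by push_cast; ring
    rwa [e, norm_neg]

/-- Straighten the left end of the arc so that it starts in `p`. -/
lemma exists_left (h : IsNearId k p q δ) (hpc : p < c) (hcq : c ≤ q) (hδ : 2 * δ < c - p) :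
    ∃ k', IsNearId k' p q δ ∧ EqOn k' k (Icc c q) ∧ k' p = p ∧
      (∀ u ∈ Ioc p q, p < (k' u).re) ∧
      ((∀ u ∈ Icc p c, k u = u) → ∀ u ∈ Icc p c, k' u = u) := by
  obtain ⟨g, hg, h1, h2, h3, h4⟩ := h.reflect.exists_right (d := -c) (by linarith) (by linarith)
    (by linarith)
  have := hg.reflect
  simp only [neg_neg] at this
  refine ⟨_, this, ?_, ?_, ?_, ?_⟩
  · intro u hu
    have := h1 (show -u ∈ Icc (-q) (-c) from ⟨by linarith [hu.2], by linarith [hu.1]⟩)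
    simp [this]
  · simp [h2]
  · intro u hu
    have := h3 (-u) ⟨by linarith [hu.2], by linarith [hu.1]⟩
    simp only [Complex.neg_re]; linarith
  · intro hid u hu
    have := h4 (fun w hw => by
      rw [hid (-w) ⟨by linarith [hw.2], by linarith [hw.1]⟩]; simp) (-u)
      ⟨by linarith [hu.2], by linarith [hu.1]⟩
    simp [this]

/-- Straighten both ends of the arc. -/
lemma exists_both (h : IsNearId k p q δ) (hpc : p < c) (hcd : c ≤ d) (hdq : d < q)
    (hδ : 2 * δ < c - p) (hδ' : 2 * δ < q - d) {η : ℝ} (hη : δ < η) :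
    ∃ k', IsNearId k' p q δ ∧ IsRectArc k' p q η ∧ EqOn k' k (Icc c d) ∧
      ((∀ u ∈ Icc p c, k u = u) → ∀ u ∈ Icc p c, k' u = u) ∧
      ((∀ u ∈ Icc d q, k u = u) → ∀ u ∈ Icc d q, k' u = u) := by
  obtain ⟨f, hf, f1, f2, f3, f4⟩ := h.exists_right (hpc.le.trans hcd) hdq hδ'
  obtain ⟨g, hg, g1, g2, g3, g4⟩ := hf.exists_left hpc (hcd.trans hdq.le) hδ
  have hpq : p < q := by linarith
  have hδ0 : 0 ≤ δ := (norm_nonneg _).trans (h.near p ⟨le_rfl, hpq.le⟩)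
  refine ⟨g, hg, ⟨hpq, hδ0.trans_lt hη, hg.cont, hg.inj, g2, ?_, ?_⟩, ?_, ?_, ?_⟩
  · rw [g1 ⟨by linarith, le_rfl⟩, f2]
  · intro u hu
    refine ⟨⟨g3 u ⟨hu.1, hu.2.le⟩, ?_⟩, ?_⟩
    · rcases le_total c u with hc | hc
      · rw [g1 ⟨hc, hu.2.le⟩]; exact f3 u ⟨hu.1.le, hu.2⟩
      · have := (hg.re_bounds (Ioo_subset_Icc_self hu)).2
        linarith
    · exact abs_lt.1 ((hg.im_bound (Ioo_subset_Icc_self hu)).trans_lt hη)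
  · intro u hu
    rw [g1 ⟨hu.1, hu.2.trans hdq.le⟩, f1 ⟨hpc.le.trans hu.1, hu.2⟩]
  · intro hid u hu
    refine g4 (fun w hw => ?_) u hu
    rw [f1 ⟨hw.1, hw.2.trans hcd⟩, hid w hw]
  · intro hid u hu
    rw [g1 ⟨hcd.trans hu.1, hu.2⟩, f4 hid u hu]

end IsNearId

/-- The closed reference rectangle. -/
def closedRect : Set ℂ := Icc 0 1 ×ℂ Icc (-1) 1

/-- The open reference rectangle. -/
def openRect : Set ℂ := Ioo 0 1 ×ℂ Ioo (-1) 1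

lemma isCompact_closedRect : IsCompact closedRect := isCompact_Icc.reProdIm isCompact_Icc

lemma openRect_subset : openRect ⊆ closedRect :=
  fun _ h => ⟨Ioo_subset_Icc_self h.1, Ioo_subset_Icc_self h.2⟩

lemma ofReal_mem_closedRect {u : ℝ} (hu : u ∈ Icc (0 : ℝ) 1) : (u : ℂ) ∈ closedRect :=
  ⟨hu, by simp⟩

lemma ofReal_mem_openRect {u : ℝ} (hu : u ∈ Ioo (0 : ℝ) 1) : (u : ℂ) ∈ openRect :=
  ⟨hu, by simp⟩

/-- `F` is a homeomorphism of the reference rectangle onto the closed Jordan domain of `P`. -/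
structure IsChart (F : ℂ → ℂ) (P : Set ℂ) : Prop where
  loop : IsJordanLoop P
  cont : ContinuousOn F closedRect
  bij : BijOn F closedRect (fill P)
  image_frame : F '' (closedRect \ openRect) = P

lemma disjoint_inside_self {K : Set ℂ} : Disjoint (inside K) K :=
  Set.disjoint_left.2 fun z hz hK => by
    have : z ∈ Kᶜ := by rw [compl_eq_inside_union_outside]; exact Or.inl hz
    exact this hK

namespace IsChart

variable {F : ℂ → ℂ} {P : Set ℂ}

lemma mem_inside_iff (h : IsChart F P) {z : ℂ} (hz : z ∈ closedRect) :
    F z ∈ inside P ↔ z ∈ openRect := by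
  constructor
  · intro hi
    by_contra hc
    exact disjoint_inside_self.le_bot ⟨hi, h.image_frame ▸ mem_image_of_mem F ⟨hz, hc⟩⟩
  · intro ho
    rcases h.bij.mapsTo hz with hi | hP
    · exact hi
    · rw [← h.image_frame] at hP
      obtain ⟨w, ⟨hw, hw'⟩, e⟩ := hP
      rw [h.bij.injOn hw hz e] at hw'
      exact absurd ho hw'

lemma isCompact_fill (h : IsChart F P) : IsCompact (fill P) := h.loop.isCompact_closedInside

lemma frontier_fill (h : IsChart F P) : frontier (fill P) ⊆ P := by
  intro z hz
  rcases h.isCompact_fill.isClosed.frontier_subset hz with hi | hP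
  · exact absurd (interior_maximal (subset_union_left : inside P ⊆ fill P)
      (isOpen_inside h.loop.isClosed) hi) hz.2
  · exact hP

/-- The inverse of a chart. -/
def inv (F : ℂ → ℂ) : ℂ → ℂ := Function.invFunOn F closedRect

lemma invOn (h : IsChart F P) : InvOn (inv F) F closedRect (fill P) := h.bij.invOn_invFunOn

lemma mapsTo_inv (h : IsChart F P) : MapsTo (inv F) (fill P) closedRect :=
  h.bij.surjOn.mapsTo_invFunOn

lemma continuousOn_inv (h : IsChart F P) : ContinuousOn (inv F) (fill P) := by
  have := continuousOn_invFunOn_image isCompact_closedRect h.cont h.bij.injOn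
  rwa [h.bij.image_eq] at this

lemma exists_homeomorph (h : IsChart F P) {K : ℂ ≃ₜ ℂ} (hK : ∀ z ∉ openRect, K z = z) {ε : ℝ}
    (hε : ∀ z ∈ closedRect, ‖F (K z) - F z‖ ≤ ε) :
    ∃ H : ℂ ≃ₜ ℂ, (∀ z ∈ closedRect, H (F z) = F (K z)) ∧ (∀ z ∉ inside P, H z = z) ∧
      ∀ z, ‖H z - z‖ ≤ ε := by
  have hm : ∀ (L : ℂ ≃ₜ ℂ), (∀ z ∉ openRect, L z = z) → MapsTo L closedRect closedRect := by
    intro L hL z hz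
    by_contra hc
    have h1 : L (L z) = L z := hL _ fun h => hc (openRect_subset h)
    have h2 : L z = z := L.injective h1
    exact hc (by rwa [h2])
  have hK' : ∀ z ∉ openRect, K.symm z = z := fun z hz => by
    rw [Homeomorph.symm_apply_eq, hK z hz]
  have hb : BijOn K closedRect closedRect :=
    ⟨hm K hK, K.injective.injOn, fun z hz => ⟨K.symm z, hm _ hK' hz, by simp⟩⟩
  have hbG : BijOn (inv F) (fill P) closedRect :=
    ⟨h.mapsTo_inv, h.invOn.2.injOn, fun z hz => ⟨F z, h.bij.mapsTo hz, h.invOn.1 hz⟩⟩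
  have hP : ∀ z ∈ P, F (K (inv F z)) = z := by
    intro z hz
    have hzf : z ∈ fill P := Or.inr hz
    have h1 : inv F z ∉ openRect := by
      rw [← h.mem_inside_iff (h.mapsTo_inv hzf), h.invOn.2 hzf]
      exact fun hi => disjoint_inside_self.le_bot ⟨hi, hz⟩
    rw [hK _ h1, h.invOn.2 hzf]
  obtain ⟨H, h1, h2⟩ := exists_homeomorph_of_bijOn h.isCompact_fill (F := F ∘ K ∘ inv F)
    (h.cont.comp (K.continuous.comp_continuousOn h.continuousOn_inv)
      (hb.mapsTo.comp h.mapsTo_inv)) (h.bij.comp (hb.comp hbG))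
    fun z hz => hP z (h.frontier_fill hz)
  have key : ∀ z ∈ closedRect, H (F z) = F (K z) := fun z hz => by
    rw [h1 _ (h.bij.mapsTo hz), Function.comp, Function.comp, h.invOn.1 hz]
  have hout : ∀ z ∉ inside P, H z = z := fun z hz => by
    by_cases hzP : z ∈ P
    · rw [h1 _ (Or.inr hzP)]; exact hP z hzP
    · exact h2 z fun hf => hf.elim hz hzP
  refine ⟨H, key, hout, fun z => ?_⟩
  by_cases hz : z ∈ fill P
  · obtain ⟨w, hw, rfl⟩ := h.bij.surjOn hz
    rw [key w hw]; exact hε w hw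
  · rw [h2 z hz, sub_self, norm_zero]
    exact (norm_nonneg _).trans (hε 0 ⟨by simp, by simp⟩)

end IsChart

/-- Every parametrized crosscut is the real axis of some chart. -/
lemma exists_isChart {P : Set ℂ} (hP : IsJordanLoop P) {β : ℝ → ℂ}
    (hβ : ContinuousOn β (Icc 0 1)) (hi : InjOn β (Icc 0 1))
    (hc : IsCrosscut P (β '' Icc 0 1) (β 0) (β 1)) :
    ∃ F, IsChart F P ∧ ∀ u ∈ Icc (0 : ℝ) 1, F (u : ℂ) = β u := by
  have h01 : (0 : ℝ) < 1 := zero_lt_one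
  have eQ : closedRect \ openRect = frame 0 1 1 := rfl
  obtain ⟨A', B', hA', hB', hU', hI'⟩ := hP.split hc.2.1 hc.2.2.1 hc.1.ne
  have hmn : (-1 : ℝ) ≠ 0 := by norm_num
  set A := Prod.fst '' gate 1 0 0 0 1 1 0 with hAdef
  set B := Prod.fst '' gate (-1) 0 0 0 1 1 0 with hBdef
  have hgA := isArc_gate_frame (η := 1) h01 one_ne_zero
  have hgB := isArc_gate_frame (η := -1) h01 hmn
  have hA := hgA.image continuous_fst.continuousOn (injOn_fst_gate one_ne_zero h01 h01)
  have hB := hgB.image continuous_fst.continuousOn (injOn_fst_gate hmn h01 h01)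
  simp only [Complex.ofReal_zero, Complex.ofReal_one] at hA hB
  rw [← hAdef] at hA
  rw [← hBdef] at hB
  have hU : A ∪ B = frame 0 1 1 := by
    rw [hAdef, hBdef, ← image_union, gate_union h01 h01, fst_image_diag]
  have hI : A ∩ B ⊆ {0, 1} := by
    rintro _ ⟨⟨z, hz, rfl⟩, ⟨w, hw, e⟩⟩
    have e' : z = w := by
      have h1 := ((mem_gate_iff h01 z).1 hz).1
      have h2 := ((mem_gate_iff h01 w).1 hw).1
      exact Prod.ext e.symm (by rw [← h1, ← h2, e])
    have := gate_inter h01 h01 ⟨hz, e' ▸ hw⟩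
    rcases this with h | h
    · left; simp [h]
    · right; rw [mem_singleton_iff] at h; simp [h]
  obtain ⟨σ, hσ, s1, s2, s3, s4⟩ := hA.exists_pairing hA'
  obtain ⟨τ, hτ, t1, t2, t3, t4⟩ := hB.exists_pairing hB'
  have crossFst : ∀ z ∈ σ, ∀ w ∈ τ, z.1 = w.1 → z = w ∧ (z = (0, β 0) ∨ z = (1, β 1)) := by
    intro z hz w hw e
    have hm : z.1 ∈ A ∩ B := ⟨s1 ▸ mem_image_of_mem _ hz, e ▸ t1 ▸ mem_image_of_mem _ hw⟩
    rcases hI hm with h | h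
    · have z0 : z = (0, β 0) := s3 hz hσ.left_mem h
      have w0 : w = (0, β 0) := t3 hw hτ.left_mem (e ▸ h)
      exact ⟨z0.trans w0.symm, Or.inl z0⟩
    · have z0 : z = (1, β 1) := s3 hz hσ.right_mem h
      have w0 : w = (1, β 1) := t3 hw hτ.right_mem (e ▸ h)
      exact ⟨z0.trans w0.symm, Or.inr z0⟩
  have crossSnd : ∀ z ∈ σ, ∀ w ∈ τ, z.2 = w.2 → z = w := by
    intro z hz w hw e
    have hm : z.2 ∈ A' ∩ B' := ⟨s2 ▸ mem_image_of_mem _ hz, e ▸ t2 ▸ mem_image_of_mem _ hw⟩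
    rw [hI'] at hm
    rcases hm with h | h
    · exact (s4 hz hσ.left_mem h).trans (t4 hw hτ.left_mem (e ▸ h)).symm
    · exact (s4 hz hσ.right_mem h).trans (t4 hw hτ.right_mem (e ▸ h)).symm
  have hστ : σ ∩ τ ⊆ {((0 : ℂ), β 0), ((1 : ℂ), β 1)} :=
    fun z hz => (crossFst z hz.1 z hz.2 rfl).2
  have hcell : IsCell (σ ∪ τ) := ⟨.of_arcs hσ hτ hστ,
    InjOn.union_of_cross s3 t3 fun z hz w hw e => (crossFst z hz w hw e).1,
    InjOn.union_of_cross s4 t4 crossSnd⟩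
  have f1 : Prod.fst '' (σ ∪ τ) = frame 0 1 1 := by rw [image_union, s1, t1, hU]
  have f2 : Prod.snd '' (σ ∪ τ) = P := by rw [image_union, s2, t2, hU']
  set κ : Set (ℂ × ℂ) := (fun u : ℝ => ((u : ℂ), β u)) '' Icc 0 1 with hκdef
  have hpair : ContinuousOn (fun u : ℝ => ((u : ℂ), β u)) (Icc 0 1) :=
    Complex.continuous_ofReal.continuousOn.prodMk hβ
  have hκ : IsArc κ ((0 : ℂ), β 0) ((1 : ℂ), β 1) := by
    have := isArc_image_Icc h01 hpair fun u hu w hw e => by simpa using congrArg Prod.fst e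
    simpa using this
  have k1 : InjOn Prod.fst κ := by
    rintro _ ⟨u, hu, rfl⟩ _ ⟨w, hw, rfl⟩ e
    have : u = w := Complex.ofReal_injective e
    rw [this]
  have k2 : InjOn Prod.snd κ := by
    rintro _ ⟨u, hu, rfl⟩ _ ⟨w, hw, rfl⟩ e
    rw [hi hu hw e]
  have e2 : Prod.snd '' κ = β '' Icc 0 1 := by rw [hκdef, image_image]
  have hsplit : IsSplit (σ ∪ τ) (σ ∪ κ) (τ ∪ κ) := by
    refine ⟨hcell, σ, τ, κ, _, _, hσ, hτ, hστ, rfl, hκ, k1, k2, ?_, ?_, rfl, rfl⟩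
    · rw [f1, ← eQ]
      refine ⟨hκ.image continuous_fst.continuousOn k1, ⟨⟨by simp, by simp⟩, fun h => h.1.1.ne rfl⟩,
        ⟨⟨by simp, by simp⟩, fun h => h.1.2.ne rfl⟩, ?_⟩
      rw [eQ, inside_frame h01 h01]
      rintro _ ⟨⟨_, ⟨u, hu, rfl⟩, rfl⟩, hne⟩
      refine ofReal_mem_openRect ⟨lt_of_le_of_ne hu.1 ?_, lt_of_le_of_ne hu.2 ?_⟩
      · rintro rfl; exact hne (Or.inl (by simp))
      · rintro rfl; exact hne (Or.inr (by simp))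
    · rw [f2, e2]; exact hc
  have hsub := IsSubdivision.split hsplit (.refl hsplit.isCell_left) (.refl hsplit.isCell_right)
  obtain ⟨F, hF, hb, -, hFS⟩ := schoenflies hsub
  rw [f1, fill_frame h01 h01] at hF hb
  rw [f2] at hb
  have hFρ : ∀ z ∈ σ ∪ τ, F z.1 = z.2 := fun z hz => by
    obtain ⟨s, hs, hzs⟩ := hsub.exists_mem z hz
    exact hFS s hs z hzs
  refine ⟨F, ⟨hP, hF, hb, ?_⟩, fun u hu => ?_⟩
  · rw [eQ, ← f1, ← f2, image_image]
    exact image_congr hFρ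
  · exact hFS (σ ∪ κ) (Or.inl rfl) _ (Or.inr ⟨u, hu, rfl⟩)

/-- `h` embeds `G` and moves points by less than `δ`. -/
structure IsMove (G : Set ℂ) (h : ℂ → ℂ) (δ : ℝ) : Prop where
  cont : ContinuousOn h G
  inj : InjOn h G
  near : ∀ z ∈ G, ‖h z - z‖ < δ

lemma IsMove.mono {G : Set ℂ} {h : ℂ → ℂ} {δ δ' : ℝ} (hm : IsMove G h δ) (hδ : δ ≤ δ') :
    IsMove G h δ' := ⟨hm.cont, hm.inj, fun z hz => (hm.near z hz).trans_le hδ⟩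

/-- Small moves of `G` are realized on `X` by small homeomorphisms of the plane. -/
def Good (G X : Set ℂ) : Prop :=
  ∀ ε > 0, ∃ δ > 0, ∀ h, IsMove G h δ →
    ∃ H : ℂ ≃ₜ ℂ, (∀ z ∈ X, H z = h z) ∧ ∀ z, ‖H z - z‖ < ε

/-- Small moves of `G` that fix `X` are realized on `X ∪ E` by small homeomorphisms of the
plane. -/
def Step (G X E : Set ℂ) : Prop :=
  ∀ ε > 0, ∃ δ > 0, ∀ h, IsMove G h δ → (∀ z ∈ X, h z = z) →
    ∃ H : ℂ ≃ₜ ℂ, (∀ z ∈ X ∪ E, H z = h z) ∧ ∀ z, ‖H z - z‖ < ε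

lemma Good.mono {G X Y : Set ℂ} (h : Good G Y) (hXY : X ⊆ Y) : Good G X := fun ε hε => by
  obtain ⟨δ, hδ, hh⟩ := h ε hε
  refine ⟨δ, hδ, fun f hf => ?_⟩
  obtain ⟨H, h1, h2⟩ := hh f hf
  exact ⟨H, fun z hz => h1 z (hXY hz), h2⟩

lemma Step.mono {G X E E' : Set ℂ} (h : Step G X E) (hE : E' ⊆ E) : Step G X E' :=
  fun ε hε => by
    obtain ⟨δ, hδ, hh⟩ := h ε hε
    refine ⟨δ, hδ, fun f hf hid => ?_⟩
    obtain ⟨H, h1, h2⟩ := hh f hf hid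
    exact ⟨H, fun z hz => h1 z (union_subset_union_right _ hE hz), h2⟩

lemma good_empty (G : Set ℂ) : Good G ∅ := fun ε hε =>
  ⟨1, one_pos, fun _ _ => ⟨Homeomorph.refl ℂ, by simp, by simpa using hε⟩⟩

lemma Good.step {G X E : Set ℂ} (h : Good G X) (hs : Step G X E) : Good G (X ∪ E) := by
  intro ε hε
  obtain ⟨δ₂, hδ₂, h2⟩ := hs (ε / 2) (half_pos hε)
  obtain ⟨δ₁, hδ₁, h1⟩ := h (min (ε / 2) (δ₂ / 2)) (by positivity)
  refine ⟨min δ₁ (δ₂ / 2), by positivity, fun f hf => ?_⟩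
  obtain ⟨H₁, e1, n1⟩ := h1 f (hf.mono (min_le_left _ _))
  have hinv : ∀ w, ‖H₁.symm w - w‖ < δ₂ / 2 := fun w => by
    have := n1 (H₁.symm w)
    rw [Homeomorph.apply_symm_apply, norm_sub_rev] at this
    exact this.trans_le (min_le_right _ _)
  obtain ⟨H₂, e2, n2⟩ := h2 (fun z => H₁.symm (f z)) ⟨H₁.symm.continuous.comp_continuousOn hf.cont,
    fun x hx y hy e => hf.inj hx hy (H₁.symm.injective e), fun z hz => by
      have a := hinv (f z)
      have b := (hf.near z hz).trans_le (min_le_right _ _)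
      calc ‖H₁.symm (f z) - z‖ = ‖(H₁.symm (f z) - f z) + (f z - z)‖ := by congr 1; ring
        _ ≤ _ := norm_add_le _ _
        _ < δ₂ := by linarith⟩ fun z hz => by rw [← e1 z hz]; simp
  refine ⟨H₂.trans H₁, fun z hz => ?_, fun z => ?_⟩
  · simp [e2 z hz]
  · have a := n2 z
    have b := (n1 (H₂ z)).trans_le (min_le_left _ _)
    calc ‖H₁ (H₂ z) - z‖ = ‖(H₁ (H₂ z) - H₂ z) + (H₂ z - z)‖ := by congr 1; ring
      _ ≤ _ := norm_add_le _ _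
      _ < ε := by linarith

namespace IsChart

variable {F : ℂ → ℂ} {P G X : Set ℂ} {p c d q : ℝ}

lemma continuousOn_real (h : IsChart F P) (hp : 0 ≤ p) (hq : q ≤ 1) :
    ContinuousOn (fun u : ℝ => F u) (Icc p q) :=
  h.cont.comp Complex.continuous_ofReal.continuousOn
    fun _ hu => ofReal_mem_closedRect ⟨hp.trans hu.1, hu.2.trans hq⟩

lemma injOn_real (h : IsChart F P) (hp : 0 ≤ p) (hq : q ≤ 1) :
    InjOn (fun u : ℝ => F u) (Icc p q) := fun _ hu _ hw e =>
  Complex.ofReal_injective (h.bij.injOn (ofReal_mem_closedRect ⟨hp.trans hu.1, hu.2.trans hq⟩)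
    (ofReal_mem_closedRect ⟨hp.trans hw.1, hw.2.trans hq⟩) e)

/-- Small rectangle arcs are realized in the chart by small homeomorphisms of the plane. -/
lemma exists_move (h : IsChart F P) (hp : 0 ≤ p) (hpq : p < q) (hq : q ≤ 1) {σ : ℝ}
    (hσ : 0 < σ) (hσ1 : σ ≤ 1) {ε : ℝ} (hε : 0 < ε) : ∃ δ > 0, ∃ η, δ < η ∧ ∀ k, IsNearId k p q δ → IsRectArc k p q η →
      ∃ H : ℂ ≃ₜ ℂ, (∀ u ∈ Icc p q, H (F (u : ℂ)) = F (k u)) ∧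
        (∀ z ∉ F '' (Ioo p q ×ℂ Ioo (-σ) σ), H z = z) ∧ ∀ z, ‖H z - z‖ < ε := by
  have hu := isCompact_closedRect.uniformContinuousOn_of_continuous h.cont
  rw [Metric.uniformContinuousOn_iff] at hu
  obtain ⟨δ₁, hδ₁, hF⟩ := hu (ε / 2) (half_pos hε)
  obtain ⟨n, hn⟩ := exists_nat_one_div_lt (show 0 < δ₁ / 6 by positivity)
  set η := min (σ / 2) (δ₁ / 5) with hη
  have hη0 : 0 < η := by positivity
  have hw : 0 < (q - p) / (n + 1) := div_pos (sub_pos.2 hpq) (by positivity)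
  refine ⟨min (η / 2) ((q - p) / (n + 1) / 6), by positivity, η,
    (min_le_left _ _).trans_lt (by linarith), fun k hk hr => ?_⟩
  obtain ⟨K, k1, k2, k3⟩ := hr.exists_homeomorph n hk.near (by
    have := min_le_right (η / 2) ((q - p) / (n + 1) / 6); linarith)
  have hη1 : η ≤ σ / 2 := min_le_left _ _
  have hη2 : η ≤ δ₁ / 5 := min_le_right _ _
  have hsm : ∀ z, ‖K z - z‖ < δ₁ := fun z => (k3 z).trans_lt (by
    have : (q - p) / (n + 1) ≤ 1 / (n + 1) := by gcongr; linarith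
    linarith)
  have hK : ∀ z ∉ Ioo p q ×ℂ Ioo (-σ) σ, K z = z := fun z hz => k1 z fun hz' =>
    hz ⟨hz'.1, ⟨by linarith [hz'.2.1], by linarith [hz'.2.2]⟩⟩
  have hsub : Ioo p q ×ℂ Ioo (-σ) σ ⊆ openRect := fun z hz => ⟨⟨by linarith [hz.1.1],
    by linarith [hz.1.2]⟩, ⟨by linarith [hz.2.1], by linarith [hz.2.2]⟩⟩
  have hmem : ∀ z ∈ closedRect, K z ∈ closedRect := by
    intro z hz
    by_cases hz' : z ∈ Ioo p q ×ℂ Ioo (-σ) σ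
    · by_contra hc
      have h1 : K (K z) = K z := hK _ fun h' => hc (openRect_subset (hsub h'))
      have h2 : K z = z := K.injective h1
      exact hc (by rwa [h2])
    · rwa [hK z hz']
  obtain ⟨H, H1, H2, H3⟩ := h.exists_homeomorph (K := K) (fun z hz => hK z fun h' => hz (hsub h'))
    (ε := ε / 2) fun z hz => by
      rw [← dist_eq_norm]
      exact (hF _ (hmem z hz) _ hz (by rw [dist_eq_norm]; exact hsm z)).le
  refine ⟨H, fun u hu => ?_, fun z hz => ?_, fun z => (H3 z).trans_lt (half_lt_self hε)⟩
  · rw [H1 _ (ofReal_mem_closedRect ⟨hp.trans hu.1, hu.2.trans hq⟩), k2 u hu]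
  · by_cases hzf : z ∈ fill P
    · obtain ⟨w, hw, rfl⟩ := h.bij.surjOn hzf
      rw [H1 w hw, hK w fun h' => hz (mem_image_of_mem F h')]
    · exact H2 z fun hi => hzf (Or.inl hi)

/-- Small moves are near the identity in the chart. -/
lemma exists_near (h : IsChart F P) (hp : 0 ≤ p) (hq : q ≤ 1)
    (hG : ∀ u ∈ Icc p q, F (u : ℂ) ∈ G) {δ₀ : ℝ} (hδ₀ : 0 < δ₀) :
    ∃ δ > 0, ∀ f, IsMove G f δ → (∀ u ∈ Icc p q, f (F (u : ℂ)) ∈ fill P) →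
      IsNearId (fun u => inv F (f (F (u : ℂ)))) p q δ₀ := by
  have hu := h.isCompact_fill.uniformContinuousOn_of_continuous h.continuousOn_inv
  rw [Metric.uniformContinuousOn_iff] at hu
  obtain ⟨δ, hδ, hi⟩ := hu δ₀ hδ₀
  refine ⟨δ, hδ, fun f hf hfill => ⟨?_, ?_, ?_⟩⟩
  · exact h.continuousOn_inv.comp (hf.cont.comp (h.continuousOn_real hp hq) hG) hfill
  · intro u hu w hw e
    exact h.injOn_real hp hq hu hw
      (hf.inj (hG u hu) (hG w hw) (h.invOn.2.injOn (hfill u hu) (hfill w hw) e))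
  · intro u hu
    have hQ := ofReal_mem_closedRect ⟨hp.trans hu.1, hu.2.trans hq⟩
    have := hi _ (hfill u hu) _ (h.bij.mapsTo hQ) (by
      rw [dist_eq_norm]; exact hf.near _ (hG u hu))
    rw [h.invOn.1 hQ, dist_eq_norm] at this
    exact this.le

lemma inv_eq (h : IsChart F P) {u : ℝ} (hu : u ∈ Icc (0 : ℝ) 1) : inv F (F (u : ℂ)) = u :=
  h.invOn.1 (ofReal_mem_closedRect hu)

/-- Adjusting the inner part of a chart axis. -/
lemma step_inner (h : IsChart F P) (hp : 0 < p) (hpc : p < c) (hcd : c ≤ d) (hdq : d < q)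
    (hq : q < 1) {σ : ℝ} (hσ : 0 < σ) (hσ1 : σ ≤ 1) (hG : ∀ u ∈ Icc p q, F (u : ℂ) ∈ G)
    (hX : ∀ z ∈ X, z ∈ F '' (Ioo p q ×ℂ Ioo (-σ) σ) →
      (z ∈ (fun u : ℝ => F u) '' Icc p c ∧ (fun u : ℝ => F u) '' Icc p c ⊆ X) ∨
      (z ∈ (fun u : ℝ => F u) '' Icc d q ∧ (fun u : ℝ => F u) '' Icc d q ⊆ X)) :
    Step G X ((fun u : ℝ => F u) '' Icc c d) := by
  intro ε hε
  have hpq : p < q := by linarith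
  have hI : ∀ u ∈ Icc p q, u ∈ Icc (0 : ℝ) 1 := fun u hu => ⟨by linarith [hu.1], by linarith [hu.2]⟩
  obtain ⟨δ₀, hδ₀, η, hη, hmv⟩ := h.exists_move hp.le hpq hq.le hσ hσ1 hε
  set δ₁ := min δ₀ (min ((c - p) / 3) ((q - d) / 3)) with hδ₁
  have hδ₁0 : 0 < δ₁ := by
    have := sub_pos.2 hpc; have := sub_pos.2 hdq; positivity
  have d1 : δ₁ ≤ δ₀ := min_le_left _ _
  have d2 : δ₁ ≤ (c - p) / 3 := (min_le_right _ _).trans (min_le_left _ _)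
  have d3 : δ₁ ≤ (q - d) / 3 := (min_le_right _ _).trans (min_le_right _ _)
  obtain ⟨δ₂, hδ₂, hnear⟩ := h.exists_near hp.le hq.le hG hδ₁0
  have hcpt : IsCompact ((fun u : ℝ => F u) '' Icc p q) :=
    isCompact_Icc.image_of_continuousOn (h.continuousOn_real hp.le hq.le)
  obtain ⟨δ₃, hδ₃, hth⟩ := hcpt.exists_thickening_subset_open (isOpen_inside h.loop.isClosed) (by
    rintro _ ⟨u, hu, rfl⟩
    rw [h.mem_inside_iff (ofReal_mem_closedRect (hI u hu))]
    exact ofReal_mem_openRect ⟨by linarith [hu.1], by linarith [hu.2]⟩)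
  refine ⟨min δ₂ δ₃, by positivity, fun f hf hid => ?_⟩
  have hfill : ∀ u ∈ Icc p q, f (F (u : ℂ)) ∈ fill P := fun u hu => Or.inl (hth (by
    rw [mem_thickening_iff]
    refine ⟨F u, ⟨u, hu, rfl⟩, ?_⟩
    rw [dist_eq_norm]
    exact (hf.near _ (hG u hu)).trans_le (min_le_right _ _)))
  have hk := hnear f (hf.mono (min_le_left _ _)) hfill
  obtain ⟨k, hkn, hkr, e1, e2, e3⟩ := hk.exists_both hpc hcd hdq (by linarith) (by linarith)
    (d1.trans_lt hη)
  obtain ⟨H, H1, H2, H3⟩ := hmv k ⟨hkn.cont, hkn.inj, fun u hu => (hkn.near u hu).trans d1⟩ hkr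
  refine ⟨H, ?_, H3⟩
  rintro z (hz | ⟨u, hu, rfl⟩)
  · rw [hid z hz]
    by_cases hz' : z ∈ F '' (Ioo p q ×ℂ Ioo (-σ) σ)
    · rcases hX z hz hz' with ⟨⟨u, hu, rfl⟩, hs⟩ | ⟨⟨u, hu, rfl⟩, hs⟩
      · simp only
        rw [H1 u ⟨hu.1, by linarith [hu.2]⟩, e2 _ u hu]
        intro w hw
        rw [hid _ (hs ⟨w, hw, rfl⟩), h.inv_eq (hI w ⟨hw.1, by linarith [hw.2]⟩)]
      · simp only
        rw [H1 u ⟨by linarith [hu.1], hu.2⟩, e3 _ u hu]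
        intro w hw
        rw [hid _ (hs ⟨w, hw, rfl⟩), h.inv_eq (hI w ⟨by linarith [hw.1], hw.2⟩)]
    · exact H2 z hz'
  · have hu' : u ∈ Icc p q := ⟨hpc.le.trans hu.1, hu.2.trans hdq.le⟩
    simp only
    rw [H1 u hu', e1 hu]
    exact h.invOn.2 (hfill u hu')

/-- Adjusting a segment of a chart axis, relative to a closed set off the axis and to adjacent
segments of the axis. -/
lemma step_axis (h : IsChart F P) (hc : 0 < c) (hcd : c ≤ d) (hd : d < 1)
    (hG : ∀ u ∈ Icc (0 : ℝ) 1, F (u : ℂ) ∈ G) {X₀ : Set ℂ} (hX₀ : IsClosed X₀)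
    (hdis : ∀ u ∈ Ioo (0 : ℝ) 1, F (u : ℂ) ∉ X₀)
    (hX : ∀ z ∈ X, z ∈ X₀ ∨
      (z ∈ (fun u : ℝ => F u) '' Icc 0 c ∧ (fun u : ℝ => F u) '' Icc 0 c ⊆ X) ∨
      (z ∈ (fun u : ℝ => F u) '' Icc d 1 ∧ (fun u : ℝ => F u) '' Icc d 1 ⊆ X)) :
    Step G X ((fun u : ℝ => F u) '' Icc c d) := by
  have hD : IsClosed (closedRect ∩ F ⁻¹' X₀) :=
    h.cont.preimage_isClosed_of_isClosed isCompact_closedRect.isClosed hX₀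
  have hS : IsCompact ((fun u : ℝ => (u : ℂ)) '' Icc (c / 2) ((1 + d) / 2)) :=
    isCompact_Icc.image Complex.continuous_ofReal
  obtain ⟨σ, hσ, hth⟩ := hS.exists_thickening_subset_open hD.isOpen_compl (by
    rintro _ ⟨u, hu, rfl⟩ hm
    exact hdis u ⟨by linarith [hu.1], by linarith [hu.2]⟩ hm.2)
  have hI : ∀ {s t : ℝ}, 0 ≤ s → t ≤ 1 → ∀ u ∈ Icc s t, (u : ℂ) ∈ closedRect :=
    fun hs ht u hu => ofReal_mem_closedRect ⟨hs.trans hu.1, hu.2.trans ht⟩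
  refine h.step_inner (p := c / 2) (q := (1 + d) / 2) (σ := min σ 1) (by linarith) (by linarith)
    hcd (by linarith) (by linarith) (by positivity) (min_le_right _ _)
    (fun u hu => hG u ⟨by linarith [hu.1], by linarith [hu.2]⟩) fun z hz => ?_
  rintro ⟨w, ⟨hw1, hw2⟩, rfl⟩
  simp only [mem_preimage, mem_Ioo] at hw1 hw2
  have hwR : w ∈ closedRect := ⟨⟨by linarith [hw1.1], by linarith [hw1.2]⟩,
    ⟨by linarith [hw2.1, min_le_right σ 1], by linarith [hw2.2, min_le_right σ 1]⟩⟩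
  rcases hX _ hz with h0 | ⟨⟨u, hu, e⟩, hs⟩ | ⟨⟨u, hu, e⟩, hs⟩
  · refine absurd ⟨hwR, h0⟩ (hth ?_)
    rw [mem_thickening_iff]
    refine ⟨(w.re : ℂ), ⟨w.re, ⟨hw1.1.le, hw1.2.le⟩, rfl⟩, ?_⟩
    have : w - (w.re : ℂ) = w.im * Complex.I := by
      apply Complex.ext <;> simp
    rw [dist_eq_norm, this, norm_mul, Complex.norm_I, mul_one, Complex.norm_real, Real.norm_eq_abs,
      abs_lt]
    exact ⟨by linarith [hw2.1, min_le_left σ 1], by linarith [hw2.2, min_le_left σ 1]⟩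
  · have : (u : ℂ) = w := h.bij.injOn (hI le_rfl (by linarith) u hu) hwR e
    subst this
    rw [Complex.ofReal_re] at hw1
    exact Or.inl ⟨⟨u, ⟨hw1.1.le, hu.2⟩, rfl⟩,
      (image_mono (Icc_subset_Icc_left (by linarith))).trans hs⟩
  · have : (u : ℂ) = w := h.bij.injOn (hI (by linarith) le_rfl u hu) hwR e
    subst this
    rw [Complex.ofReal_re] at hw1
    exact Or.inr ⟨⟨u, ⟨hu.1, hw1.2.le⟩, rfl⟩,
      (image_mono (Icc_subset_Icc_right (by linarith))).trans hs⟩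

/-- Adjusting a leg that starts at a fixed boundary point. -/
lemma step_leg (h : IsChart F P) (hd : 0 < d) (hdq : d < q) (hq : q < 1)
    (hG : ∀ u ∈ Icc 0 q, F (u : ℂ) ∈ G) (hXG : X ⊆ G) (hX : Disjoint X (inside P)) {r : ℝ}
    (hr : 0 < r) (hPX : P ∩ ball (F 0) r ⊆ X) :
    Step G X ((fun u : ℝ => F u) '' Icc 0 d) := by
  intro ε hε
  have hq0 : 0 < q := by linarith
  have hI : ∀ u ∈ Icc 0 q, u ∈ Icc (0 : ℝ) 1 := fun u hu => ⟨hu.1, by linarith [hu.2]⟩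
  obtain ⟨δ₀, hδ₀, η, hη, hmv⟩ := h.exists_move le_rfl hq0 hq.le one_pos le_rfl hε
  set δ₁ := min δ₀ (min (d / 3) ((q - d) / 3)) with hδ₁
  have hδ₁0 : 0 < δ₁ := by have := sub_pos.2 hdq; positivity
  have d1 : δ₁ ≤ δ₀ := min_le_left _ _
  have d2 : δ₁ ≤ d / 3 := (min_le_right _ _).trans (min_le_left _ _)
  have d3 : δ₁ ≤ (q - d) / 3 := (min_le_right _ _).trans (min_le_right _ _)
  obtain ⟨δ₂, hδ₂, hnear⟩ := h.exists_near le_rfl hq.le hG hδ₁0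
  have h0P : F 0 ∈ P := by
    rw [← h.image_frame]
    exact ⟨0, ⟨⟨by simp, by simp⟩, fun h => h.1.1.ne rfl⟩, rfl⟩
  have h0X : F 0 ∈ X := hPX ⟨h0P, mem_ball_self hr⟩
  have hin : ∀ u ∈ Ioc 0 q, F (u : ℂ) ∈ inside P := fun u hu => by
    rw [h.mem_inside_iff (ofReal_mem_closedRect (hI u ⟨hu.1.le, hu.2⟩))]
    exact ofReal_mem_openRect ⟨hu.1, by linarith [hu.2]⟩
  have hFc := h.continuousOn_real le_rfl hq.le
  have hCc : IsCompact (Icc 0 q ∩ (fun u : ℝ => F u) ⁻¹' (ball (F 0) (r / 2))ᶜ) :=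
    isCompact_Icc.of_isClosed_subset (hFc.preimage_isClosed_of_isClosed isClosed_Icc
      isOpen_ball.isClosed_compl) inter_subset_left
  set C := insert q (Icc 0 q ∩ (fun u : ℝ => F u) ⁻¹' (ball (F 0) (r / 2))ᶜ) with hC
  have hCs : C ⊆ Ioc 0 q := by
    rintro u (rfl | ⟨hu, hu'⟩)
    · exact ⟨hq0, le_rfl⟩
    · refine ⟨lt_of_le_of_ne hu.1 ?_, hu.2⟩
      rintro rfl
      exact hu' (by simpa using half_pos hr)
  obtain ⟨δ₃, hδ₃, hth⟩ := ((hCc.insert q).image_of_continuousOn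
    (hFc.mono (hCs.trans Ioc_subset_Icc_self))).exists_thickening_subset_open
      (isOpen_inside h.loop.isClosed) (by rintro _ ⟨u, hu, rfl⟩; exact hin u (hCs hu))
  refine ⟨min δ₂ (min δ₃ (r / 2)), by positivity, fun f hf hid => ?_⟩
  have hCf : ∀ u ∈ C, f (F (u : ℂ)) ∈ inside P := fun u hu => hth (by
    rw [mem_thickening_iff]
    refine ⟨F u, ⟨u, hu, rfl⟩, ?_⟩
    rw [dist_eq_norm]
    exact (hf.near _ (hG u (Ioc_subset_Icc_self (hCs hu)))).trans_le
      ((min_le_right _ _).trans (min_le_left _ _)))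
  have hfin : ∀ u ∈ Ioc 0 q, f (F (u : ℂ)) ∈ inside P := by
    have hsub : (fun u : ℝ => f (F (u : ℂ))) '' Ioc 0 q ⊆ inside P := by
      refine subset_inside_of_preconnected h.loop.isClosed (a := f (F (q : ℂ))) ?_ ?_
        ⟨q, ⟨hq0, le_rfl⟩, rfl⟩ (hCf q (mem_insert _ _))
      · exact isPreconnected_Ioc.image _ ((hf.cont.comp hFc hG).mono Ioc_subset_Icc_self)
      · rw [Set.disjoint_left]
        rintro _ ⟨u, hu, rfl⟩ hP
        by_cases hb : F (u : ℂ) ∈ ball (F 0) (r / 2)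
        · have hm : f (F (u : ℂ)) ∈ X := hPX ⟨hP, by
            have h1 := (hf.near _ (hG u (Ioc_subset_Icc_self hu))).trans_le
              ((min_le_right _ _).trans (min_le_right _ _))
            rw [← dist_eq_norm] at h1
            rw [mem_ball] at hb ⊢
            linarith [dist_triangle (f (F (u : ℂ))) (F u) (F 0)]⟩
          have h2 := hf.inj (hXG hm) (hG u (Ioc_subset_Icc_self hu)) (hid _ hm)
          exact hX.le_bot ⟨hm, by rw [h2]; exact hin u hu⟩
        · exact disjoint_inside_self.le_bot
            ⟨hCf u (mem_insert_of_mem _ ⟨Ioc_subset_Icc_self hu, hb⟩), hP⟩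
    exact fun u hu => hsub ⟨u, hu, rfl⟩
  have hf0 : f (F ((0 : ℝ) : ℂ)) = F ((0 : ℝ) : ℂ) := hid _ (by simpa using h0X)
  have hfill : ∀ u ∈ Icc 0 q, f (F (u : ℂ)) ∈ fill P := fun u hu => by
    rcases hu.1.eq_or_lt with rfl | h0
    · rw [hf0]; right; simpa using h0P
    · exact Or.inl (hfin u ⟨h0, hu.2⟩)
  have hk := hnear f (hf.mono (min_le_left _ _)) hfill
  obtain ⟨k, hkn, e1, e2, e3, -⟩ := hk.exists_right hd.le hdq (by linarith)
  have hkr : IsRectArc k 0 q η := by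
    refine ⟨hq0, hδ₀.trans hη, hkn.cont, hkn.inj, ?_, e2, fun u hu => ⟨⟨?_, ?_⟩, ?_⟩⟩
    · rw [e1 ⟨le_rfl, hd.le⟩]
      simp only
      rw [hf0, h.inv_eq (by simp)]
    · rcases le_total u d with hud | hud
      · rw [e1 ⟨hu.1.le, hud⟩]
        have h3 := hfin u ⟨hu.1, hu.2.le⟩
        have h4 : F (inv F (f (F u))) ∈ inside P := by rw [h.invOn.2 (Or.inl h3)]; exact h3
        exact ((h.mem_inside_iff (h.mapsTo_inv (Or.inl h3))).1 h4).1.1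
      · have := (hkn.re_bounds (Ioo_subset_Icc_self hu)).1
        linarith
    · exact e3 u ⟨hu.1.le, hu.2⟩
    · exact abs_lt.1 (((hkn.im_bound (Ioo_subset_Icc_self hu)).trans d1).trans_lt hη)
  obtain ⟨H, H1, H2, H3⟩ := hmv k ⟨hkn.cont, hkn.inj, fun u hu => (hkn.near u hu).trans d1⟩ hkr
  refine ⟨H, ?_, H3⟩
  rintro z (hz | ⟨u, hu, rfl⟩)
  · rw [hid z hz]
    refine H2 z fun ⟨w, hw, e⟩ => hX.le_bot ⟨hz, ?_⟩
    have hwo : w ∈ openRect := ⟨⟨hw.1.1, by linarith [hw.1.2]⟩, hw.2⟩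
    rw [← e, h.mem_inside_iff (openRect_subset hwo)]
    exact hwo
  · have hu' : u ∈ Icc 0 q := ⟨hu.1, hu.2.trans hdq.le⟩
    simp only
    rw [H1 u hu', e1 hu]
    exact h.invOn.2 (hfill u hu')

end IsChart

lemma isJordanLoop_sphere (v : ℂ) {R : ℝ} (hR : 0 < R) : IsJordanLoop (sphere v R) := by
  refine ⟨fun t => circleMap v R (2 * Real.pi * t), ?_, ?_, ?_, ?_⟩
  · exact (continuous_circleMap v R).comp (by fun_prop)
  · intro t
    simp only [mul_add, mul_one]
    exact periodic_circleMap v R _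
  · intro x hx y hy e
    have hpi := Real.two_pi_pos
    rw [circleMap_eq_circleMap_iff v hR.ne'] at e
    obtain ⟨n, hn⟩ := e
    have h1 : (2 * Real.pi * x : ℝ) = 2 * Real.pi * y + n * (2 * Real.pi) := by
      have := congrArg Complex.im hn
      simpa using this
    have h2 : x = y + n := by
      have : 2 * Real.pi * x = 2 * Real.pi * (y + n) := by linarith
      exact mul_left_cancel₀ hpi.ne' this
    have h3 : (-1 : ℝ) < n := by linarith [hx.1, hy.2]
    have h4 : (n : ℝ) < 1 := by linarith [hx.2, hy.1]
    have h5 : n = 0 := by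
      have : (-1 : ℤ) < n := by exact_mod_cast h3
      have : n < 1 := by exact_mod_cast h4
      omega
    simpa [h5] using h2
  · rw [← abs_of_pos hR, ← range_circleMap v R]
    have : Function.Surjective fun t : ℝ => 2 * Real.pi * t := fun y =>
      ⟨y / (2 * Real.pi), by field_simp⟩
    rw [abs_of_pos hR]
    exact this.range_comp (circleMap v R)

lemma inside_sphere (v : ℂ) {R : ℝ} (hR : 0 < R) : inside (sphere v R) = ball v R := by
  have hJ := isJordanLoop_sphere v hR
  have hsub : inside (sphere v R) ⊆ ball v R := fun z hz => by
    have h1 := inside_subset_of_convex (convex_closedBall v R) sphere_subset_closedBall hz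
    have h2 : z ∉ sphere v R := fun h => disjoint_inside_self.le_bot ⟨hz, h⟩
    rw [mem_closedBall] at h1
    rw [mem_sphere] at h2
    exact lt_of_le_of_ne h1 h2
  refine hsub.antisymm ?_
  obtain ⟨a, ha⟩ := hJ.inside_nonempty
  exact subset_inside_of_preconnected hJ.isClosed (convex_ball v R).isPreconnected
    sphere_disjoint_ball.symm (hsub ha) ha

/-- A leg of the disc `ball v R`: an arc from the centre to the boundary circle. -/
structure IsLeg (ℓ : ℝ → ℂ) (v : ℂ) (R : ℝ) : Prop where
  cont : ContinuousOn ℓ (Icc 0 1)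
  inj : InjOn ℓ (Icc 0 1)
  zero : ℓ 0 = v
  one : ℓ 1 ∈ sphere v R
  mem : ∀ u ∈ Ico (0 : ℝ) 1, ℓ u ∈ ball v R

namespace IsLeg

variable {ℓ ℓ' : ℝ → ℂ} {v : ℂ} {R : ℝ}

lemma pos (h : IsLeg ℓ v R) : 0 < R := by
  have := h.mem 0 (by simp)
  exact pos_of_mem_ball this

lemma isArc (h : IsLeg ℓ v R) : IsArc (ℓ '' Icc 0 1) v (ℓ 1) :=
  ⟨ℓ, h.cont, h.inj, h.zero, rfl, rfl⟩

lemma diff_subset (h : IsLeg ℓ v R) : ℓ '' Icc 0 1 \ {v, ℓ 1} ⊆ inside (sphere v R) := by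
  rintro _ ⟨⟨u, hu, rfl⟩, hn⟩
  rw [inside_sphere v h.pos]
  exact h.mem u ⟨hu.1, lt_of_le_of_ne hu.2 fun e => hn (by simp [e])⟩

lemma subset_fill (h : IsLeg ℓ v R) : ℓ '' Icc 0 1 ⊆ inside (sphere v R) ∪ sphere v R := by
  rintro _ ⟨u, hu, rfl⟩
  rcases hu.2.eq_or_lt with rfl | h1
  · exact Or.inr h.one
  · left
    rw [inside_sphere v h.pos]
    exact h.mem u ⟨hu.1, h1⟩

lemma one_notMem_inside (h : IsLeg ℓ v R) : ℓ 1 ∉ inside (sphere v R) := fun h' =>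
  disjoint_inside_self.le_bot ⟨h', h.one⟩

/-- Two legs form a crosscut of the disc. -/
lemma isCrosscut (h : IsLeg ℓ v R) (h' : IsLeg ℓ' v R)
    (hd : ℓ '' Icc 0 1 ∩ ℓ' '' Icc 0 1 ⊆ {v}) :
    IsCrosscut (sphere v R) (ℓ '' Icc 0 1 ∪ ℓ' '' Icc 0 1) (ℓ 1) (ℓ' 1) := by
  have hv : v ∈ inside (sphere v R) := by
    rw [inside_sphere v h.pos]; exact mem_ball_self h.pos
  refine ⟨h.isArc.symm.trans h'.isArc hd, h.one, h'.one, ?_⟩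
  rintro z ⟨hz | hz, hn⟩
  · by_cases e : z = v
    · rwa [e]
    · exact h.diff_subset ⟨hz, fun h => h.elim e fun h => hn (Or.inl h)⟩
  · by_cases e : z = v
    · rwa [e]
    · exact h'.diff_subset ⟨hz, fun h => h.elim e fun h => hn (Or.inr h)⟩

end IsLeg

/-- A crosscut-free arc stays in one of the two halves cut off by a crosscut. -/
lemma IsCrosscut.exists_half {P γ S : Set ℂ} {p q : ℂ} (hP : IsJordanLoop P)
    (hγ : IsCrosscut P γ p q) (hS : IsPreconnected S) (hne : S.Nonempty) (hSP : S ⊆ inside P)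
    (hSγ : Disjoint S γ) :
    ∃ Q, IsJordanLoop Q ∧ γ ⊆ Q ∧ Q ⊆ P ∪ γ ∧ inside Q ⊆ inside P ∧ S ⊆ inside Q := by
  obtain ⟨A, B, hA, hB, rfl, hAB⟩ := hP.split hγ.2.1 hγ.2.2.1 hγ.1.ne
  obtain ⟨l1, l2, s1, s2, -, hc⟩ := theta_lemma hA hB hAB.subset hγ
  obtain ⟨x, hx⟩ := hne
  have hdis : Disjoint S (A ∪ B) := disjoint_inside_self.mono_left hSP
  rw [disjoint_union_right] at hdis
  rcases hc (hSP hx) with (h | h) | h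
  · exact ⟨A ∪ γ, l1, subset_union_right, union_subset_union_left _ subset_union_left, s1,
      subset_inside_of_preconnected l1.isClosed hS (disjoint_union_right.2 ⟨hdis.1, hSγ⟩) hx h⟩
  · exact ⟨B ∪ γ, l2, subset_union_right, union_subset_union_left _ subset_union_right, s2,
      subset_inside_of_preconnected l2.isClosed hS (disjoint_union_right.2 ⟨hdis.2, hSγ⟩) hx h⟩
  · exact absurd h (disjoint_left.1 hSγ hx)

section Sector

variable {ι : Type*} {ℓ : ι → ℝ → ℂ} {v : ℂ} {R : ℝ}

/-- The sector of the disc cut by the legs in `S` that contains a further leg. -/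
lemma exists_sector [DecidableEq ι] (hℓ : ∀ i, IsLeg (ℓ i) v R)
    (hd : ∀ i j, i ≠ j → ℓ i '' Icc 0 1 ∩ ℓ j '' Icc 0 1 ⊆ {v}) {i j e : ι} (hij : i ≠ j)
    (hei : e ≠ i) (hej : e ≠ j) (S : Finset ι) (heS : e ∉ S) :
    ∃ P, IsJordanLoop P ∧ v ∈ P ∧ P ⊆ sphere v R ∪ ⋃ k ∈ insert i (insert j S), ℓ k '' Icc 0 1 ∧
      inside P ⊆ inside (sphere v R) ∧ ℓ e '' Icc 0 1 \ {v, ℓ e 1} ⊆ inside P ∧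
      ∀ k ∈ insert i (insert j S), Disjoint (ℓ k '' Icc 0 1) (inside P) := by
  have hopen : ∀ k l, k ≠ l → Disjoint (ℓ k '' Icc 0 1 \ {v, ℓ k 1}) (ℓ l '' Icc 0 1) := by
    intro k l hkl
    rw [disjoint_left]
    exact fun z hz hz' => hz.2 (Or.inl (hd k l hkl ⟨hz.1, hz'⟩))
  have hpc : ∀ k, IsPreconnected (ℓ k '' Icc 0 1 \ {v, ℓ k 1}) ∧
      (ℓ k '' Icc 0 1 \ {v, ℓ k 1}).Nonempty := fun k =>
    ⟨(hℓ k).isArc.isPreconnected_diff.1, (hℓ k).isArc.isPreconnected_diff.2.1⟩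
  have hR := (hℓ e).pos
  have hJ := isJordanLoop_sphere v hR
  induction S using Finset.induction_on with
  | empty =>
    have hcc := (hℓ i).isCrosscut (hℓ j) (hd i j hij)
    obtain ⟨Q, hQ, h1, h2, h3, h4⟩ := hcc.exists_half hJ (hpc e).1 (hpc e).2 (hℓ e).diff_subset
      (disjoint_union_right.2 ⟨hopen e i hei, hopen e j hej⟩)
    refine ⟨Q, hQ, h1 (Or.inl (hℓ i).isArc.left_mem), ?_, h3, h4, ?_⟩
    · refine h2.trans (union_subset_union_right _ ?_)
      rintro z (hz | hz)
      · exact mem_biUnion (by simp) hz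
      · exact mem_biUnion (by simp) hz
    · intro k hk
      simp only [Finset.mem_insert, Finset.notMem_empty, or_false] at hk
      rcases hk with rfl | rfl
      · exact (disjoint_inside_self.mono_right (subset_union_left.trans h1)).symm
      · exact (disjoint_inside_self.mono_right (subset_union_right.trans h1)).symm
  | insert f S hf ih =>
    obtain ⟨P, hP, hvP, hPs, hin, heP, hdP⟩ := ih fun h => heS (Finset.mem_insert_of_mem h)
    have hef : e ≠ f := fun h => heS (h ▸ Finset.mem_insert_self _ _)
    have hmono : insert i (insert j S) ⊆ insert i (insert j (insert f S)) := by
      intro x hx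
      simp only [Finset.mem_insert] at hx ⊢
      tauto
    by_cases hfS : f ∈ insert i (insert j S)
    · have : insert i (insert j (insert f S)) = insert i (insert j S) := by
        ext x; simp only [Finset.mem_insert] at hfS ⊢
        constructor
        · rintro (h | h | h | h) <;> subst_vars <;> tauto
        · tauto
      rw [this]
      exact ⟨P, hP, hvP, hPs, hin, heP, hdP⟩
    have hfP : Disjoint (ℓ f '' Icc 0 1 \ {v, ℓ f 1}) P := by
      refine Disjoint.mono_right hPs (disjoint_union_right.2 ⟨?_, ?_⟩)
      · exact disjoint_inside_self.mono_left (hℓ f).diff_subset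
      · rw [disjoint_iUnion₂_right]
        intro k hk
        exact hopen f k fun h => hfS (h ▸ hk)
    have h1P : ℓ f 1 ∉ inside P := fun h => (hℓ f).one_notMem_inside (hin h)
    have hv' : v ∉ inside P := fun h => disjoint_inside_self.le_bot ⟨h, hvP⟩
    by_cases hc : Disjoint (ℓ f '' Icc 0 1 \ {v, ℓ f 1}) (inside P)
    · refine ⟨P, hP, hvP, hPs.trans (union_subset_union_right _
        (biUnion_subset_biUnion_left hmono)), hin, heP, fun k hk => ?_⟩
      simp only [Finset.mem_insert] at hk
      rcases hk with rfl | rfl | rfl | hk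
      · exact hdP _ (by simp)
      · exact hdP _ (by simp)
      · rw [disjoint_left] at hc ⊢
        intro z hz hz'
        refine hc ⟨hz, ?_⟩ hz'
        rintro (rfl | rfl)
        · exact hv' hz'
        · exact h1P hz'
      · exact hdP _ (by simp [hk])
    · obtain ⟨x, hx, hx'⟩ := not_disjoint_iff.1 hc
      have hfin := subset_inside_of_preconnected hP.isClosed (hpc f).1 hfP hx hx'
      have hqP : ℓ f 1 ∈ P := by
        have h1 := closure_mono hfin ((hℓ f).isArc.isPreconnected_diff.2.2 (hℓ f).isArc.right_mem)
        exact (closure_inside_subset hP.isClosed h1).resolve_left h1P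
      obtain ⟨Q, hQ, q1, q2, q3, q4⟩ := IsCrosscut.exists_half hP
        ⟨(hℓ f).isArc, hvP, hqP, hfin⟩ (hpc e).1 (hpc e).2 heP (hopen e f hef)
      refine ⟨Q, hQ, q1 (hℓ f).isArc.left_mem, ?_, q3.trans hin, q4, fun k hk => ?_⟩
      · refine q2.trans (union_subset (hPs.trans (union_subset_union_right _
          (biUnion_subset_biUnion_left hmono))) ?_)
        exact fun z hz => Or.inr (mem_biUnion (by simp) hz)
      · simp only [Finset.mem_insert] at hk
        rcases hk with rfl | rfl | rfl | hk
        · exact (hdP _ (by simp)).mono_right q3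
        · exact (hdP _ (by simp)).mono_right q3
        · exact (disjoint_inside_self.mono_right q1).symm
        · exact (hdP _ (by simp [hk])).mono_right q3

end Sector

namespace IsLeg

variable {ℓ ℓ' : ℝ → ℂ} {v : ℂ} {R : ℝ} {G X : Set ℂ}

/-- Adjusting two legs of a disc that is disjoint from `X`. -/
lemma step_pair (h : IsLeg ℓ v R) (h' : IsLeg ℓ' v R)
    (hd : ℓ '' Icc 0 1 ∩ ℓ' '' Icc 0 1 ⊆ {v}) (hG : ℓ '' Icc 0 1 ⊆ G) (hG' : ℓ' '' Icc 0 1 ⊆ G)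
    (hX : Disjoint X (ball v R)) :
    Step G X (ℓ '' Icc 0 (1 / 2) ∪ ℓ' '' Icc 0 (1 / 2)) := by
  set β : ℝ → ℂ := fun u => if u ≤ 1 / 2 then ℓ (1 - 2 * u) else ℓ' (2 * u - 1) with hβ
  have b1 : ∀ u ≤ 1 / 2, β u = ℓ (1 - 2 * u) := fun u hu => if_pos hu
  have b2 : ∀ u, 1 / 2 ≤ u → β u = ℓ' (2 * u - 1) := fun u hu => by
    rcases hu.eq_or_lt with rfl | hu
    · rw [b1 _ le_rfl]; norm_num [h.zero, h'.zero]
    · exact if_neg hu.not_ge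
  have hcont : ContinuousOn β (Icc 0 1) := by
    refine continuousOn_Icc_ite (by norm_num) (by norm_num) ?_ ?_ ?_
    · exact h.cont.comp (by fun_prop) fun u hu => ⟨by linarith [hu.2], by linarith [hu.1]⟩
    · exact h'.cont.comp (by fun_prop) fun u hu => ⟨by linarith [hu.1], by linarith [hu.2]⟩
    · norm_num [h.zero, h'.zero]
  have m1 : ∀ u ∈ Icc (0 : ℝ) (1 / 2), 1 - 2 * u ∈ Icc (0 : ℝ) 1 := fun u hu =>
    ⟨by linarith [hu.2], by linarith [hu.1]⟩
  have m2 : ∀ u ∈ Icc (1 / 2 : ℝ) 1, 2 * u - 1 ∈ Icc (0 : ℝ) 1 := fun u hu =>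
    ⟨by linarith [hu.1], by linarith [hu.2]⟩
  have cross : ∀ x ∈ Icc (0 : ℝ) (1 / 2), ∀ y ∈ Icc (1 / 2 : ℝ) 1, β x = β y → x = y := by
    intro x hx y hy e
    have e' := e
    rw [b1 x hx.2, b2 y hy.1] at e
    have hv := hd ⟨⟨_, m1 x hx, rfl⟩, ⟨_, m2 y hy, e.symm⟩⟩
    rw [mem_singleton_iff] at hv
    have hx0 := h.inj (m1 x hx) (by simp) (hv.trans h.zero.symm)
    have hy0 := h'.inj (m2 y hy) (by simp) ((e.symm.trans hv).trans h'.zero.symm)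
    linarith
  have hinj : InjOn β (Icc 0 1) := by
    intro x hx y hy e
    rcases le_total x (1 / 2) with h1 | h1 <;> rcases le_total y (1 / 2) with h2 | h2
    · rw [b1 x h1, b1 y h2] at e
      have := h.inj (m1 x ⟨hx.1, h1⟩) (m1 y ⟨hy.1, h2⟩) e
      linarith
    · exact cross x ⟨hx.1, h1⟩ y ⟨h2, hy.2⟩ e
    · exact (cross y ⟨hy.1, h2⟩ x ⟨h1, hx.2⟩ e.symm).symm
    · rw [b2 x h1, b2 y h2] at e
      have := h'.inj (m2 x ⟨h1, hx.2⟩) (m2 y ⟨h2, hy.2⟩) e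
      linarith
  have himg : β '' Icc 0 1 = ℓ '' Icc 0 1 ∪ ℓ' '' Icc 0 1 := by
    apply subset_antisymm
    · rintro _ ⟨u, hu, rfl⟩
      rcases le_total u (1 / 2) with h1 | h1
      · rw [b1 u h1]; exact Or.inl ⟨_, m1 u ⟨hu.1, h1⟩, rfl⟩
      · rw [b2 u h1]; exact Or.inr ⟨_, m2 u ⟨h1, hu.2⟩, rfl⟩
    · rintro _ (⟨u, hu, rfl⟩ | ⟨u, hu, rfl⟩)
      · refine ⟨(1 - u) / 2, ⟨by linarith [hu.2], by linarith [hu.1]⟩, ?_⟩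
        rw [b1 _ (by linarith [hu.1])]; congr 1; ring
      · refine ⟨(1 + u) / 2, ⟨by linarith [hu.1], by linarith [hu.2]⟩, ?_⟩
        rw [b2 _ (by linarith [hu.1])]; congr 1; ring
  have hcc := h.isCrosscut h' hd
  have hβ0 : β 0 = ℓ 1 := by rw [b1 0 (by norm_num)]; norm_num
  have hβ1 : β 1 = ℓ' 1 := by rw [b2 1 (by norm_num)]; norm_num
  obtain ⟨F, hF, hFβ⟩ := exists_isChart (isJordanLoop_sphere v h.pos) hcont hinj (by
    rw [himg, hβ0, hβ1]; exact hcc)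
  have hsub : ℓ '' Icc 0 (1 / 2) ∪ ℓ' '' Icc 0 (1 / 2) ⊆
      (fun u : ℝ => F u) '' Icc (1 / 4) (3 / 4) := by
    rintro _ (⟨u, hu, rfl⟩ | ⟨u, hu, rfl⟩)
    · refine ⟨(1 - u) / 2, ⟨by linarith [hu.2], by linarith [hu.1]⟩, ?_⟩
      simp only
      rw [hFβ _ ⟨by linarith [hu.2], by linarith [hu.1]⟩, b1 _ (by linarith [hu.1])]
      congr 1; ring
    · refine ⟨(1 + u) / 2, ⟨by linarith [hu.1], by linarith [hu.2]⟩, ?_⟩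
      simp only
      rw [hFβ _ ⟨by linarith [hu.1], by linarith [hu.2]⟩, b2 _ (by linarith [hu.1])]
      congr 1; ring
  have hstep : Step G X ((fun u : ℝ => F u) '' Icc (1 / 4) (3 / 4)) := by
    refine hF.step_axis (X₀ := (ball v R)ᶜ) (by norm_num) (by norm_num) (by norm_num) ?_
      isOpen_ball.isClosed_compl ?_ fun z hz => Or.inl fun h => hX.le_bot ⟨hz, h⟩
    · intro u hu
      rw [hFβ u hu]
      have : β u ∈ β '' Icc 0 1 := ⟨u, hu, rfl⟩
      rw [himg] at this
      exact union_subset hG hG' this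
    · intro u hu hn
      apply hn
      have h2 := (hF.mem_inside_iff (ofReal_mem_closedRect (Ioo_subset_Icc_self hu))).2
        (ofReal_mem_openRect hu)
      rwa [inside_sphere v h.pos] at h2
  exact hstep.mono hsub

end IsLeg

/-- Near a vertex, small moves are realized on all legs. -/
lemma Good.union_legs {ι : Type*} {ℓ : ι → ℝ → ℂ} {v : ℂ} {R : ℝ} {G X : Set ℂ}
    (hX : Good G X) (hXG : X ⊆ G) (hXR : Disjoint X (ball v R)) (hℓ : ∀ i, IsLeg (ℓ i) v R)
    (hd : ∀ i j, i ≠ j → ℓ i '' Icc 0 1 ∩ ℓ j '' Icc 0 1 ⊆ {v})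
    (hG : ∀ i, ℓ i '' Icc 0 1 ⊆ G) {i j : ι} (hij : i ≠ j) (S : Finset ι) :
    Good G (X ∪ ⋃ k ∈ S, ℓ k '' Icc 0 (1 / 2)) := by
  classical
  suffices h : Good G (X ∪ ⋃ k ∈ insert i (insert j S), ℓ k '' Icc 0 (1 / 2)) by
    refine h.mono (union_subset_union_right _ (biUnion_subset_biUnion_left fun k hk => ?_))
    simp only [Finset.mem_coe, Finset.mem_insert]
    exact Or.inr (Or.inr hk)
  induction S using Finset.induction_on with
  | empty =>
    have := hX.step ((hℓ i).step_pair (hℓ j) (hd i j hij) (hG i) (hG j) hXR)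
    simpa using this
  | insert e S he ih =>
    by_cases hm : e ∈ insert i (insert j S)
    · have : insert i (insert j (insert e S)) = insert i (insert j S) := by
        ext x; simp only [Finset.mem_insert] at hm ⊢
        constructor
        · rintro (h | h | h | h) <;> subst_vars <;> tauto
        · tauto
      rwa [this]
    have hei : e ≠ i := fun h => hm (by simp [h])
    have hej : e ≠ j := fun h => hm (by simp [h])
    obtain ⟨P, hP, hvP, hPs, hin, heP, hdP⟩ := exists_sector hℓ hd hij hei hej S he
    set T := insert i (insert j S) with hT
    have hqP : ℓ e 1 ∈ P := by
      have h1 := closure_mono heP ((hℓ e).isArc.isPreconnected_diff.2.2 (hℓ e).isArc.right_mem)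
      exact (closure_inside_subset hP.isClosed h1).resolve_left
        fun h => (hℓ e).one_notMem_inside (hin h)
    have hcc : IsCrosscut P (ℓ e '' Icc 0 1) (ℓ e 0) (ℓ e 1) := by
      rw [(hℓ e).zero]
      exact ⟨(hℓ e).isArc, hvP, hqP, heP⟩
    obtain ⟨F, hF, hFβ⟩ := exists_isChart hP (hℓ e).cont (hℓ e).inj hcc
    have hF0 : F 0 = v := by
      have := hFβ 0 (by simp)
      rwa [(hℓ e).zero, Complex.ofReal_zero] at this
    have hfar : IsCompact (sphere v R ∪ ⋃ k ∈ T, ℓ k '' Icc (1 / 2) 1) :=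
      (isCompact_sphere v R).union (T.isCompact_biUnion fun k _ =>
        isCompact_Icc.image_of_continuousOn ((hℓ k).cont.mono
          (Icc_subset_Icc_left (by norm_num))))
    have hvfar : v ∉ sphere v R ∪ ⋃ k ∈ T, ℓ k '' Icc (1 / 2) 1 := by
      rintro (h | h)
      · have := (hℓ e).pos
        rw [mem_sphere, dist_self] at h
        linarith
      · obtain ⟨k, -, u, hu, e'⟩ := by simpa only [mem_iUnion, exists_prop] using h
        have := (hℓ k).inj ⟨by linarith [hu.1], hu.2⟩ (by simp) (e'.trans (hℓ k).zero.symm)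
        linarith [hu.1]
    obtain ⟨r, hr, hball⟩ := Metric.isOpen_iff.1 hfar.isClosed.isOpen_compl v hvfar
    have hstep := hF.step_leg (d := 1 / 2) (q := 3 / 4) (G := G)
      (X := X ∪ ⋃ k ∈ T, ℓ k '' Icc 0 (1 / 2)) (by norm_num) (by norm_num) (by norm_num)
      (fun u hu => by
        have hu' : u ∈ Icc (0 : ℝ) 1 := ⟨hu.1, by linarith [hu.2]⟩
        rw [hFβ u hu']; exact hG e ⟨u, hu', rfl⟩)
      (union_subset hXG (iUnion₂_subset fun k _ =>
        (image_mono (Icc_subset_Icc_right (by norm_num))).trans (hG k)))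
      (disjoint_union_left.2 ⟨hXR.mono_right (by rwa [inside_sphere v (hℓ e).pos] at hin),
        disjoint_iUnion₂_left.2 fun k hk => (hdP k hk).mono_left
          (image_mono (Icc_subset_Icc_right (by norm_num)))⟩) hr (by
        rw [hF0]
        rintro z ⟨hzP, hzr⟩
        have hz := hball hzr
        rcases hPs hzP with h | h
        · exact absurd (Or.inl h) hz
        · obtain ⟨k, hk, u, hu, rfl⟩ := by simpa only [mem_iUnion, exists_prop] using h
          rcases le_total u (1 / 2) with h2 | h2
          · exact Or.inr (mem_biUnion hk ⟨u, ⟨hu.1, h2⟩, rfl⟩)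
          · refine absurd (Or.inr ?_) hz
            exact mem_biUnion hk (mem_image_of_mem (ℓ k) ⟨h2, hu.2⟩))
    refine (ih.step hstep).mono ?_
    rintro z (hz | hz)
    · exact Or.inl (Or.inl hz)
    · obtain ⟨k, hk, hz'⟩ := by simpa only [mem_iUnion, exists_prop] using hz
      have hk' : k = e ∨ k ∈ T := by
        simp only [hT, Finset.mem_insert] at hk ⊢; tauto
      rcases hk' with rfl | hk'
      · right
        obtain ⟨u, hu, rfl⟩ := hz'
        exact ⟨u, hu, hFβ u ⟨hu.1, by linarith [hu.2]⟩⟩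
      · exact Or.inl (Or.inr (mem_biUnion hk' hz'))

lemma exists_first_time {g : ℝ → ℝ} {x y R : ℝ} (hxy : x ≤ y) (hg : ContinuousOn g (Icc x y))
    (hx : g x < R) (hy : R < g y) : ∃ t ∈ Ioo x y, g t = R ∧ ∀ w ∈ Ico x t, g w < R := by
  have hc : IsCompact (Icc x y ∩ g ⁻¹' {R}) := isCompact_Icc.of_isClosed_subset
    (hg.preimage_isClosed_of_isClosed isClosed_Icc isClosed_singleton) inter_subset_left
  have hne : (Icc x y ∩ g ⁻¹' {R}).Nonempty := by
    obtain ⟨t, ht, e⟩ := intermediate_value_Icc hxy hg ⟨hx.le, hy.le⟩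
    exact ⟨t, ht, e⟩
  obtain ⟨t, ⟨ht, htR⟩, hmin⟩ := hc.exists_isLeast hne
  rw [mem_preimage, mem_singleton_iff] at htR
  refine ⟨t, ⟨lt_of_le_of_ne ht.1 ?_, lt_of_le_of_ne ht.2 ?_⟩, htR, fun w hw => ?_⟩
  · rintro rfl; exact hx.ne htR
  · rintro rfl; exact hy.ne' htR
  · by_contra! hcon
    obtain ⟨w', hw', e⟩ := intermediate_value_Icc hw.1
      (hg.mono (Icc_subset_Icc_right (hw.2.le.trans ht.2))) ⟨hx.le, hcon⟩
    have := hmin ⟨⟨hw'.1, hw'.2.trans (hw.2.le.trans ht.2)⟩, e⟩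
    linarith [hw'.2, hw.2]

/-- An arc leaving a disc starts with a leg. -/
lemma exists_isLeg {a : ℝ → ℂ} {R : ℝ} (ha : ContinuousOn a (Icc 0 1)) (hi : InjOn a (Icc 0 1))
    (hR : 0 < R) (h1 : R < dist (a 1) (a 0)) :
    ∃ t ∈ Ioo (0 : ℝ) 1, IsLeg (fun u => a (t * u)) (a 0) R := by
  obtain ⟨t, ht, e, hlt⟩ := exists_first_time (g := fun u => dist (a u) (a 0)) zero_le_one
    (by fun_prop) (by simpa using hR) h1
  have hm : ∀ u ∈ Icc (0 : ℝ) 1, t * u ∈ Icc (0 : ℝ) 1 := fun u hu =>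
    ⟨mul_nonneg ht.1.le hu.1, mul_le_one₀ ht.2.le hu.1 hu.2⟩
  refine ⟨t, ht, ha.comp (by fun_prop) hm, fun x hx y hy e => ?_, by simp, by simpa [← dist_eq_norm] using e,
    fun u hu => ?_⟩
  · exact mul_left_cancel₀ ht.1.ne' (hi (hm x hx) (hm y hy) e)
  · exact hlt _ ⟨mul_nonneg ht.1.le hu.1, mul_lt_of_lt_one_right ht.1 hu.2⟩

/-- Around an interior parameter, an arc is the axis of a chart. -/
lemma exists_isChart_arc {a : ℝ → ℂ} (ha : ContinuousOn a (Icc 0 1)) (hi : InjOn a (Icc 0 1))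
    {u : ℝ} (hu : u ∈ Ioo (0 : ℝ) 1) : ∃ s t, s ∈ Ioo 0 u ∧ t ∈ Ioo u 1 ∧ ∃ F P, IsChart F P ∧
      ∀ w ∈ Icc (0 : ℝ) 1, F (w : ℂ) = a (s + (t - s) * w) := by
  have huI := Ioo_subset_Icc_self hu
  have d0 : 0 < dist (a 0) (a u) :=
    dist_pos.2 fun e => hu.1.ne (hi (by simp) huI e)
  have d1 : 0 < dist (a 1) (a u) :=
    dist_pos.2 fun e => hu.2.ne' (hi (by simp) huI e)
  obtain ⟨R, hR, hR'⟩ := exists_between (lt_min d0 d1)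
  obtain ⟨t, ht, et, hlt⟩ := exists_first_time (g := fun w => dist (a w) (a u)) hu.2.le
    ((continuous_id.dist continuous_const).comp_continuousOn (ha.mono (Icc_subset_Icc_left hu.1.le))) (by simpa using hR)
    (hR'.trans_le (min_le_right _ _))
  obtain ⟨s, hs, es, hls⟩ := exists_first_time (g := fun w => dist (a (-w)) (a u)) (x := -u) (y := 0)
    (by linarith [hu.1])
    ((continuous_id.dist continuous_const).comp_continuousOn (ha.comp continuousOn_neg
      fun w hw => ⟨by simpa using hw.2, by linarith [hw.1, hu.2]⟩)) (by simpa using hR)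
    (by simpa using hR'.trans_le (min_le_left _ _))
  have hs1 : -s ∈ Ioo 0 u := ⟨by linarith [hs.2], by linarith [hs.1]⟩
  have hst : 0 < t - -s := by linarith [hs1.2, ht.1]
  have hball : ∀ w ∈ Ioo (-s) t, a w ∈ ball (a u) R := by
    intro w hw
    rcases le_total u w with h | h
    · exact hlt w ⟨h, hw.2⟩
    · have := hls (-w) ⟨by linarith, by linarith [hw.1]⟩
      simpa using this
  have hm : ∀ w ∈ Icc (0 : ℝ) 1, -s + (t - -s) * w ∈ Icc (-s) t := fun w hw =>
    ⟨by nlinarith [hw.1], by nlinarith [hw.2]⟩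
  have hsub : Icc (-s) t ⊆ Icc 0 1 := Icc_subset_Icc hs1.1.le ht.2.le
  have hc : ContinuousOn (fun w => a (-s + (t - -s) * w)) (Icc 0 1) :=
    ha.comp (by fun_prop) fun w hw => hsub (hm w hw)
  have hinj : InjOn (fun w => a (-s + (t - -s) * w)) (Icc 0 1) := fun x hx y hy e => by
    have := hi (hsub (hm x hx)) (hsub (hm y hy)) e
    exact mul_left_cancel₀ hst.ne' (by linarith)
  obtain ⟨F, hF, hFβ⟩ := exists_isChart (isJordanLoop_sphere (a u) hR) hc hinj (by
    refine ⟨isArc_image_Icc one_pos hc hinj, by simpa [← dist_eq_norm] using es,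
      by simpa [← dist_eq_norm] using et, ?_⟩
    rintro _ ⟨⟨w, hw, rfl⟩, hn⟩
    rw [inside_sphere _ hR]
    refine hball _ ⟨?_, ?_⟩
    · have : 0 < w := lt_of_le_of_ne hw.1 fun e => hn (Or.inl (by rw [← e]))
      nlinarith
    · have : w < 1 := lt_of_le_of_ne hw.2 fun e => hn (Or.inr (by rw [e]; rfl))
      nlinarith)
  exact ⟨-s, t, hs1, ht, F, _, hF, hFβ⟩

lemma image_axis_eq {F : ℂ → ℂ} {a : ℝ → ℂ} {s t c d : ℝ} (hst : s < t)
    (hF : ∀ w ∈ Icc (0 : ℝ) 1, F (w : ℂ) = a (s + (t - s) * w)) (hc : s ≤ c) (hd : d ≤ t) :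
    (fun u : ℝ => F u) '' Icc ((c - s) / (t - s)) ((d - s) / (t - s)) = a '' Icc c d := by
  have h0 : 0 < t - s := sub_pos.2 hst
  apply subset_antisymm
  · rintro _ ⟨u, hu, rfl⟩
    have h1 := (div_le_iff₀ h0).1 hu.1
    have h2 := (le_div_iff₀ h0).1 hu.2
    refine ⟨s + (t - s) * u, ⟨by linarith, by linarith⟩, (hF u ⟨?_, ?_⟩).symm⟩
    · exact (div_nonneg (by linarith) h0.le).trans hu.1
    · exact hu.2.trans ((div_le_one h0).2 (by linarith))
  · rintro _ ⟨u, hu, rfl⟩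
    have hm : (u - s) / (t - s) ∈ Icc (0 : ℝ) 1 := ⟨div_nonneg (by linarith [hu.1]) h0.le,
      (div_le_one h0).2 (by linarith [hu.2])⟩
    refine ⟨(u - s) / (t - s), ⟨by gcongr; exact hu.1, by gcongr; exact hu.2⟩, ?_⟩
    simp only
    rw [hF _ hm]
    congr 1
    field_simp
    ring

section Edge

variable {a : ℝ → ℂ} {G K : Set ℂ} {m : ℝ}

/-- Locally along an arc, realizability propagates. -/
lemma exists_propagate (ha : ContinuousOn a (Icc 0 1)) (hi : InjOn a (Icc 0 1))
    (hG : a '' Icc 0 1 ⊆ G) (hK : IsClosed K) (haK : ∀ w ∈ Ioo (0 : ℝ) 1, a w ∉ K)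
    (hm1 : m ≤ 1) {u : ℝ} (hu : u ∈ Ioo (0 : ℝ) 1) :
    ∃ s t, u ∈ Ioo s t ∧ ∀ c d, s < c → c ≤ d → d < t → d ≤ m →
      Good G (K ∪ a '' Icc 0 c ∪ a '' Icc m 1) → Good G (K ∪ a '' Icc 0 d ∪ a '' Icc m 1) := by
  obtain ⟨s, t, hs, ht, F, P, hF, hFa⟩ := exists_isChart_arc ha hi hu
  have hst : s < t := hs.2.trans ht.1
  have hst' : 0 < t - s := sub_pos.2 hst
  refine ⟨s, t, ⟨hs.2, ht.1⟩, fun c d hc hcd hd hdm hgood => ?_⟩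
  have hm' : ∀ w ∈ Icc (0 : ℝ) 1, s + (t - s) * w ∈ Icc s t := fun w hw =>
    ⟨by nlinarith [hw.1], by nlinarith [hw.2]⟩
  have key : ∀ e, c ≤ e → e < t → e ≤ m → (t ≤ m ∨ e = m) →
      Good G ((K ∪ a '' Icc 0 c ∪ a '' Icc m 1) ∪ a '' Icc c e) := by
    intro e hce het hem hor
    refine hgood.step ?_
    rw [← image_axis_eq hst hFa hc.le het.le]
    have hcl : ∀ x y : ℝ, 0 ≤ x → y ≤ 1 → IsClosed (a '' Icc x y) := fun x y hx hy =>
      (isCompact_Icc.image_of_continuousOn (ha.mono (Icc_subset_Icc hx hy))).isClosed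
    have i0 : (fun u : ℝ => F u) '' Icc 0 ((c - s) / (t - s)) = a '' Icc s c := by
      rw [← image_axis_eq hst hFa le_rfl (hce.trans het.le), sub_self, zero_div]
    have i1 : (fun u : ℝ => F u) '' Icc ((e - s) / (t - s)) 1 = a '' Icc e t := by
      rw [← image_axis_eq hst hFa (hc.le.trans hce) le_rfl, div_self hst'.ne']
    refine hF.step_axis (X₀ := K ∪ a '' Icc 0 s ∪ a '' Icc t 1) (div_pos (by linarith) hst')
      (by gcongr) ((div_lt_one hst').2 (by linarith)) ?_
      ((hK.union (hcl 0 s le_rfl (by linarith [ht.2]))).union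
        (hcl t 1 (by linarith [hs.1]) le_rfl)) ?_ ?_
    · intro w hw
      rw [hFa w hw]
      exact hG ⟨_, Icc_subset_Icc hs.1.le ht.2.le (hm' w hw), rfl⟩
    · intro w hw
      rw [hFa w (Ioo_subset_Icc_self hw)]
      have h1 : s < s + (t - s) * w := by nlinarith [hw.1]
      have h2 : s + (t - s) * w < t := by nlinarith [hw.2]
      have h01 : s + (t - s) * w ∈ Ioo (0 : ℝ) 1 := ⟨hs.1.trans h1, h2.trans ht.2⟩
      rintro ((h | ⟨x, hx, e'⟩) | ⟨x, hx, e'⟩)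
      · exact haK _ h01 h
      · have := hi ⟨hx.1, by linarith [hx.2, ht.2]⟩ (Ioo_subset_Icc_self h01) e'
        linarith [hx.2]
      · have := hi ⟨by linarith [hx.1, hs.1], hx.2⟩ (Ioo_subset_Icc_self h01) e'
        linarith [hx.1]
    · rw [i0, i1]
      rintro z ((hz | ⟨x, hx, rfl⟩) | ⟨x, hx, rfl⟩)
      · exact Or.inl (Or.inl (Or.inl hz))
      · rcases le_total x s with h | h
        · exact Or.inl (Or.inl (Or.inr ⟨x, ⟨hx.1, h⟩, rfl⟩))
        · exact Or.inr (Or.inl ⟨⟨x, ⟨h, hx.2⟩, rfl⟩, (image_mono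
            (Icc_subset_Icc_left hs.1.le)).trans (subset_union_right.trans subset_union_left)⟩)
      · rcases le_total t x with h | h
        · exact Or.inl (Or.inr ⟨x, ⟨h, hx.2⟩, rfl⟩)
        · rcases hor with h' | rfl
          · exact Or.inl (Or.inr ⟨x, ⟨h'.trans hx.1, hx.2⟩, rfl⟩)
          · exact Or.inr (Or.inr ⟨⟨x, ⟨hx.1, h⟩, rfl⟩, (image_mono
              (Icc_subset_Icc_right ht.2.le)).trans subset_union_right⟩)
  have hsub : ∀ e, d ≤ e → K ∪ a '' Icc 0 d ∪ a '' Icc m 1 ⊆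
      (K ∪ a '' Icc 0 c ∪ a '' Icc m 1) ∪ a '' Icc c e := by
    rintro e hde z ((hz | ⟨x, hx, rfl⟩) | hz)
    · exact Or.inl (Or.inl (Or.inl hz))
    · rcases le_total x c with h | h
      · exact Or.inl (Or.inl (Or.inr ⟨x, ⟨hx.1, h⟩, rfl⟩))
      · exact Or.inr ⟨x, ⟨h, hx.2.trans hde⟩, rfl⟩
    · exact Or.inl (Or.inr hz)
  rcases le_or_gt t m with h | h
  · exact (key d hcd hd hdm (Or.inl h)).mono (hsub d le_rfl)
  · exact (key m (hcd.trans hdm) h le_rfl (Or.inr rfl)).mono (hsub m hdm)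

/-- If small moves are realized near both ends of an arc, they are realized on the whole arc. -/
lemma Good.union_edge (ha : ContinuousOn a (Icc 0 1)) (hi : InjOn a (Icc 0 1))
    (hG : a '' Icc 0 1 ⊆ G) (hK : IsClosed K) (haK : ∀ w ∈ Ioo (0 : ℝ) 1, a w ∉ K)
    {c : ℝ} (hc : 0 < c) (hm : m < 1) (hgood : Good G (K ∪ a '' Icc 0 c ∪ a '' Icc m 1)) :
    Good G (K ∪ a '' Icc 0 1) := by
  rcases le_or_gt m c with hcm | hcm
  · refine hgood.mono ?_
    rintro z (hz | ⟨x, hx, rfl⟩)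
    · exact Or.inl (Or.inl hz)
    · rcases le_total x c with h | h
      · exact Or.inl (Or.inr ⟨x, ⟨hx.1, h⟩, rfl⟩)
      · exact Or.inr ⟨x, ⟨hcm.trans h, hx.2⟩, rfl⟩
  have hloc : ∀ u : Icc c m, ∃ s t, (u : ℝ) ∈ Ioo s t ∧ ∀ c d, s < c → c ≤ d → d < t → d ≤ m →
      Good G (K ∪ a '' Icc 0 c ∪ a '' Icc m 1) → Good G (K ∪ a '' Icc 0 d ∪ a '' Icc m 1) :=
    fun u => exists_propagate ha hi hG hK haK hm.le ⟨hc.trans_le u.2.1, u.2.2.trans_lt hm⟩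
  choose s t hst hp using hloc
  obtain ⟨τ, hτ0, hmono, ⟨N, hN⟩, hsub⟩ := exists_monotone_Icc_subset_open_cover_Icc hcm.le
    (c := fun u : Icc c m => ((↑) : Icc c m → ℝ) ⁻¹' Ioo (s u) (t u))
    (fun u => isOpen_Ioo.preimage continuous_subtype_val)
    (fun u _ => mem_iUnion.2 ⟨u, hst u⟩)
  have hall : ∀ n, Good G (K ∪ a '' Icc 0 (τ n : ℝ) ∪ a '' Icc m 1) := by
    intro n
    induction n with
    | zero => rwa [hτ0]
    | succ n ih =>
      obtain ⟨i, hi⟩ := hsub n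
      have hle : τ n ≤ τ (n + 1) := hmono n.le_succ
      exact hp i _ _ (hi ⟨le_rfl, hle⟩).1 hle (hi ⟨hle, le_rfl⟩).2 (τ (n + 1)).2.2 ih
  have := hall N
  rw [hN N le_rfl] at this
  refine this.mono ?_
  rintro z (hz | ⟨x, hx, rfl⟩)
  · exact Or.inl (Or.inl hz)
  · rcases le_total x m with h | h
    · exact Or.inl (Or.inr ⟨x, ⟨hx.1, h⟩, rfl⟩)
    · exact Or.inr ⟨x, ⟨h, hx.2⟩, rfl⟩

end Edge

/-- A family of arcs with endpoints in the finite set `V`, otherwise disjoint from each other and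
from `V`, such that every point of `V` is an endpoint of at least two arcs. -/
structure IsArcGraph {X ι : Type*} [TopologicalSpace X] (a : ι → ℝ → X) (V : Set X) : Prop where
  finite : V.Finite
  cont : ∀ i, ContinuousOn (a i) (Icc 0 1)
  inj : ∀ i, InjOn (a i) (Icc 0 1)
  zero : ∀ i, a i 0 ∈ V
  one : ∀ i, a i 1 ∈ V
  notMem : ∀ i, ∀ u ∈ Ioo (0 : ℝ) 1, a i u ∉ V
  disj : ∀ i j, i ≠ j → ∀ u ∈ Ioo (0 : ℝ) 1, ∀ w ∈ Ioo (0 : ℝ) 1, a i u ≠ a j w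
  deg : ∀ v ∈ V, ∃ i j, i ≠ j ∧ (a i 0 = v ∨ a i 1 = v) ∧ (a j 0 = v ∨ a j 1 = v)

/-- The arcs of a family together with their reversals. -/
def dart {X ι : Type*} (a : ι → ℝ → X) (e : ι × Bool) (u : ℝ) : X :=
  if e.2 then a e.1 (1 - u) else a e.1 u

namespace IsArcGraph

variable {ι : Type*} {a : ι → ℝ → ℂ} {V : Set ℂ}

lemma dart_mem (e : ι × Bool) {u : ℝ} (hu : u ∈ Icc (0 : ℝ) 1) :
    dart a e u ∈ a e.1 '' Icc 0 1 := by
  unfold dart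
  split_ifs
  · exact ⟨1 - u, ⟨by linarith [hu.2], by linarith [hu.1]⟩, rfl⟩
  · exact ⟨u, hu, rfl⟩

lemma cont_dart (h : IsArcGraph a V) (e : ι × Bool) : ContinuousOn (dart a e) (Icc 0 1) := by
  unfold dart
  split_ifs
  · exact (h.cont e.1).comp (by fun_prop) fun u hu => ⟨by linarith [hu.2], by linarith [hu.1]⟩
  · exact h.cont e.1

lemma inj_dart (h : IsArcGraph a V) (e : ι × Bool) : InjOn (dart a e) (Icc 0 1) := by
  intro x hx y hy
  unfold dart
  split_ifs
  · intro e'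
    have := h.inj e.1 ⟨by linarith [hx.2], by linarith [hx.1]⟩
      ⟨by linarith [hy.2], by linarith [hy.1]⟩ e'
    linarith
  · exact fun e' => h.inj e.1 hx hy e'

lemma dart_zero (h : IsArcGraph a V) (e : ι × Bool) : dart a e 0 ∈ V := by
  unfold dart
  split_ifs
  · simpa using h.one e.1
  · exact h.zero e.1

lemma dart_one (h : IsArcGraph a V) (e : ι × Bool) : dart a e 1 ∈ V := by
  unfold dart
  split_ifs
  · simpa using h.zero e.1
  · exact h.one e.1

lemma inter_subset (h : IsArcGraph a V) {i j : ι} (hij : i ≠ j) :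
    a i '' Icc 0 1 ∩ a j '' Icc 0 1 ⊆ V := by
  rintro _ ⟨⟨u, hu, rfl⟩, ⟨w, hw, e⟩⟩
  rcases hu.1.eq_or_lt with rfl | u0
  · exact h.zero i
  rcases hu.2.eq_or_lt with rfl | u1
  · exact h.one i
  rcases hw.1.eq_or_lt with rfl | w0
  · exact e ▸ h.zero j
  rcases hw.2.eq_or_lt with rfl | w1
  · exact e ▸ h.one j
  exact absurd e.symm (h.disj i j hij u ⟨u0, u1⟩ w ⟨w0, w1⟩)

lemma notMem_of_ne (h : IsArcGraph a V) {i j : ι} (hij : i ≠ j) {u : ℝ}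
    (hu : u ∈ Ioo (0 : ℝ) 1) : a i u ∉ a j '' Icc 0 1 := fun hm =>
  h.notMem i u hu (h.inter_subset hij ⟨⟨u, Ioo_subset_Icc_self hu, rfl⟩, hm⟩)

lemma fst_ne (h : IsArcGraph a V) {e f : ι × Bool} (hef : e ≠ f)
    (h0 : dart a e 0 = dart a f 0) : e.1 ≠ f.1 := by
  rcases e with ⟨i, s⟩
  rcases f with ⟨j, t⟩
  rintro hij
  simp only at hij
  subst hij
  have h01 : a i 0 ≠ a i 1 := fun e => zero_ne_one (h.inj i (by simp) (by simp) e)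
  cases s <;> cases t <;> simp [dart] at hef h0
  · exact h01 h0
  · exact h01 h0.symm

lemma exists_darts (h : IsArcGraph a V) {v : ℂ} (hv : v ∈ V) :
    ∃ e f : ι × Bool, e ≠ f ∧ dart a e 0 = v ∧ dart a f 0 = v := by
  obtain ⟨i, j, hij, hi, hj⟩ := h.deg v hv
  have key : ∀ i, (a i 0 = v ∨ a i 1 = v) → ∃ s : Bool, dart a (i, s) 0 = v := by
    rintro i (hi | hi)
    · exact ⟨false, by simpa [dart] using hi⟩
    · exact ⟨true, by simpa [dart] using hi⟩
  obtain ⟨s, hs⟩ := key i hi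
  obtain ⟨t, ht⟩ := key j hj
  exact ⟨(i, s), (j, t), fun e => hij (congrArg Prod.fst e), hs, ht⟩

lemma exists_radius (hV : V.Finite) :
    ∃ R > 0, ∀ v ∈ V, ∀ w ∈ V, v ≠ w → 2 * R < dist v w := by
  have : ∀ᶠ R : ℝ in 𝓝[>] 0, ∀ v ∈ V, ∀ w ∈ V, v ≠ w → 2 * R < dist v w := by
    refine (eventually_all_finite hV).2 fun v _ => (eventually_all_finite hV).2 fun w _ => ?_
    by_cases hvw : v = w
    · exact Eventually.of_forall fun R h => absurd hvw h
    · have h2 : ∀ᶠ R : ℝ in 𝓝[>] 0, R < dist v w / 2 :=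
        (eventually_lt_nhds (half_pos (dist_pos.2 hvw))).filter_mono nhdsWithin_le_nhds
      filter_upwards [h2] with R hR _
      linarith
  obtain ⟨R, h1, h2⟩ := (this.and self_mem_nhdsWithin).exists
  exact ⟨R, h2, h1⟩

/-- Small moves of an arc graph in the plane are realized near the vertices. -/
lemma exists_good_legs [Finite ι] (h : IsArcGraph a V) : ∃ c : ι × Bool → ℝ,
    (∀ e, c e ∈ Ioo 0 1) ∧
      Good (⋃ i, a i '' Icc 0 1) (⋃ e, dart a e '' Icc 0 (c e)) := by
  classical
  have := Fintype.ofFinite ι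
  set G := ⋃ i, a i '' Icc 0 1 with hGdef
  obtain ⟨R, hR, hsep⟩ := exists_radius h.finite
  have hleg : ∀ e, ∃ t ∈ Ioo (0 : ℝ) 1, IsLeg (fun u => dart a e (t * u)) (dart a e 0) R := by
    intro e
    refine exists_isLeg (h.cont_dart e) (h.inj_dart e) hR ?_
    have := hsep _ (h.dart_one e) _ (h.dart_zero e) fun e' =>
      one_ne_zero (h.inj_dart e (by simp) (by simp) e')
    linarith
  choose T hT hℓ using hleg
  have hmT : ∀ e, ∀ u ∈ Icc (0 : ℝ) 1, T e * u ∈ Icc (0 : ℝ) 1 := fun e u hu =>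
    ⟨mul_nonneg (hT e).1.le hu.1, mul_le_one₀ (hT e).2.le hu.1 hu.2⟩
  have hsubG : ∀ e, (fun u => dart a e (T e * u)) '' Icc 0 1 ⊆ a e.1 '' Icc 0 1 := by
    rintro e _ ⟨u, hu, rfl⟩
    exact dart_mem e (hmT e u hu)
  have haG : ∀ i, a i '' Icc 0 1 ⊆ G := fun i => subset_iUnion (fun i => a i '' Icc 0 1) i
  have hhalf : Icc (0 : ℝ) (1 / 2) ⊆ Icc 0 1 := Icc_subset_Icc_right (by norm_num)
  have main : ∀ W : Finset ℂ, ↑W ⊆ V → Good G (⋃ e, ⋃ (_ : dart a e 0 ∈ W),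
      (fun u => dart a e (T e * u)) '' Icc 0 (1 / 2)) := by
    intro W
    induction W using Finset.induction_on with
    | empty => intro _; simpa using good_empty G
    | insert v W hvW ih =>
      intro hW
      have hvV : v ∈ V := hW (by simp)
      have hWV : ↑W ⊆ V := fun x hx => hW (by simp [Finset.mem_coe.1 hx])
      obtain ⟨e, f, hef, he, hf⟩ := h.exists_darts hvV
      have := (ih hWV).union_legs (v := v) (R := R) (ι := {e // dart a e 0 = v})
        (ℓ := fun e u => dart a e.1 (T e.1 * u))
        (iUnion₂_subset fun e _ => (image_mono hhalf).trans ((hsubG e).trans (haG _)))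
        (by
          rw [disjoint_left]
          intro z hz hzv
          obtain ⟨e, heW, u, hu, rfl⟩ := by simpa only [mem_iUnion, exists_prop] using hz
          have h1 := (hℓ e).mem u ⟨hu.1, by linarith [hu.2]⟩
          have h2 := hsep _ (h.dart_zero e) v hvV fun e' => hvW (e' ▸ heW)
          have h3 := dist_triangle_left (dart a e 0) v (dart a e (T e * u))
          rw [mem_ball] at h1 hzv
          linarith)
        (fun e => by have := hℓ e.1; rwa [e.2] at this)
        (by
          rintro e f hef z ⟨hz, hz'⟩
          have hzV := h.inter_subset (h.fst_ne (fun e' => hef (Subtype.ext e'))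
            (e.2.trans f.2.symm)) ⟨hsubG _ hz, hsubG _ hz'⟩
          by_contra hne
          have h2 := hsep z hzV v hvV hne
          obtain ⟨u, hu, rfl⟩ := hz
          have h3 := (hℓ e.1).subset_fill ⟨u, hu, rfl⟩
          rw [e.2, inside_sphere v hR] at h3
          have h4 : dart a e.1 (T e.1 * u) ∈ closedBall v R :=
            h3.elim (fun h => ball_subset_closedBall h) fun h => sphere_subset_closedBall h
          rw [mem_closedBall] at h4
          simp only at h2
          linarith)
        (fun e => (hsubG e.1).trans (haG _))
        (i := ⟨e, he⟩) (j := ⟨f, hf⟩) (fun e' => hef (Subtype.ext_iff.1 e')) Finset.univ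
      refine this.mono ?_
      intro z hz
      obtain ⟨e, heW, hz'⟩ := by simpa only [mem_iUnion, exists_prop] using hz
      rcases Finset.mem_insert.1 heW with h1 | h1
      · right
        simp only [mem_iUnion]
        exact ⟨⟨e, h1⟩, Finset.mem_univ _, hz'⟩
      · left
        simp only [mem_iUnion]
        exact ⟨e, h1, hz'⟩
  refine ⟨fun e => T e / 2, fun e => ⟨half_pos (hT e).1, by linarith [(hT e).2, (hT e).1]⟩,
    (main h.finite.toFinset (by simp)).mono ?_⟩
  rintro z hz
  obtain ⟨e, u, hu, rfl⟩ := mem_iUnion.1 hz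
  simp only [mem_iUnion]
  refine ⟨e, by simpa using h.dart_zero e, u / T e, ⟨div_nonneg hu.1 (hT e).1.le, ?_⟩, ?_⟩
  · rw [div_le_iff₀ (hT e).1]
    linarith [hu.2]
  · simp only
    congr 1
    field_simp [(hT e).1.ne']

/-- Small moves of an arc graph in the plane are realized by small homeomorphisms. -/
theorem good [Finite ι] (h : IsArcGraph a V) :
    Good (⋃ i, a i '' Icc 0 1) (⋃ i, a i '' Icc 0 1) := by
  classical
  have := Fintype.ofFinite ι
  obtain ⟨c, hc, hgood⟩ := h.exists_good_legs
  set G := ⋃ i, a i '' Icc 0 1 with hGdef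
  have haG : ∀ i, a i '' Icc 0 1 ⊆ G := fun i => subset_iUnion (fun i => a i '' Icc 0 1) i
  have hsub : ∀ e, dart a e '' Icc 0 (c e) ⊆ a e.1 '' Icc 0 1 := by
    rintro e _ ⟨u, hu, rfl⟩
    exact dart_mem e ⟨hu.1, hu.2.trans (hc e).2.le⟩
  have main : ∀ I : Finset ι, Good G ((⋃ e, dart a e '' Icc 0 (c e)) ∪
      ⋃ i ∈ I, a i '' Icc 0 1) := by
    intro I
    induction I using Finset.induction_on with
    | empty => simpa using hgood
    | insert i I hi ih =>
      set K := (⋃ e ∈ (Finset.univ.filter fun e : ι × Bool => e.1 ≠ i), dart a e '' Icc 0 (c e)) ∪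
        ⋃ j ∈ I, a j '' Icc 0 1 with hK
      have hKc : IsClosed K := by
        refine IsCompact.isClosed (IsCompact.union ?_ ?_)
        · exact Finset.isCompact_biUnion _ fun e _ => isCompact_Icc.image_of_continuousOn
            ((h.cont_dart e).mono (Icc_subset_Icc_right (hc e).2.le))
        · exact Finset.isCompact_biUnion _ fun e _ => isCompact_Icc.image_of_continuousOn
            (h.cont e)
      have := Good.union_edge (G := G) (K := K) (h.cont i) (h.inj i) (haG i) hKc
        (by
          rintro w hw (hm | hm)
          · obtain ⟨e, he, hm'⟩ := by simpa only [mem_iUnion, exists_prop] using hm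
            exact h.notMem_of_ne (by simpa using he : e.1 ≠ i).symm hw (hsub e hm')
          · obtain ⟨j, hj, hm'⟩ := by simpa only [mem_iUnion, exists_prop] using hm
            exact h.notMem_of_ne (fun e : i = j => hi (e ▸ hj)) hw hm')
        (hc (i, false)).1 (m := 1 - c (i, true)) (by linarith [(hc (i, true)).1])
        (ih.mono (by
          rintro z (((hz | hz) | ⟨u, hu, rfl⟩) | ⟨u, hu, rfl⟩)
          · obtain ⟨e, -, hz'⟩ := by simpa only [mem_iUnion, exists_prop] using hz
            exact Or.inl (mem_iUnion.2 ⟨e, hz'⟩)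
          · exact Or.inr hz
          · exact Or.inl (mem_iUnion.2 ⟨(i, false), u, hu, by simp [dart]⟩)
          · exact Or.inl (mem_iUnion.2 ⟨(i, true), 1 - u, ⟨by linarith [hu.2], by linarith [hu.1]⟩,
              by simp [dart]⟩)))
      refine this.mono ?_
      rintro z (hz | hz)
      · obtain ⟨e, hz'⟩ := mem_iUnion.1 hz
        by_cases he : e.1 = i
        · exact Or.inr (he ▸ hsub e hz')
        · exact Or.inl (Or.inl (mem_biUnion (by simpa using he) hz'))
      · obtain ⟨j, hj, hz'⟩ := by simpa only [mem_iUnion, exists_prop] using hz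
        rcases Finset.mem_insert.1 hj with rfl | hj
        · exact Or.inr hz'
        · exact Or.inl (Or.inr (mem_biUnion hj hz'))
  refine (main Finset.univ).mono fun z hz => Or.inr ?_
  obtain ⟨i, hz'⟩ := mem_iUnion.1 hz
  exact mem_biUnion (Finset.mem_univ i) hz'

end IsArcGraph

section

variable {X : Type*} [TopologicalSpace X]

/-- A properly embedded open arc in a compact space that accumulates only at finitely many
points has a limit at its end. -/
lemma exists_tendsto_end [T2Space X] [CompactSpace X] {e V : Set X} (hV : V.Finite)
    (hcl : closure e \ e ⊆ V) {f : ℝ → X} (hf : ContinuousOn f (Ioo 0 1))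
    (hm : MapsTo f (Ioo 0 1) e) (hK : ∀ C ⊆ e, IsCompact C → IsCompact (Ioo 0 1 ∩ f ⁻¹' C)) :
    ∃ v ∈ V, Tendsto f (𝓝[>] 0) (𝓝 v) := by
  obtain ⟨v, hv⟩ := exists_clusterPt_of_compactSpace (map f (𝓝[>] 0))
  have hv : MapClusterPt v (𝓝[>] 0) f := hv
  have key : ∀ W : Set X, IsOpen W → V ⊆ W → ∃ s > 0, s < 1 ∧ f '' Ioo 0 s ⊆ W := by
    intro W hW hVW
    have hC : closure e \ W ⊆ e := fun x hx => by
      by_contra h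
      exact hx.2 (hVW (hcl ⟨hx.1, h⟩))
    have hc := hK _ hC (isClosed_closure.isCompact.diff hW)
    have h0 : (Ioo (0 : ℝ) 1 ∩ f ⁻¹' (closure e \ W))ᶜ ∈ 𝓝 (0 : ℝ) :=
      hc.isClosed.isOpen_compl.mem_nhds fun h => lt_irrefl _ h.1.1
    obtain ⟨r, hr, hr'⟩ := Metric.mem_nhds_iff.1 h0
    refine ⟨min r (1 / 2), by positivity, (min_le_right _ _).trans_lt (by norm_num), ?_⟩
    rintro _ ⟨u, hu, rfl⟩
    have hu1 : u ∈ Ioo (0 : ℝ) 1 :=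
      ⟨hu.1, hu.2.trans ((min_le_right _ _).trans_lt (by norm_num))⟩
    have hur : u ∈ ball (0 : ℝ) r := by
      rw [mem_ball, Real.dist_eq, sub_zero, abs_of_pos hu.1]
      exact hu.2.trans_le (min_le_left _ _)
    by_contra h
    exact hr' hur ⟨hu1, subset_closure (hm hu1), h⟩
  have hnear : ∀ s > (0 : ℝ), Ioo 0 s ∈ 𝓝[>] (0 : ℝ) := fun s hs => Ioo_mem_nhdsGT hs
  have hvV : v ∈ V := by
    by_contra h
    obtain ⟨U, U', hU, hU', hvU, hVU, hd⟩ := SeparatedNhds.of_isCompact_isCompact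
      (isCompact_singleton (x := v)) hV.isCompact (disjoint_singleton_left.2 h)
    obtain ⟨s, hs, -, hsW⟩ := key U' hU' hVU
    obtain ⟨u, hu, hus⟩ := ((mapClusterPt_iff_frequently.1 hv U
      (hU.mem_nhds (hvU rfl))).and_eventually (hnear s hs)).exists
    exact hd.le_bot ⟨hu, hsW ⟨u, hus, rfl⟩⟩
  refine ⟨v, hvV, ?_⟩
  intro N hN
  obtain ⟨U, U', hU, hU', hvU, hVU, hd⟩ := SeparatedNhds.of_isCompact_isCompact
    (isCompact_singleton (x := v)) (hV.subset (sdiff_subset (s := V) (t := {v}))).isCompact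
    (disjoint_singleton_left.2 fun h => h.2 rfl)
  have hUN : IsOpen (U ∩ interior N) := hU.inter isOpen_interior
  have hvUN : v ∈ U ∩ interior N := ⟨hvU rfl, mem_interior_iff_mem_nhds.2 hN⟩
  obtain ⟨s, hs, hs1, hsW⟩ := key (U ∩ interior N ∪ U') (hUN.union hU') fun x hx => by
    by_cases h : x = v
    · exact Or.inl (h ▸ hvUN)
    · exact Or.inr (hVU ⟨hx, h⟩)
  obtain ⟨u, hu, hus⟩ := ((mapClusterPt_iff_frequently.1 hv _
    (hUN.mem_nhds hvUN)).and_eventually (hnear s hs)).exists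
  have hsub := (isPreconnected_Ioo.image f (hf.mono (Ioo_subset_Ioo_right hs1.le))
    ).subset_left_of_subset_union hUN hU' (hd.mono_left inter_subset_left) hsW
      ⟨_, ⟨u, hus, rfl⟩, hu⟩
  exact mem_map.2 (mem_of_superset (hnear s hs) fun x hx =>
    show f x ∈ N from interior_subset (hsub ⟨x, hx, rfl⟩).2)

/-- A parametrization of an edge with vertices in `V`: either an arc with both ends in `V`, or a
closed curve. -/
structure IsEdgeParam (e V : Set X) (a : ℝ → X) : Prop where
  cont : ContinuousOn a (Icc 0 1)
  injLeft : InjOn a (Ico 0 1)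
  injRight : InjOn a (Ioc 0 1)
  mapsTo : ∀ u ∈ Ioo (0 : ℝ) 1, a u ∈ e
  subset : e ⊆ a '' Icc 0 1
  ends : (a 0 ∈ V ∧ a 1 ∈ V) ∨ (a 0 = a 1 ∧ a 0 ∈ e)

lemma IsJordanCurve.isJordanLoop {e : Set X} (h : IsJordanCurve e) : IsJordanLoop e := by
  obtain ⟨φ⟩ := h
  have x0 : sphere (0 : ℂ) 1 := ⟨1, by simp⟩
  have h1 : IsJordanLoop (univ : Set (sphere (0 : ℂ) 1)) := by
    obtain ⟨g, hg, hp, hi, hr⟩ := isJordanLoop_sphere 0 one_pos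
    have hmem : ∀ t, g t ∈ sphere (0 : ℂ) 1 := fun t => hr ▸ mem_range_self t
    refine ⟨fun t => ⟨g t, hmem t⟩, hg.subtype_mk _, fun t => Subtype.ext (hp t), fun s hs t ht h =>
      hi hs ht (Subtype.ext_iff.1 h), eq_univ_of_forall fun x => ?_⟩
    obtain ⟨t, ht⟩ : (x : ℂ) ∈ range g := by rw [hr]; exact x.2
    exact ⟨t, Subtype.ext ht⟩
  have h2 := h1.image (f := fun x => (φ.symm x : X))
    (continuous_subtype_val.comp φ.symm.continuous).continuousOn
    (Subtype.val_injective.comp φ.symm.injective).injOn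
  convert h2
  ext x
  simp only [image_univ, mem_range]
  exact ⟨fun hx => ⟨φ ⟨x, hx⟩, by simp⟩, by rintro ⟨y, rfl⟩; exact (φ.symm y).2⟩

lemma IsJordanCurve.exists_isEdgeParam {e : Set X} (h : IsJordanCurve e) (V : Set X) :
    ∃ a, IsEdgeParam e V a := by
  obtain ⟨g, hg, hp, hi, rfl⟩ := h.isJordanLoop
  have h01 : g 1 = g 0 := by simpa using hp 0
  refine ⟨g, hg.continuousOn, hi, ?_, fun u _ => mem_range_self u, ?_, Or.inr ⟨h01.symm,
    mem_range_self 0⟩⟩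
  · have hflip : ∀ x ∈ Ioc (0 : ℝ) 1, ∀ y ∈ Ioo (0 : ℝ) 1, g x = g y → x = y := by
      intro x hx y hy hxy
      rcases hx.2.lt_or_eq with h | rfl
      · exact hi ⟨hx.1.le, h⟩ ⟨hy.1.le, hy.2⟩ hxy
      · exact absurd (hi ⟨le_rfl, one_pos⟩ ⟨hy.1.le, hy.2⟩ (h01.symm.trans hxy)) hy.1.ne
    intro x hx y hy hxy
    rcases hy.2.lt_or_eq with h | rfl
    · exact hflip x hx y ⟨hy.1, h⟩ hxy
    · rcases hx.2.lt_or_eq with h | rfl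
      · exact (hflip 1 hy x ⟨hx.1, h⟩ hxy.symm).symm
      · rfl
  · rw [range_eq_image_Ico_of_periodic hp]
    exact image_mono Ico_subset_Icc_self

lemma IsSimpleArc.exists_isEdgeParam [T2Space X] [CompactSpace X] {e V : Set X}
    (h : IsSimpleArc e) (hV : V.Finite) (hcl : closure e \ e ⊆ V) (hd : Disjoint e V) :
    ∃ a, IsEdgeParam e V a := by
  obtain ⟨φ⟩ := h
  have x0 : X := φ.symm ⟨1 / 2, by norm_num, by norm_num⟩
  obtain ⟨f, hfφ⟩ : ∃ f : ℝ → X, ∀ u (hu : u ∈ Ioo (0 : ℝ) 1), f u = φ.symm ⟨u, hu⟩ := by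
    classical
    exact ⟨fun u => if hu : u ∈ Ioo (0 : ℝ) 1 then φ.symm ⟨u, hu⟩ else x0,
      fun u hu => dif_pos hu⟩
  have hcont : ContinuousOn f (Ioo 0 1) := by
    rw [continuousOn_iff_continuous_domRestrict]
    convert continuous_subtype_val.comp φ.symm.continuous using 1
    funext u
    exact hfφ u u.2
  have hmem : MapsTo f (Ioo 0 1) e := fun u hu => by rw [hfφ u hu]; exact (φ.symm _).2
  have hinj : InjOn f (Ioo 0 1) := fun x hx y hy hxy => by
    rw [hfφ x hx, hfφ y hy] at hxy
    exact Subtype.ext_iff.1 (φ.symm.injective (Subtype.ext hxy))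
  have hsurj : ∀ x ∈ e, ∃ u ∈ Ioo (0 : ℝ) 1, f u = x := fun x hx =>
    ⟨φ ⟨x, hx⟩, (φ ⟨x, hx⟩).2, by rw [hfφ _ (φ ⟨x, hx⟩).2]; simp⟩
  have hK : ∀ C ⊆ e, IsCompact C → IsCompact (Ioo 0 1 ∩ f ⁻¹' C) := by
    intro C hC hc
    have h1 : IsCompact ((↑) ⁻¹' C : Set e) :=
      (IsInducing.subtypeVal.isCompact_preimage_iff (by simpa using hC)).2 hc
    convert (h1.image φ.continuous).image continuous_subtype_val using 1
    ext u
    constructor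
    · rintro ⟨hu, huC⟩
      refine ⟨⟨u, hu⟩, ⟨φ.symm ⟨u, hu⟩, ?_, by simp⟩, rfl⟩
      rw [mem_preimage, ← hfφ u hu]
      exact huC
    · rintro ⟨_, ⟨x, hx, rfl⟩, rfl⟩
      refine ⟨(φ x).2, ?_⟩
      rw [mem_preimage, hfφ _ (φ x).2]
      simpa using hx
  obtain ⟨v, hv, hvt⟩ := exists_tendsto_end hV hcl hcont hmem hK
  have hmap : MapsTo (fun u : ℝ => 1 - u) (Ioo 0 1) (Ioo 0 1) := fun u hu =>
    ⟨by linarith [hu.2], by linarith [hu.1]⟩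
  obtain ⟨w, hw, hwt⟩ := exists_tendsto_end (f := fun u => f (1 - u)) hV hcl
    (hcont.comp (by fun_prop) hmap) (fun u hu => hmem (hmap hu)) fun C hC hc => by
      convert (hK C hC hc).image (f := fun u : ℝ => 1 - u) (by fun_prop) using 1
      ext u
      constructor
      · rintro ⟨hu, huC⟩
        exact ⟨1 - u, ⟨hmap hu, huC⟩, by ring⟩
      · rintro ⟨y, ⟨hy, hyC⟩, rfl⟩
        exact ⟨hmap hy, by simpa using hyC⟩
  have hwt' : Tendsto f (𝓝[<] 1) (𝓝 w) := by
    have h1 : Tendsto (fun u : ℝ => 1 - u) (𝓝[<] 1) (𝓝[>] 0) := by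
      refine tendsto_nhdsWithin_iff.2 ⟨?_, ?_⟩
      · have : Tendsto (fun u : ℝ => 1 - u) (𝓝 1) (𝓝 (1 - 1)) :=
          (continuous_const.sub continuous_id).tendsto 1
        rw [sub_self] at this
        exact this.mono_left nhdsWithin_le_nhds
      · filter_upwards [self_mem_nhdsWithin] with u hu
        exact sub_pos.2 (mem_Iio.1 hu)
    simpa [Function.comp_def] using hwt.comp h1
  set a := extendFrom (Ioo 0 1) f
  have ha : ∀ u ∈ Ioo (0 : ℝ) 1, a u = f u := fun u hu =>
    extendFrom_extends hcont u hu
  have ha0 : a 0 = v := eq_lim_at_left_extendFrom_Ioo zero_lt_one hvt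
  have ha1 : a 1 = w := eq_lim_at_right_extendFrom_Ioo zero_lt_one hwt'
  have hne : ∀ u ∈ Ioo (0 : ℝ) 1, ∀ x ∈ V, a u ≠ x := fun u hu x hx h =>
    hd.le_bot ⟨hmem hu, by rw [← ha u hu, h]; exact hx⟩
  have hinj' : InjOn a (Ioo 0 1) := fun x hx y hy hxy =>
    hinj hx hy (by rwa [← ha x hx, ← ha y hy])
  refine ⟨a, continuousOn_Icc_extendFrom_Ioo hcont hvt hwt', ?_, ?_,
    fun u hu => ha u hu ▸ hmem hu, ?_, Or.inl ⟨ha0 ▸ hv, ha1 ▸ hw⟩⟩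
  · intro x hx y hy hxy
    rcases hx.1.eq_or_lt with rfl | hx0
    · rcases hy.1.eq_or_lt with rfl | hy0
      · rfl
      · exact absurd (hxy.symm.trans ha0) (hne y ⟨hy0, hy.2⟩ v hv)
    · rcases hy.1.eq_or_lt with rfl | hy0
      · exact absurd (hxy.trans ha0) (hne x ⟨hx0, hx.2⟩ v hv)
      · exact hinj' ⟨hx0, hx.2⟩ ⟨hy0, hy.2⟩ hxy
  · intro x hx y hy hxy
    rcases hx.2.eq_or_lt with rfl | hx0
    · rcases hy.2.eq_or_lt with rfl | hy0
      · rfl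
      · exact absurd (hxy.symm.trans ha1) (hne y ⟨hy.1, hy0⟩ w hw)
    · rcases hy.2.eq_or_lt with rfl | hy0
      · exact absurd (hxy.trans ha1) (hne x ⟨hx.1, hx0⟩ w hw)
      · exact hinj' ⟨hx.1, hx0⟩ ⟨hy.1, hy0⟩ hxy
  · intro x hx
    obtain ⟨u, hu, rfl⟩ := hsurj x hx
    exact ⟨u, Ioo_subset_Icc_self hu, ha u hu⟩

lemma IsEdgeParam.eq_end [T2Space X] {e V : Set X} {a : ℝ → X} (h : IsEdgeParam e V a) {v : X}
    (hv : v ∈ closure e \ e) : v = a 0 ∨ v = a 1 := by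
  obtain ⟨u, hu, rfl⟩ := closure_minimal h.subset (isCompact_Icc.image_of_continuousOn
    h.cont).isClosed hv.1
  rcases hu.1.eq_or_lt with rfl | h0
  · exact Or.inl rfl
  rcases hu.2.eq_or_lt with rfl | h1
  · exact Or.inr rfl
  exact absurd (h.mapsTo u ⟨h0, h1⟩) hv.2

namespace IsLemniscateGraphWith

variable {G V : Set X}

lemma edge_subset {e : Set X} (he : e ∈ graphEdges G V) : e ⊆ G \ V := by
  obtain ⟨x, -, rfl⟩ := he
  exact connectedComponentIn_subset _ _

lemma edge_eq {e e' : Set X} (he : e ∈ graphEdges G V) (he' : e' ∈ graphEdges G V) {x : X}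
    (hx : x ∈ e) (hx' : x ∈ e') : e = e' := by
  obtain ⟨y, -, rfl⟩ := he
  obtain ⟨z, -, rfl⟩ := he'
  rw [connectedComponentIn_eq hx, connectedComponentIn_eq hx']

lemma exists_edges (h : IsLemniscateGraphWith G V) {v : X} (hv : v ∈ V) :
    ∃ e ∈ graphEdges G V, ∃ e' ∈ graphEdges G V, e ≠ e' ∧ v ∈ closure e \ e ∧
      v ∈ closure e' \ e' := by
  have h4 := h.degree_ge_four v hv
  have hfin : {e ∈ graphEdges G V | v ∈ closure e \ e}.Finite := h.edges_finite.subset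
    fun e he => he.1
  have hle : {e ∈ graphEdges G V | closure e \ e = {v}}.ncard ≤
      {e ∈ graphEdges G V | v ∈ closure e \ e}.ncard :=
    ncard_le_ncard (fun e he => ⟨he.1, he.2 ▸ rfl⟩) hfin
  unfold vertexDegree at h4
  obtain ⟨e, he, e', he', hne⟩ := (one_lt_ncard hfin).1 (by omega :
    1 < {e ∈ graphEdges G V | v ∈ closure e \ e}.ncard)
  exact ⟨e, he.1, e', he'.1, hne, he.2, he'.2⟩

/-- A lemniscate graph is a finite union of arcs meeting only at their ends. -/
theorem exists_isArcGraph [T2Space X] [CompactSpace X] (h : IsLemniscateGraphWith G V) :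
    ∃ (b : graphEdges G V × Bool → ℝ → X) (V' : Set X), IsArcGraph b V' ∧
      ⋃ i, b i '' Icc 0 1 = G := by
  have hfin := h.edges_finite.to_subtype
  have hdV : ∀ e ∈ graphEdges G V, Disjoint e V := fun e he =>
    disjoint_left.2 fun x hx => (edge_subset he hx).2
  have hex : ∀ e : graphEdges G V, ∃ a, IsEdgeParam e.1 V a := fun e => by
    rcases h.edge_shape e e.2 with h1 | h1
    · exact h1.exists_isEdgeParam V
    · exact h1.1.exists_isEdgeParam h.vertex_finite h1.2 (hdV e e.2)
  choose a ha using hex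
  have key : ∀ e e' : graphEdges G V, ∀ p ∈ Ioo (0 : ℝ) 1, ∀ q ∈ Icc (0 : ℝ) 1,
      a e p = a e' q → e = e' ∧ p = q := by
    intro e e' p hp q hq hpq
    have hmem : a e' q ∈ e.1 := hpq ▸ (ha e).mapsTo p hp
    have hqV : a e' q ∉ V := (edge_subset e.2 hmem).2
    have hq' : a e' q ∈ e'.1 := by
      rcases hq.1.eq_or_lt with rfl | h0
      · rcases (ha e').ends with h1 | h1
        · exact absurd h1.1 hqV
        · exact h1.2
      rcases hq.2.eq_or_lt with rfl | h1
      · rcases (ha e').ends with h1 | h1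
        · exact absurd h1.2 hqV
        · exact h1.1 ▸ h1.2
      exact (ha e').mapsTo q ⟨h0, h1⟩
    obtain rfl : e = e' := Subtype.ext (edge_eq e.2 e'.2 hmem hq')
    refine ⟨rfl, ?_⟩
    rcases hq.2.eq_or_lt with rfl | h1
    · exact (ha e).injRight ⟨hp.1, hp.2.le⟩ ⟨one_pos, le_rfl⟩ hpq
    · exact (ha e).injLeft ⟨hp.1.le, hp.2⟩ ⟨hq.1, h1⟩ hpq
  let s : Bool → ℝ := fun t => cond t 1 0
  have hs : ∀ t, s t = 0 ∨ s t = 1 := fun t => by cases t <;> simp [s]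
  let b : graphEdges G V × Bool → ℝ → X := fun i u => a i.1 ((u + s i.2) / 2)
  have hIcc : ∀ t, ∀ u ∈ Icc (0 : ℝ) 1, (u + s t) / 2 ∈ Icc (0 : ℝ) 1 := fun t u hu => by
    rcases hs t with h | h <;> rw [h] <;> constructor <;> linarith [hu.1, hu.2]
  have hIoo : ∀ t, ∀ u ∈ Ioo (0 : ℝ) 1, (u + s t) / 2 ∈ Ioo (0 : ℝ) 1 := fun t u hu => by
    rcases hs t with h | h <;> rw [h] <;> constructor <;> linarith [hu.1, hu.2]
  have hb0 : ∀ e, b (e, false) 0 = a e 0 := fun e => by simp [b, s]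
  have hb1 : ∀ e, b (e, false) 1 = a e (1 / 2) := fun e => by simp [b, s]
  have hb2 : ∀ e, b (e, true) 0 = a e (1 / 2) := fun e => by simp [b, s]
  have hb3 : ∀ e, b (e, true) 1 = a e 1 := fun e => by
    simp only [b, s, cond_true]; norm_num
  set V' : Set X := V ∪ range (fun e => a e 0) ∪ range (fun e => a e (1 / 2)) with hV'
  have hend1 : ∀ e, a e 1 ∈ V' := fun e => by
    rcases (ha e).ends with h1 | h1
    · exact Or.inl (Or.inl h1.2)
    · exact Or.inl (Or.inr ⟨e, h1.1⟩)
  have hdegV : ∀ v ∈ V, ∃ i j, i ≠ j ∧ (b i 0 = v ∨ b i 1 = v) ∧ (b j 0 = v ∨ b j 1 = v) := by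
    intro v hv
    obtain ⟨e, he, e', he', hne, h1, h2⟩ := h.exists_edges hv
    have hx : ∀ e : graphEdges G V, v ∈ closure e.1 \ e.1 →
        ∃ t, b (e, t) 0 = v ∨ b (e, t) 1 = v := by
      intro e hve
      rcases (ha e).eq_end hve with h | h
      · exact ⟨false, Or.inl ((hb0 e).trans h.symm)⟩
      · exact ⟨true, Or.inr ((hb3 e).trans h.symm)⟩
    obtain ⟨t, ht⟩ := hx ⟨e, he⟩ h1
    obtain ⟨t', ht'⟩ := hx ⟨e', he'⟩ h2
    exact ⟨_, _, fun hh => hne (congrArg (fun i => (i.1 : Set X)) hh), ht, ht'⟩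
  refine ⟨b, V', ⟨?_, ?_, ?_, ?_, ?_, ?_, ?_, ?_⟩, ?_⟩
  · exact (h.vertex_finite.union (finite_range _)).union (finite_range _)
  · exact fun i => (ha i.1).cont.comp (by fun_prop) fun u hu => hIcc i.2 u hu
  · rintro ⟨e, t⟩ x hx y hy hxy
    have : (x + s t) / 2 = (y + s t) / 2 := by
      cases t
      · refine (ha e).injLeft ?_ ?_ hxy <;> simp only [s, cond_false] <;> constructor <;>
          linarith [hx.1, hx.2, hy.1, hy.2]
      · refine (ha e).injRight ?_ ?_ hxy <;> simp only [s, cond_true] <;> constructor <;>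
          linarith [hx.1, hx.2, hy.1, hy.2]
    linarith
  · rintro ⟨e, _ | _⟩
    · exact Or.inl (Or.inr ⟨e, (hb0 e).symm⟩)
    · exact Or.inr ⟨e, (hb2 e).symm⟩
  · rintro ⟨e, _ | _⟩
    · exact Or.inr ⟨e, (hb1 e).symm⟩
    · rw [hb3]; exact hend1 e
  · rintro ⟨e, t⟩ u hu ((h1 | ⟨e', h1⟩) | ⟨e', h1⟩)
    · exact (edge_subset e.2 ((ha e).mapsTo _ (hIoo t u hu))).2 h1
    · have := (key e e' _ (hIoo t u hu) 0 (by simp) h1.symm).2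
      exact (hIoo t u hu).1.ne this.symm
    · have := (key e e' _ (hIoo t u hu) (1 / 2) (by norm_num) h1.symm).2
      rcases hs t with h | h <;> rw [h] at this <;> linarith [hu.1, hu.2]
  · rintro ⟨e, t⟩ ⟨e', t'⟩ hne u hu w hw huw
    obtain ⟨rfl, h2⟩ := key e e' _ (hIoo t u hu) _ (Ioo_subset_Icc_self (hIoo t' w hw)) huw
    apply hne
    have htt : t = t' := by
      cases t <;> cases t' <;> simp only [s, cond_true, cond_false] at h2 <;>
        first | rfl | (exfalso; linarith [hu.1, hu.2, hw.1, hw.2])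
    rw [htt]
  · rintro v ((hv | ⟨e, rfl⟩) | ⟨e, rfl⟩)
    · exact hdegV v hv
    · rcases (ha e).ends with h1 | h1
      · exact hdegV _ h1.1
      · exact ⟨(e, false), (e, true), by simp, Or.inl (hb0 e), Or.inr ((hb3 e).trans h1.1.symm)⟩
    · exact ⟨(e, false), (e, true), by simp, Or.inr (hb1 e), Or.inl (hb2 e)⟩
  · apply Subset.antisymm
    · refine iUnion_subset fun i => ?_
      rintro _ ⟨u, hu, rfl⟩
      have hGe := fun x hx => (edge_subset (G := G) i.1.2 hx (a := x)).1
      have hp := hIcc i.2 u hu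
      change a i.1 ((u + s i.2) / 2) ∈ G
      generalize (u + s i.2) / 2 = p at hp
      rcases hp.1.eq_or_lt with rfl | h0
      · rcases (ha i.1).ends with h1 | h1
        · exact h.vertex_subset h1.1
        · exact hGe _ h1.2
      rcases hp.2.eq_or_lt with rfl | h1
      · rcases (ha i.1).ends with h1 | h1
        · exact h.vertex_subset h1.2
        · exact hGe _ (h1.1 ▸ h1.2)
      exact hGe _ ((ha i.1).mapsTo p ⟨h0, h1⟩)
    · intro x hx
      by_cases hxV : x ∈ V
      · obtain ⟨i, -, -, h1 | h1, -⟩ := hdegV x hxV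
        · exact mem_iUnion.2 ⟨i, 0, by simp, h1⟩
        · exact mem_iUnion.2 ⟨i, 1, by simp, h1⟩
      · let e : graphEdges G V := ⟨connectedComponentIn (G \ V) x, x, ⟨hx, hxV⟩, rfl⟩
        obtain ⟨p, hp, hpx⟩ := (ha e).subset (mem_connectedComponentIn (F := G \ V) ⟨hx, hxV⟩)
        rcases le_total p (1 / 2) with h1 | h1
        · refine mem_iUnion.2 ⟨(e, false), 2 * p, ⟨by linarith [hp.1], by linarith⟩, ?_⟩
          rw [← hpx]
          simp only [b, s, cond_false]
          congr 1; ring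
        · refine mem_iUnion.2 ⟨(e, true), 2 * p - 1, ⟨by linarith, by linarith [hp.2]⟩, ?_⟩
          rw [← hpx]
          simp only [b, s, cond_true]
          congr 1; ring

end IsLemniscateGraphWith

end

section

variable {X Y ι : Type*} [TopologicalSpace X] [TopologicalSpace Y]

/-- An arc contains no Jordan curve. -/
lemma IsJordanLoop.not_subset_image_Icc [T2Space X] {J : Set X} (hJ : IsJordanLoop J) {a : ℝ → X}
    (hc : ContinuousOn a (Icc 0 1)) (hi : InjOn a (Icc 0 1)) : ¬ J ⊆ a '' Icc 0 1 := by
  intro hsub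
  obtain ⟨g, hg, hp, hgi, rfl⟩ := hJ
  have hk := continuousOn_invFunOn_image isCompact_Icc hc hi
  have hki : InjOn (Function.invFunOn a (Icc 0 1)) (a '' Icc 0 1) :=
    Function.invFunOn_injOn_image a _
  set k : ℝ → ℝ := Function.invFunOn a (Icc 0 1) ∘ g
  have hkc : Continuous k := hk.comp_continuous hg fun t => hsub (mem_range_self t)
  have hinj : InjOn k (Ico 0 1) := hki.comp hgi fun t _ => hsub (mem_range_self t)
  have hk1 : k 1 = k 0 := congrArg (Function.invFunOn a (Icc 0 1)) (by simpa using hp 0)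
  have hne : k 0 ≠ k (1 / 2) := fun h => by
    have := hinj (by norm_num) (by norm_num) h
    norm_num at this
  have hmid : (k 0 + k (1 / 2)) / 2 ∈ uIcc (k 0) (k (1 / 2)) := by
    rcases le_total (k 0) (k (1 / 2)) with h | h
    · rw [uIcc_of_le h]; constructor <;> linarith
    · rw [uIcc_of_ge h]; constructor <;> linarith
  obtain ⟨s, hs, hse⟩ := intermediate_value_uIcc hkc.continuousOn hmid
  have hmid' : (k 0 + k (1 / 2)) / 2 ∈ uIcc (k (1 / 2)) (k 1) := by
    rwa [hk1, uIcc_comm]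
  obtain ⟨t, ht, hte⟩ := intermediate_value_uIcc hkc.continuousOn hmid'
  rw [uIcc_of_le (by norm_num)] at hs ht
  have ht1 : t ≠ 1 := fun h => hne (by rw [h, hk1] at hte; linarith)
  have hs2 : s ≠ 1 / 2 := fun h => hne (by rw [h] at hse; linarith)
  have := hinj ⟨hs.1, by linarith [hs.2]⟩ ⟨by linarith [ht.1], lt_of_le_of_ne ht.2 ht1⟩
    (hse.trans hte.symm)
  exact hs2 (le_antisymm hs.2 (this ▸ ht.1))

/-- The image of an arc graph under an embedding. -/
lemma IsArcGraph.comp {b : ι → ℝ → X} {V : Set X} (h : IsArcGraph b V) {f : X → Y}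
    (hf : ContinuousOn f (⋃ i, b i '' Icc 0 1)) (hi : InjOn f (⋃ i, b i '' Icc 0 1)) :
    IsArcGraph (fun i u => f (b i u)) (f '' V) := by
  have hmem : ∀ i, ∀ u ∈ Icc (0 : ℝ) 1, b i u ∈ ⋃ i, b i '' Icc 0 1 := fun i u hu =>
    mem_iUnion.2 ⟨i, u, hu, rfl⟩
  have hV : V ⊆ ⋃ i, b i '' Icc 0 1 := fun v hv => by
    obtain ⟨i, -, -, h1 | h1, -⟩ := h.deg v hv
    · exact h1 ▸ hmem i 0 (by simp)
    · exact h1 ▸ hmem i 1 (by simp)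
  refine ⟨h.finite.image f, fun i => hf.comp (h.cont i) (hmem i), fun i => hi.comp (h.inj i) (hmem i),
    fun i => ⟨_, h.zero i, rfl⟩, fun i => ⟨_, h.one i, rfl⟩, ?_, ?_, ?_⟩
  · rintro i u hu ⟨v, hv, hvu⟩
    exact h.notMem i u hu (hi (hV hv) (hmem i u (Ioo_subset_Icc_self hu)) hvu ▸ hv)
  · intro i j hij u hu w hw huw
    exact h.disj i j hij u hu w hw
      (hi (hmem i u (Ioo_subset_Icc_self hu)) (hmem j w (Ioo_subset_Icc_self hw)) huw)
  · rintro _ ⟨v, hv, rfl⟩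
    obtain ⟨i, j, hij, h1, h2⟩ := h.deg v hv
    exact ⟨i, j, hij, h1.imp (congrArg f) (congrArg f), h2.imp (congrArg f) (congrArg f)⟩

lemma IsArcGraph.isCompact_iUnion [Finite ι] {b : ι → ℝ → X} {V : Set X} (h : IsArcGraph b V) :
    IsCompact (⋃ i, b i '' Icc 0 1) :=
  _root_.isCompact_iUnion fun i => isCompact_Icc.image_of_continuousOn (h.cont i)

/-- An arc graph does not fill the sphere. -/
lemma IsArcGraph.exists_notMem [Finite ι] {b : ι → ℝ → X} {V : Set X} (h : IsArcGraph b V)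
    (M : X ≃ₜ OnePoint ℂ) : ∃ p, p ∉ ⋃ i, b i '' Icc 0 1 := by
  have : T2Space X := M.symm.t2Space
  have : CompactSpace X := M.symm.compactSpace
  have : Nonempty X := ⟨M.symm OnePoint.infty⟩
  by_contra! hall
  obtain ⟨i, hi⟩ := nonempty_interior_of_iUnion_of_closed
    (fun i => (isCompact_Icc.image_of_continuousOn (h.cont i)).isClosed)
    (eq_univ_of_forall hall)
  have hcont : Continuous fun z : ℂ => M.symm (z : OnePoint ℂ) :=
    M.symm.continuous.comp OnePoint.continuous_coe
  have hinj : Function.Injective fun z : ℂ => M.symm (z : OnePoint ℂ) :=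
    M.symm.injective.comp OnePoint.coe_injective
  have hdense : DenseRange fun z : ℂ => M.symm (z : OnePoint ℂ) :=
    M.symm.surjective.denseRange.comp OnePoint.denseRange_coe M.symm.continuous
  obtain ⟨z, hz⟩ := hdense.exists_mem_open isOpen_interior hi
  obtain ⟨r, hr, hr'⟩ := Metric.nhds_basis_closedBall.mem_iff.1
    ((isOpen_interior.preimage hcont).mem_nhds hz)
  refine ((isJordanLoop_sphere z hr).image hcont.continuousOn hinj.injOn).not_subset_image_Icc
    (h.cont i) (h.inj i) ?_
  rintro _ ⟨w, hw, rfl⟩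
  exact interior_subset (hr' (sphere_subset_closedBall hw))

end

namespace OnePoint

/-- The inversion `z ↦ 1 / z` of the Riemann sphere. -/
def inversion (x : OnePoint ℂ) : OnePoint ℂ :=
  x.elim ((0 : ℂ) : OnePoint ℂ) fun z => if z = 0 then infty else ((z⁻¹ : ℂ) : OnePoint ℂ)

lemma inversion_infty : inversion infty = ((0 : ℂ) : OnePoint ℂ) := rfl

lemma inversion_zero : inversion ((0 : ℂ) : OnePoint ℂ) = infty := if_pos rfl

lemma inversion_coe {z : ℂ} (hz : z ≠ 0) : inversion z = ((z⁻¹ : ℂ) : OnePoint ℂ) := if_neg hz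

lemma inversion_involutive : Function.Involutive inversion := by
  intro x
  induction x using OnePoint.rec with
  | infty => rw [inversion_infty, inversion_zero]
  | coe z =>
    by_cases hz : z = 0
    · rw [hz, inversion_zero, inversion_infty]
    · rw [inversion_coe hz, inversion_coe (inv_ne_zero hz), inv_inv]

lemma continuous_inversion : Continuous inversion := by
  rw [OnePoint.continuous_iff]
  constructor
  · rw [inversion_infty, coclosedCompact_eq_cocompact, ← Metric.cobounded_eq_cocompact]
    have h1 : Tendsto (fun z : ℂ => ((z⁻¹ : ℂ) : OnePoint ℂ)) (Bornology.cobounded ℂ)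
        (𝓝 ((0 : ℂ) : OnePoint ℂ)) :=
      (OnePoint.continuous_coe.tendsto 0).comp tendsto_inv₀_cobounded
    refine h1.congr' ?_
    filter_upwards [Bornology.eventually_ne_cobounded (0 : ℂ)] with z hz
    exact (inversion_coe hz).symm
  · rw [continuous_iff_continuousAt]
    intro z
    by_cases hz : z = 0
    · subst hz
      rw [continuousAt_iff_punctured_nhds, inversion_zero]
      have h1 : Tendsto (fun z : ℂ => ((z⁻¹ : ℂ) : OnePoint ℂ)) (𝓝[≠] 0) (𝓝 infty) := by
        refine OnePoint.tendsto_coe_infty.comp ?_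
        rw [coclosedCompact_eq_cocompact, ← Metric.cobounded_eq_cocompact]
        exact tendsto_inv₀_nhdsNE_zero
      refine h1.congr' ?_
      filter_upwards [self_mem_nhdsWithin] with z hz
      exact (inversion_coe hz).symm
    · have h1 : ContinuousAt (fun z : ℂ => ((z⁻¹ : ℂ) : OnePoint ℂ)) z :=
        OnePoint.continuous_coe.continuousAt.comp (continuousAt_inv₀ hz)
      refine h1.congr ?_
      filter_upwards [isOpen_ne.mem_nhds hz] with w hw
      exact (inversion_coe hw).symm

/-- The homeomorphism group of the sphere acts transitively. -/
lemma exists_homeomorph_eq_infty (p : OnePoint ℂ) :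
    ∃ N : OnePoint ℂ ≃ₜ OnePoint ℂ, N p = infty := by
  induction p using OnePoint.rec with
  | infty => exact ⟨Homeomorph.refl _, rfl⟩
  | coe c =>
    let I : OnePoint ℂ ≃ₜ OnePoint ℂ :=
      ⟨inversion_involutive.toPerm, continuous_inversion, continuous_inversion⟩
    refine ⟨(Homeomorph.subRight c).onePointCongr.trans I, ?_⟩
    change inversion (((c - c : ℂ)) : OnePoint ℂ) = infty
    rw [sub_self, inversion_zero]

end OnePoint

/-- Small moves of an arc graph in a sphere missing the point at infinity of a chart extend. -/
lemma IsArcGraph.exists_extension_of_chart {X ι : Type*} [MetricSpace X] [Finite ι]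
    {b : ι → ℝ → X} {V : Set X} (hb : IsArcGraph b V) (M : X ≃ₜ OnePoint ℂ)
    (hM : ∀ x ∈ ⋃ i, b i '' Icc 0 1, M x ≠ OnePoint.infty) {ε : ℝ} (hε : 0 < ε) :
    ∃ δ > 0, ∀ h : X → X, ContinuousOn h (⋃ i, b i '' Icc 0 1) →
      InjOn h (⋃ i, b i '' Icc 0 1) → (∀ x ∈ ⋃ i, b i '' Icc 0 1, dist (h x) x < δ) →
      ∃ H : X ≃ₜ X, (∀ x ∈ ⋃ i, b i '' Icc 0 1, H x = h x) ∧ ∀ x, dist (H x) x ≤ ε := by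
  set G := ⋃ i, b i '' Icc 0 1 with hGdef
  have hGc : IsCompact G := hb.isCompact_iUnion
  set i : ℂ → X := fun z => M.symm (z : OnePoint ℂ) with hi
  set U : Set X := {x | M x ≠ OnePoint.infty} with hU
  have hUo : IsOpen U := isClosed_singleton.isOpen_compl.preimage M.continuous
  have hic : Continuous i := M.symm.continuous.comp OnePoint.continuous_coe
  have hiinj : Function.Injective i := M.symm.injective.comp OnePoint.coe_injective
  obtain ⟨q, hqi⟩ : ∃ q : X → ℂ, ∀ z, q (i z) = z :=
    ⟨Function.invFun i, Function.leftInverse_invFun hiinj⟩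
  have hUi : ∀ x ∈ U, ∃ z, i z = x := fun x hx => by
    obtain ⟨z, hz⟩ := OnePoint.ne_infty_iff_exists.1 hx
    exact ⟨z, by rw [hi]; simp [hz]⟩
  have hiq : ∀ x ∈ U, i (q x) = x := fun x hx => by
    obtain ⟨z, rfl⟩ := hUi x hx
    rw [hqi]
  have hMq : ∀ x ∈ U, M x = (q x : OnePoint ℂ) := fun x hx => by
    conv_lhs => rw [← hiq x hx]
    simp [hi]
  have hio : IsOpenEmbedding i := M.symm.isOpenEmbedding.comp OnePoint.isOpenEmbedding_coe
  have hqc : ∀ x ∈ U, ContinuousAt q x := fun x hx => by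
    obtain ⟨z, rfl⟩ := hUi x hx
    rw [← hio.continuousAt_iff]
    exact continuousAt_id.congr (Eventually.of_forall fun z => (hqi z).symm)
  have hqU : InjOn q U := fun x hx y hy hxy => by rw [← hiq x hx, hxy, hiq y hy]
  have hgood := (hb.comp (f := q) (fun x hx => (hqc x (hM x hx)).continuousWithinAt)
    (hqU.mono hM)).good
  have hGq : ⋃ i, (fun u => q (b i u)) '' Icc 0 1 = q '' G := by
    rw [hGdef, image_iUnion]
    exact iUnion_congr fun j => by rw [image_image]
  rw [hGq] at hgood
  have hiu : UniformContinuous i := by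
    refine hic.uniformContinuous_of_tendsto_cocompact (x := M.symm OnePoint.infty) ?_
    rw [← coclosedCompact_eq_cocompact]
    exact (M.symm.continuous.tendsto _).comp OnePoint.tendsto_coe_infty
  obtain ⟨ε₁, hε₁, hiε⟩ := Metric.uniformContinuous_iff.1 hiu ε hε
  obtain ⟨δ₁, hδ₁, hmove⟩ := hgood ε₁ hε₁
  obtain ⟨δ₂, hδ₂, hth⟩ := hGc.exists_thickening_subset_open hUo hM
  obtain ⟨δ₃, hδ₃, hq3⟩ := Metric.mem_uniformity_dist.1
    (hGc.uniformContinuousAt_of_continuousAt q (fun x hx => hqc x (hM x hx))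
      (Metric.dist_mem_uniformity hδ₁))
  refine ⟨min δ₂ δ₃, lt_min hδ₂ hδ₃, fun h hc hinj hnear => ?_⟩
  have hhU : ∀ x ∈ G, h x ∈ U := fun x hx => hth (mem_thickening_iff.2
    ⟨x, hx, (hnear x hx).trans_le (min_le_left _ _)⟩)
  have hiG : MapsTo i (q '' G) G := by
    rintro _ ⟨x, hx, rfl⟩
    rwa [hiq x (hM x hx)]
  obtain ⟨H', hH', hH'ε⟩ := hmove (fun z => q (h (i z))) {
    cont := fun z hz => ContinuousAt.comp_continuousWithinAt (g := q)
      (hqc _ (hhU _ (hiG hz))) ((hc.comp hic.continuousOn hiG) z hz)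
    inj := fun z hz w hw hzw => hiinj (hinj (hiG hz) (hiG hw)
      (hqU (hhU _ (hiG hz)) (hhU _ (hiG hw)) hzw))
    near := by
      rintro _ ⟨x, hx, rfl⟩
      rw [hiq x (hM x hx), ← dist_eq_norm, dist_comm]
      exact hq3 (by rw [dist_comm]; exact (hnear x hx).trans_le (min_le_right _ _)) hx }
  set H : X ≃ₜ X := (M.trans H'.onePointCongr).trans M.symm with hH
  have hHU : ∀ x ∈ U, H x = i (H' (q x)) := fun x hx => by
    simp [hH, hMq x hx, hi]
  refine ⟨H, fun x hx => ?_, fun x => ?_⟩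
  · rw [hHU x (hM x hx), hH' _ ⟨x, hx, rfl⟩, hiq x (hM x hx), hiq _ (hhU x hx)]
  · by_cases hx : x ∈ U
    · rw [hHU x hx]
      conv_lhs => arg 2; rw [← hiq x hx]
      exact (hiε (by rw [dist_eq_norm]; exact hH'ε _)).le
    · have hx' : M x = OnePoint.infty := not_not.1 hx
      have : H x = x := by
        rw [← M.symm_apply_apply x, hx']
        simp [hH]
      rw [this, dist_self]
      exact hε.le

/-- Small moves of a lemniscate graph in a metric sphere extend to small homeomorphisms. -/
theorem IsLemniscateGraph.exists_extension {X : Type*} [t : TopologicalSpace X] (m : MetricSpace X)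
    (hm : m.toPseudoMetricSpace.toUniformSpace.toTopologicalSpace = t) (M : X ≃ₜ OnePoint ℂ)
    {G : Set X} (hG : IsLemniscateGraph G) {ε : ℝ} (hε : 0 < ε) :
    ∃ δ > 0, ∀ h : X → X, ContinuousOn h G → InjOn h G →
      (∀ x ∈ G, m.toPseudoMetricSpace.toDist.dist (h x) x < δ) →
      ∃ H : X ≃ₜ X, (∀ x ∈ G, H x = h x) ∧
        ∀ x, m.toPseudoMetricSpace.toDist.dist (H x) x ≤ ε := by
  subst hm
  have : CompactSpace X := M.symm.compactSpace
  obtain ⟨V, hV⟩ := hG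
  have := hV.edges_finite.to_subtype
  obtain ⟨b, V', hb, hbG⟩ := hV.exists_isArcGraph
  rw [← hbG]
  obtain ⟨p, hp⟩ := hb.exists_notMem M
  obtain ⟨N, hN⟩ := OnePoint.exists_homeomorph_eq_infty (M p)
  refine hb.exists_extension_of_chart (M.trans N) (fun x hx hinf => hp ?_) hε
  rw [← hN] at hinf
  exact M.injective (N.injective hinf) ▸ hx

/-- Extension of small homeomorphic displacements of a lemniscate graph: any
embedding of the graph moving points less than `δ` extends to a homeomorphism of
the sphere moving points less than `ε`. -/
theorem small_move_extension
    (m : MetricSpace (OnePoint ℂ)) (hm : InducesSphereTopology m)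
    (G : Set (OnePoint ℂ)) (hG : IsLemniscateGraph G)
    (ε : ℝ) (hε : 0 < ε) :
    ∃ δ > 0, ∀ h : OnePoint ℂ → OnePoint ℂ,
      ContinuousOn h G → Set.InjOn h G →
      (∀ z ∈ G, mdist m (h z) z < δ) →
      ∃ H : OnePoint ℂ ≃ₜ OnePoint ℂ,
        (∀ z ∈ G, H z = h z) ∧ ∃ c < ε, ∀ z, mdist m (H z) z ≤ c := by
  obtain ⟨δ, hδ, hext⟩ :=
    hG.exists_extension m hm (Homeomorph.refl (OnePoint ℂ)) (half_pos hε)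
  refine ⟨δ, hδ, fun h hc hi hnear => ?_⟩
  obtain ⟨H, hH, hHε⟩ := hext h hc hi hnear
  exact ⟨H, hH, ε / 2, half_lt_self hε, hHε⟩

end
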